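/- (Kérékjartó–Eilenberg) Let D² be the closed unit disc {z ∈ ℂ : |z| ≤ 1} and let f : D² → D² be a homeomorphism of finite order, i.e. f^m = id for some integer m ≥ 1. Then there exist a real-linear isometry r of ℂ (an element of O(2), which maps D² onto itself) and a homeomorphism h : D² → D² such that f = h ∘ r ∘ h⁻¹ on D². -/

import Mathlib

set_option linter.all false
set_option linter.deprecated false

namespace KE
open Set Metric Topology Filter

/-- `h` has a continuous logarithm on `K`. -/
def HasLog {X : Type*} [TopologicalSpace X] (h : X → ℂ) (K : Set X) : Prop :=
  ∃ L : X → ℂ, ContinuousOn L K ∧ ∀ x ∈ K, h x = Complex.exp (L x)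

section basic
variable {X Y : Type*} [TopologicalSpace X] [TopologicalSpace Y]

lemma HasLog.mono {h : X → ℂ} {K K' : Set X} (H : HasLog h K) (hK : K' ⊆ K) : HasLog h K' := by
  obtain ⟨L, hL, e⟩ := H
  exact ⟨L, hL.mono hK, fun x hx => e x (hK hx)⟩

lemma HasLog.congr {h h' : X → ℂ} {K : Set X} (H : HasLog h K) (hh : ∀ x ∈ K, h' x = h x) :
    HasLog h' K := by
  obtain ⟨L, hL, e⟩ := H
  exact ⟨L, hL, fun x hx => (hh x hx).trans (e x hx)⟩

lemma HasLog.mul {h h' : X → ℂ} {K : Set X} (H : HasLog h K) (H' : HasLog h' K) :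
    HasLog (fun x => h x * h' x) K := by
  obtain ⟨L, hL, e⟩ := H
  obtain ⟨L', hL', e'⟩ := H'
  exact ⟨fun x => L x + L' x, hL.add hL', fun x hx => by
    simp only [e x hx, e' x hx, Complex.exp_add]⟩

lemma HasLog.inv {h : X → ℂ} {K : Set X} (H : HasLog h K) : HasLog (fun x => (h x)⁻¹) K := by
  obtain ⟨L, hL, e⟩ := H
  exact ⟨fun x => - L x, hL.neg, fun x hx => by
    simp only [e x hx, Complex.exp_neg]⟩

lemma HasLog.div {h h' : X → ℂ} {K : Set X} (H : HasLog h K) (H' : HasLog h' K) :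
    HasLog (fun x => h x / h' x) K :=
  (H.mul H'.inv).congr fun x _ => div_eq_mul_inv _ _

lemma HasLog.comp {h : X → ℂ} {K : Set X} (H : HasLog h K) {g : Y → X} {K' : Set Y}
    (hg : ContinuousOn g K') (hm : MapsTo g K' K) : HasLog (fun y => h (g y)) K' := by
  obtain ⟨L, hL, e⟩ := H
  exact ⟨fun y => L (g y), hL.comp hg hm, fun y hy => e _ (hm hy)⟩

lemma HasLog.ne_zero {h : X → ℂ} {K : Set X} (H : HasLog h K) {x : X} (hx : x ∈ K) : h x ≠ 0 := by
  obtain ⟨L, _, e⟩ := H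
  rw [e x hx]; exact Complex.exp_ne_zero _

lemma hasLog_const {c : ℂ} (hc : c ≠ 0) (K : Set X) : HasLog (fun _ => c) K :=
  ⟨fun _ => Complex.log c, continuousOn_const, fun _ _ => (Complex.exp_log hc).symm⟩

lemma hasLog_of_slit {h : X → ℂ} {K : Set X} (hc : ContinuousOn h K)
    (hs : ∀ x ∈ K, h x ∈ Complex.slitPlane) : HasLog h K :=
  ⟨fun x => Complex.log (h x), hc.clog hs, fun x hx =>
    (Complex.exp_log (Complex.slitPlane_ne_zero (hs x hx))).symm⟩

/-- two logarithms differ by a continuous integer-valued function -/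
lemma exists_int_of_exp_eq {K : Set X} {L₁ L₂ : X → ℂ} (h₁ : ContinuousOn L₁ K)
    (h₂ : ContinuousOn L₂ K) (he : ∀ x ∈ K, Complex.exp (L₁ x) = Complex.exp (L₂ x)) :
    ∃ n : X → ℤ, ContinuousOn n K ∧
      ∀ x ∈ K, L₁ x = L₂ x + n x * (2 * Real.pi * Complex.I) := by
  have : ∀ x, ∃ n : ℤ, x ∈ K → L₁ x = L₂ x + n * (2 * Real.pi * Complex.I) := by
    intro x
    by_cases hx : x ∈ K
    · obtain ⟨n, hn⟩ := Complex.exp_eq_exp_iff_exists_int.1 (he x hx)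
      exact ⟨n, fun _ => hn⟩
    · exact ⟨0, fun h => absurd h hx⟩
  choose n hn using this
  refine ⟨n, ?_, hn⟩
  have hpi : (2 * Real.pi * Complex.I : ℂ) ≠ 0 := Complex.two_pi_I_ne_zero
  rw [Int.isClosedEmbedding_coe_real.isInducing.continuousOn_iff]
  have : ContinuousOn (fun x => ((L₁ x - L₂ x) / (2 * Real.pi * Complex.I)).re) K :=
    Complex.continuous_re.comp_continuousOn ((h₁.sub h₂).div_const _)
  refine this.congr fun x hx => ?_
  have : (L₁ x - L₂ x) / (2 * Real.pi * Complex.I) = (n x : ℂ) := by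
    rw [div_eq_iff hpi]; linear_combination hn x hx
  simp only [this, Function.comp, Complex.intCast_re]

lemma log_diff_const {K : Set X} {L₁ L₂ : X → ℂ} (hK : IsPreconnected K) (h₁ : ContinuousOn L₁ K)
    (h₂ : ContinuousOn L₂ K) (he : ∀ x ∈ K, Complex.exp (L₁ x) = Complex.exp (L₂ x)) :
    ∃ n : ℤ, ∀ x ∈ K, L₁ x = L₂ x + n * (2 * Real.pi * Complex.I) := by
  obtain ⟨n, hn, e⟩ := exists_int_of_exp_eq h₁ h₂ he
  rcases K.eq_empty_or_nonempty with rfl | ⟨a, ha⟩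
  · exact ⟨0, by simp⟩
  · exact ⟨n a, fun x hx => by rw [e x hx, hK.constant hn hx ha]⟩

/-- gluing two functions continuous on closed sets -/
lemma glue_continuousOn {Z : Type*} [TopologicalSpace Z] {K₁ K₂ : Set X} (c₁ : IsClosed K₁)
    (c₂ : IsClosed K₂) {f g : X → Z}
    (hf : ContinuousOn f K₁) (hg : ContinuousOn g K₂) (hfg : ∀ x ∈ K₁ ∩ K₂, f x = g x) :
    ∃ F : X → Z, ContinuousOn F (K₁ ∪ K₂) ∧ (∀ x ∈ K₁, F x = f x) ∧ ∀ x ∈ K₂, F x = g x := by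
  classical
  have e1 : ∀ x ∈ K₁, (if x ∈ K₁ then f x else g x) = f x := fun x hx => if_pos hx
  have e2 : ∀ x ∈ K₂, (if x ∈ K₁ then f x else g x) = g x := fun x hx => by
    by_cases h : x ∈ K₁
    · rw [if_pos h, hfg x ⟨h, hx⟩]
    · rw [if_neg h]
  refine ⟨fun x => if x ∈ K₁ then f x else g x, ?_, e1, e2⟩
  exact (hf.congr e1).union_of_isClosed (hg.congr e2) c₁ c₂

lemma HasLog.union {h : X → ℂ} {K₁ K₂ : Set X} (H₁ : HasLog h K₁) (H₂ : HasLog h K₂)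
    (c₁ : IsClosed K₁) (c₂ : IsClosed K₂) (hp : IsPreconnected (K₁ ∩ K₂)) :
    HasLog h (K₁ ∪ K₂) := by
  obtain ⟨L₁, h₁, e₁⟩ := H₁
  obtain ⟨L₂, h₂, e₂⟩ := H₂
  obtain ⟨n, hn⟩ := log_diff_const hp (h₁.mono inter_subset_left) (h₂.mono inter_subset_right)
    (fun x hx => by rw [← e₁ x hx.1, ← e₂ x hx.2])
  obtain ⟨F, hF, f1, f2⟩ := glue_continuousOn c₁ c₂ h₁
    (h₂.add (continuousOn_const (c := (n : ℂ) * (2 * Real.pi * Complex.I)))) hn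
  refine ⟨F, hF, ?_⟩
  rintro x (hx | hx)
  · rw [f1 x hx, e₁ x hx]
  · rw [f2 x hx, e₂ x hx, Pi.add_apply, Complex.exp_add, Complex.exp_int_mul_two_pi_mul_I, mul_one]

end basic

lemma hasLog_of_simplyConnected {X : Type*} [TopologicalSpace X] {K : Set X} [SimplyConnectedSpace K]
    [LocallyPathConnectedSpace K] {h : X → ℂ} (hc : ContinuousOn h K) (h0 : ∀ x ∈ K, h x ≠ 0) :
    HasLog h K := by
  classical
  obtain ⟨a⟩ : Nonempty K := inferInstance
  obtain ⟨F, ⟨-, hF⟩, -⟩ := Complex.isCoveringMapOn_exp.existsUnique_continuousMap_lifts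
    (A := K) (f := ⟨K.domRestrict h, continuousOn_iff_continuous_domRestrict.1 hc⟩) (a₀ := a)
    (e₀ := Complex.log (h a)) (Complex.exp_log (h0 a a.2))
    (fun x => h0 x x.2)
  refine ⟨fun x => if hx : x ∈ K then F ⟨x, hx⟩ else 0, ?_, ?_⟩
  · rw [continuousOn_iff_continuous_domRestrict]
    refine F.continuous.congr fun x => ?_
    simp
  · intro x hx
    have := congrFun hF ⟨x, hx⟩
    simp only [hx, dif_pos]
    exact this.symm

lemma hasLog_of_convex {E : Type*} [NormedAddCommGroup E] [NormedSpace ℝ E] {K : Set E}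
    (hK : Convex ℝ K) {h : E → ℂ} (hc : ContinuousOn h K) (h0 : ∀ x ∈ K, h x ≠ 0) :
    HasLog h K := by
  rcases K.eq_empty_or_nonempty with rfl | hne
  · exact ⟨0, continuousOn_empty _, by simp⟩
  have := hK.contractibleSpace hne
  have := hK.locallyPathConnectedSpace
  exact hasLog_of_simplyConnected hc h0

lemma not_hasLog_sub_sphere {R : ℝ} {x : ℂ} (hx : ‖x‖ < R) :
    ¬ HasLog (fun z => z - x) (sphere (0 : ℂ) R) := by
  intro H
  have hR : 0 < R := (norm_nonneg x).trans_lt hx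
  have Hid : HasLog (fun z : ℂ => z) (sphere (0 : ℂ) R) := by
    have : HasLog (fun z : ℂ => (z - x) / z) (sphere (0 : ℂ) R) := by
      have hne : ∀ z ∈ sphere (0 : ℂ) R, z ≠ 0 := by
        rintro z hz rfl
        simp at hz; linarith
      refine hasLog_of_slit ((continuousOn_id.sub continuousOn_const).div continuousOn_id hne) ?_
      intro z hz
      rw [Complex.mem_slitPlane_iff]
      left
      have h1 : (z - x) / z = 1 - x / z := by field_simp [hne z hz]
      have h2 : ‖x / z‖ < 1 := by
        rw [norm_div, div_lt_one (norm_pos_iff.2 (hne z hz))]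
        simpa [mem_sphere_zero_iff_norm.1 hz] using hx
      have := (Complex.abs_re_le_norm (x / z)).trans_lt h2
      rw [abs_lt] at this
      simp only [id, h1, Complex.sub_re, Complex.one_re]; linarith
    refine (H.div this).congr fun z hz => ?_
    have hz0 : z ≠ 0 := by
      rintro rfl
      simp at hz; linarith
    have := H.ne_zero hz
    field_simp
  obtain ⟨L, hL, e⟩ := Hid
  have hm : ∀ t : ℝ, (R : ℂ) * Complex.exp (t * Complex.I) ∈ sphere (0 : ℂ) R := by
    intro t
    simp [Complex.norm_exp_ofReal_mul_I, abs_of_pos hR]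
  obtain ⟨n, hn⟩ := log_diff_const (K := (univ : Set ℝ)) (L₁ := fun t : ℝ => L (R * Complex.exp (t * Complex.I)))
    (L₂ := fun t => Complex.log R + t * Complex.I) isPreconnected_univ
    (hL.comp (by fun_prop) (fun t _ => hm t)) (by fun_prop) (fun t _ => by
      beta_reduce
      rw [← e _ (hm t), Complex.exp_add, Complex.exp_log (by exact_mod_cast hR.ne')])
  have h0 := hn 0 trivial
  have h1 := hn (2 * Real.pi) trivial
  simp only [Complex.ofReal_mul, Complex.ofReal_ofNat, Complex.exp_two_pi_mul_I, Complex.ofReal_zero,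
    zero_mul, Complex.exp_zero] at h0 h1
  rw [h0] at h1
  have : (2 * Real.pi * Complex.I : ℂ) = 0 := by linear_combination -h1
  exact Complex.two_pi_I_ne_zero this

/-- no zero-free extension of `z - x` from a big circle -/
lemma no_ext {R : ℝ} {x : ℂ} (hx : ‖x‖ < R) {h : ℂ → ℂ} (hc : ContinuousOn h (closedBall 0 R))
    (h0 : ∀ z ∈ closedBall (0 : ℂ) R, h z ≠ 0) (hs : ∀ z ∈ sphere (0 : ℂ) R, h z = z - x) : False :=
  not_hasLog_sub_sphere hx
    (((hasLog_of_convex (convex_closedBall 0 R) hc h0).mono sphere_subset_closedBall).congr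
      fun z hz => (hs z hz).symm)

/-- a zero-free function on the punctured disc with a log on the circle has a log. -/
lemma hasLog_punctured {h : ℂ → ℂ} (hc : ContinuousOn h (closedBall 0 1 \ {0}))
    (h0 : ∀ z ∈ closedBall (0 : ℂ) 1 \ {0}, h z ≠ 0) (hs : HasLog h (sphere 0 1)) :
    HasLog h (closedBall (0 : ℂ) 1 \ {0}) := by
  have hm : MapsTo Complex.exp {w : ℂ | w.re ≤ 0} (closedBall (0 : ℂ) 1 \ {0}) := by
    intro w hw
    simp only [Set.mem_sdiff, mem_closedBall_zero_iff, Complex.norm_exp, mem_singleton_iff,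
      Complex.exp_ne_zero, not_false_eq_true, and_true]
    simpa using hw
  have hcv : Convex ℝ {w : ℂ | w.re ≤ 0} := convex_halfSpace_re_le 0
  obtain ⟨L, hL, e⟩ := hasLog_of_convex (K := {w : ℂ | w.re ≤ 0}) (h := fun w => h (Complex.exp w))
    hcv (hc.comp Complex.continuous_exp.continuousOn hm) (fun w hw => h0 _ (hm hw))
  replace e : ∀ w : ℂ, w.re ≤ 0 → h (Complex.exp w) = Complex.exp (L w) := e
  obtain ⟨M, hM, eM⟩ := hs
  -- periodicity
  obtain ⟨n, hn⟩ := log_diff_const (L₁ := fun w => L (w + 2 * Real.pi * Complex.I)) (L₂ := L)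
    hcv.isPreconnected (hL.comp (by fun_prop) (fun w hw => by simpa using hw)) hL
    (fun w hw => by
      rw [← e _ hw, ← e (w + 2 * Real.pi * Complex.I) (by simpa using hw), Complex.exp_periodic w])
  have hI : ∀ t : ℝ, (t * Complex.I : ℂ).re = 0 := fun t => by simp
  obtain ⟨k, hk⟩ := log_diff_const (K := (univ : Set ℝ)) (L₁ := fun t : ℝ => L (t * Complex.I))
    (L₂ := fun t : ℝ => M (Complex.exp (t * Complex.I))) isPreconnected_univ
    (hL.comp (by fun_prop) (fun t _ => (hI t).le))
    (hM.comp (by fun_prop) (fun t _ => by simp [Complex.norm_exp_ofReal_mul_I]))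
    (fun t _ => by
      rw [← e _ (hI t).le, eM _ (by simp [Complex.norm_exp_ofReal_mul_I])])
  have hn0 : (n : ℂ) * (2 * Real.pi * Complex.I) = 0 := by
    have a0 := hk 0 trivial
    have a1 := hk (2 * Real.pi) trivial
    have a2 := hn 0 (by simp)
    simp only [Complex.ofReal_mul, Complex.ofReal_ofNat, Complex.exp_two_pi_mul_I,
      Complex.ofReal_zero, zero_mul, Complex.exp_zero, zero_add] at a0 a1 a2
    rw [a1, a0] at a2
    linear_combination -a2
  have hper : ∀ w : ℂ, w.re ≤ 0 → L (w + 2 * Real.pi * Complex.I) = L w := fun w hw => by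
    have := hn w hw
    rw [hn0, add_zero] at this; exact this
  have hperN : ∀ (j : ℕ) (w : ℂ), w.re ≤ 0 → L (w + j * (2 * Real.pi * Complex.I)) = L w := by
    intro j
    induction j with
    | zero => intro w _; simp
    | succ j ih =>
      intro w hw
      have := hper (w + j * (2 * Real.pi * Complex.I)) (by simpa using hw)
      rw [ih w hw] at this
      rw [← this]; congr 1; push_cast; ring
  have hperE : ∀ w w' : ℂ, w.re ≤ 0 → w'.re ≤ 0 → Complex.exp w = Complex.exp w' → L w = L w' := by
    intro w w' hw hw' h
    obtain ⟨j, hj⟩ := Complex.exp_eq_exp_iff_exists_int.1 h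
    obtain ⟨j, rfl | rfl⟩ := j.eq_nat_or_neg
    · rw [hj]; simpa using hperN j w' hw'
    · have : w' = w + j * (2 * Real.pi * Complex.I) := by rw [hj]; push_cast; ring
      rw [this, hperN j w hw]
  have hre : ∀ z ∈ closedBall (0 : ℂ) 1 \ {0}, (Complex.log z).re ≤ 0 := by
    rintro z ⟨hz, hz0⟩
    rw [Complex.log_re]
    exact Real.log_nonpos (norm_nonneg _) (by simpa using hz)
  refine ⟨fun z => L (Complex.log z), ?_, fun z hz => by
    rw [← e _ (hre z hz), Complex.exp_log hz.2]⟩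
  intro z hz
  by_cases hsl : z ∈ Complex.slitPlane
  · exact ContinuousWithinAt.comp (t := {w : ℂ | w.re ≤ 0}) (hL _ (hre z hz))
      (continuousAt_clog hsl).continuousWithinAt hre
  · have hsl' : -z ∈ Complex.slitPlane := by
      rw [Complex.mem_slitPlane_iff] at hsl ⊢
      simp only [Complex.neg_re, Complex.neg_im]
      push Not at hsl
      left
      have hz0 : z ≠ 0 := hz.2
      rcases hsl.1.lt_or_eq with h | h
      · linarith
      · exact absurd (Complex.ext h hsl.2) hz0
    have key : ∀ y ∈ closedBall (0 : ℂ) 1 \ {0},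
        L (Complex.log y) = L (Complex.log (-y) + Real.pi * Complex.I) := by
      intro y hy
      refine hperE _ _ (hre y hy) ?_ ?_
      · simpa using hre (-y) (by simpa using hy)
      · rw [Complex.exp_log hy.2, Complex.exp_add, Complex.exp_log (neg_ne_zero.2 hy.2),
          Complex.exp_pi_mul_I]; ring
    refine ContinuousWithinAt.congr ?_ key (key z hz)
    refine ContinuousWithinAt.comp (t := {w : ℂ | w.re ≤ 0}) (hL _ ?_) ?_ ?_
    · simpa using hre (-z) (by simpa using hz)
    · exact (((continuousAt_clog hsl').comp continuous_neg.continuousAt).add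
        continuousAt_const).continuousWithinAt
    · intro y hy
      simpa using hre (-y) (by simpa using hy)

lemma tietze {X : Type*} [TopologicalSpace X] [NormalSpace X] {K : Set X} (hK : IsClosed K)
    {L : X → ℂ} (hL : ContinuousOn L K) : ∃ G : X → ℂ, Continuous G ∧ ∀ x ∈ K, G x = L x := by
  obtain ⟨g, hg⟩ := ContinuousMap.exists_restrict_eq hK
    (⟨K.domRestrict L, continuousOn_iff_continuous_domRestrict.1 hL⟩ : C(K, ℂ))
  exact ⟨g, g.continuous, fun x hx => congrArg (fun φ : C(K, ℂ) => φ ⟨x, hx⟩) hg⟩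

lemma bdd_no_log {K B : Set ℂ} {x : ℂ} {w : ℂ → ℂ} (hK : IsCompact K) (hB : IsOpen B)
    (bB : Bornology.IsBounded B) (hf : frontier B ⊆ K) (hx : x ∈ B)
    (hw : ContinuousOn w (closure B)) (hw0 : ∀ z ∈ closure B, w z ≠ 0)
    (H : HasLog (fun z => (z - x) * w z) K) : False := by
  obtain ⟨L, hL, e⟩ := H
  obtain ⟨G, hG, eG⟩ := tietze hK.isClosed hL
  obtain ⟨h, hc, h1, h2⟩ := glue_continuousOn (K₁ := closure B) (K₂ := Bᶜ) isClosed_closure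
    hB.isClosed_compl (f := fun z => Complex.exp (G z) / w z) (g := fun z => z - x)
    ((hG.cexp.continuousOn).div hw hw0) (by fun_prop) (by
      rintro z ⟨hz, hz'⟩
      have hzK : z ∈ K := hf (by rw [hB.frontier_eq]; exact ⟨hz, hz'⟩)
      beta_reduce
      rw [eG z hzK, ← e z hzK]
      field_simp [hw0 z hz])
  have hun : closure B ∪ Bᶜ = univ := by
    rw [eq_univ_iff_forall]; intro z
    by_cases hz : z ∈ B
    · exact Or.inl (subset_closure hz)
    · exact Or.inr hz
  rw [hun] at hc
  obtain ⟨R, hR⟩ := bB.subset_ball 0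
  refine no_ext (R := R) (x := x) (by simpa using hR hx) (h := h) (hc.mono (subset_univ _)) ?_ ?_
  · intro z _
    by_cases hz : z ∈ B
    · rw [h1 z (subset_closure hz)]
      exact div_ne_zero (Complex.exp_ne_zero _) (hw0 z (subset_closure hz))
    · rw [h2 z hz]
      exact sub_ne_zero.2 (fun h => hz (h ▸ hx))
  · intro z hz
    refine h2 z fun hzB => ?_
    have := hR hzB
    simp at hz this; linarith

lemma frontier_comp_subset {U : Set ℂ} (hU : IsOpen U) (x : ℂ) :
    frontier (connectedComponentIn U x) ⊆ Uᶜ := by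
  intro z hz hzU
  have ho : IsOpen (connectedComponentIn U x) := hU.connectedComponentIn
  have hoz : IsOpen (connectedComponentIn U z) := hU.connectedComponentIn
  rw [ho.frontier_eq] at hz
  obtain ⟨w, hw1, hw2⟩ := mem_closure_iff.1 hz.1 _ hoz (mem_connectedComponentIn hzU)
  have := (connectedComponentIn_eq hw1).trans (connectedComponentIn_eq hw2).symm
  exact hz.2 (this ▸ mem_connectedComponentIn hzU)

/-- `x` and `y` are in the same component of the complement of `K` -/
def NSep (K : Set ℂ) (x y : ℂ) : Prop := y ∈ connectedComponentIn Kᶜ x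

lemma NSep.left {K : Set ℂ} {x y : ℂ} (h : NSep K x y) : x ∉ K :=
  connectedComponentIn_nonempty_iff.1 ⟨y, h⟩

lemma NSep.right {K : Set ℂ} {x y : ℂ} (h : NSep K x y) : y ∉ K :=
  connectedComponentIn_subset _ _ h

lemma NSep.symm {K : Set ℂ} {x y : ℂ} (h : NSep K x y) : NSep K y x := by
  unfold NSep
  rw [← connectedComponentIn_eq h]; exact mem_connectedComponentIn h.left

lemma NSep.trans {K : Set ℂ} {x y z : ℂ} (h : NSep K x y) (h' : NSep K y z) : NSep K x z := by
  unfold NSep at *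
  rwa [connectedComponentIn_eq h]

lemma NSep.of_preconn {K C : Set ℂ} {x y : ℂ} (hC : IsPreconnected C) (hCK : C ⊆ Kᶜ) (hx : x ∈ C)
    (hy : y ∈ C) : NSep K x y := hC.subset_connectedComponentIn hx hCK hy

lemma NSep.mono {K K' : Set ℂ} {x y : ℂ} (h : NSep K x y) (hK : K' ⊆ K) : NSep K' x y :=
  connectedComponentIn_mono _ (compl_subset_compl.2 hK) h

lemma hasLog_near {K : Set ℂ} {x y : ℂ} (h : ∀ z ∈ K, ‖y - x‖ < ‖z - x‖) :
    HasLog (fun z => (z - y) / (z - x)) K := by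
  have hne : ∀ z ∈ K, z - x ≠ 0 := fun z hz => norm_pos_iff.1 ((norm_nonneg _).trans_lt (h z hz))
  refine hasLog_of_slit (ContinuousOn.div (by fun_prop) (by fun_prop) hne) fun z hz => ?_
  rw [Complex.mem_slitPlane_iff]
  left
  have h1 : (z - y) / (z - x) = 1 - (y - x) / (z - x) := by
    have := hne z hz
    field_simp; ring
  have h2 : ‖(y - x) / (z - x)‖ < 1 := by
    rw [norm_div, div_lt_one (norm_pos_iff.2 (hne z hz))]
    exact h z hz
  have := (Complex.abs_re_le_norm ((y - x) / (z - x))).trans_lt h2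
  rw [abs_lt] at this
  rw [h1, Complex.sub_re, Complex.one_re]; linarith

lemma NSep.hasLog {K : Set ℂ} (hK : IsClosed K) {x y : ℂ} (h : NSep K x y) :
    HasLog (fun z => (z - x) / (z - y)) K := by
  refine (isPreconnected_connectedComponentIn (x := x) (F := Kᶜ)).induction₂'
    (fun a b => HasLog (fun z => (z - a) / (z - b)) K) ?_ ?_ (mem_connectedComponentIn h.left) h
  · intro a ha
    have haK : a ∉ K := connectedComponentIn_subset _ _ ha
    obtain ⟨ε, hε, hb⟩ := Metric.isOpen_iff.1 hK.isOpen_compl a haK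
    filter_upwards [mem_nhdsWithin_of_mem_nhds (ball_mem_nhds a hε)] with b hb'
    have key : HasLog (fun z => (z - b) / (z - a)) K := hasLog_near fun z hz => by
      have h1 : ¬ dist z a < ε := fun h => hb h hz
      rw [mem_ball, dist_eq_norm] at hb'
      rw [dist_eq_norm] at h1
      exact hb'.trans_le (not_lt.1 h1)
    exact ⟨key.inv.congr fun z _ => (inv_div _ _).symm, key⟩
  · intro a b c _ hb _ h1 h2
    refine (h1.mul h2).congr fun z hz => ?_
    have : z - b ≠ 0 := sub_ne_zero.2 (by
      rintro rfl; exact connectedComponentIn_subset _ _ hb hz)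
    by_cases hc : z - c = 0
    · simp [hc]
    · field_simp

lemma isPreconnected_far {R : ℝ} (hR : 0 < R) : IsPreconnected {z : ℂ | R < ‖z‖} := by
  have : {z : ℂ | R < ‖z‖} = Complex.exp '' {w : ℂ | Real.log R < w.re} := by
    ext z
    constructor
    · intro hz
      have hz' : R < ‖z‖ := hz
      have : z ≠ 0 := norm_pos_iff.1 (hR.trans hz)
      exact ⟨Complex.log z, by
        rw [mem_setOf_eq, Complex.log_re]; exact Real.log_lt_log hR hz', Complex.exp_log this⟩
    · rintro ⟨w, hw, rfl⟩
      rw [mem_setOf_eq, Complex.norm_exp]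
      exact (Real.log_lt_iff_lt_exp hR).1 hw
  rw [this]
  exact ((convex_halfSpace_re_gt _).isPreconnected).image _ Complex.continuous_exp.continuousOn

lemma NSep_of_unbounded {K : Set ℂ} (hK : Bornology.IsBounded K) {x y : ℂ}
    (hx : ¬ Bornology.IsBounded (connectedComponentIn Kᶜ x))
    (hy : ¬ Bornology.IsBounded (connectedComponentIn Kᶜ y)) : NSep K x y := by
  obtain ⟨R, hR, hb⟩ := hK.subset_ball_lt 0 0
  have far : ∀ u, ¬ Bornology.IsBounded (connectedComponentIn Kᶜ u) →
      ∃ v, R < ‖v‖ ∧ NSep K u v := by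
    intro u hu
    by_contra! hcon
    refine hu ((isBounded_closedBall (x := (0 : ℂ)) (r := R)).subset fun v hv => ?_)
    by_contra hv'
    exact hcon v (by simpa using hv') hv
  obtain ⟨a, ha, hxa⟩ := far x hx
  obtain ⟨b, hb', hyb⟩ := far y hy
  refine hxa.trans (NSep.trans ?_ hyb.symm)
  refine NSep.of_preconn (isPreconnected_far hR) ?_ ha hb'
  intro z hz hzK
  have := hb hzK
  simp at this
  exact absurd hz (by simp; linarith)

lemma far_unbounded {K : Set ℂ} {R : ℝ} (hR : 0 < R) (hK : K ⊆ closedBall 0 R) {y : ℂ}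
    (hy : R < ‖y‖) : ¬ Bornology.IsBounded (connectedComponentIn Kᶜ y) := by
  intro hb
  have hsub : {z : ℂ | R < ‖z‖} ⊆ connectedComponentIn Kᶜ y := by
    refine (isPreconnected_far hR).subset_connectedComponentIn hy ?_
    intro z hz hzK
    have := hK hzK
    simp at this
    exact absurd hz (by simp; linarith)
  obtain ⟨R', h1, h2⟩ := (hb.subset hsub).subset_ball_lt R 0
  have : ((R' : ℂ)) ∈ ball (0 : ℂ) R' := h2 (by
    simp [abs_of_pos (hR.trans h1), h1])
  simp [abs_of_pos (hR.trans h1)] at this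

/-- Eilenberg's criterion. -/
lemma NSep_of_hasLog {K : Set ℂ} (hK : IsCompact K) {x y : ℂ} (hx : x ∉ K) (hy : y ∉ K)
    (H : HasLog (fun z => (z - x) / (z - y)) K) : NSep K x y := by
  have key : ∀ x y : ℂ, x ∉ K → y ∉ K → HasLog (fun z => (z - x) / (z - y)) K →
      Bornology.IsBounded (connectedComponentIn Kᶜ x) → NSep K x y := by
    intro x y hx hy H hb
    by_contra hn
    have hfr : frontier (connectedComponentIn Kᶜ x) ⊆ K := by
      simpa using frontier_comp_subset hK.isClosed.isOpen_compl x
    have hyc : ∀ z ∈ closure (connectedComponentIn Kᶜ x), z - y ≠ 0 := by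
      rintro z hz h0
      rw [sub_eq_zero] at h0
      rw [closure_eq_self_union_frontier] at hz
      rcases hz with h | h
      · exact hn (h0 ▸ h)
      · exact hy (h0 ▸ hfr h)
    exact bdd_no_log hK hK.isClosed.isOpen_compl.connectedComponentIn hb hfr
      (mem_connectedComponentIn hx) (w := fun z => (z - y)⁻¹)
      (ContinuousOn.inv₀ (by fun_prop) hyc) (fun z hz => inv_ne_zero (hyc z hz))
      (H.congr fun z _ => (div_eq_mul_inv _ _).symm)
  by_cases h1 : Bornology.IsBounded (connectedComponentIn Kᶜ x)
  · exact key x y hx hy H h1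
  by_cases h2 : Bornology.IsBounded (connectedComponentIn Kᶜ y)
  · exact (key y x hy hx (H.inv.congr fun z _ => (inv_div _ _).symm) h2).symm
  exact NSep_of_unbounded hK.isBounded h1 h2

lemma janiszewski {K₁ K₂ : Set ℂ} (h₁ : IsCompact K₁) (h₂ : IsCompact K₂)
    (hp : IsPreconnected (K₁ ∩ K₂)) {x y : ℂ} (n₁ : NSep K₁ x y) (n₂ : NSep K₂ x y) :
    NSep (K₁ ∪ K₂) x y :=
  NSep_of_hasLog (h₁.union h₂) (by rintro (h | h); exacts [n₁.left h, n₂.left h])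
    (by rintro (h | h); exacts [n₁.right h, n₂.right h])
    ((n₁.hasLog h₁.isClosed).union (n₂.hasLog h₂.isClosed) h₁.isClosed h₂.isClosed hp)

lemma hasLog_sub_far {K : Set ℂ} {y : ℂ} (h : ∀ z ∈ K, ‖z‖ < ‖y‖) : HasLog (fun z => z - y) K := by
  have h1 : HasLog (fun z => (-y) * (1 - z / y)) K := by
    by_cases hy : y = 0
    · have : K = ∅ := by
        rw [eq_empty_iff_forall_notMem]; intro z hz
        have := h z hz
        rw [hy, norm_zero] at this
        exact absurd this (not_lt.2 (norm_nonneg _))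
      rw [this]; exact ⟨0, continuousOn_empty _, by simp⟩
    refine (hasLog_const (neg_ne_zero.2 hy) K).mul (hasLog_of_slit (by fun_prop) fun z hz => ?_)
    rw [Complex.mem_slitPlane_iff]; left
    have h2 : ‖z / y‖ < 1 := by
      rw [norm_div, div_lt_one (norm_pos_iff.2 hy)]; exact h z hz
    have := (Complex.abs_re_le_norm (z / y)).trans_lt h2
    rw [abs_lt] at this
    rw [Complex.sub_re, Complex.one_re]; linarith
  refine h1.congr fun z hz => ?_
  have : y ≠ 0 := by
    rintro rfl
    have := h z hz
    rw [norm_zero] at this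
    exact absurd this (not_lt.2 (norm_nonneg _))
  field_simp; ring

lemma hasLog_sub_of_unbounded {K : Set ℂ} (hK : IsCompact K) {x : ℂ}
    (hx : ¬ Bornology.IsBounded (connectedComponentIn Kᶜ x)) : HasLog (fun z => z - x) K := by
  obtain ⟨R, hR, hb⟩ := hK.isBounded.subset_ball_lt 0 0
  have hy : R < ‖((R + 1 : ℝ) : ℂ)‖ := by
    rw [Complex.norm_real, Real.norm_of_nonneg (by linarith)]; linarith
  have hn : NSep K x ((R + 1 : ℝ) : ℂ) := NSep_of_unbounded hK.isBounded hx
    (far_unbounded hR (hb.trans ball_subset_closedBall) hy)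
  have h2 : HasLog (fun z => z - ((R + 1 : ℝ) : ℂ)) K := hasLog_sub_far fun z hz => by
    have := hb hz
    rw [mem_ball_zero_iff] at this
    exact this.trans hy
  refine ((hn.hasLog hK.isClosed).mul h2).congr fun z hz => ?_
  have := h2.ne_zero hz
  field_simp

lemma not_hasLog_sub_of_bounded {K : Set ℂ} (hK : IsCompact K) {x : ℂ} (hx : x ∉ K)
    (hb : Bornology.IsBounded (connectedComponentIn Kᶜ x)) : ¬ HasLog (fun z => z - x) K := by
  intro H
  refine bdd_no_log hK hK.isClosed.isOpen_compl.connectedComponentIn hb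
    (by simpa using frontier_comp_subset hK.isClosed.isOpen_compl x)
      (mem_connectedComponentIn hx) (w := fun z => 1) continuousOn_const (fun z _ => one_ne_zero)
      (H.congr fun z _ => mul_one _)

/-- products of integer powers of `z - p`, `p ∈ S`. -/
inductive RatOn (S : Set ℂ) : (ℂ → ℂ) → Prop
  | one : RatOn S (fun _ => 1)
  | mul (r : ℂ → ℂ) (p : ℂ) (k : ℤ) : RatOn S r → p ∈ S → RatOn S (fun z => r z * (z - p) ^ k)

lemma RatOn.mono {S T : Set ℂ} {r : ℂ → ℂ} (h : RatOn S r) (hST : S ⊆ T) : RatOn T r := by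
  induction h with
  | one => exact .one
  | mul r p k _ hp ih => exact .mul r p k ih (hST hp)

lemma RatOn.mul' {S : Set ℂ} {r r' : ℂ → ℂ} (h : RatOn S r) (h' : RatOn S r') :
    RatOn S (fun z => r z * r' z) := by
  induction h' with
  | one => simpa using h
  | mul r' p k _ hp ih => simpa [mul_assoc] using RatOn.mul _ p k ih hp

lemma HasLog.zpow {X : Type*} [TopologicalSpace X] {h : X → ℂ} {K : Set X} (H : HasLog h K) (k : ℤ) :
    HasLog (fun x => h x ^ k) K := by
  obtain ⟨L, hL, e⟩ := H
  exact ⟨fun x => k * L x, continuousOn_const.mul hL, fun x hx => by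
    beta_reduce; rw [e x hx, ← Complex.exp_int_mul]⟩

lemma RatOn.hasLog {S K : Set ℂ} {r : ℂ → ℂ} (h : RatOn S r)
    (H : ∀ p ∈ S, HasLog (fun z => z - p) K) : HasLog r K := by
  induction h with
  | one => exact hasLog_const one_ne_zero K
  | mul r p k _ hp ih => exact ih.mul ((H p hp).zpow k)

lemma chain {P : ℝ → ℝ → Prop} (h : ∀ s t u, s ≤ t → t ≤ u → P s t → P t u → P s u)
    (hl : ∀ c, ∃ δ > 0, ∀ s t, c - δ < s → s ≤ t → t < c + δ → P s t) {a b : ℝ} (hab : a ≤ b) :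
    P a b := by
  choose δ hδ hP using hl
  obtain ⟨t, t0, tm, ⟨m, hm⟩, ht⟩ := exists_monotone_Icc_subset_open_cover_Icc hab
    (c := fun c : ℝ => {x : Icc a b | c - δ c < x.1 ∧ x.1 < c + δ c})
    (fun c => (isOpen_lt continuous_const continuous_subtype_val).inter
      (isOpen_lt continuous_subtype_val continuous_const))
    (fun x _ => mem_iUnion.2 ⟨x.1, by
      have := hδ x.1
      constructor <;> linarith⟩)
  have key : ∀ n, P a (t n) := by
    intro n
    induction n with
    | zero =>
      obtain ⟨c, hc⟩ := ht 0
      have := hc ⟨le_rfl, tm (Nat.zero_le 1)⟩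
      replace this : c - δ c < (t 0).1 ∧ (t 0).1 < c + δ c := this
      rw [t0] at this ⊢
      exact hP c _ _ this.1 le_rfl this.2
    | succ n ih =>
      obtain ⟨c, hc⟩ := ht n
      have hle : t n ≤ t (n + 1) := tm n.le_succ
      exact h _ _ _ (t n).2.1 hle ih (hP c _ _ (hc ⟨le_rfl, hle⟩).1 hle (hc ⟨hle, le_rfl⟩).2)
  have := key m
  rwa [hm m le_rfl] at this

lemma thicken_log {K : Set ℂ} (hK : IsCompact K) {h : ℂ → ℂ} (hc : ContinuousOn h K)
    {g : ℂ → ℝ} (hg : Continuous g) {c : ℝ} (H : HasLog h (K ∩ {z | g z = c})) :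
    ∃ δ > 0, HasLog h (K ∩ {z | |g z - c| < δ}) := by
  obtain ⟨L, hL, e⟩ := H
  have hcl : IsClosed (K ∩ {z | g z = c}) := hK.isClosed.inter (isClosed_eq hg continuous_const)
  obtain ⟨G, hG, eG⟩ := tietze hcl hL
  have hcont : ContinuousOn (fun z => h z * Complex.exp (-G z)) K := hc.mul (by fun_prop)
  set B : Set ℂ := K ∩ (fun z => (h z * Complex.exp (-G z)).re) ⁻¹' (Iic 0) with hB
  have hBc : IsCompact B := hK.of_isClosed_subset
    ((Complex.continuous_re.comp_continuousOn hcont).preimage_isClosed_of_isClosed hK.isClosed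
      isClosed_Iic) inter_subset_left
  have hpos : ∀ z ∈ B, 0 < |g z - c| := by
    rintro z ⟨hz, hz'⟩
    rw [abs_pos, sub_ne_zero]
    intro hgz
    have hzz : z ∈ K ∩ {z | g z = c} := ⟨hz, hgz⟩
    simp only [mem_preimage, mem_Iic] at hz'
    rw [eG z hzz, e z hzz, ← Complex.exp_add] at hz'
    norm_num at hz'
  obtain ⟨δ, hδ, hδ'⟩ : ∃ δ > 0, ∀ z ∈ B, δ ≤ |g z - c| := by
    rcases B.eq_empty_or_nonempty with hE | hne
    · exact ⟨1, one_pos, by simp [hE]⟩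
    · obtain ⟨z, hz, hmin⟩ := hBc.exists_isMinOn hne
        (f := fun z => |g z - c|) (by fun_prop)
      exact ⟨_, hpos z hz, fun w hw => hmin hw⟩
  refine ⟨δ, hδ, ?_⟩
  have h1 : HasLog (fun z => h z * Complex.exp (-G z)) (K ∩ {z | |g z - c| < δ}) := by
    refine hasLog_of_slit (hcont.mono inter_subset_left) fun z hz => ?_
    rw [Complex.mem_slitPlane_iff]; left
    by_contra hcon
    exact absurd (hδ' z ⟨hz.1, not_lt.1 hcon⟩) (not_le.2 hz.2)
  have h2 : HasLog (fun z => Complex.exp (G z)) (K ∩ {z | |g z - c| < δ}) :=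
    ⟨G, hG.continuousOn, fun _ _ => rfl⟩
  refine (h1.mul h2).congr fun z _ => ?_
  rw [mul_assoc, ← Complex.exp_add]; simp

lemma hasLog_line {K : Set ℂ} (hK : IsCompact K) {h : ℂ → ℂ} (hc : ContinuousOn h K)
    (h0 : ∀ z ∈ K, h z ≠ 0) (c : ℝ) : HasLog h (K ∩ {z | z.re = c}) := by
  set F := K ∩ {z | z.re = c} with hF
  have hFc : IsCompact F := hK.inter_right (isClosed_eq Complex.continuous_re continuous_const)
  have hsub : ∀ t : ℝ, (F ∩ {z | z.im = t}).Subsingleton := by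
    rintro t z ⟨⟨_, hz⟩, hz'⟩ w ⟨⟨_, hw⟩, hw'⟩
    exact Complex.ext (hz.trans hw.symm) (hz'.trans hw'.symm)
  obtain ⟨R, hR⟩ := hFc.isBounded.subset_closedBall 0
  by_cases hR0 : 0 ≤ R
  · have := chain (P := fun s t => HasLog h (F ∩ {z | s ≤ z.im ∧ z.im ≤ t})) ?_ ?_
      (a := -R) (b := R) (by linarith)
    · refine this.mono fun z hz => ⟨hz, ?_⟩
      have h1 := (Complex.abs_im_le_norm z).trans (mem_closedBall_zero_iff.1 (hR hz))
      exact abs_le.1 h1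
    · intro s t u hst htu h1 h2
      have hcl : ∀ a b : ℝ, IsClosed (F ∩ {z : ℂ | a ≤ z.im ∧ z.im ≤ b}) := fun a b =>
        hFc.isClosed.inter ((isClosed_le continuous_const Complex.continuous_im).inter
          (isClosed_le Complex.continuous_im continuous_const))
      refine (h1.union h2 (hcl _ _) (hcl _ _) ?_).mono ?_
      · refine Set.Subsingleton.isPreconnected ((hsub t).anti ?_)
        rintro z ⟨⟨hz, _, h1⟩, ⟨_, h2, _⟩⟩
        exact ⟨hz, le_antisymm h1 h2⟩
      · rintro z ⟨hz, h1, h2⟩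
        rcases le_total z.im t with h | h
        · exact Or.inl ⟨hz, h1, h⟩
        · exact Or.inr ⟨hz, h, h2⟩
    · intro t
      have : HasLog h (F ∩ {z | z.im = t}) := by
        rcases (hsub t).eq_empty_or_singleton with hE | ⟨w, hw⟩
        · rw [hE]; exact ⟨0, continuousOn_empty _, by simp⟩
        · rw [hw]
          have hwK : w ∈ K := (hw.symm ▸ mem_singleton w : w ∈ F ∩ {z | z.im = t}).1.1
          exact ⟨fun _ => Complex.log (h w), continuousOn_const, fun z hz => by
            rw [mem_singleton_iff.1 hz, Complex.exp_log (h0 w hwK)]⟩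
      obtain ⟨δ, hδ, H⟩ := thicken_log hFc (hc.mono inter_subset_left) Complex.continuous_im this
      refine ⟨δ, hδ, fun s u hs _ hu => H.mono ?_⟩
      rintro z ⟨hz, h1, h2⟩
      exact ⟨hz, by rw [mem_setOf_eq, abs_lt]; constructor <;> linarith⟩
  · have hE : F = ∅ := by
      rw [eq_empty_iff_forall_notMem]; intro z hz
      exact hR0 ((norm_nonneg z).trans (mem_closedBall_zero_iff.1 (hR hz)))
    rw [hE]; exact ⟨0, continuousOn_empty _, by simp⟩

lemma log_neg_of_im_pos {w : ℂ} (h : 0 < w.im) :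
    Complex.log (-w) = Complex.log w - Real.pi * Complex.I := by
  apply Complex.ext
  · simp [Complex.log_re]
  · simp [Complex.log_im, Complex.arg_neg_eq_arg_sub_pi_of_im_pos h]

lemma log_neg_of_im_neg {w : ℂ} (h : w.im < 0) :
    Complex.log (-w) = Complex.log w + Real.pi * Complex.I := by
  apply Complex.ext
  · simp [Complex.log_re]
  · simp [Complex.log_im, Complex.arg_neg_eq_arg_add_pi_of_im_neg h]

lemma slit_of_re_nonneg {w : ℂ} (h : 0 ≤ w.re) (h0 : w ≠ 0) : w ∈ Complex.slitPlane := by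
  rw [Complex.mem_slitPlane_iff]
  rcases h.lt_or_eq with h | h
  · exact Or.inl h
  · exact Or.inr fun h' => h0 (Complex.ext h.symm h')

lemma hasLog_sub_right {K : Set ℂ} {p : ℂ} (hp : p ∉ K) (h : ∀ z ∈ K, p.re ≤ z.re) :
    HasLog (fun z => z - p) K :=
  hasLog_of_slit (by fun_prop) fun z hz => slit_of_re_nonneg (by simpa using h z hz)
    (sub_ne_zero.2 fun h => hp (h ▸ hz))

lemma hasLog_sub_left {K : Set ℂ} {p : ℂ} (hp : p ∉ K) (h : ∀ z ∈ K, z.re ≤ p.re) :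
    HasLog (fun z => z - p) K := by
  have : HasLog (fun z => (-1 : ℂ) * (p - z)) K :=
    (hasLog_const (by norm_num) K).mul (hasLog_of_slit (by fun_prop) fun z hz =>
      slit_of_re_nonneg (by simpa using h z hz) (sub_ne_zero.2 fun h => hp (h ▸ hz)))
  exact this.congr fun z _ => by ring

/-- gluing along a vertical line -/
lemma glue_line {KL KR : Set ℂ} (hL : IsCompact KL) (hR : IsCompact KR) (c : ℝ)
    (hKL : ∀ z ∈ KL, z.re ≤ c) (hKR : ∀ z ∈ KR, c ≤ z.re)
    (hLR : ∀ z, z.re = c → (z ∈ KL ↔ z ∈ KR)) {h : ℂ → ℂ} (H1 : HasLog h KL)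
    (H2 : HasLog h KR) :
    ∃ r, RatOn {p | p ∉ KL ∪ KR ∧ p.re = c} r ∧ HasLog (fun z => h z * r z) (KL ∪ KR) := by
  obtain ⟨L1, c1, e1⟩ := H1
  obtain ⟨L2, c2, e2⟩ := H2
  have hLRe : ∀ z ∈ KL, z ∈ KR → z.re = c := fun z h1 h2 => le_antisymm (hKL z h1) (hKR z h2)
  obtain ⟨n, hn, en⟩ := exists_int_of_exp_eq (K := KL ∩ KR) (c1.mono inter_subset_left)
    (c2.mono inter_subset_right) (fun x hx => by rw [← e1 x hx.1, ← e2 x hx.2])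
  -- the condition carried along the line
  let Q : ℝ → Prop := fun t => ∃ (r M1 M2 : ℂ → ℂ) (k : ℤ),
    RatOn {p | p ∉ KL ∪ KR ∧ p.re = c} r ∧ ContinuousOn M1 KL ∧ ContinuousOn M2 KR ∧
    (∀ z ∈ KL, h z * r z = Complex.exp (M1 z)) ∧ (∀ z ∈ KR, h z * r z = Complex.exp (M2 z)) ∧
    (∀ z ∈ KL ∩ KR, z.im ≤ t → M1 z = M2 z) ∧
    (∀ z ∈ KL ∩ KR, t ≤ z.im → M1 z = M2 z + (n z - k : ℤ) * (2 * Real.pi * Complex.I))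
  have hIc : IsCompact (KL ∩ KR) := hL.inter hR
  obtain ⟨R, hR0, hRb⟩ := hIc.isBounded.subset_ball_lt 0 0
  have him : ∀ z ∈ KL ∩ KR, -R < z.im ∧ z.im < R := fun z hz =>
    abs_lt.1 ((Complex.abs_im_le_norm z).trans_lt (mem_ball_zero_iff.1 (hRb hz)))
  have hQ0 : Q (-R) := by
    refine ⟨fun _ => 1, L1, L2, 0, .one, c1, c2, fun z hz => by simp [e1 z hz],
      fun z hz => by simp [e2 z hz], ?_, ?_⟩
    · intro z hz h'
      exact absurd (him z hz).1 (not_lt.2 h')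
    · intro z hz _
      simpa using en z hz
  have main := chain (P := fun s t => Q s → Q t) ?_ ?_ (a := -R) (b := R) (by linarith) hQ0
  · obtain ⟨r, M1, M2, k, hr, m1, m2, f1, f2, f3, -⟩ := main
    obtain ⟨M, hM, g1, g2⟩ := glue_continuousOn hL.isClosed hR.isClosed m1 m2
      (fun z hz => f3 z hz (him z hz).2.le)
    refine ⟨r, hr, M, hM, ?_⟩
    rintro z (hz | hz)
    · rw [g1 z hz, ← f1 z hz]
    · rw [g2 z hz, ← f2 z hz]
  · intro s t u _ _ h1 h2 h3
    exact h2 (h1 h3)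
  · intro t
    -- n is constant near height t
    obtain ⟨δ, hδ, hconst⟩ : ∃ δ > 0, ∀ z ∈ KL ∩ KR, ∀ w ∈ KL ∩ KR, |z.im - t| < δ →
        |w.im - t| < δ → n z = n w := by
      by_cases hw : ∃ w ∈ KL ∩ KR, w.im = t
      · obtain ⟨w, hw, hwt⟩ := hw
        have hcw := hn w hw
        have : ∀ᶠ z in 𝓝[KL ∩ KR] w, n z = n w := by
          have := hcw (mem_nhds_discrete.2 (mem_singleton (n w)))
          exact this
        obtain ⟨δ, hδ, hb⟩ := Metric.mem_nhdsWithin_iff.1 this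
        have key : ∀ z ∈ KL ∩ KR, |z.im - t| < δ → n z = n w := by
          intro z hz hzt
          refine hb ⟨?_, hz⟩
          rw [mem_ball, dist_eq_norm]
          have hre : (z - w).re = 0 := by
            rw [Complex.sub_re, hLRe z hz.1 hz.2, hLRe w hw.1 hw.2, sub_self]
          have hI : z - w = ((z.im - t : ℝ) : ℂ) * Complex.I := by
            apply Complex.ext
            · rw [hre]; simp
            · simp [hwt]
          rw [hI, norm_mul, Complex.norm_I, mul_one, Complex.norm_real]
          exact hzt
        exact ⟨δ, hδ, fun z hz w' hw' h1 h2 => (key z hz h1).trans (key w' hw' h2).symm⟩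
      · push Not at hw
        rcases (KL ∩ KR).eq_empty_or_nonempty with hE | hne
        · exact ⟨1, one_pos, by simp [hE]⟩
        · obtain ⟨z, hz, hmin⟩ := hIc.exists_isMinOn hne (f := fun z => |z.im - t|)
            (by fun_prop)
          refine ⟨|z.im - t|, abs_pos.2 (sub_ne_zero.2 (hw z hz)), fun w hw' _ _ h1 _ => ?_⟩
          exact absurd (hmin hw') (not_le.2 h1)
    refine ⟨δ, hδ, fun s u hs hsu hu => ?_⟩
    rintro ⟨r, M1, M2, k, hr, m1, m2, f1, f2, f3, f4⟩
    -- the value of n on the window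
    obtain ⟨v, hv⟩ : ∃ v : ℤ, ∀ z ∈ KL ∩ KR, s ≤ z.im → z.im ≤ u → n z = v := by
      by_cases hw : ∃ w ∈ KL ∩ KR, s ≤ w.im ∧ w.im ≤ u
      · obtain ⟨w, hw, w1, w2⟩ := hw
        exact ⟨n w, fun z hz z1 z2 => hconst z hz w hw (abs_lt.2 ⟨by linarith, by linarith⟩)
          (abs_lt.2 ⟨by linarith, by linarith⟩)⟩
      · push Not at hw
        exact ⟨0, fun z hz z1 z2 => absurd z2 (not_le.2 (hw z hz z1))⟩
    set p : ℂ := ⟨c, s⟩ with hp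
    by_cases hps : p ∈ KL ∪ KR
    · have hpI : p ∈ KL ∩ KR := by
        rcases hps with h | h
        · exact ⟨h, (hLR p rfl).1 h⟩
        · exact ⟨(hLR p rfl).2 h, h⟩
      have hkv : k = v := by
        have a1 := f3 p hpI le_rfl
        have a2 := f4 p hpI le_rfl
        rw [a1] at a2
        have a3 : (((n p - k : ℤ) : ℂ)) * (2 * Real.pi * Complex.I) = 0 := by
          linear_combination -a2
        rcases mul_eq_zero.1 a3 with a4 | a4
        · have : n p - k = 0 := by exact_mod_cast a4
          have := hv p hpI le_rfl hsu
          omega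
        · exact absurd a4 Complex.two_pi_I_ne_zero
      refine ⟨r, M1, M2, k, hr, m1, m2, f1, f2, ?_, fun z hz hzu => f4 z hz (hsu.trans hzu)⟩
      intro z hz hzu
      rcases le_total z.im s with h' | h'
      · exact f3 z hz h'
      · rw [f4 z hz h', hv z hz h' hzu, hkv]; simp
    · have hpL : p ∉ KL := fun h => hps (Or.inl h)
      have hpR : p ∉ KR := fun h => hps (Or.inr h)
      have ne : ∀ z ∈ KL ∪ KR, z - p ≠ 0 := fun z hz => sub_ne_zero.2 fun h => hps (h ▸ hz)
      have sl1 : ∀ z ∈ KL, -(z - p) ∈ Complex.slitPlane := fun z hz =>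
        slit_of_re_nonneg (by simpa [hp] using hKL z hz) (neg_ne_zero.2 (ne z (Or.inl hz)))
      have sl2 : ∀ z ∈ KR, z - p ∈ Complex.slitPlane := fun z hz =>
        slit_of_re_nonneg (by simpa [hp] using hKR z hz) (ne z (Or.inr hz))
      have hzs : ∀ z ∈ KL ∩ KR, z.im ≠ s := by
        intro z hz h'
        have : z = p := Complex.ext (hLRe z hz.1 hz.2) h'
        exact hpL (this ▸ hz.1)
      refine ⟨fun z => r z * (z - p) ^ (v - k), fun z => M1 z + ((v - k : ℤ) : ℂ) *
          (Complex.log (-(z - p)) - Real.pi * Complex.I),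
        fun z => M2 z + ((v - k : ℤ) : ℂ) * Complex.log (z - p), v,
        .mul r p (v - k) hr ⟨hps, rfl⟩, ?_, ?_, ?_, ?_, ?_, ?_⟩
      · exact m1.add (continuousOn_const.mul (((by fun_prop : ContinuousOn (fun z : ℂ => -(z - p))
          KL).clog sl1).sub continuousOn_const))
      · exact m2.add (continuousOn_const.mul ((by fun_prop : ContinuousOn (fun z : ℂ => (z - p))
          KR).clog sl2))
      · intro z hz
        rw [Complex.exp_add, ← f1 z hz, Complex.exp_int_mul, Complex.exp_sub,
          Complex.exp_log (neg_ne_zero.2 (ne z (Or.inl hz))), Complex.exp_pi_mul_I]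
        rw [neg_div_neg_eq, div_one, mul_assoc]
      · intro z hz
        rw [Complex.exp_add, ← f2 z hz, Complex.exp_int_mul,
          Complex.exp_log (ne z (Or.inr hz)), mul_assoc]
      · intro z hz hzu
        rcases lt_or_gt_of_ne (hzs z hz) with h' | h'
        · have : (z - p).im < 0 := by simpa [hp] using h'
          beta_reduce
          rw [f3 z hz h'.le, log_neg_of_im_neg this]; ring
        · have : 0 < (z - p).im := by simpa [hp] using h'
          beta_reduce
          rw [f4 z hz h'.le, log_neg_of_im_pos this, hv z hz h'.le hzu]; push_cast; ring
      · intro z hz hzu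
        have h' : s < z.im := lt_of_le_of_ne (hsu.trans hzu) (hzs z hz).symm
        have : 0 < (z - p).im := by simpa [hp] using h'
        beta_reduce
        rw [f4 z hz h'.le, log_neg_of_im_pos this]; push_cast; ring

/-- Eilenberg's factorization theorem. -/
theorem factorization {K : Set ℂ} (hK : IsCompact K) {h : ℂ → ℂ} (hc : ContinuousOn h K)
    (h0 : ∀ z ∈ K, h z ≠ 0) : ∃ r, RatOn Kᶜ r ∧ HasLog (fun z => h z * r z) K := by
  obtain ⟨R, hR0, hRb⟩ := hK.isBounded.subset_ball_lt 0 0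
  have hcp : ∀ a b : ℝ, IsCompact (K ∩ {z : ℂ | a ≤ z.re ∧ z.re ≤ b}) := fun a b =>
    hK.inter_right ((isClosed_le continuous_const Complex.continuous_re).inter
      (isClosed_le Complex.continuous_re continuous_const))
  have := chain (P := fun s t => ∃ r, RatOn {p | p ∉ K ∧ s ≤ p.re ∧ p.re ≤ t} r ∧
    HasLog (fun z => h z * r z) (K ∩ {z | s ≤ z.re ∧ z.re ≤ t})) ?_ ?_
      (a := -R) (b := R) (by linarith)
  · obtain ⟨r, hr, hl⟩ := this
    refine ⟨r, hr.mono fun p hp => hp.1, hl.mono fun z hz => ⟨hz, ?_⟩⟩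
    have h1 := (Complex.abs_re_le_norm z).trans (mem_ball_zero_iff.1 (hRb hz)).le
    exact abs_le.1 h1
  · rintro s t u hst htu ⟨r1, hr1, H1⟩ ⟨r2, hr2, H2⟩
    have H1' : HasLog (fun z => (h z * r1 z) * r2 z) (K ∩ {z | s ≤ z.re ∧ z.re ≤ t}) :=
      H1.mul (hr2.hasLog fun p hp => hasLog_sub_left (fun h => hp.1 h.1)
        fun z hz => hz.2.2.trans hp.2.1)
    have H2' : HasLog (fun z => (h z * r1 z) * r2 z) (K ∩ {z | t ≤ z.re ∧ z.re ≤ u}) := by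
      have : HasLog (fun z => (h z * r2 z) * r1 z) (K ∩ {z | t ≤ z.re ∧ z.re ≤ u}) :=
        H2.mul (hr1.hasLog fun p hp => hasLog_sub_right (fun h => hp.1 h.1)
          fun z hz => hp.2.2.trans hz.2.1)
      exact this.congr fun z _ => by ring
    obtain ⟨r3, hr3, H3⟩ := glue_line (hcp s t) (hcp t u) t (fun z hz => hz.2.2)
      (fun z hz => hz.2.1) (by
        rintro z rfl
        constructor
        · rintro ⟨hz, _, _⟩; exact ⟨hz, le_rfl, htu⟩
        · rintro ⟨hz, _, _⟩; exact ⟨hz, hst, le_rfl⟩) H1' H2'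
    refine ⟨fun z => r1 z * r2 z * r3 z, ?_, ?_⟩
    · refine RatOn.mul' (RatOn.mul' (hr1.mono ?_) (hr2.mono ?_)) (hr3.mono ?_)
      · rintro p ⟨h1, h2, h3⟩; exact ⟨h1, h2, h3.trans htu⟩
      · rintro p ⟨h1, h2, h3⟩; exact ⟨h1, hst.trans h2, h3⟩
      · rintro p ⟨h1, rfl⟩
        refine ⟨fun hp => h1 (Or.inl ⟨hp, hst, le_rfl⟩), hst, htu⟩
    · refine (H3.mono ?_).congr fun z _ => by ring
      rintro z ⟨hz, h1, h2⟩
      rcases le_total z.re t with h | h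
      · exact Or.inl ⟨hz, h1, h⟩
      · exact Or.inr ⟨hz, h, h2⟩
  · intro c
    obtain ⟨δ, hδ, H⟩ := thicken_log hK hc Complex.continuous_re (hasLog_line hK hc h0 c)
    refine ⟨δ, hδ, fun s t h1 _ h2 => ⟨fun _ => 1, .one, (H.mono ?_).congr fun z _ => mul_one _⟩⟩
    rintro z ⟨hz, z1, z2⟩
    exact ⟨hz, by rw [mem_setOf_eq, abs_lt]; constructor <;> linarith⟩

/-- if the complement has no bounded component, every zero-free function has a logarithm -/
lemma hasLog_of_no_bounded {K : Set ℂ} (hK : IsCompact K)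
    (hu : ∀ x ∉ K, ¬ Bornology.IsBounded (connectedComponentIn Kᶜ x)) {h : ℂ → ℂ}
    (hc : ContinuousOn h K) (h0 : ∀ z ∈ K, h z ≠ 0) : HasLog h K := by
  obtain ⟨r, hr, H⟩ := factorization hK hc h0
  have hrl : HasLog r K := hr.hasLog fun p hp => hasLog_sub_of_unbounded hK (hu p hp)
  refine (H.div hrl).congr fun z hz => ?_
  have := hrl.ne_zero hz
  field_simp

/-- two continua meeting in exactly two points separate the plane. -/
lemma exists_bounded_comp {A B : Set ℂ} (hA : IsCompact A) (hB : IsCompact B)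
    (pA : IsPreconnected A) (pB : IsPreconnected B) {e e' : ℂ} (hne : e ≠ e')
    (hAB : A ∩ B = {e, e'}) :
    ∃ x ∉ A ∪ B, Bornology.IsBounded (connectedComponentIn (A ∪ B)ᶜ x) := by
  by_contra! hcon
  have he : e ∈ A ∩ B := by rw [hAB]; simp
  have he' : e' ∈ A ∩ B := by rw [hAB]; simp
  have hd : ∀ z : ℂ, dist z e + dist z e' ≠ 0 := by
    intro z hz
    have h1 := dist_nonneg (x := z) (y := e)
    have h2 := dist_nonneg (x := z) (y := e')
    have h3 : dist z e = 0 := by linarith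
    have h4 : dist z e' = 0 := by linarith
    exact hne ((dist_eq_zero.1 h3).symm.trans (dist_eq_zero.1 h4))
  let u : ℂ → ℂ := fun z => ((dist z e / (dist z e + dist z e') : ℝ) : ℂ) * (2 * Real.pi * Complex.I)
  have hu : Continuous u := by
    have : Continuous fun z : ℂ => dist z e / (dist z e + dist z e') :=
      (by fun_prop : Continuous fun z : ℂ => dist z e).div (by fun_prop) hd
    exact (Complex.continuous_ofReal.comp this).mul continuous_const
  have ue : u e = 0 := by simp [u]
  have ue' : u e' = 2 * Real.pi * Complex.I := by
    have : dist e' e ≠ 0 := dist_ne_zero.2 hne.symm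
    simp [u, this]
  obtain ⟨h, hc, h1, h2⟩ := glue_continuousOn hA.isClosed hB.isClosed
    (f := fun _ => (1 : ℂ)) (g := fun z => Complex.exp (u z)) continuousOn_const
    hu.cexp.continuousOn (by
      rw [hAB]
      rintro z (rfl | rfl)
      · simp [ue]
      · simp [ue', Complex.exp_two_pi_mul_I])
  obtain ⟨L, hL, e0⟩ := hasLog_of_no_bounded (hA.union hB) hcon hc (by
    rintro z (hz | hz)
    · rw [h1 z hz]; exact one_ne_zero
    · rw [h2 z hz]; exact Complex.exp_ne_zero _)
  obtain ⟨n, hn⟩ := log_diff_const pA (L₁ := L) (L₂ := fun _ => 0) (hL.mono subset_union_left)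
    continuousOn_const (fun z hz => by rw [← e0 z (Or.inl hz), h1 z hz, Complex.exp_zero])
  obtain ⟨k, hk⟩ := log_diff_const pB (L₁ := L) (L₂ := u) (hL.mono subset_union_right)
    hu.continuousOn (fun z hz => by rw [← e0 z (Or.inr hz), h2 z hz])
  have a1 := hn e he.1
  have a2 := hn e' he'.1
  have a3 := hk e he.2
  have a4 := hk e' he'.2
  rw [ue] at a3
  rw [ue'] at a4
  exact Complex.two_pi_I_ne_zero (by linear_combination a2 - a1 + a3 - a4)

/-- the closed unit disc -/
abbrev DD : Set ℂ := closedBall (0 : ℂ) 1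

/-- `f` is conjugate on the disc to a linear isometry -/
def Good (f : ℂ → ℂ) : Prop := ∃ (r : ℂ ≃ₗᵢ[ℝ] ℂ) (h : ℂ → ℂ), ContinuousOn h DD ∧ BijOn h DD DD ∧
  ∀ x ∈ DD, h (f x) = r (h x)

lemma Good.of_conj {f g φ : ℂ → ℂ} (hφ : ContinuousOn φ DD) (bφ : BijOn φ DD DD)
    (hfg : ∀ x ∈ DD, φ (f x) = g (φ x)) (H : Good g) : Good f := by
  obtain ⟨r, h, hc, hb, he⟩ := H
  exact ⟨r, h ∘ φ, hc.comp hφ bφ.mapsTo, hb.comp bφ, fun x hx => by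
    simp only [Function.comp, hfg x hx, he _ (bφ.mapsTo hx)]⟩

lemma convex_disc_diff {x : ℂ} (hx : ‖x‖ = 1) : Convex ℝ (DD \ {x}) := by
  intro a ha b hb s t hs ht hst
  refine ⟨convex_closedBall 0 1 ha.1 hb.1 hs ht hst, ?_⟩
  intro h
  rw [mem_singleton_iff] at h
  by_cases hab : a = b
  · subst hab
    rw [← add_smul, hst, one_smul] at h
    exact ha.2 h
  rcases hs.eq_or_lt with rfl | hs
  · rw [zero_add] at hst; subst hst
    simp at h; exact hb.2 h
  rcases ht.eq_or_lt with rfl | ht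
  · rw [add_zero] at hst; subst hst
    simp at h; exact ha.2 h
  have := strictConvex_closedBall ℝ (0 : ℂ) 1 ha.1 hb.1 hab hs ht hst
  rw [h, interior_closedBall _ one_ne_zero] at this
  simp [hx] at this

lemma iterate_mapsTo {f : ℂ → ℂ} {S : Set ℂ} (hm : MapsTo f S S) (k : ℕ) : MapsTo f^[k] S S :=
  hm.iterate k

lemma iterate_continuousOn {f : ℂ → ℂ} {S : Set ℂ} (hc : ContinuousOn f S) (hm : MapsTo f S S)
    (k : ℕ) : ContinuousOn f^[k] S := hc.iterate hm k

/-- finite-order homeomorphisms preserve the boundary circle -/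
lemma sphere_invariant {f : ℂ → ℂ} (hc : ContinuousOn f DD) (hm : MapsTo f DD DD) {n : ℕ}
    (hn : 0 < n) (hf : ∀ x ∈ DD, f^[n] x = x) : MapsTo f (sphere 0 1) (sphere 0 1) := by
  intro x hx
  by_contra hy
  have hxD : x ∈ DD := sphere_subset_closedBall hx
  have hyD : f x ∈ DD := hm hxD
  have hy' : ‖f x‖ < 1 := lt_of_le_of_ne (by simpa using hyD) (by simpa using hy)
  obtain ⟨k, rfl⟩ : ∃ k, n = k + 1 := ⟨n - 1, by omega⟩
  have hfg : ∀ z ∈ DD, f (f^[k] z) = z := fun z hz => by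
    rw [← Function.iterate_succ_apply' f k z]; exact hf z hz
  have hgf : ∀ z ∈ DD, f^[k] (f z) = z := fun z hz => by
    rw [← Function.iterate_succ_apply f k z]; exact hf z hz
  have h1 : HasLog (fun w => f w - f x) (DD \ {x}) :=
    hasLog_of_convex (convex_disc_diff (by simpa using hx))
      ((hc.mono diff_subset).sub continuousOn_const) (fun w hw h0 => hw.2 (by
        rw [sub_eq_zero] at h0
        rw [mem_singleton_iff, ← hgf w hw.1, h0, hgf x hxD]))
  have h2 := h1.comp (g := f^[k]) (K' := sphere 0 1)
    ((iterate_continuousOn hc hm k).mono sphere_subset_closedBall) (by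
      intro z hz
      have hzD : z ∈ DD := sphere_subset_closedBall hz
      refine ⟨iterate_mapsTo hm k hzD, fun h => ?_⟩
      rw [mem_singleton_iff] at h
      have := hfg z hzD
      rw [h] at this
      rw [this] at hy; exact hy hz)
  exact not_hasLog_sub_sphere hy' (h2.congr fun z hz => by
    simp only [hfg z (sphere_subset_closedBall hz)])

/-! circle homeomorphisms and coning -/

/-- homogeneous extension of a circle map with lift `φ`. -/
noncomputable def cone (φ : ℝ → ℝ) (z : ℂ) : ℂ := ‖z‖ * Complex.exp (φ (Complex.arg z) * Complex.I)

lemma per_nat {φ : ℝ → ℝ} {c : ℝ} (hp : ∀ t, φ (t + 2 * Real.pi) = φ t + c) (t : ℝ) (k : ℕ) :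
    φ (t + k * (2 * Real.pi)) = φ t + k * c := by
  induction k with
  | zero => simp
  | succ k ih =>
    have := hp (t + k * (2 * Real.pi))
    rw [ih] at this
    push_cast
    rw [show t + (k + 1) * (2 * Real.pi) = t + k * (2 * Real.pi) + 2 * Real.pi by ring, this]; ring

lemma per_int {φ : ℝ → ℝ} {c : ℝ} (hp : ∀ t, φ (t + 2 * Real.pi) = φ t + c) (t : ℝ) (k : ℤ) :
    φ (t + k * (2 * Real.pi)) = φ t + k * c := by
  obtain ⟨k, rfl | rfl⟩ := k.eq_nat_or_neg
  · simpa using per_nat hp t k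
  · have := per_nat hp (t + ((-(k : ℤ) : ℤ) : ℝ) * (2 * Real.pi)) k
    push_cast at this ⊢
    rw [show t + -(k : ℝ) * (2 * Real.pi) + k * (2 * Real.pi) = t by ring] at this
    rw [this]; ring

lemma exp_real_eq {s t : ℝ} (h : Complex.exp (s * Complex.I) = Complex.exp (t * Complex.I)) :
    ∃ k : ℤ, s = t + k * (2 * Real.pi) := by
  obtain ⟨k, hk⟩ := Complex.exp_eq_exp_iff_exists_int.1 h
  refine ⟨k, ?_⟩
  have := congrArg Complex.im hk
  simpa using this

lemma cone_apply {φ : ℝ → ℝ} (hp : ∀ t, φ (t + 2 * Real.pi) = φ t + 2 * Real.pi) {r : ℝ}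
    (hr : 0 ≤ r) (t : ℝ) :
    cone φ (r * Complex.exp (t * Complex.I)) = r * Complex.exp (φ t * Complex.I) := by
  have hn : ‖(r : ℂ) * Complex.exp (t * Complex.I)‖ = r := by
    simp [Complex.norm_exp_ofReal_mul_I, abs_of_nonneg hr]
  rw [cone, hn]
  rcases hr.eq_or_lt with rfl | hr
  · simp
  congr 1
  have h1 := Complex.norm_mul_exp_arg_mul_I ((r : ℂ) * Complex.exp (t * Complex.I))
  rw [hn] at h1
  have h2 := mul_left_cancel₀ (by exact_mod_cast hr.ne') h1
  obtain ⟨k, hk⟩ := exp_real_eq h2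
  rw [hk, per_int hp]
  push_cast
  rw [add_mul, Complex.exp_add, mul_assoc, Complex.exp_int_mul_two_pi_mul_I, mul_one]

lemma norm_cone (φ : ℝ → ℝ) (z : ℂ) : ‖cone φ z‖ = ‖z‖ := by
  simp [cone, Complex.norm_exp_ofReal_mul_I]

lemma polar (z : ℂ) : ∃ t : ℝ, z = ‖z‖ * Complex.exp (t * Complex.I) :=
  ⟨_, (Complex.norm_mul_exp_arg_mul_I z).symm⟩

lemma continuous_cone {φ : ℝ → ℝ} (hc : Continuous φ)
    (hp : ∀ t, φ (t + 2 * Real.pi) = φ t + 2 * Real.pi) : Continuous (cone φ) := by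
  rw [continuous_iff_continuousAt]
  intro z
  by_cases hz : z = 0
  · subst hz
    have : cone φ 0 = 0 := by simp [cone]
    rw [ContinuousAt, this, tendsto_zero_iff_norm_tendsto_zero]
    simp only [norm_cone]
    exact continuous_norm.tendsto' 0 0 norm_zero
  by_cases hs : z ∈ Complex.slitPlane
  · have h1 := Complex.continuousAt_arg hs
    unfold cone
    exact (Complex.continuous_ofReal.continuousAt.comp continuous_norm.continuousAt).mul
      (ContinuousAt.cexp ((Complex.continuous_ofReal.continuousAt.comp
        (hc.continuousAt.comp h1)).mul continuousAt_const))
  · have hs' : -z ∈ Complex.slitPlane := by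
      rw [Complex.mem_slitPlane_iff] at hs ⊢
      push Not at hs
      left
      rcases hs.1.lt_or_eq with h | h
      · simpa using h
      · exact absurd (Complex.ext h hs.2) hz
    have key : ∀ w : ℂ, cone φ w =
        ‖w‖ * Complex.exp (φ (Complex.arg (-w) + Real.pi) * Complex.I) := by
      intro w
      rw [← cone_apply hp (norm_nonneg w)]
      congr 1
      have := Complex.norm_mul_exp_arg_mul_I (-w)
      push_cast
      rw [add_mul, Complex.exp_add, Complex.exp_pi_mul_I, ← mul_assoc, ← norm_neg w, this]; ring
    have h1 : ContinuousAt (fun w : ℂ => Complex.arg (-w) + Real.pi) z :=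
      (ContinuousAt.comp (f := fun w : ℂ => -w) (Complex.continuousAt_arg hs')
        continuous_neg.continuousAt).add continuousAt_const
    rw [show cone φ = _ from funext key]
    exact (Complex.continuous_ofReal.continuousAt.comp continuous_norm.continuousAt).mul
      (ContinuousAt.cexp ((Complex.continuous_ofReal.continuousAt.comp
        (hc.continuousAt.comp h1)).mul continuousAt_const))

lemma surj_of_per {φ : ℝ → ℝ} (hc : Continuous φ)
    (hp : ∀ t, φ (t + 2 * Real.pi) = φ t + 2 * Real.pi) (y : ℝ) : ∃ t, φ t = y := by
  have hpi := Real.two_pi_pos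
  obtain ⟨k, hk⟩ := exists_int_gt ((y - φ 0) / (2 * Real.pi))
  obtain ⟨j, hj⟩ := exists_int_lt ((y - φ 0) / (2 * Real.pi))
  rw [div_lt_iff₀ hpi] at hk
  rw [lt_div_iff₀ hpi] at hj
  have h1 := per_int hp 0 k
  have h2 := per_int hp 0 j
  exact mem_range_of_exists_le_of_exists_ge hc ⟨_, by rw [h2]; linarith⟩ ⟨_, by rw [h1]; linarith⟩

/-- inverse lift -/
lemma exists_inv_lift {φ : ℝ → ℝ} (hc : Continuous φ) (hm : StrictMono φ)
    (hp : ∀ t, φ (t + 2 * Real.pi) = φ t + 2 * Real.pi) :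
    ∃ ψ : ℝ → ℝ, Continuous ψ ∧ (∀ t, ψ (t + 2 * Real.pi) = ψ t + 2 * Real.pi) ∧
      (∀ t, φ (ψ t) = t) ∧ ∀ t, ψ (φ t) = t := by
  let e : ℝ ≃o ℝ := hm.orderIsoOfSurjective φ (surj_of_per hc hp)
  have he : ∀ t, φ (e.symm t) = t := fun t => e.apply_symm_apply t
  have he' : ∀ t, e.symm (φ t) = t := fun t => e.symm_apply_apply t
  refine ⟨e.symm, e.symm.continuous, fun t => hm.injective ?_, he, he'⟩
  rw [hp, he, he]

lemma cone_cone {φ ψ : ℝ → ℝ} (hp : ∀ t, φ (t + 2 * Real.pi) = φ t + 2 * Real.pi)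
    (h : ∀ t, φ (ψ t) = t) (z : ℂ) : cone φ (cone ψ z) = z := by
  conv_lhs => rw [show cone ψ z = ‖z‖ * Complex.exp (ψ (Complex.arg z) * Complex.I) from rfl]
  rw [cone_apply hp (norm_nonneg z), h, Complex.norm_mul_exp_arg_mul_I]

lemma iter_per {F : ℝ → ℝ} {k : ℤ} (hF : ∀ t, F (t + 2 * Real.pi) = F t + k * (2 * Real.pi))
    (n : ℕ) (t : ℝ) : F^[n] (t + 2 * Real.pi) = F^[n] t + (k ^ n : ℤ) * (2 * Real.pi) := by
  induction n generalizing t with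
  | zero => simp
  | succ n ih =>
    rw [Function.iterate_succ_apply', Function.iterate_succ_apply', ih, per_int hF]
    push_cast; ring

/-- finite order circle maps are linear in suitable coordinates -/
lemma circle_conj {f : ℂ → ℂ} (hc : ContinuousOn f (sphere 0 1))
    (hm : MapsTo f (sphere 0 1) (sphere 0 1)) {n : ℕ} (hn : 0 < n)
    (hf : ∀ x ∈ sphere (0 : ℂ) 1, f^[n] x = x) :
    ∃ φ : ℝ → ℝ, Continuous φ ∧ StrictMono φ ∧ (∀ t, φ (t + 2 * Real.pi) = φ t + 2 * Real.pi) ∧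
      ((∃ ζ : ℂ, ζ ^ n = 1 ∧ ∀ z ∈ sphere (0 : ℂ) 1, cone φ (f z) = ζ * cone φ z) ∨
       (∀ z ∈ sphere (0 : ℂ) 1, cone φ (f z) = (starRingEnd ℂ) (cone φ z))) := by
  have hE : ∀ t : ℝ, Complex.exp (t * Complex.I) ∈ sphere (0 : ℂ) 1 := fun t => by
    simp [Complex.norm_exp_ofReal_mul_I]
  have hpi := Real.two_pi_pos
  -- the lift
  obtain ⟨L, hL, e⟩ := hasLog_of_convex (K := (univ : Set ℝ))
    (h := fun t : ℝ => f (Complex.exp (t * Complex.I))) convex_univ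
    (hc.comp (by fun_prop) (fun t _ => hE t)) (fun t _ h0 => by
      have := hm (hE t)
      beta_reduce at h0
      rw [h0] at this
      simp at this)
  obtain ⟨F, hFc, hF⟩ : ∃ F : ℝ → ℝ, Continuous F ∧ ∀ t : ℝ,
      f (Complex.exp (t * Complex.I)) = Complex.exp (F t * Complex.I) := by
    refine ⟨fun t => (L t).im, Complex.continuous_im.comp (continuousOn_univ.1 hL), fun t => ?_⟩
    have h1 : f (Complex.exp (t * Complex.I)) = Complex.exp (L t) := e t trivial
    have h2 := hm (hE t)
    rw [h1, mem_sphere_zero_iff_norm, Complex.norm_exp, Real.exp_eq_one_iff] at h2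
    rw [h1]; congr 1
    apply Complex.ext <;> simp [h2]
  have hFn : ∀ (j : ℕ) (t : ℝ), f^[j] (Complex.exp (t * Complex.I)) =
      Complex.exp (F^[j] t * Complex.I) := by
    intro j t
    induction j with
    | zero => simp
    | succ j ih => rw [Function.iterate_succ_apply', ih, hF, Function.iterate_succ_apply']
  -- continuous real functions whose values are in 2πℤ differ by constants
  have hconst : ∀ G H : ℝ → ℝ, Continuous G → Continuous H →
      (∀ t : ℝ, Complex.exp (G t * Complex.I) = Complex.exp (H t * Complex.I)) →
      ∃ k : ℤ, ∀ t, G t = H t + k * (2 * Real.pi) := by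
    intro G H hG hH h
    obtain ⟨k, hk⟩ := log_diff_const (K := (univ : Set ℝ)) (L₁ := fun t => (G t * Complex.I : ℂ))
      (L₂ := fun t => (H t * Complex.I : ℂ)) isPreconnected_univ
      (by fun_prop) (by fun_prop) (fun t _ => h t)
    refine ⟨k, fun t => ?_⟩
    have := congrArg Complex.im (hk t trivial)
    simpa using this
  obtain ⟨k, hk⟩ := hconst (fun t => F (t + 2 * Real.pi)) F (by fun_prop) hFc (fun t => by
    rw [← hF, ← hF]; congr 1
    push_cast
    rw [add_mul, Complex.exp_add, Complex.exp_two_pi_mul_I, mul_one])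
  obtain ⟨c, hcc⟩ := hconst (F^[n]) id (hFc.iterate n) continuous_id (fun t => by
    rw [← hFn, hf _ (hE t)]; rfl)
  simp only [id] at hcc hk
  have hinj : Function.Injective F := by
    obtain ⟨m, rfl⟩ : ∃ m, n = m + 1 := ⟨n - 1, by omega⟩
    intro a b hab
    have h1 := hcc a
    have h2 := hcc b
    rw [Function.iterate_succ_apply, hab, ← Function.iterate_succ_apply F m b, h2] at h1
    linarith
  have hkn : k ^ n = 1 := by
    have h1 := iter_per hk n 0
    rw [hcc, hcc] at h1
    have h2 : (2 * Real.pi) = ((k ^ n : ℤ) : ℝ) * (2 * Real.pi) := by linarith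
    have h3 : ((k ^ n : ℤ) : ℝ) = 1 := by
      have := mul_right_cancel₀ hpi.ne' ((one_mul (2 * Real.pi)).trans h2)
      exact this.symm
    exact_mod_cast h3
  have hk1 : k = 1 ∨ k = -1 := Int.isUnit_iff.1 (IsUnit.of_pow_eq_one hkn hn.ne')
  have hsph : ∀ z ∈ sphere (0 : ℂ) 1, ∃ t : ℝ, z = Complex.exp (t * Complex.I) := by
    intro z hz
    obtain ⟨t, ht⟩ := polar z
    rw [mem_sphere_zero_iff_norm.1 hz] at ht
    exact ⟨t, by simpa using ht⟩
  have hcone : ∀ φ : ℝ → ℝ, (∀ t, φ (t + 2 * Real.pi) = φ t + 2 * Real.pi) → ∀ t : ℝ,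
      cone φ (Complex.exp (t * Complex.I)) = Complex.exp (φ t * Complex.I) := by
    intro φ hp t
    have := cone_apply hp zero_le_one t
    simpa using this
  have hmono := hFc.strictMono_of_inj hinj
  rcases hk1 with rfl | rfl
  · -- orientation preserving
    have hFm : StrictMono F := by
      rcases hmono with h | h
      · exact h
      · have h1 := h (show (0 : ℝ) < 0 + 2 * Real.pi by linarith)
        rw [hk] at h1
        push_cast at h1
        linarith
    have hnC : (n : ℂ) ≠ 0 := by exact_mod_cast hn.ne'
    have hn' : (n : ℝ) ≠ 0 := by exact_mod_cast hn.ne'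
    have hnp : (0 : ℝ) < n := by exact_mod_cast hn
    refine ⟨fun t => (∑ i ∈ Finset.range n, F^[i] t) / n, ?_, ?_, ?_, Or.inl ?_⟩
    · exact (continuous_finset_sum _ fun i _ => hFc.iterate i).div_const _
    · intro a b hab
      refine div_lt_div_of_pos_right (Finset.sum_lt_sum_of_nonempty (by simpa using hn.ne') ?_) hnp
      intro i _
      exact hFm.iterate i hab
    · intro t
      have : ∀ i ∈ Finset.range n, F^[i] (t + 2 * Real.pi) = F^[i] t + 2 * Real.pi := by
        intro i _
        rw [iter_per hk]; simp
      beta_reduce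
      rw [Finset.sum_congr rfl this, Finset.sum_add_distrib, Finset.sum_const, Finset.card_range]
      field_simp
      simp
      ring
    · refine ⟨Complex.exp (c * (2 * Real.pi) / n * Complex.I), ?_, ?_⟩
      · rw [← Complex.exp_nat_mul]
        have : (n : ℂ) * (c * (2 * Real.pi) / n * Complex.I) = c * (2 * Real.pi * Complex.I) := by
          field_simp
        rw [this, Complex.exp_int_mul_two_pi_mul_I]
      · intro z hz
        obtain ⟨t, rfl⟩ := hsph z hz
        have hp : ∀ t, (fun t => (∑ i ∈ Finset.range n, F^[i] t) / n) (t + 2 * Real.pi) =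
            (fun t => (∑ i ∈ Finset.range n, F^[i] t) / n) t + 2 * Real.pi := by
          intro t
          have : ∀ i ∈ Finset.range n, F^[i] (t + 2 * Real.pi) = F^[i] t + 2 * Real.pi := by
            intro i _
            rw [iter_per hk]; simp
          beta_reduce
          rw [Finset.sum_congr rfl this, Finset.sum_add_distrib, Finset.sum_const, Finset.card_range]
          field_simp
          simp
          ring
        rw [hF, hcone _ hp, hcone _ hp, ← Complex.exp_add]
        congr 1
        have h1 : (∑ i ∈ Finset.range n, F^[i] (F t)) =
            (∑ i ∈ Finset.range n, F^[i] t) + c * (2 * Real.pi) := by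
          have h2 := Finset.sum_range_succ' (fun i => F^[i] t) n
          have h3 := Finset.sum_range_succ (fun i => F^[i] t) n
          rw [h3, hcc] at h2
          simp only [Function.iterate_succ_apply, Function.iterate_zero, id] at h2
          linarith
        beta_reduce
        rw [h1]
        push_cast
        field_simp
        ring
  · -- orientation reversing
    have hFm : StrictAnti F := by
      rcases hmono with h | h
      · have h1 := h (show (0 : ℝ) < 0 + 2 * Real.pi by linarith)
        rw [hk] at h1
        push_cast at h1
        linarith
      · exact h
    -- fixed point
    obtain ⟨t0, ht0⟩ : ∃ t, F t = t := by
      have : ∃ t, t - F t = 0 := by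
        have hp2 : ∀ t, (fun t => (t - F t) / 2) (t + 2 * Real.pi)
            = (fun t => (t - F t) / 2) t + 2 * Real.pi := by
          intro t; beta_reduce; rw [hk]; push_cast; ring
        obtain ⟨t, ht⟩ := surj_of_per (φ := fun t => (t - F t) / 2) (by fun_prop) hp2 0
        exact ⟨t, by linarith⟩
      obtain ⟨t, ht⟩ := this
      exact ⟨t, by linarith⟩
    have hc0 : c = 0 := by
      have h1 := hcc t0
      rw [Function.iterate_fixed ht0] at h1
      have : (c : ℝ) * (2 * Real.pi) = 0 := by linarith
      rcases mul_eq_zero.1 this with h | h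
      · exact_mod_cast h
      · linarith
    have hFF : ∀ t, F (F t) = t := by
      intro t
      have hmn : StrictMono (fun t => F (F t)) := fun a b h => hFm (hFm h)
      have hnn : (fun t => F (F t))^[n] t = t := by
        have : (fun t => F (F t)) = F^[2] := rfl
        rw [this, ← Function.iterate_mul, mul_comm, Function.iterate_mul]
        exact Function.iterate_fixed (by rw [hcc, hc0]; simp) 2
      by_contra hne
      rcases lt_or_gt_of_ne hne with h | h
      · have key : ∀ j : ℕ, (fun t => F (F t))^[j + 1] t < t := by
          intro j
          induction j with
          | zero => simpa using h
          | succ j ih =>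
            rw [Function.iterate_succ_apply']
            exact (hmn ih).trans h
        have := key (n - 1)
        rw [Nat.sub_add_cancel hn, hnn] at this
        exact lt_irrefl _ this
      · have key : ∀ j : ℕ, t < (fun t => F (F t))^[j + 1] t := by
          intro j
          induction j with
          | zero => simpa using h
          | succ j ih =>
            rw [Function.iterate_succ_apply']
            exact lt_trans h (hmn ih)
        have := key (n - 1)
        rw [Nat.sub_add_cancel hn, hnn] at this
        exact lt_irrefl _ this
    have hp : ∀ t, (fun t => (t - F t) / 2) (t + 2 * Real.pi)
        = (fun t => (t - F t) / 2) t + 2 * Real.pi := by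
      intro t; beta_reduce; rw [hk]; push_cast; ring
    refine ⟨fun t => (t - F t) / 2, by fun_prop, ?_, hp, Or.inr ?_⟩
    · intro a b hab
      have := hFm hab
      simp only
      linarith
    · intro z hz
      obtain ⟨t, rfl⟩ := hsph z hz
      rw [hF, hcone _ hp, hcone _ hp, ← Complex.exp_conj, hFF]
      congr 1
      rw [map_mul, Complex.conj_ofReal, Complex.conj_I]
      push_cast
      ring

/-- reduction to globally defined maps which are linear outside the disc -/
theorem normalize {f : ℂ → ℂ} (hc : ContinuousOn f DD) (hm : MapsTo f DD DD) {n : ℕ}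
    (hn : 0 < n) (hf : ∀ x ∈ DD, f^[n] x = x)
    (H : ∀ g : ℂ → ℂ, Continuous g → (∀ z, g^[n] z = z) →
      ((∃ ζ : ℂ, ζ ^ n = 1 ∧ ∀ z, 1 ≤ ‖z‖ → g z = ζ * z) ∨
        (∀ z, 1 ≤ ‖z‖ → g z = (starRingEnd ℂ) z)) → Good g) : Good f := by
  have hs := sphere_invariant hc hm hn hf
  obtain ⟨φ, φc, φm, φp, hr⟩ := circle_conj (hc.mono sphere_subset_closedBall) hs hn
    (fun x hx => hf x (sphere_subset_closedBall hx))
  obtain ⟨ψ, ψc, ψp, φψ, ψφ⟩ := exists_inv_lift φc φm φp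
  have e1 := cone_cone φp φψ
  have e2 := cone_cone ψp ψφ
  have c1 := continuous_cone φc φp
  have c2 := continuous_cone ψc ψp
  have mD : ∀ θ : ℝ → ℝ, MapsTo (cone θ) DD DD := fun θ z hz => by
    simpa [norm_cone] using hz
  have key : ∀ r : ℂ → ℂ, Continuous r → (∀ z, ‖r z‖ = ‖z‖) → (∀ z, r^[n] z = z) →
      (∀ z ∈ sphere (0 : ℂ) 1, cone φ (f z) = r (cone φ z)) →
      (∀ g : ℂ → ℂ, Continuous g → (∀ z, g^[n] z = z) → (∀ z, 1 ≤ ‖z‖ → g z = r z) → Good g) →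
      Good f := by
    intro r rc rn ri hrs HH
    have hgl : ∃ g : ℂ → ℂ, ContinuousOn g (DD ∪ {z : ℂ | 1 ≤ ‖z‖}) ∧
        (∀ z ∈ DD, g z = cone φ (f (cone ψ z))) ∧ ∀ z ∈ {z : ℂ | 1 ≤ ‖z‖}, g z = r z :=
      glue_continuousOn isClosed_closedBall (isClosed_le continuous_const continuous_norm)
        (c1.comp_continuousOn (hc.comp c2.continuousOn (mD ψ))) rc.continuousOn
        (fun z hz => by
          have hz1 : z ∈ sphere (0 : ℂ) 1 := by
            have a := hz.1
            have b : 1 ≤ ‖z‖ := hz.2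
            simp only [mem_closedBall_zero_iff] at a
            simp; linarith
          rw [hrs _ (by simpa [norm_cone] using hz1), e1])
    obtain ⟨g, gc, g1, g2⟩ := hgl
    have gc' : Continuous g := by
      rw [← continuousOn_univ]
      refine gc.mono fun z _ => ?_
      rcases le_total ‖z‖ 1 with h | h
      · left; simpa using h
      · right; exact h
    have gi : ∀ z, g^[n] z = z := by
      intro z
      rcases le_total ‖z‖ 1 with h | h
      · have hz : z ∈ DD := by simpa using h
        have : ∀ k : ℕ, g^[k] z = cone φ (f^[k] (cone ψ z)) := by
          intro k
          induction k with
          | zero => simp [e1]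
          | succ k ih =>
            rw [Function.iterate_succ_apply', ih, g1 _ (mD _ (iterate_mapsTo hm k (mD _ hz))), e2,
              Function.iterate_succ_apply']
        rw [this, hf _ (mD _ hz), e1]
      · have : ∀ k : ℕ, g^[k] z = r^[k] z ∧ ‖r^[k] z‖ = ‖z‖ := by
          intro k
          induction k with
          | zero => simp
          | succ k ih =>
            rw [Function.iterate_succ_apply', ih.1, Function.iterate_succ_apply', rn]
            exact ⟨g2 _ (by rw [mem_setOf_eq, ih.2]; exact h), ih.2⟩
        rw [(this n).1, ri]
    refine Good.of_conj c1.continuousOn ⟨mD φ, ?_, ?_⟩ (fun x hx => ?_) (HH g gc' gi g2)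
    · intro a _ b _ hab
      rw [← e2 a, hab, e2]
    · intro z hz
      exact ⟨cone ψ z, mD _ hz, e1 z⟩
    · rw [g1 _ (mD _ hx), e2]
  rcases hr with ⟨ζ, hζ, hr⟩ | hr
  · refine key (fun z => ζ * z) (by fun_prop) ?_ ?_ hr
      (fun g a b c => H g a b (Or.inl ⟨ζ, hζ, c⟩))
    · intro z
      have : ‖ζ‖ = 1 := Complex.norm_eq_one_of_pow_eq_one hζ hn.ne'
      simp [this]
    · intro z
      have : ∀ k : ℕ, (fun z => ζ * z)^[k] z = ζ ^ k * z := by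
        intro k
        induction k with
        | zero => simp
        | succ k ih => rw [Function.iterate_succ_apply', ih]; ring
      rw [this, hζ, one_mul]
  · have hinv : Function.Involutive (fun z : ℂ => (starRingEnd ℂ) z) := fun z => by simp
    refine key (fun z => (starRingEnd ℂ) z) Complex.continuous_conj (by simp) ?_ hr
      (fun g a b c => H g a b (Or.inr c))
    rcases n.even_or_odd with he | ho
    · intro z; rw [hinv.iterate_even he]; rfl
    · exfalso
      have : ∀ k : ℕ, cone φ (f^[k] (cone ψ Complex.I)) =
          (fun z : ℂ => (starRingEnd ℂ) z)^[k] Complex.I ∧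
          f^[k] (cone ψ Complex.I) ∈ sphere (0 : ℂ) 1 := by
        intro k
        induction k with
        | zero => simp [e1, norm_cone]
        | succ k ih =>
          rw [Function.iterate_succ_apply', hr _ ih.2, ih.1, Function.iterate_succ_apply']
          exact ⟨rfl, hs ih.2⟩
      have h1 := (this n).1
      rw [hf _ (mD _ (by simp)), e1, hinv.iterate_odd ho] at h1
      have := congrArg Complex.im h1
      simp at this
      linarith

section Arc
variable {G : Type} [Group G] [Finite G] [MulAction G ℂ] [ContinuousConstSMul G ℂ]

lemma lift_lemma {A : Set ℝ} (hA : IsOpen A) (hconv : Convex ℝ A)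
    {P : ℝ → Quotient (MulAction.orbitRel G ℂ)} (hP : ContinuousOn P A)
    (hfree : ∀ u ∈ A, ∃ e : ℂ, MulAction.stabilizer G e = ⊥ ∧ P u = Quotient.mk _ e)
    {a₀ : ℝ} (ha : a₀ ∈ A) {e₀ : ℂ} (he : P a₀ = Quotient.mk _ e₀) :
    ∃ F : ℝ → ℂ, ContinuousOn F A ∧ F a₀ = e₀ ∧ ∀ u ∈ A, P u = Quotient.mk _ (F u) := by
  haveI : ContractibleSpace A := hconv.contractibleSpace ⟨a₀, ha⟩
  haveI : LocallyPathConnectedSpace A := hA.locallyPathConnectedSpace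
  have cov := isCoveringMapOn_quotientMk_of_properlyDiscontinuousSMul (G := G) (E := ℂ)
  obtain ⟨F, ⟨h1, h2⟩, -⟩ := cov.existsUnique_continuousMap_lifts
    (f := (⟨A.domRestrict P, continuousOn_iff_continuous_domRestrict.1 hP⟩ : C(A, _)))
    (a₀ := ⟨a₀, ha⟩) (e₀ := e₀) he.symm (fun a => by
      obtain ⟨e, he, h⟩ := hfree a a.2
      exact ⟨e, he, h.symm⟩)
  classical
  refine ⟨fun u => if h : u ∈ A then F ⟨u, h⟩ else 0, ?_, ?_, ?_⟩
  · rw [continuousOn_iff_continuous_domRestrict]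
    convert F.continuous using 1
    ext u
    simp [Set.domRestrict]
  · simp [ha, h1]
  · intro u hu
    have := congrFun h2 ⟨u, hu⟩
    simp only [hu, dif_pos]
    exact this.symm

/-- the family of closed sets used in the arc lemma -/
def ArcFam (R : ℝ → ℝ → Prop) : Set (Set ℝ) :=
  {C | IsClosed C ∧ C ⊆ Icc 0 1 ∧ 0 ∈ C ∧ 1 ∈ C ∧
    ∀ s ∈ C, ∀ t ∈ C, s < t → Ioo s t ∩ C = ∅ → R s t}

lemma arcFam_minimal {R : ℝ → ℝ → Prop} (hR : IsClosed {p : ℝ × ℝ | R p.1 p.2}) :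
    ∃ C, Minimal (· ∈ ArcFam R) C := by
  apply zorn_superset
  intro c hc hch
  rcases c.eq_empty_or_nonempty with rfl | hne
  · refine ⟨Icc 0 1, ⟨isClosed_Icc, subset_rfl, by simp, by simp, ?_⟩, by simp⟩
    intro s hs t ht hst h
    exfalso
    have : (s + t) / 2 ∈ Ioo s t ∩ Icc 0 1 := by
      obtain ⟨a, b⟩ := hs
      obtain ⟨c, d⟩ := ht
      constructor <;> constructor <;> linarith
    rw [h] at this; exact this
  refine ⟨⋂₀ c, ⟨isClosed_sInter fun S hS => (hc hS).1, ?_, fun S hS => (hc hS).2.2.1,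
    fun S hS => (hc hS).2.2.2.1, ?_⟩, fun S hS => sInter_subset_of_mem hS⟩
  · obtain ⟨S, hS⟩ := hne
    exact (sInter_subset_of_mem hS).trans (hc hS).2.1
  intro s hs t ht hst hgap
  -- approximate
  have key : ∀ ε > 0, ε < (t - s) / 2 → ∃ s' t' : ℝ, |s' - s| ≤ ε ∧ |t' - t| ≤ ε ∧ R s' t' := by
    intro ε he he2
    have : ∃ S ∈ c, Icc (s + ε) (t - ε) ∩ S = ∅ := by
      by_contra hcon
      push Not at hcon
      haveI : Nonempty c := hne.to_subtype
      have := IsCompact.nonempty_iInter_of_directed_nonempty_isCompact_isClosed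
        (fun S : c => Icc (s + ε) (t - ε) ∩ (S : Set ℝ)) (by
          intro S T
          rcases hch.total S.2 T.2 with h | h
          · exact ⟨S, subset_rfl, inter_subset_inter_right _ h⟩
          · exact ⟨T, inter_subset_inter_right _ h, subset_rfl⟩)
        (fun S => hcon S S.2) (fun S => isCompact_Icc.inter_right (hc S.2).1)
        (fun S => isClosed_Icc.inter (hc S.2).1)
      obtain ⟨x, hx⟩ := this
      rw [mem_iInter] at hx
      have hx1 : x ∈ Icc (s + ε) (t - ε) := (hx ⟨_, hne.some_mem⟩).1
      have : x ∈ Ioo s t ∩ ⋂₀ c := ⟨⟨by linarith [hx1.1], by linarith [hx1.2]⟩,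
        fun S hS => (hx ⟨S, hS⟩).2⟩
      rw [hgap] at this; exact this
    obtain ⟨S, hS, hSe⟩ := this
    obtain ⟨Sc, Ssub, S0, S1, Sg⟩ := hc hS
    have k1 : IsCompact (S ∩ Icc s (s + ε)) := isCompact_Icc.inter_left Sc
    have k2 : IsCompact (S ∩ Icc (t - ε) t) := isCompact_Icc.inter_left Sc
    obtain ⟨s', hs', hs'm⟩ := k1.exists_isGreatest ⟨s, hs S hS, by constructor <;> linarith⟩
    obtain ⟨t', ht', ht'm⟩ := k2.exists_isLeast ⟨t, ht S hS, by constructor <;> linarith⟩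
    refine ⟨s', t', ?_, ?_, Sg s' hs'.1 t' ht'.1 (by linarith [hs'.2.2, ht'.2.1]) ?_⟩
    · rw [abs_le]; constructor <;> linarith [hs'.2.1, hs'.2.2]
    · rw [abs_le]; constructor <;> linarith [ht'.2.1, ht'.2.2]
    · rw [eq_empty_iff_forall_notMem]
      rintro x ⟨hx, hxS⟩
      by_cases h1 : x ≤ s + ε
      · have := hs'm ⟨hxS, by linarith [hx.1, hs'.2.1], h1⟩
        linarith [hx.1]
      by_cases h2 : t - ε ≤ x
      · have := ht'm ⟨hxS, h2, by linarith [hx.2, ht'.2.2]⟩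
        linarith [hx.2]
      have : x ∈ Icc (s + ε) (t - ε) ∩ S := ⟨⟨by linarith, by linarith⟩, hxS⟩
      rw [hSe] at this; exact this
  have : (s, t) ∈ closure {p : ℝ × ℝ | R p.1 p.2} := by
    rw [Metric.mem_closure_iff]
    intro ε he
    obtain ⟨s', t', h1, h2, h3⟩ := key (min (ε / 2) ((t - s) / 4)) (by
      apply lt_min <;> linarith) (by
      have := min_le_right (ε / 2) ((t - s) / 4); linarith)
    refine ⟨(s', t'), h3, ?_⟩
    have := min_le_left (ε / 2) ((t - s) / 4)
    rw [Prod.dist_eq, max_lt_iff, dist_comm, Real.dist_eq, dist_comm, Real.dist_eq]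
    constructor <;> simp only <;> linarith
  rw [hR.closure_eq] at this
  exact this

lemma arcFam_gap {R : ℝ → ℝ → Prop} {C : Set ℝ} (hC : Minimal (· ∈ ArcFam R) C) {s t : ℝ}
    (hs : s ∈ C) (ht : t ∈ C) (hst : s < t) (h : R s t) : Ioo s t ∩ C = ∅ := by
  obtain ⟨Cc, Csub, C0, C1, Cg⟩ := hC.prop
  have hmem : C \ Ioo s t ∈ ArcFam R := by
    refine ⟨Cc.sdiff isOpen_Ioo, diff_subset.trans Csub, ⟨C0, fun h => ?_⟩, ⟨C1, fun h => ?_⟩, ?_⟩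
    · linarith [h.1, (Csub hs).1]
    · linarith [h.2, (Csub ht).2]
    · intro a ha b hb hab hgap
      by_cases hh : Ioo a b ∩ C = ∅
      · exact Cg a ha.1 b hb.1 hab hh
      obtain ⟨x, hx, hxC⟩ := nonempty_iff_ne_empty.2 hh
      have hno : ∀ y ∈ Ioo a b, y ∈ C → y ∈ Ioo s t := by
        intro y hy hyC
        by_contra hy2
        have : y ∈ Ioo a b ∩ (C \ Ioo s t) := ⟨hy, hyC, hy2⟩
        rw [hgap] at this; exact this
      have hx2 := hno x hx hxC
      have ha2 : a ≤ s := by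
        by_contra hlt; push Not at hlt
        exact ha.2 ⟨hlt, hx.1.trans hx2.2⟩
      have hb2 : t ≤ b := by
        by_contra hlt; push Not at hlt
        exact hb.2 ⟨hx2.1.trans hx.2, hlt⟩
      have ha3 : s ≤ a := by
        by_contra hlt; push Not at hlt
        exact lt_irrefl _ (hno s ⟨hlt, hx2.1.trans hx.2⟩ hs).1
      have hb3 : b ≤ t := by
        by_contra hlt; push Not at hlt
        exact lt_irrefl _ (hno t ⟨hx.1.trans hx2.2, hlt⟩ ht).2
      rw [le_antisymm ha2 ha3, le_antisymm hb3 hb2]; exact h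
  have := hC.le_of_le hmem diff_subset
  rw [eq_empty_iff_forall_notMem]
  rintro x ⟨hx, hxC⟩
  exact (this hxC).2 hx

/-- if `R` is an equivalence relation, closed, we get a monotone reparametrisation -/
lemma arc_retract {R : ℝ → ℝ → Prop} (hR : IsClosed {p : ℝ × ℝ | R p.1 p.2})
    (he : Equivalence R) :
    ∃ m : ℝ → ℝ, (∀ u, m u ∈ Icc (0 : ℝ) 1) ∧ (∀ u ≤ 0, m u = 0) ∧ (∀ u, 1 ≤ u → m u = 1) ∧
      (∀ u ∈ Icc (0 : ℝ) 1, m u ≤ u) ∧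
      (∀ u ∈ Icc (0 : ℝ) 1, m u < u → ∃ t, m u < t ∧ t ≤ 1 ∧ R (m u) t) ∧
      (∀ s t, s ≤ t → R (m s) (m t) → ∀ w ∈ Icc s t, R (m s) (m w)) ∧
      ∀ u, ∃ v, R v (m u) ∧ v ∈ Icc (0 : ℝ) 1 ∧ ∀ δ > 0, ∀ᶠ w in 𝓝 u, ∃ v', R v' (m w) ∧
        v' ∈ Icc (0 : ℝ) 1 ∧ |v' - v| ≤ δ := by
  obtain ⟨C, hC⟩ := arcFam_minimal hR
  obtain ⟨Cc, Csub, C0, C1, Cg⟩ := hC.prop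
  have hcomp : IsCompact C := isCompact_Icc.of_isClosed_subset Cc Csub
  have hex : ∀ u : ℝ, 0 ≤ u → ∃ x, IsGreatest (C ∩ Iic u) x := fun u hu =>
    (hcomp.inter_right isClosed_Iic).exists_isGreatest ⟨0, C0, hu⟩
  choose! M hM using hex
  let m : ℝ → ℝ := fun u => M (max u 0)
  have hm : ∀ u, IsGreatest (C ∩ Iic (max u 0)) (m u) := fun u => hM _ (le_max_right _ _)
  have hmC : ∀ u, m u ∈ C := fun u => (hm u).1.1
  have hmm : Monotone m := fun a b hab => (hm b).2 ⟨hmC a, (hm a).1.2.trans (max_le_max_right 0 hab)⟩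
  have hmle : ∀ u, 0 ≤ u → m u ≤ u := fun u hu => by
    have := (hm u).1.2
    rwa [mem_Iic, max_eq_left hu] at this
  have hmge : ∀ u, ∀ c ∈ C, c ≤ u → c ≤ m u := fun u c hc hcu =>
    (hm u).2 ⟨hc, hcu.trans (le_max_left _ _)⟩
  have hm0 : ∀ u ≤ 0, m u = 0 := fun u hu => by
    have := (hm u).1.2
    rw [mem_Iic, max_eq_right hu] at this
    exact le_antisymm this (Csub (hmC u)).1
  refine ⟨m, fun u => Csub (hmC u), hm0, fun u hu => ?_, fun u hu => hmle u hu.1, ?_, ?_, ?_⟩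
  · exact le_antisymm (Csub (hmC u)).2 (hmge u 1 C1 hu)
  · intro u hu hlt
    obtain ⟨t, ht, htm⟩ := (hcomp.inter_right (isClosed_Ici (a := u))).exists_isLeast ⟨1, C1, hu.2⟩
    refine ⟨t, hlt.trans_le ht.2, (Csub ht.1).2, Cg _ (hmC u) t ht.1 (hlt.trans_le ht.2) ?_⟩
    rw [eq_empty_iff_forall_notMem]
    rintro x ⟨hx, hxC⟩
    rcases le_total x u with h | h
    · linarith [hmge u x hxC h, hx.1]
    · linarith [htm ⟨hxC, h⟩, hx.2]
  · intro s t hst h w hw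
    rcases (hmm hst).eq_or_lt with h1 | h1
    · have : m w = m s := le_antisymm ((hmm hw.2).trans h1.ge) (hmm hw.1)
      rw [this]; exact he.refl _
    · have hg := arcFam_gap hC (hmC s) (hmC t) h1 h
      have : m w = m s ∨ m w = m t := by
        by_contra hcon
        push Not at hcon
        have : m w ∈ Ioo (m s) (m t) ∩ C := ⟨⟨lt_of_le_of_ne (hmm hw.1) hcon.1.symm,
          lt_of_le_of_ne (hmm hw.2) hcon.2⟩, hmC w⟩
        rw [hg] at this; exact this
      rcases this with h2 | h2 <;> rw [h2]
      · exact he.refl _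
      · exact h
  · intro u
    rcases lt_or_ge u 0 with hu | hu
    · refine ⟨0, by rw [hm0 u hu.le]; exact he.refl _, by simp, fun δ hδ => ?_⟩
      filter_upwards [Iio_mem_nhds hu] with w hw
      exact ⟨0, by rw [hm0 w (le_of_lt hw)]; exact he.refl _, by simp, by simp [hδ.le]⟩
    by_cases huC : u ∈ C
    · refine ⟨u, ?_, Csub huC, fun δ hδ => ?_⟩
      · rw [le_antisymm (hmle u hu) (hmge u u huC le_rfl)]; exact he.refl _
      have hmu : m u = u := le_antisymm (hmle u hu) (hmge u u huC le_rfl)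
      have right : ∀ w, u ≤ w → w ≤ u + δ → ∃ v', R v' (m w) ∧ v' ∈ Icc (0 : ℝ) 1 ∧ |v' - u| ≤ δ := by
        intro w h1 h2
        refine ⟨m w, he.refl _, Csub (hmC w), ?_⟩
        have a := hmle w (hu.trans h1)
        have b := hmge w u huC h1
        rw [abs_le]; constructor <;> linarith
      have left : ∀ᶠ w in 𝓝 u, w ≤ u → ∃ v', R v' (m w) ∧ v' ∈ Icc (0 : ℝ) 1 ∧ |v' - u| ≤ δ := by
        by_cases hc : ∃ c ∈ C, c < u ∧ u - δ ≤ c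
        · obtain ⟨c, hcC, hcu, hcd⟩ := hc
          filter_upwards [Ioi_mem_nhds hcu] with w hw hwu
          refine ⟨m w, he.refl _, Csub (hmC w), ?_⟩
          have a := hmge w c hcC (le_of_lt hw)
          have b := hmm hwu
          rw [abs_le]; constructor <;> linarith
        · push Not at hc
          rcases hu.eq_or_lt with h0 | h0
          · subst h0
            filter_upwards with w hw
            refine ⟨m w, he.refl _, Csub (hmC w), ?_⟩
            rw [hm0 w hw]; simp [hδ.le]
          filter_upwards [Ioi_mem_nhds (show max (u - δ) 0 < u from max_lt (by linarith) h0)] with w hw hwu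
          rw [mem_Ioi, max_lt_iff] at hw
          rcases hwu.eq_or_lt with rfl | hwu
          · refine ⟨m w, he.refl _, Csub (hmC w), by rw [hmu]; simp [hδ.le]⟩
          refine ⟨u, ?_, Csub huC, by simp [hδ.le]⟩
          refine he.symm (Cg (m w) (hmC w) u huC ((hmle w hw.2.le).trans_lt hwu) ?_)
          rw [eq_empty_iff_forall_notMem]
          rintro x ⟨hx, hxC⟩
          have h3 := hc x hxC hx.2
          have := hmge w x hxC (by linarith)
          linarith [hx.1]
      filter_upwards [left, Iio_mem_nhds (show u < u + δ by linarith)] with w h1 h2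
      rcases le_total w u with h | h
      · exact h1 h
      · exact right w h (le_of_lt h2)
    · refine ⟨m u, he.refl _, Csub (hmC u), fun δ hδ => ?_⟩
      obtain ⟨ε, hε, hb⟩ := Metric.mem_nhds_iff.1 (Cc.isOpen_compl.mem_nhds huC)
      have hu0 : 0 < u := lt_of_le_of_ne hu (fun h => huC (h ▸ C0))
      filter_upwards [Metric.ball_mem_nhds u hε, Ioi_mem_nhds hu0] with w hw hw0
      rw [Metric.mem_ball, Real.dist_eq, abs_lt] at hw
      have hno : ∀ c ∈ C, |c - u| < ε → False := fun c hc h => hb (show c ∈ ball u ε by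
        rw [Metric.mem_ball, Real.dist_eq]; exact h) hc
      have : m w = m u := by
        apply le_antisymm
        · by_contra hlt; push Not at hlt
          by_cases h1 : m w ≤ u
          · linarith [hmge u _ (hmC w) h1]
          · push Not at h1
            exact hno _ (hmC w) (by
              have := hmle w (le_of_lt hw0)
              rw [abs_lt]; constructor <;> linarith)
        · by_contra hlt; push Not at hlt
          by_cases h1 : m u ≤ w
          · linarith [hmge w _ (hmC u) h1]
          · push Not at h1
            exact hno _ (hmC u) (by
              have := hmle u hu
              rw [abs_lt]; constructor <;> linarith)
      exact ⟨m u, by rw [this]; exact he.refl _, Csub (hmC u), by simp [hδ.le]⟩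

/-- The arc lemma. -/
theorem arc_lemma {q : ℝ → ℂ} (hq : Continuous q)
    (hfree : ∀ t ∈ Ioo (0 : ℝ) 1, MulAction.stabilizer G (q t) = ⊥)
    (h0 : MulAction.stabilizer G (q 0) = ⊥ ∨ ∀ γ : G, γ • q 0 = q 0)
    (h1 : ∀ γ : G, γ • q 1 = q 1)
    (hf0 : ∀ t ∈ Ioc (0 : ℝ) 1, q t ∉ MulAction.orbit G (q 0)) :
    ∃ τ : ℝ → ℂ, ContinuousOn τ (Icc 0 1) ∧ τ 0 = q 0 ∧ τ 1 = q 1 ∧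
      (∀ u ∈ Icc (0 : ℝ) 1, ∃ v ∈ Icc (0 : ℝ) 1, τ u ∈ MulAction.orbit G (q v)) ∧
      ∀ s t, 0 ≤ s → s ≤ t → t ≤ 1 → τ s ∈ MulAction.orbit G (τ t) →
        ∀ w ∈ Icc s t, τ w = τ s := by
  have hcl : IsClosed {p : ℝ × ℝ | q p.1 ∈ MulAction.orbit G (q p.2)} := by
    have : {p : ℝ × ℝ | q p.1 ∈ MulAction.orbit G (q p.2)} = ⋃ γ : G, {p | γ • q p.2 = q p.1} := by
      ext p; simp [MulAction.mem_orbit_iff]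
    rw [this]
    refine isClosed_iUnion_of_finite fun γ => isClosed_eq ?_ (by fun_prop)
    exact (continuous_const_smul γ).comp (by fun_prop)
  have hrel : ∀ x y : ℂ, x ∈ MulAction.orbit G y ↔
      (Quotient.mk (MulAction.orbitRel G ℂ) x) = Quotient.mk _ y := fun x y => by
    rw [Quotient.eq]; rfl
  let mk : ℂ → Quotient (MulAction.orbitRel G ℂ) := Quotient.mk _
  have mkc : Continuous mk := continuous_quotient_mk'
  have heq : Equivalence (fun s t : ℝ => q s ∈ MulAction.orbit G (q t)) := by
    simp only [hrel]
    exact ⟨fun _ => rfl, fun h => h.symm, fun h h' => h.trans h'⟩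
  obtain ⟨m, mI, m0, m1, mle, mgap, mmon, mcont⟩ := arc_retract hcl heq
  simp only [hrel] at mmon mcont mgap
  let P : ℝ → Quotient (MulAction.orbitRel G ℂ) := fun u => mk (q (m u))
  have hPc : Continuous P := by
    rw [continuous_iff_continuousAt]
    intro u
    obtain ⟨v, hv, hvI, hvd⟩ := mcont u
    change Tendsto P (𝓝 u) (𝓝 (P u))
    rw [tendsto_def]
    intro W hW
    have hW' : W ∈ 𝓝 (mk (q v)) := by rw [show mk (q v) = P u from hv]; exact hW
    have := (mkc.comp hq).continuousAt.preimage_mem_nhds hW'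
    obtain ⟨ε, hε, hb⟩ := Metric.mem_nhds_iff.1 this
    filter_upwards [hvd (ε / 2) (by linarith)] with w hw
    obtain ⟨v', h1, h2, h3⟩ := hw
    have : P w = mk (q v') := h1.symm
    rw [mem_preimage, this]
    exact hb (show v' ∈ ball v ε by rw [Metric.mem_ball, Real.dist_eq]; linarith)
  -- the fixed points are alone in their orbits
  have hm1 : ∀ u, u < 1 → m u < 1 := by
    intro u hu
    rcases lt_or_ge u 0 with h | h
    · rw [m0 u h.le]; exact one_pos
    · exact (mle u ⟨h, hu.le⟩).trans_lt hu
  have fixlim : ∀ (e : ℂ), (∀ γ : G, γ • e = e) → ∀ (F : ℝ → ℂ) (A : Set ℝ) (u : ℝ),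
      (∀ w ∈ A, P w = mk (F w)) → P u = mk e → F u = e → ContinuousWithinAt F A u := by
    intro e hfix F A u hF hPu hFu
    rw [ContinuousWithinAt, hFu, tendsto_def]
    intro W hW
    -- saturated neighbourhood
    let W' : Set ℂ := ⋂ γ : G, (fun x => γ • x) ⁻¹' interior W
    have hW'o : IsOpen W' := isOpen_iInter_of_finite fun γ =>
      isOpen_interior.preimage (continuous_const_smul γ)
    have heW' : e ∈ W' := mem_iInter.2 fun γ => by
      rw [mem_preimage, hfix]; exact mem_interior_iff_mem_nhds.2 hW
    have hop : IsOpen (mk '' W') := by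
      exact (isOpenMap_quotient_mk'_mul (Γ := G) (T := ℂ)) _ hW'o
    have hn : mk '' W' ∈ 𝓝 (P u) := hop.mem_nhds (by rw [hPu]; exact ⟨e, heW', rfl⟩)
    filter_upwards [mem_nhdsWithin_of_mem_nhds (hPc.continuousAt.preimage_mem_nhds hn),
      self_mem_nhdsWithin] with w hw hwA
    obtain ⟨x, hx, hxw⟩ := hw
    rw [hF w hwA] at hxw
    obtain ⟨γ, hγ⟩ := (hrel _ _).2 hxw.symm
    have := mem_iInter.1 hx γ
    rw [mem_preimage] at this
    rw [mem_preimage, ← hγ]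
    exact interior_subset this
  have hmk1 : ∀ x, mk x = mk (q 1) → x = q 1 := by
    intro x hx
    obtain ⟨γ, hγ⟩ := (hrel _ _).2 hx
    rw [← hγ]; exact h1 γ
  have main : ∃ τ : ℝ → ℂ, ContinuousOn τ (Icc 0 1) ∧ τ 0 = q 0 ∧
      ∀ u ∈ Icc (0 : ℝ) 1, P u = mk (τ u) := by
    have P0 : P 0 = mk (q 0) := by simp only [P]; rw [m0 0 le_rfl]
    have P1 : P 1 = mk (q 1) := by simp only [P]; rw [m1 1 le_rfl]
    rcases h0 with h0 | h0
    · obtain ⟨F, Fc, F0, FP⟩ := lift_lemma (G := G) (A := Iio 1) isOpen_Iio (convex_Iio 1)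
        hPc.continuousOn (fun u hu => ⟨q (m u), by
          rcases (mI u).1.eq_or_lt with h | h
          · rw [← h]; exact h0
          · exact hfree _ ⟨h, hm1 u hu⟩, rfl⟩) (a₀ := 0) (by simp) P0
      classical
      have hFP : ∀ u ∈ Icc (0 : ℝ) 1, P u = mk (Function.update F 1 (q 1) u) := by
        intro u hu
        by_cases h : u = 1
        · subst h; simp [P1]
        · rw [Function.update_of_ne h]; exact FP u (lt_of_le_of_ne hu.2 h)
      refine ⟨Function.update F 1 (q 1), fun u hu => ?_, by simp [F0], hFP⟩
      by_cases h : u = 1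
      · subst h
        exact fixlim (q 1) h1 _ _ 1 hFP P1 (by simp)
      · refine ContinuousAt.continuousWithinAt ?_
        have hu1 := lt_of_le_of_ne hu.2 h
        refine (Fc.continuousAt (Iio_mem_nhds hu1)).congr ?_
        filter_upwards [Iio_mem_nhds hu1] with w hw
        rw [Function.update_of_ne (ne_of_lt hw)]
    · have hP0 : ∀ u ∈ Icc (0 : ℝ) 1, m u = 0 → u = 0 := by
        intro u hu hmu
        by_contra hu0
        have hu0' := lt_of_le_of_ne hu.1 (Ne.symm hu0)
        obtain ⟨t, t1, t2, t3⟩ := mgap u hu (by rw [hmu]; exact hu0')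
        rw [hmu] at t1 t3
        exact hf0 t ⟨t1, t2⟩ ((hrel _ _).2 t3.symm)
      obtain ⟨F, Fc, F0, FP⟩ := lift_lemma (G := G) (A := Ioo 0 1) isOpen_Ioo (convex_Ioo 0 1)
        hPc.continuousOn (fun u hu => ⟨q (m u), by
          rcases (mI u).1.eq_or_lt with h | h
          · linarith [hP0 u ⟨hu.1.le, hu.2.le⟩ h.symm, hu.1]
          · exact hfree _ ⟨h, hm1 u hu.2⟩, rfl⟩) (a₀ := 1 / 2) (by norm_num)
          (show P (1 / 2) = Quotient.mk _ (q (m (1 / 2))) from rfl)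
      classical
      have hFP : ∀ u ∈ Icc (0 : ℝ) 1,
          P u = mk (Function.update (Function.update F 1 (q 1)) 0 (q 0) u) := by
        intro u hu
        by_cases h : u = 0
        · subst h; simp [P0]
        rw [Function.update_of_ne h]
        by_cases h' : u = 1
        · subst h'; simp [P1]
        · rw [Function.update_of_ne h']
          exact FP u ⟨lt_of_le_of_ne hu.1 (Ne.symm h), lt_of_le_of_ne hu.2 h'⟩
      refine ⟨Function.update (Function.update F 1 (q 1)) 0 (q 0), fun u hu => ?_, by simp, hFP⟩
      by_cases h : u = 0
      · subst h
        exact fixlim (q 0) h0 _ _ 0 hFP P0 (by simp)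
      by_cases h' : u = 1
      · subst h'
        exact fixlim (q 1) h1 _ _ 1 hFP P1 (by simp)
      · refine ContinuousAt.continuousWithinAt ?_
        have hu1 : u ∈ Ioo (0 : ℝ) 1 := ⟨lt_of_le_of_ne hu.1 (Ne.symm h), lt_of_le_of_ne hu.2 h'⟩
        refine (Fc.continuousAt (isOpen_Ioo.mem_nhds hu1)).congr ?_
        filter_upwards [isOpen_Ioo.mem_nhds hu1] with w hw
        rw [Function.update_of_ne (ne_of_gt hw.1), Function.update_of_ne (ne_of_lt hw.2)]
  obtain ⟨τ, τc, τ0, τP⟩ := main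
  refine ⟨τ, τc, τ0, ?_, ?_, ?_⟩
  · apply hmk1
    rw [← τP 1 (by simp)]
    simp only [P]; rw [m1 1 le_rfl]
  · intro u hu
    exact ⟨m u, mI u, (hrel _ _).2 (τP u hu).symm⟩
  · intro s t hs hst ht h
    have hsI : s ∈ Icc (0 : ℝ) 1 := ⟨hs, hst.trans ht⟩
    have htI : t ∈ Icc (0 : ℝ) 1 := ⟨hs.trans hst, ht⟩
    have hsub : Icc s t ⊆ Icc 0 1 := Icc_subset_Icc hs ht
    have hPP : ∀ w ∈ Icc s t, P s = P w := mmon s t hst (by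
      have := (hrel _ _).1 h
      change P s = P t
      rw [τP s hsI, τP t htI]; exact this)
    have hfin : (MulAction.orbit G (τ s)).Finite := by
      exact Set.finite_range _
    have himg : τ '' Icc s t ⊆ MulAction.orbit G (τ s) := by
      rintro _ ⟨w, hw, rfl⟩
      refine (hrel _ _).2 ?_
      change mk _ = mk _
      rw [← τP w (hsub hw), ← τP s hsI, hPP w hw]
    have hpre : (τ '' Icc s t).Subsingleton :=
      hfin.countable.isTotallyDisconnected _ himg (isPreconnected_Icc.image _ (τc.mono hsub))
    intro w hw
    exact hpre ⟨w, hw, rfl⟩ ⟨s, ⟨le_rfl, hst⟩, rfl⟩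

end Arc

/-- continuity descends along continuous maps of compact sets -/
lemma factor_continuousOn {X Y Z : Type*} [TopologicalSpace X] [TopologicalSpace Y] [T2Space Y]
    [TopologicalSpace Z] {K : Set X} (hK : IsCompact K) {f : X → Y} (hf : ContinuousOn f K)
    {l : Y → Z} (h : ContinuousOn (fun x => l (f x)) K) : ContinuousOn l (f '' K) := by
  rw [continuousOn_iff_isClosed]
  intro t ht
  obtain ⟨u, hu, he⟩ := continuousOn_iff_isClosed.1 h t ht
  refine ⟨f '' (K ∩ u), ((hK.inter_right hu).image_of_continuousOn
    (hf.mono inter_subset_left)).isClosed, ?_⟩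
  ext y
  constructor
  · rintro ⟨hy, x, hx, rfl⟩
    have : x ∈ u ∩ K := by rw [← he]; exact ⟨hy, hx⟩
    exact ⟨⟨x, ⟨hx, this.1⟩, rfl⟩, ⟨x, hx, rfl⟩⟩
  · rintro ⟨⟨x, ⟨hx, hxu⟩, rfl⟩, -⟩
    have : x ∈ (fun x => l (f x)) ⁻¹' t ∩ K := by rw [he]; exact ⟨hxu, hx⟩
    exact ⟨this.1, ⟨x, hx, rfl⟩⟩

def AllLog (K : Set ℂ) : Prop :=
  ∀ h : ℂ → ℂ, ContinuousOn h K → (∀ z ∈ K, h z ≠ 0) → HasLog h K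

lemma AllLog.nsep {K : Set ℂ} (H : AllLog K) (hK : IsCompact K) {x y : ℂ} (hx : x ∉ K)
    (hy : y ∉ K) : NSep K x y := by
  refine NSep_of_hasLog hK hx hy (H _ ?_ ?_)
  · refine ContinuousOn.div (by fun_prop) (by fun_prop) ?_
    intro z hz h0
    rw [sub_eq_zero] at h0; exact hy (h0 ▸ hz)
  · intro z hz
    refine div_ne_zero ?_ ?_ <;> intro h0 <;> rw [sub_eq_zero] at h0
    · exact hx (h0 ▸ hz)
    · exact hy (h0 ▸ hz)

lemma AllLog.connected_compl {K : Set ℂ} (H : AllLog K) (hK : IsCompact K) :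
    IsPreconnected Kᶜ := by
  rcases (Kᶜ).eq_empty_or_nonempty with h | ⟨x, hx⟩
  · rw [h]; exact isPreconnected_empty
  have : Kᶜ = connectedComponentIn Kᶜ x := by
    apply subset_antisymm
    · intro y hy; exact H.nsep hK hx hy
    · exact connectedComponentIn_subset _ _
  rw [this]; exact isPreconnected_connectedComponentIn

/-- weakly monotone arcs -/
def MonoArc (τ : ℝ → ℂ) (a b : ℝ) : Prop := ContinuousOn τ (Icc a b) ∧
  ∀ s t, a ≤ s → s ≤ t → t ≤ b → τ s = τ t → ∀ w ∈ Icc s t, τ w = τ s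

lemma MonoArc.sub {τ : ℝ → ℂ} {a b c d : ℝ} (h : MonoArc τ a b) (hc : a ≤ c) (hd : d ≤ b) :
    MonoArc τ c d := ⟨h.1.mono (Icc_subset_Icc hc hd), fun s t hs hst ht =>
      h.2 s t (hc.trans hs) hst (ht.trans hd)⟩

lemma MonoArc.comp {τ : ℝ → ℂ} {a b : ℝ} (h : MonoArc τ a b) {g : ℂ → ℂ} (hg : Continuous g)
    (hi : Function.Injective g) : MonoArc (fun t => g (τ t)) a b :=
  ⟨hg.comp_continuousOn h.1, fun s t hs hst ht he w hw => by
    beta_reduce; rw [h.2 s t hs hst ht (hi he) w hw]⟩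

lemma MonoArc.compact {τ : ℝ → ℂ} {a b : ℝ} (h : MonoArc τ a b) : IsCompact (τ '' Icc a b) :=
  isCompact_Icc.image_of_continuousOn h.1

lemma MonoArc.preconn {τ : ℝ → ℂ} {a b : ℝ} (h : MonoArc τ a b) : IsPreconnected (τ '' Icc a b) :=
  isPreconnected_Icc.image _ h.1

lemma MonoArc.allLog {τ : ℝ → ℂ} {a b : ℝ} (h : MonoArc τ a b) : AllLog (τ '' Icc a b) := by
  intro f hf hf0
  obtain ⟨L, hL, e⟩ := hasLog_of_convex (K := Icc a b) (h := fun t => f (τ t)) (convex_Icc a b)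
    (hf.comp h.1 (mapsTo_image _ _)) (fun t ht => hf0 _ ⟨t, ht, rfl⟩)
  have key : ∀ s ∈ Icc a b, ∀ t ∈ Icc a b, s ≤ t → τ s = τ t → L s = L t := by
    intro s hs t ht hst hτ
    have hc := h.2 s t hs.1 hst ht.2 hτ
    have hsub : Icc s t ⊆ Icc a b := Icc_subset_Icc hs.1 ht.2
    obtain ⟨n, hn⟩ := log_diff_const (K := Icc s t) (L₁ := L) (L₂ := fun _ => L s)
      isPreconnected_Icc (hL.mono hsub) continuousOn_const (fun w hw => by
        rw [← e w (hsub hw), ← e s hs]; beta_reduce; rw [hc w hw])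
    have h1 := hn s ⟨le_rfl, hst⟩
    have h2 := hn t ⟨hst, le_rfl⟩
    rw [h2]; exact h1
  have key' : ∀ s ∈ Icc a b, ∀ t ∈ Icc a b, τ s = τ t → L s = L t := by
    intro s hs t ht hτ
    rcases le_total s t with h | h
    · exact key s hs t ht h hτ
    · exact (key t ht s hs h hτ.symm).symm
  have hch : ∀ z ∈ τ '' Icc a b, ∃ t ∈ Icc a b, τ t = z := fun z hz => hz
  choose! σ hσ1 hσ2 using hch
  have hl : ∀ t ∈ Icc a b, L (σ (τ t)) = L t := fun t ht =>
    key' _ (hσ1 _ ⟨t, ht, rfl⟩) t ht (hσ2 _ ⟨t, ht, rfl⟩)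
  refine ⟨fun z => L (σ z), factor_continuousOn isCompact_Icc h.1 (hL.congr hl), ?_⟩
  rintro _ ⟨t, ht, rfl⟩
  beta_reduce
  rw [hl t ht]; exact e t ht

/-- interior of a monotone arc -/
lemma MonoArc.preconn_int {τ : ℝ → ℂ} {a b : ℝ} (h : MonoArc τ a b) :
    IsPreconnected (τ '' Icc a b \ {τ a, τ b}) := by
  have : τ '' Icc a b \ {τ a, τ b} = τ '' {u ∈ Icc a b | τ u ≠ τ a ∧ τ u ≠ τ b} := by
    ext z; constructor
    · rintro ⟨⟨u, hu, rfl⟩, h2⟩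
      simp only [mem_insert_iff, mem_singleton_iff, not_or] at h2
      exact ⟨u, ⟨hu, h2⟩, rfl⟩
    · rintro ⟨u, ⟨hu, h2⟩, rfl⟩
      exact ⟨⟨u, hu, rfl⟩, by simpa using h2⟩
  rw [this]
  refine IsPreconnected.image (OrdConnected.isPreconnected ⟨?_⟩) _ (h.1.mono (sep_subset _ _))
  rintro u ⟨hu, hu1, hu2⟩ v ⟨hv, hv1, hv2⟩ w hw
  refine ⟨⟨hu.1.trans hw.1, hw.2.trans hv.2⟩, fun hc => ?_, fun hc => ?_⟩
  · exact hu1 (h.2 a w le_rfl (hu.1.trans hw.1) (hw.2.trans hv.2) hc.symm u ⟨hu.1, hw.1⟩)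
  · have := h.2 w b (hu.1.trans hw.1) (hw.2.trans hv.2) le_rfl hc v ⟨hw.2, hv.2⟩
    exact hv2 (this.trans hc)

/-- adding a closure point to a connected set -/
lemma preconn_insert {C : Set ℂ} (hC : IsPreconnected C) {y : ℂ} (hy : y ∈ closure C) :
    IsPreconnected (insert y C) :=
  hC.subset_closure (subset_insert _ _) (insert_subset hy subset_closure)

lemma clopen_in {B S : Set ℂ} (hB : IsOpen B) (hS : IsPreconnected S) (hBS : (B ∩ S).Nonempty)
    (hf : frontier B ∩ S = ∅) : S ⊆ B := by
  refine hS.subset_left_of_subset_union hB (isClosed_closure (s := B)).isOpen_compl ?_ ?_ (inter_comm B S ▸ hBS)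
  · exact disjoint_compl_right.mono_left subset_closure |>.mono_right le_rfl
  · intro z hz
    by_cases h : z ∈ closure B
    · left
      by_contra h2
      have : z ∈ frontier B ∩ S := ⟨by rw [hB.frontier_eq]; exact ⟨h, h2⟩, hz⟩
      rw [hf] at this; exact this
    · right; exact h

lemma clopen_no {K B : Set ℂ} (hB : IsOpen B) (bB : Bornology.IsBounded B) (hne : (B \ K).Nonempty)
    (hK : IsCompact K) (aK : AllLog K) (hf : frontier B ⊆ K) : False := by
  obtain ⟨x, hx, hxK⟩ := hne
  have h1 : Kᶜ ⊆ B := by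
    refine clopen_in hB (aK.connected_compl hK) ⟨x, hx, hxK⟩ ?_
    rw [eq_empty_iff_forall_notMem]
    rintro z ⟨h1, h2⟩
    exact h2 (hf h1)
  have : Bornology.IsBounded (univ : Set ℂ) := by
    rw [← union_compl_self K]
    exact hK.isBounded.union (bB.subset h1)
  exact NormedSpace.unbounded_univ ℝ ℂ this

/-- no three arcs with common endpoints are all accessible from infinity -/
lemma theta_lemma {T : Fin 3 → Set ℂ} {e e' : ℂ} (hne : e ≠ e') (hT : ∀ i, IsCompact (T i))
    (pT : ∀ i, IsPreconnected (T i)) (aT : ∀ i, AllLog (T i))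
    (iT : ∀ i, IsPreconnected (T i \ {e, e'}))
    (hI : ∀ i j, i ≠ j → T i ∩ T j = {e, e'}) {R : ℝ} (hR : 0 < R)
    (hTR : ∀ i, T i ⊆ closedBall 0 R) {O : Set ℂ} (pO : IsPreconnected O)
    (dO : ∀ i, Disjoint O (T i)) {zi : ℂ} (hz : zi ∈ O) (hzR : R < ‖zi‖)
    (hy : ∀ i, (closure O ∩ (T i \ {e, e'})).Nonempty) : False := by
  have B : ∀ i a b : Fin 3, i ≠ a → i ≠ b → ∀ x ∈ T i \ {e, e'}, NSep (T a ∪ T b) zi x := by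
    intro i a b ha hb x hx
    obtain ⟨y, hy1, hy2⟩ := hy i
    have h1 : IsPreconnected (insert y O ∪ (T i \ {e, e'})) :=
      (preconn_insert pO hy1).union y (mem_insert _ _) hy2 (iT i)
    have hd : ∀ c, i ≠ c → ∀ w ∈ T i \ {e, e'}, w ∉ T c := fun c hc w hw hwc =>
      hw.2 (by rw [← hI i c hc]; exact ⟨hw.1, hwc⟩)
    refine NSep.of_preconn h1 ?_ (Or.inl (mem_insert_of_mem _ hz)) (Or.inr hx)
    rintro w ((rfl | hw) | hw)
    · rintro (h | h)
      · exact hd a ha _ hy2 h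
      · exact hd b hb _ hy2 h
    · rintro (h | h)
      · exact (dO a).ne_of_mem hw h rfl
      · exact (dO b).ne_of_mem hw h rfl
    · rintro (h | h)
      · exact hd a ha _ hw h
      · exact hd b hb _ hw h
  obtain ⟨q, hq, hb⟩ := exists_bounded_comp (hT 0) (hT 1) (pT 0) (pT 1) hne (hI 0 1 (by decide))
  have hunb : ¬ NSep (T 0 ∪ T 1) zi q := by
    intro h
    have := far_unbounded hR (union_subset (hTR 0) (hTR 1)) hzR
    rw [connectedComponentIn_eq h] at this
    exact this hb
  set BB := connectedComponentIn (T 0 ∪ T 1)ᶜ q with hBB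
  have hop : IsOpen (T 0 ∪ T 1)ᶜ := ((hT 0).union (hT 1)).isClosed.isOpen_compl
  have BBo : IsOpen BB := hop.connectedComponentIn
  have hqB : q ∈ BB := mem_connectedComponentIn hq
  have hBs : BB ⊆ (T 0 ∪ T 1)ᶜ := connectedComponentIn_subset _ _
  have hfr : frontier BB ⊆ T 0 ∪ T 1 := by
    have := frontier_comp_subset hop q
    rwa [compl_compl] at this
  -- `BB` is disjoint from `T 2`
  have hB2 : ∀ w ∈ BB, w ∉ T 2 := by
    intro w hw hw2
    have hwe : w ∈ T 2 \ {e, e'} := by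
      refine ⟨hw2, fun h => hBs hw (Or.inl ?_)⟩
      rw [← hI 0 1 (by decide)] at h; exact h.1
    exact hunb ((B 2 0 1 (by decide) (by decide) w hwe).trans (NSep.symm hw))
  have step : ∀ i j : Fin 3, (i = 0 ∧ j = 1) ∨ (i = 1 ∧ j = 0) → NSep (T j ∪ T 2) zi q := by
    intro i j hij
    have hTB : ∀ k : Fin 3, (k = 0 ∨ k = 1) → ∀ w ∈ BB, w ∉ T k := by
      rintro k (rfl | rfl) w hw h
      · exact hBs hw (Or.inl h)
      · exact hBs hw (Or.inr h)
    have hj : j = 0 ∨ j = 1 := by rcases hij with h | h <;> simp [h.2]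
    have : ¬ frontier BB ⊆ T j := fun h =>
      clopen_no BBo hb ⟨q, hqB, hTB j hj q hqB⟩ (hT j) (aT j) h
    obtain ⟨y, hy1, hy2⟩ := not_subset.1 this
    have hyi : y ∈ T i := by
      rcases hij with ⟨rfl, rfl⟩ | ⟨rfl, rfl⟩ <;> rcases hfr hy1 with h | h
      · exact h
      · exact absurd h hy2
      · exact absurd h hy2
      · exact h
    have hne' : i ≠ j := by rcases hij with ⟨rfl, rfl⟩ | ⟨rfl, rfl⟩ <;> decide
    have hi2 : i ≠ 2 := by rcases hij with ⟨rfl, rfl⟩ | ⟨rfl, rfl⟩ <;> decide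
    have hyo : y ∈ T i \ {e, e'} := ⟨hyi, fun h => hy2 (by
      rw [← hI i j hne'] at h; exact h.2)⟩
    have n1 := B i j 2 hne' hi2 y hyo
    refine n1.trans (NSep.of_preconn (preconn_insert isPreconnected_connectedComponentIn
      (frontier_subset_closure hy1)) ?_ (mem_insert _ _) (mem_insert_of_mem _ hqB))
    rintro w (rfl | hw)
    · exact n1.right
    · rintro (h | h)
      · exact hTB j hj w hw h
      · exact hB2 w hw h
  have n1 := step 0 1 (by simp)
  have n2 := step 1 0 (by simp)
  have hcap : (T 1 ∪ T 2) ∩ (T 0 ∪ T 2) = T 2 := by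
    apply subset_antisymm
    · rintro w ⟨h1 | h1, h2 | h2⟩
      · have : w ∈ T 0 ∩ T 1 := ⟨h2, h1⟩
        rw [hI 0 1 (by decide), ← hI 0 2 (by decide)] at this
        exact this.2
      all_goals assumption
    · exact fun w hw => ⟨Or.inr hw, Or.inr hw⟩
  have := janiszewski ((hT 1).union (hT 2)) ((hT 0).union (hT 2)) (by rw [hcap]; exact pT 2) n1 n2
  exact hunb (this.mono (by
    rintro w (h | h)
    · exact Or.inr (Or.inl h)
    · exact Or.inl (Or.inl h)))

/-- square roots of functions with logarithms have logarithms -/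
lemma HasLog.of_sq {K : Set ℂ} {h : ℂ → ℂ} (hc : ContinuousOn h K)
    (H : HasLog (fun z => h z * h z) K) : HasLog h K := by
  obtain ⟨L, hL, e⟩ := H
  have hc2 : ContinuousOn (fun z => Complex.exp (L z / 2)) K := (hL.div_const 2).cexp
  have h1 : HasLog (fun z => Complex.I * (h z / Complex.exp (L z / 2))) K := by
    refine hasLog_of_slit (continuousOn_const.mul (hc.div hc2 fun z _ => Complex.exp_ne_zero _)) ?_
    intro z hz
    have h2 : (h z / Complex.exp (L z / 2)) ^ 2 = 1 := by
      rw [div_pow, ← Complex.exp_nat_mul, sq, show h z * h z = _ from e z hz]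
      push_cast
      rw [mul_div_cancel₀ _ (two_ne_zero)]
      exact div_self (Complex.exp_ne_zero _)
    rcases (sq_eq_one_iff.1 h2) with h3 | h3 <;> rw [h3] <;> simp [Complex.mem_slitPlane_iff]
  have h2 : HasLog (fun z => Complex.exp (L z / 2) / Complex.I) K :=
    HasLog.div ⟨_, hL.div_const 2, fun z _ => rfl⟩ (hasLog_const Complex.I_ne_zero _)
  refine (h1.mul h2).congr fun z hz => ?_
  have := Complex.exp_ne_zero (L z / 2)
  field_simp

lemma iter_inj {g : ℂ → ℂ} {n : ℕ} (hn : 0 < n) (hi : ∀ z, g^[n] z = z) : Function.Injective g := by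
  obtain ⟨k, rfl⟩ : ∃ k, n = k + 1 := ⟨n - 1, by omega⟩
  intro a b h
  rw [← hi a, ← hi b, Function.iterate_succ_apply, Function.iterate_succ_apply, h]

lemma iter_fix {g : ℂ → ℂ} {x : ℂ} (h : g x = x) (j : ℕ) : g^[j] x = x := Function.iterate_fixed h j

lemma iter_mod {g : ℂ → ℂ} {n : ℕ} (hi : ∀ z, g^[n] z = z) (j : ℕ) (z : ℂ) :
    g^[j] z = g^[j % n] z := by
  conv_lhs => rw [← Nat.div_add_mod j n, Function.iterate_add_apply, Function.iterate_mul]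
  exact Function.iterate_fixed (hi _) _

/-- inverse iterates -/
lemma iter_neg {g : ℂ → ℂ} {n : ℕ} (hn : 0 < n) (hi : ∀ z, g^[n] z = z) {j : ℕ} {x y : ℂ}
    (h : g^[j] x = y) : ∃ k, g^[k] y = x := by
  refine ⟨j * (n - 1), ?_⟩
  rw [← h, ← Function.iterate_add_apply, show j * (n - 1) + j = n * j by
    rw [mul_comm n j]; obtain ⟨k, rfl⟩ : ∃ k, n = k + 1 := ⟨n - 1, by omega⟩
    simp; ring, Function.iterate_mul]
  exact Function.iterate_fixed (hi x) j

theorem arc_iter {g : ℂ → ℂ} (hg : Continuous g) {n : ℕ} (hn : 0 < n) (hi : ∀ z, g^[n] z = z)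
    {q : ℝ → ℂ} (hq : Continuous q)
    (hfree : ∀ t ∈ Ioo (0 : ℝ) 1, ∀ j, 0 < j → j < n → g^[j] (q t) ≠ q t)
    (h0 : (∀ j, 0 < j → j < n → g^[j] (q 0) ≠ q 0) ∨ g (q 0) = q 0) (h1 : g (q 1) = q 1)
    (hf0 : ∀ t ∈ Ioc (0 : ℝ) 1, ∀ j, g^[j] (q 0) ≠ q t) :
    ∃ τ : ℝ → ℂ, MonoArc τ 0 1 ∧ τ 0 = q 0 ∧ τ 1 = q 1 ∧
      (∀ u ∈ Icc (0 : ℝ) 1, ∃ v ∈ Icc (0 : ℝ) 1, ∃ j, τ u = g^[j] (q v)) ∧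
      ∀ s ∈ Icc (0 : ℝ) 1, ∀ t ∈ Icc (0 : ℝ) 1, ∀ j, τ s = g^[j] (τ t) → τ s = τ t := by
  obtain ⟨k, hk⟩ : ∃ k, n = k + 1 := ⟨n - 1, by omega⟩
  let γ : Equiv.Perm ℂ := ⟨g, g^[k], fun z => by
    rw [← Function.iterate_succ_apply g k z]; rw [hk] at hi; exact hi z, fun z => by
    rw [← Function.iterate_succ_apply' g k z]; rw [hk] at hi; exact hi z⟩
  have hγ : ∀ (j : ℕ) (z : ℂ), (γ ^ j) z = g^[j] z := fun j z => by
    rw [← Equiv.Perm.iterate_eq_pow]; rfl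
  have hγn : γ ^ n = 1 := by
    ext z; rw [hγ, hi]; rfl
  have hfo : IsOfFinOrder γ := isOfFinOrder_iff_pow_eq_one.2 ⟨n, hn, hγn⟩
  let G := Subgroup.zpowers γ
  haveI : Finite G := (finite_zpowers.2 hfo).to_subtype
  have hG : ∀ x : G, ∃ j, j < n ∧ (x : Equiv.Perm ℂ) = γ ^ j := by
    rintro ⟨x, hx⟩
    obtain ⟨j, rfl⟩ := hfo.mem_powers_iff_mem_zpowers.2 hx
    refine ⟨j % n, Nat.mod_lt _ hn, ?_⟩
    exact pow_eq_pow_mod j hγn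
  have hGs : ∀ x : G, ∃ j, j < n ∧ (x : Equiv.Perm ℂ) = γ ^ j ∧ ∀ z : ℂ, x • z = g^[j] z := by
    intro x
    obtain ⟨j, hj, h⟩ := hG x
    refine ⟨j, hj, h, fun z => ?_⟩
    rw [← hγ, ← h]; rfl
  haveI : ContinuousConstSMul G ℂ := ⟨fun x => by
    obtain ⟨j, -, -, h⟩ := hGs x
    rw [show (fun z : ℂ => x • z) = g^[j] from funext h]
    exact hg.iterate j⟩
  have horb : ∀ x y : ℂ, x ∈ MulAction.orbit G y ↔ ∃ j, x = g^[j] y := by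
    intro x y
    rw [MulAction.mem_orbit_iff]
    constructor
    · rintro ⟨a, rfl⟩
      obtain ⟨j, -, -, h⟩ := hGs a
      exact ⟨j, h y⟩
    · rintro ⟨j, rfl⟩
      refine ⟨⟨γ ^ j, Subgroup.npow_mem_zpowers γ j⟩, ?_⟩
      rw [← hγ]; rfl
  have hst : ∀ x : ℂ, (∀ j, 0 < j → j < n → g^[j] x ≠ x) → MulAction.stabilizer G x = ⊥ := by
    intro x hx
    rw [eq_bot_iff]
    intro a ha
    obtain ⟨j, hj, h1, h2⟩ := hGs a
    rw [MulAction.mem_stabilizer_iff, h2] at ha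
    rcases Nat.eq_zero_or_pos j with rfl | hj0
    · rw [Subgroup.mem_bot]; ext1; rw [h1]; simp
    · exact absurd ha (hx j hj0 hj)
  have hfx : ∀ x : ℂ, g x = x → ∀ a : G, a • x = x := by
    intro x hx a
    obtain ⟨j, -, -, h2⟩ := hGs a
    rw [h2, iter_fix hx]
  obtain ⟨τ, τc, τ0, τ1, τq, τm⟩ := arc_lemma (G := G) hq (fun t ht => hst _ (hfree t ht))
    (h0.imp (hst _) (hfx _)) (hfx _ h1) (fun t ht h => by
      obtain ⟨j, hj⟩ := (horb _ _).1 h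
      exact hf0 t ht j hj.symm)
  refine ⟨τ, ⟨τc, fun s t hs hst ht h => τm s t hs hst ht (by rw [h]; exact MulAction.mem_orbit_self _)⟩,
    τ0, τ1, fun u hu => ?_, ?_⟩
  · obtain ⟨v, hv, h⟩ := τq u hu
    exact ⟨v, hv, (horb _ _).1 h⟩
  · intro s hs t ht j h
    rcases le_total s t with hst | hst
    · exact (τm s t hs.1 hst ht.2 ((horb _ _).2 ⟨j, h⟩) t ⟨hst, le_rfl⟩).symm
    · have : τ t ∈ MulAction.orbit G (τ s) := by
        rw [MulAction.orbit_eq_iff.2 ((horb _ _).2 ⟨j, h⟩)]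
        exact MulAction.mem_orbit_self _
      exact τm t s ht.1 hst hs.2 this s ⟨hst, le_rfl⟩

/-- maps which are linear isometries outside the disc preserve the disc -/
lemma disc_inv {g : ℂ → ℂ} {n : ℕ} (hn : 0 < n) (hi : ∀ z, g^[n] z = z)
    (hr : ∀ z, 1 ≤ ‖z‖ → ‖g z‖ = ‖z‖) {z : ℂ} (hz : ‖z‖ < 1) : ‖g z‖ < 1 := by
  by_contra h
  push Not at h
  have : ∀ k, ‖g^[k + 1] z‖ = ‖g z‖ := by
    intro k
    induction k with
    | zero => rfl
    | succ k ih => rw [Function.iterate_succ_apply', hr _ (by rw [ih]; exact h), ih]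
  have h2 := this (n - 1)
  rw [Nat.sub_add_cancel hn, hi] at h2
  linarith

/-- ratio lemma: `g z - g q` and `z - q` differ by an exponential -/
lemma ratio_log {g : ℂ → ℂ} (hg : Continuous g) (hinj : Function.Injective g)
    (ho : ∀ z, 1 ≤ ‖z‖ → g z = z) {q : ℂ} (hq : ‖q‖ < 1) (hgq : ‖g q‖ < 1) :
    ∃ v : ℂ → ℂ, ContinuousOn v (DD \ {q}) ∧
      ∀ z ∈ DD \ {q}, g z - g q = (z - q) * Complex.exp (v z) := by
  have H := hasLog_punctured (h := fun z => (g (q + 3 * z) - g q) / (3 * z)) (by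
      refine ContinuousOn.div (by fun_prop) (by fun_prop) ?_
      rintro z ⟨-, hz⟩
      simpa using hz) (by
      rintro z ⟨-, hz⟩
      refine div_ne_zero ?_ (by simpa using hz)
      rw [sub_ne_zero]
      intro h
      have := hinj h
      simp at this; exact hz this) (by
      refine hasLog_of_slit ?_ ?_
      · refine ContinuousOn.div (by fun_prop) (by fun_prop) ?_
        intro z hz h0
        have : z = 0 := by simpa using h0
        simp [this] at hz
      · intro z hz
        have hz1 : ‖z‖ = 1 := by simpa using hz
        have hz0 : z ≠ 0 := by rintro rfl; simp at hz1
        have h3 : ‖3 * z‖ = 3 := by simp [hz1]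
        have hgz : g (q + 3 * z) = q + 3 * z := ho _ (by
          have := norm_sub_norm_le (3 * z) (-q)
          rw [norm_neg, sub_neg_eq_add, add_comm] at this
          linarith)
        rw [hgz, show (q + 3 * z - g q) / (3 * z) = 1 + (q - g q) / (3 * z) by field_simp; ring]
        apply Complex.mem_slitPlane_of_norm_lt_one
        rw [norm_div, h3]
        have := norm_sub_le q (g q)
        rw [div_lt_one (by norm_num)]; linarith)
  obtain ⟨L, hL, e⟩ := H.comp (g := fun z => (z - q) / 3) (K' := DD \ {q}) (by fun_prop) (by
    rintro z ⟨hz, hzq⟩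
    rw [mem_closedBall_zero_iff] at hz
    refine ⟨?_, ?_⟩
    · rw [mem_closedBall_zero_iff, norm_div]
      have := norm_sub_le z q
      rw [show ‖(3 : ℂ)‖ = 3 by simp, div_le_one (by norm_num)]; linarith
    · simp [sub_eq_zero]; exact hzq)
  refine ⟨L, hL, fun z hz => ?_⟩
  rw [← e z hz]
  have : z - q ≠ 0 := sub_ne_zero.2 hz.2
  beta_reduce
  rw [show q + 3 * ((z - q) / 3) = z by ring]
  field_simp

/-- the case of involutions -/
lemma two_case {g : ℂ → ℂ} (hg : Continuous g) (hi : ∀ z, g (g z) = z)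
    (ho : ∀ z, 1 ≤ ‖z‖ → g z = z) {T : Set ℂ} (hT : IsCompact T) (pT : IsPreconnected T)
    (aT : AllLog T) (hTD : T ⊆ DD) {e e' : ℂ} (hne : e ≠ e') (he : g e = e) (he' : g e' = e')
    (hI : T ∩ g '' T = {e, e'}) : False := by
  have hinj : Function.Injective g := Function.LeftInverse.injective hi
  have hball : ∀ z, ‖z‖ < 1 → ‖g z‖ < 1 := fun z hz =>
    disc_inv (n := 2) two_pos hi (fun w hw => by rw [ho w hw]) hz
  have hgD : ∀ z ∈ DD, g z ∈ DD := by
    intro z hz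
    rcases lt_or_ge ‖z‖ 1 with h | h
    · simpa using (hball z h).le
    · rw [ho z h]; exact hz
  have hT' : IsCompact (g '' T) := hT.image hg
  have hT'D : g '' T ⊆ DD := by rintro _ ⟨z, hz, rfl⟩; exact hgD z (hTD hz)
  obtain ⟨q, hq, hb⟩ := exists_bounded_comp hT hT' pT (pT.image g hg.continuousOn) hne hI
  have hJ : IsCompact (T ∪ g '' T) := hT.union hT'
  have hJD : T ∪ g '' T ⊆ DD := union_subset hTD hT'D
  have hq1 : ‖q‖ < 1 := by
    by_contra h
    push Not at h
    rcases h.eq_or_lt with h | h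
    · -- on the circle: move outward
      have hseg : NSep (T ∪ g '' T) q (2 * q) := by
        refine NSep.of_preconn (C := segment ℝ q (2 * q)) (convex_segment _ _).isPreconnected ?_
          (left_mem_segment _ _ _) (right_mem_segment _ _ _)
        rintro _ ⟨a, b, ha, hb, hab, rfl⟩ hmem
        have h1 := hJD hmem
        rw [mem_closedBall_zero_iff] at h1
        have h2 : a • q + b • (2 * q) = ((a + 2 * b : ℝ) : ℂ) * q := by
          simp only [Complex.real_smul]; push_cast; ring
        rw [h2, norm_mul, ← h, mul_one, Complex.norm_real, Real.norm_eq_abs,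
          abs_of_nonneg (by linarith)] at h1
        have hb0 : b = 0 := by linarith
        have ha1 : a = 1 := by linarith
        rw [h2, hb0, ha1] at hmem
        simp at hmem
        exact hq (by simpa using hmem)
      have := far_unbounded one_pos hJD (y := 2 * q) (by rw [norm_mul, ← h]; simp)
      rw [connectedComponentIn_eq hseg] at hb
      exact this hb
    · exact far_unbounded one_pos hJD h hb
  have hgq1 := hball q hq1
  obtain ⟨v, hv, ev⟩ := ratio_log hg hinj ho hq1 hgq1
  have hqT : q ∉ T := fun h => hq (Or.inl h)
  have hgqT : g q ∉ T := fun h => hq (Or.inr ⟨g q, h, hi q⟩)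
  have hgqT' : g q ∉ g '' T := by rintro ⟨z, hz, h⟩; exact hqT (hinj h ▸ hz)
  have hgqJ : g q ∉ T ∪ g '' T := by rintro (h | h); exacts [hgqT h, hgqT' h]
  obtain ⟨l, hl, el⟩ := aT (fun z => z - q) (by fun_prop) (fun z hz h => hqT (by
    rw [sub_eq_zero] at h; exact h ▸ hz))
  obtain ⟨l', hl', el'⟩ := aT (fun z => z - g q) (by fun_prop) (fun z hz h => hgqT (by
    rw [sub_eq_zero] at h; exact h ▸ hz))
  have hTq : T ⊆ DD \ {q} := fun z hz => ⟨hTD hz, fun h => hqT (h ▸ hz)⟩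
  have hT'q : g '' T ⊆ DD \ {q} := fun z hz => ⟨hT'D hz, fun h => hq (Or.inr (h ▸ hz))⟩
  have hgT : MapsTo g (g '' T) T := by rintro _ ⟨z, hz, rfl⟩; rw [hi]; exact hz
  obtain ⟨F, Fc, F1, F2⟩ := glue_continuousOn (K₁ := T) (K₂ := g '' T) hT.isClosed hT'.isClosed
    (f := fun z => l z + l' z) (g := fun z => l (g z) + v (g z) + l' (g z) - v z) (hl.add hl')
    ((((hl.comp hg.continuousOn hgT).add (hv.comp hg.continuousOn (hgT.mono_right hTq))).add
      (hl'.comp hg.continuousOn hgT)).sub (hv.mono hT'q)) (by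
      intro z hz
      rw [hI] at hz
      rcases hz with rfl | rfl
      · simp only [he]; ring
      · simp only [he']; ring)
  have HP : HasLog (fun z => (z - q) * (z - g q)) (T ∪ g '' T) := by
    refine ⟨F, Fc, ?_⟩
    rintro z (hz | hz) <;> beta_reduce
    · rw [F1 z hz, Complex.exp_add, ← el z hz, ← el' z hz]
    · rw [F2 z hz]
      have hw := hgT hz
      have a1 : z - g q = (g z - q) * Complex.exp (v (g z)) := by
        have := ev (g z) (hTq hw)
        rwa [hi] at this
      have a2 := ev z (hT'q hz)
      have b1 := el (g z) hw
      have b2 := el' (g z) hw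
      beta_reduce at b1 b2
      rw [Complex.exp_sub, Complex.exp_add, Complex.exp_add, ← b1, ← b2, a1, a2]
      have := Complex.exp_ne_zero (v z)
      field_simp
  by_cases hn : NSep (T ∪ g '' T) q (g q)
  · have h2 := HP.mul (hn.hasLog hJ.isClosed)
    refine not_hasLog_sub_of_bounded hJ hq hb (HasLog.of_sq (by fun_prop) (h2.congr ?_))
    intro z hz
    have : z - g q ≠ 0 := sub_ne_zero.2 fun h => hgqJ (h ▸ hz)
    field_simp
  · have hop : IsOpen (T ∪ g '' T)ᶜ := hJ.isClosed.isOpen_compl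
    have hfr : frontier (connectedComponentIn (T ∪ g '' T)ᶜ q) ⊆ T ∪ g '' T := by
      have := frontier_comp_subset hop q
      rwa [compl_compl] at this
    refine bdd_no_log (w := fun z => z - g q) hJ hop.connectedComponentIn hb hfr
      (mem_connectedComponentIn hq) (by fun_prop) ?_ HP
    intro z hz h0
    rw [sub_eq_zero] at h0
    subst h0
    by_cases h : g q ∈ connectedComponentIn (T ∪ g '' T)ᶜ q
    · exact hn h
    · exact hgqJ (hfr (by rw [hop.connectedComponentIn.frontier_eq]; exact ⟨hz, h⟩))

/-- prime order case: a map of prime order which is the identity outside is the identity -/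
lemma trivial_prime {g : ℂ → ℂ} (hg : Continuous g) {p : ℕ} (hp : p.Prime) (hi : ∀ z, g^[p] z = z)
    (ho : ∀ z, 1 ≤ ‖z‖ → g z = z) : ∀ z, g z = z := by
  by_contra hcon
  push Not at hcon
  obtain ⟨x0, hx0⟩ := hcon
  have hpp := hp.pos
  have hinj := iter_inj hpp hi
  have hfp : ∀ x j, 0 < j → j < p → g^[j] x = x → g x = x := by
    intro x j h0 h1 h
    have h2 : Function.IsPeriodicPt g j x := h
    have h3 : Function.IsPeriodicPt g p x := hi x
    have := h2.gcd h3
    rwa [(Nat.coprime_of_lt_prime h0.ne' h1 hp).symm.gcd_eq_one] at this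
  have hball : ∀ z, ‖z‖ < 1 → ‖g z‖ < 1 := fun z hz =>
    disc_inv hpp hi (fun w hw => by rw [ho w hw]) hz
  have hgD : ∀ z ∈ DD, g z ∈ DD := by
    intro z hz
    rcases lt_or_ge ‖z‖ 1 with h | h
    · simpa using (hball z h).le
    · rw [ho z h]; exact hz
  have hgjD : ∀ j, ∀ z ∈ DD, g^[j] z ∈ DD := by
    intro j
    induction j with
    | zero => intro z hz; exact hz
    | succ j ih => intro z hz; rw [Function.iterate_succ_apply']; exact hgD _ (ih z hz)
  have hx01 : ‖x0‖ < 1 := by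
    by_contra h; push Not at h; exact hx0 (ho _ h)
  have hE : IsClosed {t : ℝ | g (x0 + t) = x0 + t} := isClosed_eq (by fun_prop) (by fun_prop)
  have hn2 : ∀ t : ℝ, 2 ≤ |t| → g (x0 + t) = x0 + t := by
    intro t ht
    apply ho
    have := norm_sub_norm_le (t : ℂ) (-x0)
    rw [norm_neg, sub_neg_eq_add, add_comm, Complex.norm_real, Real.norm_eq_abs] at this
    linarith
  have hbr : ∀ t : ℝ, (∀ u : ℝ, |u| < |t| → 0 ≤ u * t → g (x0 + u) ≠ x0 + u) → |t| ≤ 2 := by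
    intro t h
    by_contra h2; push Not at h2
    rcases le_total 0 t with h0 | h0
    · exact h 2 (by norm_num; linarith) (by positivity) (hn2 2 (by norm_num))
    · exact h (-2) (by norm_num; linarith) (by nlinarith) (hn2 (-2) (by norm_num))
  -- right endpoint
  obtain ⟨b, ⟨hbE, hb0⟩, hbm⟩ : ∃ b, IsLeast ({t : ℝ | g (x0 + t) = x0 + t} ∩ Ici 0) b := by
    refine ⟨_, (hE.inter isClosed_Ici).isLeast_csInf ⟨2, hn2 2 (by norm_num), by norm_num⟩ ⟨0, fun t ht => ht.2⟩⟩
  obtain ⟨a, ⟨haE, ha0⟩, ham⟩ : ∃ a, IsGreatest ({t : ℝ | g (x0 + t) = x0 + t} ∩ Iic 0) a := by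
    refine ⟨_, (hE.inter isClosed_Iic).isGreatest_csSup ⟨-2, hn2 (-2) (by norm_num), by norm_num⟩ ⟨0, fun t ht => ht.2⟩⟩
  have hbE' : g (x0 + b) = x0 + b := hbE
  have haE' : g (x0 + a) = x0 + a := haE
  rw [mem_Ici] at hb0
  rw [mem_Iic] at ha0
  have hb1 : 0 < b := hb0.lt_of_ne (by rintro rfl; simp at hbE'; exact hx0 hbE')
  have ha1 : a < 0 := ha0.lt_of_ne (by rintro rfl; simp at haE'; exact hx0 haE')
  have hin : ∀ t : ℝ, a < t → t < b → g (x0 + t) ≠ x0 + t := by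
    intro t h1 h2 h
    rcases le_total 0 t with h0 | h0
    · exact absurd (hbm ⟨h, h0⟩) (not_le.2 h2)
    · exact absurd (ham ⟨h, h0⟩) (not_le.2 h1)
  have hin1 : ∀ t : ℝ, a ≤ t → t ≤ b → x0 + t ∈ DD := by
    have h1 : ∀ t ∈ Ioo a b, x0 + (t : ℂ) ∈ DD := by
      intro t ht
      rw [mem_closedBall_zero_iff]
      by_contra h
      push Not at h
      exact hin t ht.1 ht.2 (ho _ h.le)
    intro t h2 h3
    have hc : IsClosed {t : ℝ | x0 + (t : ℂ) ∈ DD} := isClosed_closedBall.preimage (by fun_prop)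
    have := hc.closure_subset_iff.2 h1
    rw [closure_Ioo (by linarith)] at this
    exact this ⟨h2, h3⟩
  let q : ℝ → ℂ := fun s => x0 + ((a + s * (b - a) : ℝ) : ℂ)
  have hq0 : q 0 = x0 + a := by simp [q]
  have hq1 : q 1 = x0 + b := by simp [q]
  have hqin : ∀ s ∈ Ioo (0 : ℝ) 1, g (q s) ≠ q s := fun s hs =>
    hin _ (by nlinarith [hs.1]) (by nlinarith [hs.2])
  have hqD : ∀ s ∈ Icc (0 : ℝ) 1, q s ∈ DD := fun s hs =>
    hin1 _ (by nlinarith [hs.1]) (by nlinarith [hs.2])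
  have hqinj : ∀ s, q 0 = q s → s = 0 := by
    intro s h
    have : (a + 0 * (b - a) : ℝ) = a + s * (b - a) := by
      have := add_left_cancel h
      exact_mod_cast this
    have : s * (b - a) = 0 := by linarith
    rcases mul_eq_zero.1 this with h | h
    · exact h
    · linarith
  obtain ⟨τ, hτ, τ0, τ1, τq, τm⟩ := arc_iter hg hpp hi (q := q) (by fun_prop)
    (fun t ht j h0 h1 h => hqin t ht (hfp _ _ h0 h1 h)) (Or.inr (by rw [hq0]; exact haE'))
    (by rw [hq1]; exact hbE') (fun t ht j h => by
      rw [iter_fix (by rw [hq0]; exact haE')] at h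
      exact ht.1.ne' (hqinj t h))
  have he : g (τ 0) = τ 0 := by rw [τ0, hq0]; exact haE'
  have he' : g (τ 1) = τ 1 := by rw [τ1, hq1]; exact hbE'
  have hne : τ 0 ≠ τ 1 := by
    rw [τ0, τ1]; intro h; exact one_ne_zero (hqinj 1 h)
  have hgj : ∀ j, Function.Injective g^[j] := fun j => hinj.iterate j
  have hτD : τ '' Icc 0 1 ⊆ DD := by
    rintro _ ⟨u, hu, rfl⟩
    obtain ⟨v, hv, j, h⟩ := τq u hu
    rw [h]; exact hgjD j _ (hqD v hv)
  -- fixed points on tau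
  have hfixτ : ∀ u ∈ Icc (0 : ℝ) 1, g (τ u) = τ u → τ u = τ 0 ∨ τ u = τ 1 := by
    intro u hu hf
    obtain ⟨v, hv, j, h⟩ := τq u hu
    have hqv : g (q v) = q v := by
      apply hgj j
      rw [← Function.iterate_succ_apply, Function.iterate_succ_apply', ← h, hf]
    rw [h, iter_fix hqv]
    rcases hv.1.eq_or_lt with h0 | h0
    · left; rw [← h0, τ0]
    · rcases hv.2.eq_or_lt with h1 | h1
      · right; rw [h1, τ1]
      · exact absurd hqv (hqin v ⟨h0, h1⟩)
  let T : ℕ → Set ℂ := fun i => g^[i] '' (τ '' Icc 0 1)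
  have hT : ∀ i, IsCompact (T i) := fun i => hτ.compact.image (hg.iterate i)
  have hMA : ∀ i, MonoArc (fun t => g^[i] (τ t)) 0 1 := fun i => hτ.comp (hg.iterate i) (hgj i)
  have hTeq : ∀ i, T i = (fun t => g^[i] (τ t)) '' Icc 0 1 := fun i => by
    simp only [T, image_image]
  have hTm : ∀ i, MapsTo g (T i) (T (i + 1)) := by
    rintro i _ ⟨z, hz, rfl⟩
    exact ⟨z, hz, Function.iterate_succ_apply' _ _ _⟩
  have hTp : ∀ i, T (i % p) = T i := by
    intro i
    simp only [T]
    apply image_congr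
    intro z _
    exact (iter_mod hi i z).symm
  have e0 : ∀ i, g^[i] (τ 0) = τ 0 := iter_fix he
  have e1 : ∀ i, g^[i] (τ 1) = τ 1 := iter_fix he'
  have hTD : ∀ i, T i ⊆ DD := by
    rintro i _ ⟨z, hz, rfl⟩; exact hgjD _ _ (hτD hz)
  have heT : ∀ i, τ 0 ∈ T i := fun i => ⟨τ 0, ⟨0, by simp, rfl⟩, e0 i⟩
  have heT' : ∀ i, τ 1 ∈ T i := fun i => ⟨τ 1, ⟨1, by simp, rfl⟩, e1 i⟩
  have hI : ∀ i j, i < p → j < p → i ≠ j → T i ∩ T j = {τ 0, τ 1} := by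
    have key : ∀ i j, i < j → j < p → T i ∩ T j ⊆ {τ 0, τ 1} := by
      rintro i j hij hj z ⟨⟨_, ⟨s, hs, rfl⟩, rfl⟩, ⟨_, ⟨t, ht, rfl⟩, h⟩⟩
      have h1 : τ s = g^[j - i] (τ t) := by
        apply hgj i
        rw [← Function.iterate_add_apply, Nat.add_sub_cancel' hij.le, h]
      have h2 := τm s hs t ht _ h1
      rw [← h2] at h1
      have h3 := hfp _ _ (by omega) (by omega) h1.symm
      rw [iter_fix h3]
      exact hfixτ s hs h3
    intro i j hi' hj hij
    apply Subset.antisymm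
    · rcases lt_or_gt_of_ne hij with h | h
      · exact key i j h hj
      · rw [inter_comm]; exact key j i h hi'
    · rintro z (rfl | rfl)
      exacts [⟨heT i, heT j⟩, ⟨heT' i, heT' j⟩]
  have pT : ∀ i, IsPreconnected (T i) := fun i => by rw [hTeq]; exact (hMA i).preconn
  have aT : ∀ i, AllLog (T i) := fun i => by rw [hTeq]; exact (hMA i).allLog
  have iT : ∀ i, IsPreconnected (T i \ {τ 0, τ 1}) := fun i => by
    have := (hMA i).preconn_int
    beta_reduce at this
    rwa [e0, e1, ← hTeq] at this
  rcases hp.two_le.eq_or_lt with h2 | h3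
  · -- p = 2
    subst h2
    refine two_case hg hi ho (hT 0) (pT 0) (aT 0) (hTD 0) hne he he' ?_
    have := hI 0 1 (by norm_num) (by norm_num) (by norm_num)
    rwa [show T 1 = g '' T 0 by simp [T]] at this
  · let W : Set ℂ := ⋃ i ∈ Finset.range p, T i
    have hWT : ∀ i, T i ⊆ W := by
      intro i
      rw [← hTp]
      exact subset_biUnion_of_mem (u := T) (by simpa using Nat.mod_lt i hpp)
    have hW : IsCompact W := (Finset.range p).isCompact_biUnion fun i _ => hT i
    have hWD : W ⊆ DD := iUnion₂_subset fun i _ => hTD i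
    have h2W : (2 : ℂ) ∈ Wᶜ := fun h => by have := hWD h; simp at this
    have hgW : ∀ z, g z ∈ W → z ∈ W := by
      intro z hz
      obtain ⟨i, -, hz⟩ := mem_iUnion₂.1 hz
      have h4 : T (i + p) = T i := by rw [← hTp, Nat.add_mod_right, hTp]
      rw [← h4, show i + p = (i + p - 1) + 1 by omega] at hz
      obtain ⟨w, hw, h⟩ := hz
      rw [Function.iterate_succ_apply'] at h
      rw [← hinj h]
      exact hWT _ ⟨w, hw, rfl⟩
    let O := connectedComponentIn Wᶜ 2
    have hWo : IsOpen Wᶜ := hW.isClosed.isOpen_compl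
    have hOo : IsOpen O := hWo.connectedComponentIn
    have hgO : g '' O ⊆ O := by
      refine (isPreconnected_connectedComponentIn.image g hg.continuousOn).subset_connectedComponentIn
        ⟨2, mem_connectedComponentIn h2W, ho 2 (by norm_num)⟩ ?_
      rintro _ ⟨z, hz, rfl⟩ h
      exact connectedComponentIn_subset _ _ hz (hgW z h)
    have hfr : ¬ frontier O ⊆ {τ 0, τ 1} := by
      intro hf
      have hS : IsPreconnected ({τ 0, τ 1}ᶜ : Set ℂ) := by
        refine (Set.Countable.isPathConnected_compl_of_one_lt_rank ?_
          (Set.Finite.countable (by simp))).isConnected.isPreconnected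
        simp
      have hsub := clopen_in hOo hS ⟨2, mem_connectedComponentIn h2W, by
        rintro (h | h)
        · exact h2W (h ▸ hWT 0 (heT 0))
        · exact h2W (h ▸ hWT 0 (heT' 0))⟩ (by
        rw [eq_empty_iff_forall_notMem]; rintro z ⟨h1, h2⟩; exact h2 (hf h1))
      have hx : q (1/2) ∈ Wᶜ ∨ q (1/2) ∈ W := (em _).symm
      -- T 0 interior is nonempty
      obtain ⟨z, hz, hzn⟩ : ∃ z ∈ τ '' Icc 0 1, z ∉ ({τ 0, τ 1} : Set ℂ) := by
        by_contra hh
        push Not at hh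
        have h5 : IsPreconnected ({τ 0, τ 1} : Set ℂ) :=
          (Subset.antisymm (fun z hz => hh z hz) (by
            rintro z (rfl | rfl)
            exacts [⟨0, by simp, rfl⟩, ⟨1, by simp, rfl⟩])) ▸ hτ.preconn
        exact hne (((Set.Finite.countable (by simp)).isTotallyDisconnected : IsTotallyDisconnected ({τ 0, τ 1} : Set ℂ))
          _ subset_rfl h5 (by simp) (by simp))
      exact connectedComponentIn_subset _ _ (hsub hzn) (hWT 0 ⟨z, hz, rfl⟩)
    obtain ⟨y, hy, hyn⟩ := not_subset.1 hfr
    have hyW : y ∈ W := by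
      have := frontier_comp_subset hWo 2 hy
      rwa [compl_compl] at this
    obtain ⟨i, -, hyi⟩ := mem_iUnion₂.1 hyW
    have hne2 : ∀ k z, z ∉ ({τ 0, τ 1} : Set ℂ) → g^[k] z ∉ ({τ 0, τ 1} : Set ℂ) := by
      rintro k z hz (h | h)
      · exact hz (Or.inl (hgj k (by rw [h, e0])))
      · exact hz (Or.inr (hgj k (by rw [h]; exact (e1 k).symm)))
    have hgOk : ∀ k, MapsTo g^[k] (closure O) (closure O) := by
      intro k
      have h1 : MapsTo g O O := fun z hz => hgO ⟨z, hz, rfl⟩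
      exact (h1.iterate k).closure (hg.iterate k)
    have hTk : ∀ k, MapsTo g^[k] (T i) (T (i + k)) := by
      intro k
      rintro _ ⟨z, hz, rfl⟩
      exact ⟨z, hz, by rw [← Function.iterate_add_apply, add_comm]⟩
    have hyall : ∀ j, (closure O ∩ (T j \ {τ 0, τ 1})).Nonempty := by
      intro j
      refine ⟨g^[j + (p - 1) * i] y, hgOk _ (frontier_subset_closure hy), ?_, hne2 _ _ hyn⟩
      have := hTk (j + (p - 1) * i) hyi
      rw [← hTp] at this
      rw [← hTp]
      convert this using 2
      rw [show i + (j + (p - 1) * i) = j + p * i by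
        obtain ⟨k, rfl⟩ : ∃ k, p = k + 1 := ⟨p - 1, by omega⟩
        simp; ring]
      simp
    refine theta_lemma (T := fun i : Fin 3 => T i) (R := 1) (O := O) (zi := 2) hne
      (fun i => hT i) (fun i => pT i) (fun i => aT i) (fun i => iT i) (fun i j hij => hI i j
        (by omega) (by omega) (fun h => hij (Fin.ext h))) one_pos (fun i => hTD i)
      isPreconnected_connectedComponentIn (fun i => ?_) (mem_connectedComponentIn h2W) (by simp)
      (fun i => hyall i)
    rw [Set.disjoint_left]
    exact fun z hz h => connectedComponentIn_subset _ _ hz (hWT i h)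

theorem trivial_of_id_outside {g : ℂ → ℂ} (hg : Continuous g) {n : ℕ} (hn : 0 < n)
    (hi : ∀ z, g^[n] z = z) (ho : ∀ z, 1 ≤ ‖z‖ → g z = z) : ∀ z, g z = z := by
  induction n using Nat.strong_induction_on with
  | _ n ih =>
    by_cases h1 : n = 1
    · subst h1; exact hi
    · obtain ⟨p, hp, k, rfl⟩ := Nat.exists_prime_and_dvd h1
      have hk : 0 < k := Nat.pos_of_mul_pos_left hn |> fun _ => by
        rcases Nat.eq_zero_or_pos k with h | h
        · subst h; simp at hn
        · exact h
      have ho' : ∀ z, 1 ≤ ‖z‖ → g^[k] z = z := fun z hz => iter_fix (ho z hz) k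
      have h2 := trivial_prime (hg.iterate k) hp (fun z => by
        rw [← Function.iterate_mul, mul_comm]; exact hi z) ho'
      exact ih k (by nlinarith [hp.two_le]) hk h2

lemma iter_rot {g : ℂ → ℂ} {ζ : ℂ} (hζ : ‖ζ‖ = 1) (ho : ∀ z, 1 ≤ ‖z‖ → g z = ζ * z) (j : ℕ) (z : ℂ)
    (hz : 1 ≤ ‖z‖) : g^[j] z = ζ ^ j * z := by
  induction j with
  | zero => simp
  | succ j ih => rw [Function.iterate_succ_apply', ih, ho _ (by simp [hζ, hz]), pow_succ]; ring

/-- the normalised rotation type maps -/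
structure RotMap (f : ℂ → ℂ) (d : ℕ) : Prop where
  hd : 2 ≤ d
  cont : Continuous f
  per : ∀ z, f^[d] z = z
  zero : f 0 = 0
  out : ∀ z, 1 ≤ ‖z‖ → f z = Complex.exp (2 * Real.pi * Complex.I / d) * z
  free : ∀ j, 0 < j → j < d → ∀ z, f^[j] z = z → z = 0

def RotGood (f : ℂ → ℂ) (ζ : ℂ) : Prop :=
  ∃ h : ℂ → ℂ, ContinuousOn h DD ∧ BijOn h DD DD ∧ ∀ x ∈ DD, h (f x) = ζ * h x

lemma RotGood.good {f : ℂ → ℂ} {ζ : ℂ} (hζ : ‖ζ‖ = 1) (H : RotGood f ζ) : Good f := by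
  obtain ⟨h, h1, h2, h3⟩ := H
  refine ⟨rotation (Circle.exp ζ.arg), h, h1, h2, fun x hx => ?_⟩
  rw [h3 x hx, rotation_apply, Circle.coe_exp]
  have := Complex.norm_mul_exp_arg_mul_I ζ
  rw [hζ] at this
  simp at this
  rw [this]

lemma fix_exists {g : ℂ → ℂ} (hg : Continuous g) {ζ : ℂ} (hζ1 : ζ ≠ 1)
    (ho : ∀ z, 1 ≤ ‖z‖ → g z = ζ * z) : ∃ a, ‖a‖ < 1 ∧ g a = a := by
  by_contra hcon
  push Not at hcon
  have h0 : ∀ z ∈ DD, z - g z ≠ 0 := by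
    intro z hz h
    rw [sub_eq_zero] at h
    rw [mem_closedBall_zero_iff] at hz
    rcases hz.eq_or_lt with h1 | h1
    · rw [ho z h1.ge] at h
      have hz0 : z ≠ 0 := by rintro rfl; simp at h1
      exact hζ1 (mul_right_cancel₀ hz0 (by rw [← h, one_mul]))
    · exact hcon z h1 h.symm
  have H := (hasLog_of_convex (h := fun z => z - g z) (convex_closedBall (0 : ℂ) 1) (by fun_prop) h0).mono
    (sphere_subset_closedBall)
  have hz : (1 - ζ) ≠ 0 := sub_ne_zero.2 hζ1.symm
  have H2 := H.div (hasLog_const hz _)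
  refine not_hasLog_sub_sphere (x := 0) (R := 1) (by simp) (H2.congr ?_)
  intro z hz1
  have h1 : ‖z‖ = 1 := by simpa using hz1
  rw [ho z h1.ge, sub_zero]
  field_simp

/-- moving a point of the open disc to the centre -/
lemma exists_move {a : ℂ} (ha : ‖a‖ < 1) : ∃ φ : ℂ ≃ₜ ℂ, φ 0 = a ∧ ∀ z, 1 ≤ ‖z‖ → φ z = z := by
  let c : NNReal := ‖a‖₊
  let F : ℂ → ℂ := fun z => z + ((max 0 (1 - ‖z‖) : ℝ) : ℂ) * a
  have hL : ApproximatesLinearOn F ((ContinuousLinearEquiv.refl ℝ ℂ : ℂ ≃L[ℝ] ℂ) : ℂ →L[ℝ] ℂ) univ c := by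
    intro x _ y _
    have : F x - F y - (x - y) = (((max 0 (1 - ‖x‖)) - (max 0 (1 - ‖y‖)) : ℝ) : ℂ) * a := by
      simp only [F]; push_cast; ring
    change ‖F x - F y - (x - y)‖ ≤ _
    rw [this, norm_mul, Complex.norm_real, mul_comm]
    refine mul_le_mul_of_nonneg_left ?_ (norm_nonneg _)
    have h1 := abs_max_sub_max_le_abs (1 - ‖x‖) (1 - ‖y‖) 0
    rw [max_comm _ 0, max_comm _ 0] at h1
    refine h1.trans ?_
    rw [show 1 - ‖x‖ - (1 - ‖y‖) = ‖y‖ - ‖x‖ by ring, norm_sub_rev]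
    exact abs_norm_sub_norm_le _ _
  let φ := hL.toHomeomorph F (by
    right
    rw [show ‖((ContinuousLinearEquiv.refl ℝ ℂ).symm : ℂ →L[ℝ] ℂ)‖₊ = 1 from by
      rw [← NNReal.coe_inj]; exact ContinuousLinearMap.norm_id]
    simpa [c, ← NNReal.coe_lt_coe] using ha)
  have hφ : ∀ z, φ z = F z := fun z => rfl
  refine ⟨φ, ?_, fun z hz => ?_⟩
  · rw [hφ]; simp [F]
  · rw [hφ]; simp only [F]; rw [max_eq_left (by linarith)]; simp

/-- uniqueness of the fixed point -/
lemma fix_unique {g : ℂ → ℂ} (hg : Continuous g) {d : ℕ} (hd : 0 < d) (hi : ∀ z, g^[d] z = z) {ζ : ℂ}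
    (hζ : ‖ζ‖ = 1) (hζ1 : ζ ≠ 1) (ho : ∀ z, 1 ≤ ‖z‖ → g z = ζ * z) (g0 : g 0 = 0) {b : ℂ}
    (hb : g b = b) : b = 0 := by
  by_contra hb0
  have hinj := iter_inj hd hi
  have hζ0 : ζ ≠ 0 := by rintro rfl; simp at hζ
  have hgn : ∀ z, z ≠ 0 → g z ≠ 0 := fun z hz h => hz (hinj (by rw [h, g0]))
  have hbD : b ∈ DD := by
    rw [mem_closedBall_zero_iff]
    by_contra h; push Not at h
    rw [ho b h.le] at hb
    exact hζ1 (mul_right_cancel₀ hb0 (by rw [hb, one_mul]))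
  obtain ⟨u, hu, eu⟩ := hasLog_punctured (h := fun z => g z / z)
    (by refine ContinuousOn.div (by fun_prop) (by fun_prop) ?_; rintro z ⟨-, hz⟩; exact hz)
    (by rintro z ⟨-, hz⟩; exact div_ne_zero (hgn z hz) hz)
    ((hasLog_const hζ0 _).congr (by
      intro z hz
      have h1 : ‖z‖ = 1 := by simpa using hz
      have : z ≠ 0 := by rintro rfl; simp at h1
      beta_reduce
      rw [ho z h1.ge]; field_simp))
  have hgD : MapsTo g (DD \ {0}) (DD \ {0}) := by
    rintro z ⟨hz, hz0⟩
    refine ⟨?_, hgn z hz0⟩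
    rw [mem_closedBall_zero_iff] at hz ⊢
    rcases hz.eq_or_lt with h | h
    · rw [ho z h.ge, norm_mul, hζ, h, one_mul]
    · exact (disc_inv hd hi (fun w hw => by rw [ho w hw, norm_mul, hζ, one_mul]) h).le
  have hconn : IsPreconnected (DD \ {(0 : ℂ)}) := by
    have h1 : (fun z : ℂ => z) '' (DD \ {0}) = (fun p : ℝ × ℝ => (p.1 : ℂ) * Complex.exp (p.2 * Complex.I)) '' (Ioc 0 1 ×ˢ univ) := by
      ext z; constructor
      · rintro ⟨w, ⟨hw, hw0⟩, rfl⟩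
        rw [mem_closedBall_zero_iff] at hw
        exact ⟨(‖w‖, w.arg), ⟨⟨norm_pos_iff.2 hw0, hw⟩, trivial⟩, Complex.norm_mul_exp_arg_mul_I w⟩
      · rintro ⟨⟨r, t⟩, ⟨hr, -⟩, rfl⟩
        refine ⟨_, ⟨?_, ?_⟩, rfl⟩
        · rw [mem_closedBall_zero_iff]
          simp only [norm_mul, Complex.norm_exp_ofReal_mul_I, Complex.norm_real]
          rw [mul_one, Real.norm_of_nonneg hr.1.le]; exact hr.2
        · simp [hr.1.ne']
    rw [image_id'] at h1
    rw [h1]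
    exact ((isPreconnected_Ioc).prod isPreconnected_univ).image _ (by fun_prop)
  let S : ℂ → ℂ := fun z => ∑ i ∈ Finset.range d, u (g^[i] z)
  have hS : ContinuousOn S (DD \ {0}) := by
    refine continuousOn_finset_sum _ fun i _ => ?_
    exact hu.comp (hg.iterate i).continuousOn (hgD.iterate i)
  have hit : ∀ z ∈ DD \ {0}, ∀ k, Complex.exp (∑ i ∈ Finset.range k, u (g^[i] z)) = g^[k] z / z := by
    intro z hz k
    have hz0 : z ≠ 0 := hz.2
    induction k with
    | zero => simp [hz0]
    | succ k ih =>
      have h1 := hgD.iterate k hz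
      have h2 : g^[k] z ≠ 0 := h1.2
      have h3 := eu _ h1
      beta_reduce at h3
      rw [Finset.sum_range_succ, Complex.exp_add, ih, ← h3, Function.iterate_succ_apply']
      field_simp
  have hone : (1 : ℂ) ∈ DD \ {0} := by simp
  have hbm : b ∈ DD \ {0} := ⟨hbD, hb0⟩
  obtain ⟨N, hN⟩ := log_diff_const hconn (L₁ := S) (L₂ := fun _ => 0) hS continuousOn_const (by
    intro z hz
    have hz0 : z ≠ 0 := hz.2
    simp only [S]
    rw [hit z hz, hi]; simp [hz0])
  -- on the circle `u` is constant
  have hcs : IsPreconnected (sphere (0 : ℂ) 1) :=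
    (isConnected_sphere (by simp) (0 : ℂ) zero_le_one).isPreconnected
  have hss : sphere (0 : ℂ) 1 ⊆ DD \ {0} := by
    intro z hz
    refine ⟨sphere_subset_closedBall hz, ?_⟩
    rintro rfl; simp at hz
  obtain ⟨M, hM⟩ := log_diff_const hcs (L₁ := u) (L₂ := fun _ => Complex.log ζ) (hu.mono hss) continuousOn_const (by
    intro z hz
    have h1 : ‖z‖ = 1 := by simpa using hz
    have : z ≠ 0 := by rintro rfl; simp at h1
    rw [← eu z (hss hz), Complex.exp_log hζ0]
    beta_reduce
    rw [ho z h1.ge]; field_simp)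
  have hone' : (1 : ℂ) ∈ sphere (0 : ℂ) 1 := by simp
  have hu1 : ∀ z ∈ sphere (0 : ℂ) 1, u z = u 1 := fun z hz => by rw [hM z hz, hM 1 hone']
  have S1 : S 1 = d * u 1 := by
    simp only [S]
    rw [Finset.sum_congr rfl (fun i _ => hu1 _ ?_)]
    · simp
    · rw [iter_rot hζ ho i 1 (by simp)]; simp [hζ]
  have Sb : S b = d * u b := by
    simp only [S]
    rw [Finset.sum_congr rfl (fun i _ => by rw [iter_fix hb])]
    simp
  have hub : u b = u 1 := by
    have : (d : ℂ) * u b = d * u 1 := by rw [← Sb, ← S1, hN b hbm, hN 1 hone]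
    exact mul_left_cancel₀ (by exact_mod_cast hd.ne') this
  have h1 := eu 1 hone
  have h2 := eu b hbm
  beta_reduce at h1 h2
  rw [hub, ← h1, hb, div_self hb0, ho 1 (by simp)] at h2
  simp at h2
  exact hζ1 h2.symm

theorem rot_reduce (H : ∀ f d, RotMap f d → RotGood f (Complex.exp (2 * Real.pi * Complex.I / d)))
    {g : ℂ → ℂ} (hg : Continuous g) {n : ℕ} (hn : 0 < n) (hi : ∀ z, g^[n] z = z) {ζ : ℂ}
    (hζn : ζ ^ n = 1) (ho : ∀ z, 1 ≤ ‖z‖ → g z = ζ * z) : Good g := by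
  have hζ : ‖ζ‖ = 1 := Complex.norm_eq_one_of_pow_eq_one hζn hn.ne'
  by_cases hζ1 : ζ = 1
  · subst hζ1
    have := trivial_of_id_outside hg hn hi (fun z hz => by rw [ho z hz, one_mul])
    exact ⟨LinearIsometryEquiv.refl ℝ ℂ, id, continuousOn_id, bijOn_id _, fun x _ => by simp [this]⟩
  -- move a fixed point to the origin
  obtain ⟨a, ha, hga⟩ := fix_exists hg hζ1 ho
  obtain ⟨φ, φ0, φo⟩ := exists_move ha
  have φs : ∀ z, 1 ≤ ‖z‖ → φ.symm z = z := fun z hz => by rw [φ.symm_apply_eq, φo z hz]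
  let f : ℂ → ℂ := fun z => φ.symm (g (φ z))
  have hfc : Continuous f := by fun_prop
  have hfit : ∀ k z, f^[k] z = φ.symm (g^[k] (φ z)) := by
    intro k z
    induction k with
    | zero => simp
    | succ k ih => rw [Function.iterate_succ_apply', ih, Function.iterate_succ_apply']; simp [f]
  have hfi : ∀ z, f^[n] z = z := fun z => by rw [hfit, hi]; simp
  have hfo : ∀ z, 1 ≤ ‖z‖ → f z = ζ * z := by
    intro z hz
    simp only [f]
    rw [φo z hz, ho z hz, φs _ (by rw [norm_mul, hζ, one_mul]; exact hz)]
  have hf0 : f 0 = 0 := by simp only [f]; rw [φ0, hga, φ.symm_apply_eq, φ0]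
  suffices hgood : Good f by
    have hφD : BijOn φ.symm DD DD := by
      refine ⟨?_, φ.symm.injective.injOn, ?_⟩
      · intro z hz
        rw [mem_closedBall_zero_iff] at hz ⊢
        by_contra h; push Not at h
        have := φo _ h.le
        rw [φ.apply_symm_apply] at this
        rw [← this] at h; linarith
      · intro z hz
        refine ⟨φ z, ?_, φ.symm_apply_apply z⟩
        rw [mem_closedBall_zero_iff] at hz ⊢
        by_contra h; push Not at h
        have := φs _ h.le
        rw [φ.symm_apply_apply] at this
        rw [← this] at h; linarith
    exact Good.of_conj (φ := φ.symm) φ.symm.continuous.continuousOn hφD (by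
      intro x hx; simp [f]) hgood
  let d := orderOf ζ
  have hfo' : IsOfFinOrder ζ := isOfFinOrder_iff_pow_eq_one.2 ⟨n, hn, hζn⟩
  have hd0 : 0 < d := hfo'.orderOf_pos
  have hd1 : d ≠ 1 := fun h => hζ1 (orderOf_eq_one_iff.1 h)
  have hprim : IsPrimitiveRoot ζ d := IsPrimitiveRoot.orderOf ζ
  have hfd : ∀ z, f^[d] z = z := by
    refine trivial_of_id_outside (hfc.iterate d) hn (fun z => ?_) (fun z hz => ?_)
    · rw [← Function.iterate_mul, mul_comm, Function.iterate_mul]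
      exact Function.iterate_fixed (hfi z) d
    · rw [iter_rot hζ hfo d z hz, hprim.pow_eq_one, one_mul]
  have hprim2 := Complex.isPrimitiveRoot_exp d hd0.ne'
  haveI : NeZero d := ⟨hd0.ne'⟩
  obtain ⟨l, -, hl⟩ := hprim.eq_pow_of_pow_eq_one hprim2.pow_eq_one
  obtain ⟨k, -, hk⟩ := hprim2.eq_pow_of_pow_eq_one hprim.pow_eq_one
  have hlk : ∀ z, (f^[l])^[k] z = f z := by
    intro z
    have h1 : ζ ^ (l * k) = ζ ^ 1 := by rw [pow_mul, hl, hk, pow_one]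
    have h2 : l * k % d = 1 := hprim.pow_inj (Nat.mod_lt _ hd0) (by omega) (by
      rw [← h1]; exact pow_mod_orderOf ζ (l * k))
    rw [← Function.iterate_mul, iter_mod hfd, h2]; rfl
  have hR : RotMap (f^[l]) d := by
    refine ⟨by omega, hfc.iterate l, fun z => ?_, iter_fix hf0 l, fun z hz => ?_, ?_⟩
    · rw [← Function.iterate_mul, mul_comm, Function.iterate_mul]
      exact Function.iterate_fixed (hfd z) l
    · rw [iter_rot hζ hfo l z hz, hl]
    · intro j hj0 hjd z hz
      rw [← Function.iterate_mul] at hz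
      refine fix_unique (hfc.iterate (l * j)) hd0 (fun z => ?_) (ζ := ζ ^ (l * j)) (by simp [hζ]) ?_
        (iter_rot hζ hfo _) (iter_fix hf0 _) hz
      · rw [← Function.iterate_mul, mul_comm, Function.iterate_mul]
        exact Function.iterate_fixed (hfd z) _
      · rw [pow_mul, hl]
        intro h
        exact hprim2.pow_ne_one_of_pos_of_lt hj0.ne' hjd h
  obtain ⟨h, h1, h2, h3⟩ := H _ d hR
  refine RotGood.good hζ ⟨h, h1, h2, fun x hx => ?_⟩
  have hmap : MapsTo f DD DD := by
    intro z hz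
    rw [mem_closedBall_zero_iff] at hz ⊢
    rcases hz.eq_or_lt with h | h
    · rw [hfo z h.ge, norm_mul, hζ, h, one_mul]
    · exact (disc_inv hn hfi (fun w hw => by rw [hfo w hw, norm_mul, hζ, one_mul]) h).le
  have key : ∀ j, h ((f^[l])^[j] x) = Complex.exp (2 * Real.pi * Complex.I / d) ^ j * h x := by
    intro j
    induction j with
    | zero => simp
    | succ j ih =>
      rw [Function.iterate_succ_apply', h3 _ ((hmap.iterate l).iterate j hx), ih, pow_succ]; ring
  rw [← hlk, key, hk]

/-- Hurwitz type lemma -/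
lemma hurwitz {ι : Type*} {p : Filter ι} [p.NeBot] {G : ι → ℂ → ℂ} {g : ℂ → ℂ} {U : Set ℂ}
    (hU : IsOpen U) (pU : IsPreconnected U) (hG : ∀ i, DifferentiableOn ℂ (G i) U)
    (hc : TendstoLocallyUniformlyOn G g p U) {z₀ : ℂ} (hz₀ : z₀ ∈ U) (hz : g z₀ = 0)
    {r : ℝ} (hr : 0 < r) (hne : ∀ i, ∀ z ∈ ball z₀ r ∩ U, G i z ≠ 0) : ∀ z ∈ U, g z = 0 := by
  have hg : DifferentiableOn ℂ g U := hc.differentiableOn (Eventually.of_forall hG) hU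
  have han : AnalyticOnNhd ℂ g U := hg.analyticOnNhd hU
  by_contra hcon
  have h1 : ∀ᶠ z in 𝓝[≠] z₀, g z ≠ 0 := by
    rcases (han z₀ hz₀).eventually_eq_zero_or_eventually_ne_zero with h | h
    · exact absurd (fun z hz => han.eqOn_zero_of_preconnected_of_eventuallyEq_zero pU hz₀ h hz) hcon
    · exact h
  rw [eventually_nhdsWithin_iff] at h1
  obtain ⟨ρ, hρ, hρ1⟩ := Metric.eventually_nhds_iff_ball.1 (h1.and ((hU.eventually_mem hz₀).and (Metric.ball_mem_nhds z₀ hr)))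
  have hs : closedBall z₀ (ρ / 2) ⊆ ball z₀ ρ := closedBall_subset_ball (by linarith)
  have hsU : closedBall z₀ (ρ / 2) ⊆ U := fun z hz => (hρ1 z (hs hz)).2.1
  have hsne : ∀ z ∈ sphere z₀ (ρ / 2), g z ≠ 0 := fun z hz =>
    (hρ1 z (hs (sphere_subset_closedBall hz))).1 (by
      rintro rfl; simp at hz; linarith)
  obtain ⟨w, hw, hmin⟩ := (isCompact_sphere z₀ (ρ / 2)).exists_isMinOn
    (NormedSpace.sphere_nonempty.2 (by linarith)) ((hg.continuousOn.mono (sphere_subset_closedBall.trans hsU)).norm)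
  have hm : 0 < ‖g w‖ := norm_pos_iff.2 (hsne w hw)
  have hunif := (tendstoLocallyUniformlyOn_iff_forall_isCompact hU).1 hc _ hsU (isCompact_closedBall _ _)
  rw [Metric.tendstoUniformlyOn_iff] at hunif
  obtain ⟨i, hi⟩ := (hunif (‖g w‖ / 3) (by positivity)).exists
  have hGne : ∀ z ∈ closedBall z₀ (ρ / 2), G i z ≠ 0 := fun z hz =>
    hne i z ⟨(hρ1 z (hs hz)).2.2, hsU hz⟩
  have hmax := Complex.norm_le_of_forall_mem_frontier_norm_le (f := fun z => (G i z)⁻¹) (U := ball z₀ (ρ / 2))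
    isBounded_ball (C := (2 * ‖g w‖ / 3)⁻¹) (by
      apply DifferentiableOn.diffContOnCl
      rw [closure_ball _ (by linarith)]
      exact DifferentiableOn.inv ((hG i).mono hsU) hGne) (by
      intro z hz
      rw [frontier_ball _ (by linarith)] at hz
      have hz1 := hi z (sphere_subset_closedBall hz)
      have hz2 : ‖g w‖ ≤ ‖g z‖ := hmin hz
      rw [norm_inv]
      rw [dist_eq_norm] at hz1
      have := norm_sub_norm_le (g z) (G i z)
      exact inv_anti₀ (by positivity) (by linarith)) (z := z₀) (subset_closure (mem_ball_self (by linarith)))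
  rw [norm_inv] at hmax
  have h0 := hGne z₀ (mem_closedBall_self (by linarith))
  have h2 : 2 * ‖g w‖ / 3 ≤ ‖G i z₀‖ := (inv_le_inv₀ (norm_pos_iff.2 h0) (by positivity)).1 hmax
  have h3 := hi z₀ (mem_closedBall_self (by linarith))
  rw [hz, dist_eq_norm, zero_sub, norm_neg] at h3
  linarith

/-- Montel via ultrafilters -/
lemma montel {f : ℕ → ℂ → ℂ} {U : Set ℂ} (hU : IsOpen U) (hf : ∀ i, DifferentiableOn ℂ (f i) U)
    (hb : ∀ i, MapsTo (f i) U (ball 0 1)) (𝒰 : Ultrafilter ℕ) :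
    ∃ g : ℂ → ℂ, TendstoLocallyUniformlyOn f g (𝒰 : Filter ℕ) U ∧ ∀ z ∈ U, ‖g z‖ ≤ 1 := by
  have hlim : ∀ z ∈ U, ∃ w ∈ closedBall (0 : ℂ) 1, Tendsto (fun i => f i z) 𝒰 (𝓝 w) := by
    intro z hz
    have := (isCompact_closedBall (0 : ℂ) 1).ultrafilter_le_nhds (𝒰.map fun i => f i z) (by
      rw [le_principal_iff]
      exact Filter.mem_map.2 (Filter.univ_mem' fun i => ball_subset_closedBall (hb i hz)))
    exact this
  choose! g hg1 hg2 using hlim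
  refine ⟨g, ?_, fun z hz => by simpa using hg1 z hz⟩
  rw [Metric.tendstoLocallyUniformlyOn_iff]
  intro ε hε z hz
  obtain ⟨r, hr, hrU⟩ := Metric.isOpen_iff.1 hU z hz
  have hlip : ∀ i, ∀ w ∈ ball z r, dist (f i w) (f i z) ≤ 2 / r * dist w z := by
    intro i w hw
    refine Complex.dist_le_div_mul_dist_of_mapsTo_ball ((hf i).mono hrU) ?_ hw
    intro y hy
    have h1 := hb i (hrU hy)
    have h2 := hb i hz
    rw [mem_ball_zero_iff] at h1 h2
    rw [mem_closedBall, dist_eq_norm]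
    have := norm_sub_le (f i y) (f i z)
    linarith
  have hlip' : ∀ w ∈ ball z r, dist (g w) (g z) ≤ 2 / r * dist w z := by
    intro w hw
    exact le_of_tendsto ((hg2 w (hrU hw)).dist (hg2 z hz)) (Eventually.of_forall fun i => hlip i w hw)
  refine ⟨ball z (min r (ε * r / 8)), mem_nhdsWithin_of_mem_nhds (ball_mem_nhds _ (by positivity)), ?_⟩
  filter_upwards [Metric.tendsto_nhds.1 (hg2 z hz) (ε / 4) (by positivity)] with i hi w hw
  rw [mem_ball, lt_min_iff] at hw
  have h1 := hlip i w hw.1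
  have h2 := hlip' w hw.1
  have h3 : 2 / r * dist w z ≤ ε / 4 := by
    calc 2 / r * dist w z ≤ 2 / r * (ε * r / 8) := by gcongr; exact hw.2.le
      _ = ε / 4 := by field_simp; ring
  calc dist (g w) (f i w) ≤ dist (g w) (g z) + dist (g z) (f i z) + dist (f i z) (f i w) := dist_triangle4 _ _ _ _
    _ < ε := by rw [dist_comm (g z), dist_comm (f i z) (f i w)]; linarith

/-- Moebius maps -/
noncomputable def mob (w z : ℂ) : ℂ := (z - w) / (1 - (starRingEnd ℂ) w * z)

lemma mob_den {w z : ℂ} (hw : ‖w‖ < 1) (hz : ‖z‖ < 1) : 1 - (starRingEnd ℂ) w * z ≠ 0 := by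
  intro h
  rw [sub_eq_zero] at h
  have : ‖(starRingEnd ℂ) w * z‖ = 1 := by rw [← h]; simp
  rw [norm_mul, RCLike.norm_conj] at this
  nlinarith [norm_nonneg w, norm_nonneg z]

lemma mob_norm {w z : ℂ} (hw : ‖w‖ < 1) (hz : ‖z‖ < 1) : ‖mob w z‖ < 1 := by
  have hd := mob_den hw hz
  rw [mob, norm_div, div_lt_one (norm_pos_iff.2 hd)]
  apply lt_of_pow_lt_pow_left₀ 2 (norm_nonneg _)
  rw [← Complex.normSq_eq_norm_sq, ← Complex.normSq_eq_norm_sq]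
  have h1 : Complex.normSq w < 1 := by rw [Complex.normSq_eq_norm_sq]; nlinarith [norm_nonneg w]
  have h2 : Complex.normSq z < 1 := by rw [Complex.normSq_eq_norm_sq]; nlinarith [norm_nonneg z]
  have h3 : Complex.normSq (1 - (starRingEnd ℂ) w * z) - Complex.normSq (z - w) =
      (1 - Complex.normSq w) * (1 - Complex.normSq z) := by
    simp [Complex.normSq_apply]; ring
  nlinarith [mul_pos (sub_pos.2 h1) (sub_pos.2 h2)]

lemma mob_inj {w z z' : ℂ} (hw : ‖w‖ < 1) (hz : ‖z‖ < 1) (hz' : ‖z'‖ < 1) (h : mob w z = mob w z') :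
    z = z' := by
  rw [mob, mob, div_eq_div_iff (mob_den hw hz) (mob_den hw hz')] at h
  have h1 : (z - z') * (1 - (starRingEnd ℂ) w * w) = 0 := by linear_combination h
  rcases mul_eq_zero.1 h1 with h | h
  · exact sub_eq_zero.1 h
  · exact absurd h (mob_den hw hw)

lemma mob_deriv {w z : ℂ} (hw : ‖w‖ < 1) (hz : ‖z‖ < 1) :
    HasDerivAt (mob w) ((1 - (starRingEnd ℂ) w * w) / (1 - (starRingEnd ℂ) w * z) ^ 2) z := by
  have h1 : HasDerivAt (fun z : ℂ => z - w) 1 z := (hasDerivAt_id z).sub_const w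
  have h2 : HasDerivAt (fun z : ℂ => 1 - (starRingEnd ℂ) w * z) (-((starRingEnd ℂ) w * 1)) z :=
    ((hasDerivAt_id z).const_mul _).const_sub 1
  have := h1.div h2 (mob_den hw hz)
  refine this.congr_deriv ?_
  congr 1
  ring

/-- holomorphic square roots -/
lemma exists_sqrt {h : ℂ → ℂ} {U : Set ℂ} (hU : IsOpen U) (hd : DifferentiableOn ℂ h U)
    (H : HasLog h U) : ∃ s : ℂ → ℂ, (∀ z ∈ U, s z ^ 2 = h z) ∧ (∀ z ∈ U, s z ≠ 0) ∧
      ∀ z ∈ U, HasDerivAt s (deriv h z / (2 * s z)) z := by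
  obtain ⟨L, hL, e⟩ := H
  have hLd : ∀ z ∈ U, HasDerivAt L (deriv h z / h z) z := by
    intro z hz
    have hh : HasStrictDerivAt h (deriv h z) z :=
      ((hd.analyticOnNhd hU) z hz).hasStrictDerivAt
    have hLc : ContinuousAt L z := hL.continuousAt (hU.mem_nhds hz)
    have hz0 : h z ≠ 0 := by rw [e z hz]; exact Complex.exp_ne_zero _
    -- write `L = L z + log (h / h z)` near `z`
    have hev : ∀ᶠ y in 𝓝 z, L y = L z + Complex.log (h y / h z) := by
      have hn : ∀ᶠ y in 𝓝 z, ‖L y - L z‖ < 3 := by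
        have : Tendsto (fun y => ‖L y - L z‖) (𝓝 z) (𝓝 ‖L z - L z‖) := (hLc.sub continuousAt_const).norm
        rw [sub_self, norm_zero] at this
        exact this.eventually (gt_mem_nhds (by norm_num))
      filter_upwards [hn, hU.mem_nhds hz] with y hy hyU
      rw [e y hyU, e z hz, ← Complex.exp_sub, Complex.log_exp]
      · ring
      · have := (abs_le.1 (Complex.abs_im_le_norm (L y - L z))).1
        linarith [Real.pi_gt_three]
      · have := (abs_le.1 (Complex.abs_im_le_norm (L y - L z))).2
        linarith [Real.pi_gt_three]
    have h1 : HasDerivAt (fun y => h y / h z) (deriv h z / h z) z := hh.hasDerivAt.div_const _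
    have h2 := (h1.clog (by rw [div_self hz0]; exact Complex.one_mem_slitPlane)).const_add (L z)
    rw [div_self hz0, div_one] at h2
    exact h2.congr_of_eventuallyEq hev
  refine ⟨fun z => Complex.exp (L z / 2), fun z hz => ?_, fun z _ => Complex.exp_ne_zero _, fun z hz => ?_⟩
  · rw [e z hz, ← Complex.exp_nat_mul]; congr 1; push_cast; ring
  · have h1 := ((hLd z hz).div_const 2).cexp
    refine h1.congr_deriv ?_
    have h2 : h z = Complex.exp (L z / 2) * Complex.exp (L z / 2) := by
      rw [e z hz, ← Complex.exp_add]; congr 1; ring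
    rw [h2]
    have := Complex.exp_ne_zero (L z / 2)
    field_simp

/-- admissible family -/
structure Adm (U : Set ℂ) (a : ℂ) (f : ℂ → ℂ) : Prop where
  diff : DifferentiableOn ℂ f U
  maps : MapsTo f U (ball 0 1)
  inj : InjOn f U
  der : ∀ z ∈ U, deriv f z ≠ 0
  zero : f a = 0

lemma Adm.improve {U : Set ℂ} {a : ℂ} {f : ℂ → ℂ} (hU : IsOpen U) (ha : a ∈ U)
    (hlog : ∀ h : ℂ → ℂ, ContinuousOn h U → (∀ z ∈ U, h z ≠ 0) → HasLog h U) (hf : Adm U a f)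
    {w : ℂ} (hw : ‖w‖ < 1) (hwf : ∀ z ∈ U, f z ≠ w) :
    ∃ F, Adm U a F ∧ ‖deriv f a‖ < ‖deriv F a‖ := by
  have hfn : ∀ z ∈ U, ‖f z‖ < 1 := fun z hz => by simpa using hf.maps hz
  have hfd : ∀ z ∈ U, HasDerivAt f (deriv f z) z := fun z hz =>
    (hf.diff.differentiableAt (hU.mem_nhds hz)).hasDerivAt
  let h : ℂ → ℂ := fun z => mob w (f z)
  have hhd : ∀ z ∈ U, HasDerivAt h ((1 - (starRingEnd ℂ) w * w) / (1 - (starRingEnd ℂ) w * f z) ^ 2 * deriv f z) z :=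
    fun z hz => (mob_deriv hw (hfn z hz)).comp z (hfd z hz)
  have hdiff : DifferentiableOn ℂ h U := fun z hz => (hhd z hz).differentiableAt.differentiableWithinAt
  have hne : ∀ z ∈ U, h z ≠ 0 := fun z hz => div_ne_zero (sub_ne_zero.2 (hwf z hz)) (mob_den hw (hfn z hz))
  obtain ⟨s, s2, s0, sd⟩ := exists_sqrt hU hdiff (hlog h hdiff.continuousOn hne)
  have hsn : ∀ z ∈ U, ‖s z‖ < 1 := by
    intro z hz
    have h1 : ‖s z‖ ^ 2 < 1 := by rw [← norm_pow, s2 z hz]; exact mob_norm hw (hfn z hz)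
    nlinarith [norm_nonneg (s z)]
  let c := s a
  have hc := hsn a ha
  let F : ℂ → ℂ := fun z => mob c (s z)
  have hFd : ∀ z ∈ U, HasDerivAt F ((1 - (starRingEnd ℂ) c * c) / (1 - (starRingEnd ℂ) c * s z) ^ 2 *
      (deriv h z / (2 * s z))) z := fun z hz => (mob_deriv hc (hsn z hz)).comp z (sd z hz)
  have hden : ∀ {x : ℂ}, ‖x‖ < 1 → (1 - (starRingEnd ℂ) x * x) ≠ 0 := fun hx => mob_den hx hx
  refine ⟨F, ⟨fun z hz => (hFd z hz).differentiableAt.differentiableWithinAt, fun z hz => ?_, ?_, ?_, ?_⟩, ?_⟩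
  · rw [mem_ball_zero_iff]; exact mob_norm hc (hsn z hz)
  · intro x hx y hy hxy
    have h1 := mob_inj hc (hsn x hx) (hsn y hy) hxy
    have h2 : h x = h y := by rw [← s2 x hx, ← s2 y hy, h1]
    exact hf.inj hx hy (mob_inj hw (hfn x hx) (hfn y hy) h2)
  · intro z hz
    rw [(hFd z hz).deriv, (hhd z hz).deriv]
    have h1 := hden hc
    have h2 := mob_den hc (hsn z hz)
    have h3 := hden hw
    have h4 := mob_den hw (hfn z hz)
    have h5 := hf.der z hz
    have h6 := s0 z hz
    exact mul_ne_zero (div_ne_zero h1 (pow_ne_zero _ h2)) (div_ne_zero (mul_ne_zero (div_ne_zero h3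
      (pow_ne_zero _ h4)) h5) (mul_ne_zero two_ne_zero h6))
  · simp [F, c, mob]
  · rw [(hFd a ha).deriv, (hhd a ha).deriv, hf.zero]
    have ec : ‖c‖ ^ 2 = ‖w‖ := by
      rw [← norm_pow, s2 a ha]; simp only [h, hf.zero, mob]; simp
    have e1 : ∀ x : ℂ, ‖x‖ < 1 → ‖1 - (starRingEnd ℂ) x * x‖ = 1 - ‖x‖ ^ 2 := by
      intro x hx
      rw [mul_comm, Complex.mul_conj, Complex.normSq_eq_norm_sq, ← Complex.ofReal_one, ← Complex.ofReal_sub,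
        Complex.norm_real, Real.norm_of_nonneg (by nlinarith [norm_nonneg x])]
    simp only [norm_mul, norm_div, norm_pow]
    change _ < ‖1 - (starRingEnd ℂ) c * c‖ / ‖1 - (starRingEnd ℂ) c * c‖ ^ 2 * _
    rw [e1 c hc, e1 w hw, ← ec]
    have hc0 : 0 < ‖c‖ := norm_pos_iff.2 (s0 a ha)
    have hfa : 0 < ‖deriv f a‖ := norm_pos_iff.2 (hf.der a ha)
    have : ‖(2:ℂ)‖ = 2 := by simp
    rw [this]
    simp only [mul_zero, sub_zero, norm_one, one_pow, div_one]
    have hc1 : ‖c‖ < 1 := hc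
    change _ < (1 - ‖c‖ ^ 2) / (1 - ‖c‖ ^ 2) ^ 2 * ((1 - (‖c‖ ^ 2) ^ 2) * ‖deriv f a‖ / (2 * ‖c‖))
    have h1 : (1 - ‖c‖ ^ 2) ≠ 0 := by nlinarith
    rw [show (1 - ‖c‖ ^ 2) / (1 - ‖c‖ ^ 2) ^ 2 * ((1 - (‖c‖ ^ 2) ^ 2) * ‖deriv f a‖ / (2 * ‖c‖)) =
      (1 + ‖c‖ ^ 2) / (2 * ‖c‖) * ‖deriv f a‖ by
        rw [show 1 - (‖c‖ ^ 2) ^ 2 = (1 - ‖c‖ ^ 2) * (1 + ‖c‖ ^ 2) by ring]; field_simp]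
    have : 1 < (1 + ‖c‖ ^ 2) / (2 * ‖c‖) := by
      rw [one_lt_div (by positivity)]; nlinarith [sq_nonneg (1 - ‖c‖), mul_pos (sub_pos.2 hc1) (sub_pos.2 hc1)]
    nlinarith

/-- Riemann mapping theorem -/
theorem riemann {U : Set ℂ} {a : ℂ} (hU : IsOpen U) (pU : IsPreconnected U) (bU : Bornology.IsBounded U)
    (ha : a ∈ U) (hlog : ∀ h : ℂ → ℂ, ContinuousOn h U → (∀ z ∈ U, h z ≠ 0) → HasLog h U) :
    ∃ ψ f : ℂ → ℂ, DifferentiableOn ℂ ψ (ball 0 1) ∧ ContinuousOn f U ∧ MapsTo ψ (ball 0 1) U ∧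
      MapsTo f U (ball 0 1) ∧ (∀ z ∈ ball (0 : ℂ) 1, f (ψ z) = z) ∧ ∀ w ∈ U, ψ (f w) = w := by
  have hsup : BddAbove {x : ℝ | ∃ f, Adm U a f ∧ x = ‖deriv f a‖} := by
    obtain ⟨r, hr, hrU⟩ := Metric.isOpen_iff.1 hU a ha
    refine ⟨1 / r, ?_⟩
    rintro _ ⟨f, hf, rfl⟩
    refine Complex.norm_deriv_le_div_of_mapsTo_ball (hf.diff.mono hrU) ?_ hr
    intro z hz
    rw [hf.zero]
    exact ball_subset_closedBall (hf.maps (hrU hz))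
  obtain ⟨f0, hf0⟩ : ∃ f0, Adm U a f0 := by
    obtain ⟨R, hR⟩ := bU.subset_ball a
    have hRp : 0 < R := by
      by_contra h
      have := hR ha
      rw [ball_eq_empty.2 (not_lt.1 h)] at this
      exact this
    have hRc : (R : ℂ) ≠ 0 := by exact_mod_cast hRp.ne'
    have hd : ∀ z, HasDerivAt (fun z : ℂ => (z - a) / R) (1 / R) z := fun z =>
      ((hasDerivAt_id z).sub_const a).div_const _
    refine ⟨fun z => (z - a) / R, fun z _ => (hd z).differentiableAt.differentiableWithinAt, fun z hz => ?_,
      fun x _ y _ h => ?_, fun z _ => ?_, by simp⟩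
    · have := hR hz
      rw [mem_ball, dist_eq_norm] at this
      rw [mem_ball_zero_iff, norm_div, Complex.norm_real, Real.norm_of_nonneg hRp.le, div_lt_one hRp]
      exact this
    · beta_reduce at h
      field_simp at h
      linear_combination h
    · rw [(hd z).deriv]; exact one_div_ne_zero hRc
  have hne : {x : ℝ | ∃ f, Adm U a f ∧ x = ‖deriv f a‖}.Nonempty := ⟨_, f0, hf0, rfl⟩
  obtain ⟨x, -, hx, hxm⟩ := exists_seq_tendsto_sSup hne hsup
  choose f hf hfx using hxm
  let 𝒰 : Ultrafilter ℕ := hyperfilter ℕ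
  have h𝒰 : (𝒰 : Filter ℕ) ≤ atTop := Nat.hyperfilter_le_atTop
  obtain ⟨g, hg, hg1⟩ := montel hU (fun i => (hf i).diff) (fun i => (hf i).maps) 𝒰
  have hgd : DifferentiableOn ℂ g U := hg.differentiableOn (Eventually.of_forall fun i => (hf i).diff) hU
  have hgder := hg.deriv (Eventually.of_forall fun i => (hf i).diff) hU
  have hga : ‖deriv g a‖ = sSup {x : ℝ | ∃ f, Adm U a f ∧ x = ‖deriv f a‖} := by
    have h1 := (hgder.tendsto_at ha).norm
    have h2 := hx.mono_left h𝒰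
    refine tendsto_nhds_unique h1 (h2.congr fun i => ?_)
    rw [hfx i]; rfl
  have hgpos : deriv g a ≠ 0 := by
    rw [← norm_pos_iff, hga]
    exact (norm_pos_iff.2 (hf0.der a ha)).trans_le (le_csSup hsup ⟨f0, hf0, rfl⟩)
  have g0 : g a = 0 := by
    refine tendsto_nhds_unique (hg.tendsto_at ha) (tendsto_const_nhds.congr fun i => ((hf i).zero).symm)
  have hderd : ∀ i, DifferentiableOn ℂ (deriv (f i)) U := fun i => (hf i).diff.deriv hU
  have hgA : Adm U a g := by
    refine ⟨hgd, fun z hz => ?_, ?_, ?_, g0⟩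
    · rw [mem_ball_zero_iff]
      refine (hg1 z hz).lt_of_ne fun h => ?_
      have := Complex.norm_eqOn_of_isPreconnected_of_isMaxOn pU hU hgd hz (fun y hy => by
        change ‖g y‖ ≤ ‖g z‖; rw [h]; exact hg1 y hy) ha
      simp [g0, h] at this
    · intro z1 hz1 z2 hz2 h12
      by_contra hne12
      have hconst := hurwitz (p := (𝒰 : Filter ℕ)) (G := fun i z => f i z - f i z1) (g := fun z => g z - g z1) hU pU
        (fun i => (hf i).diff.sub_const _) (by
          have h1 : TendstoLocallyUniformlyOn (fun (i : ℕ) (_ : ℂ) => f i z1) (fun _ => g z1) (𝒰 : Filter ℕ) U := by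
            rw [Metric.tendstoLocallyUniformlyOn_iff]
            intro ε hε z hz
            refine ⟨univ, univ_mem, ?_⟩
            filter_upwards [Metric.tendsto_nhds.1 (hg.tendsto_at hz1) ε hε] with i hi y _
            rw [dist_comm]; exact hi
          rw [Metric.tendstoLocallyUniformlyOn_iff] at h1 hg ⊢
          intro ε hε z hz
          obtain ⟨t, ht, e1⟩ := hg (ε / 2) (by linarith) z hz
          obtain ⟨t', ht', e2⟩ := h1 (ε / 2) (by linarith) z hz
          refine ⟨t ∩ t', inter_mem ht ht', ?_⟩
          filter_upwards [e1, e2] with i h1 h2 y hy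
          have h3 := h1 y hy.1
          have h4 := h2 y hy.2
          rw [dist_eq_norm] at h3 h4 ⊢
          calc ‖g y - g z1 - (f i y - f i z1)‖ = ‖(g y - f i y) - (g z1 - f i z1)‖ := by congr 1; ring
            _ ≤ _ := norm_sub_le _ _
            _ < ε := by linarith)
        hz2 (by simp [h12]) (r := dist z2 z1) (dist_pos.2 (Ne.symm hne12)) (by
          rintro i z ⟨hz, hzU⟩ h
          have : z = z1 := (hf i).inj hzU hz1 (sub_eq_zero.1 h)
          subst this
          rw [mem_ball, dist_comm] at hz
          exact lt_irrefl _ hz)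
      apply hgpos
      have : g =ᶠ[𝓝 a] fun _ => g z1 := by
        filter_upwards [hU.mem_nhds ha] with y hy
        exact sub_eq_zero.1 (hconst y hy)
      rw [this.deriv_eq]; simp
    · intro z hz h
      exact hgpos (hurwitz hU pU hderd hgder hz h one_pos (fun i y hy => (hf i).der y hy.2) a ha)
  have hsurj : ∀ w ∈ ball (0 : ℂ) 1, ∃ z ∈ U, g z = w := by
    intro w hw
    by_contra hcon
    push Not at hcon
    obtain ⟨F, hF, hlt⟩ := hgA.improve hU ha hlog (by simpa using hw) hcon
    rw [hga] at hlt
    exact absurd (le_csSup hsup ⟨F, hF, rfl⟩) (not_le.2 hlt)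
  choose! ψ hψU hψ using hsurj
  have hψg : ∀ w ∈ U, ψ (g w) = w := fun w hw =>
    hgA.inj (hψU _ (hgA.maps hw)) hw (hψ _ (hgA.maps hw))
  have hstr : ∀ z ∈ U, HasStrictDerivAt g (deriv g z) z := fun z hz =>
    ((hgd.analyticOnNhd hU) z hz).hasStrictDerivAt
  have hψc : ∀ z ∈ ball (0 : ℂ) 1, ContinuousAt ψ z := by
    intro z hz
    change Tendsto ψ (𝓝 z) (𝓝 (ψ z))
    rw [tendsto_def]
    intro W hW
    have h1 : g '' (W ∩ U) ∈ 𝓝 (g (ψ z)) := by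
      rw [← (hstr _ (hψU z hz)).map_nhds_eq (hgA.der _ (hψU z hz))]
      exact Filter.image_mem_map (inter_mem hW (hU.mem_nhds (hψU z hz)))
    rw [hψ z hz] at h1
    filter_upwards [h1]
    rintro _ ⟨y, ⟨hy1, hy2⟩, rfl⟩
    rw [mem_preimage, hψg y hy2]; exact hy1
  refine ⟨ψ, g, fun z hz => ?_, hgd.continuousOn, hψU, hgA.maps, hψ, hψg⟩
  exact (HasDerivAt.of_local_left_inverse (f := g) (hψc z hz) (hstr _ (hψU z hz)).hasDerivAt
    (hgA.der _ (hψU z hz)) (by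
      filter_upwards [isOpen_ball.mem_nhds hz] with y hy using hψ y hy)).differentiableAt.differentiableWithinAt

/-- the complement of `U` is connected if its boundary lies in a connected subset of it -/
lemma compl_preconn {U Y : Set ℂ} (hU : IsOpen U) (nU : U.Nonempty) (hY : IsPreconnected Y)
    (h1 : frontier U ⊆ Y) (h2 : Y ⊆ Uᶜ) : IsPreconnected Uᶜ := by
  have key : ∀ t t' : Set ℂ, IsClosed t → IsClosed t' → Uᶜ ⊆ t ∪ t' → (Uᶜ ∩ t').Nonempty →
      Y ⊆ t → (Uᶜ ∩ (t ∩ t')).Nonempty := by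
    intro t t' ht ht' hsub hne hYt
    by_contra hcon
    rw [not_nonempty_iff_eq_empty, eq_empty_iff_forall_notMem] at hcon
    have e : Uᶜ ∩ t' = (closure U)ᶜ ∩ tᶜ := by
      ext z
      constructor
      · rintro ⟨hz, hz'⟩
        have hzt : z ∉ t := fun h => hcon z ⟨hz, h, hz'⟩
        refine ⟨fun hcl => hzt (hYt (h1 ?_)), hzt⟩
        rw [hU.frontier_eq]
        exact ⟨hcl, hz⟩
      · rintro ⟨hz, hz'⟩
        have : z ∈ Uᶜ := fun h => hz (subset_closure h)
        exact ⟨this, (hsub this).resolve_left hz'⟩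
    have hclopen : IsClopen (Uᶜ ∩ t') := by
      refine ⟨hU.isClosed_compl.inter ht', ?_⟩
      rw [e]
      exact isClosed_closure.isOpen_compl.inter ht.isOpen_compl
    have := hclopen.eq_univ hne
    obtain ⟨u, hu⟩ := nU
    have : u ∈ Uᶜ ∩ t' := by rw [this]; trivial
    exact this.1 hu
  rw [isPreconnected_closed_iff]
  intro t t' ht ht' hsub hne hne'
  by_cases hYt : Y ⊆ t
  · exact key t t' ht ht' hsub hne' hYt
  by_cases hYt' : Y ⊆ t'
  · have := key t' t ht' ht (by rwa [union_comm]) hne hYt'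
    rwa [inter_comm t t']
  obtain ⟨y, hy, hyt⟩ := not_subset.1 hYt
  obtain ⟨y', hy', hyt'⟩ := not_subset.1 hYt'
  have := isPreconnected_closed_iff.1 hY t t' ht ht' (h2.trans hsub)
    ⟨y', hy', (hsub (h2 hy')).resolve_right hyt'⟩ ⟨y, hy, (hsub (h2 hy)).resolve_left hyt⟩
  exact this.mono (inter_subset_inter_left _ h2)

lemma logs_compact {U K : Set ℂ} (hU : IsOpen U) (bU : Bornology.IsBounded U)
    (cU : IsPreconnected Uᶜ) (hK : IsCompact K) (hKU : K ⊆ U) {h : ℂ → ℂ}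
    (hc : ContinuousOn h U) (h0 : ∀ z ∈ U, h z ≠ 0) : HasLog h K := by
  obtain ⟨p, hp⟩ : (Uᶜ).Nonempty := by
    rw [nonempty_compl]
    rintro rfl
    exact NormedSpace.unbounded_univ ℝ ℂ bU
  have hsub : Uᶜ ⊆ Kᶜ := compl_subset_compl.2 hKU
  set V := connectedComponentIn Kᶜ p with hV
  have hVU : Uᶜ ⊆ V := cU.subset_connectedComponentIn hp hsub
  have hVo : IsOpen V := hK.isClosed.isOpen_compl.connectedComponentIn
  have hKV : K ⊆ Vᶜ := by
    intro z hz hzV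
    exact connectedComponentIn_subset _ _ hzV hz
  have hVc : Vᶜ ⊆ U := by rw [compl_subset_comm]; exact hVU
  have hcpt : IsCompact Vᶜ := isCompact_of_isClosed_isBounded hVo.isClosed_compl (bU.subset hVc)
  refine (hasLog_of_no_bounded hcpt ?_ (hc.mono hVc) fun z hz => h0 z (hVc hz)).mono hKV
  intro x hx hb
  rw [compl_compl] at hb
  have hxV : x ∈ V := by simpa using hx
  have : V ⊆ connectedComponentIn V x := isPreconnected_connectedComponentIn.subset_connectedComponentIn hxV subset_rfl
  have hb2 : Bornology.IsBounded Uᶜ := hb.subset (hVU.trans this)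
  have : Bornology.IsBounded (univ : Set ℂ) := by
    rw [← union_compl_self U]
    exact bU.union hb2
  exact NormedSpace.unbounded_univ ℝ ℂ this

lemma logs_open {U : Set ℂ} (hU : IsOpen U) (pU : IsPreconnected U) (bU : Bornology.IsBounded U)
    (cU : IsPreconnected Uᶜ) {h : ℂ → ℂ}
    (hc : ContinuousOn h U) (h0 : ∀ z ∈ U, h z ≠ 0) : HasLog h U := by
  rcases U.eq_empty_or_nonempty with rfl | ⟨a, ha⟩
  · exact ⟨fun _ => 0, continuousOn_empty _, by simp⟩
  have hpath : IsPathConnected U := hU.isConnected_iff_isPathConnected.1 ⟨⟨a, ha⟩, pU⟩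
  have hKz : ∀ z ∈ U, ∃ K, IsCompact K ∧ IsPreconnected K ∧ K ⊆ U ∧ a ∈ K ∧ z ∈ K := by
    intro z hz
    obtain ⟨γ, hγ⟩ := hpath.joinedIn a ha z hz
    refine ⟨range γ, isCompact_range γ.continuous, isPreconnected_range γ.continuous, ?_,
      ⟨0, γ.source⟩, ⟨1, γ.target⟩⟩
    rintro _ ⟨t, rfl⟩
    exact hγ t
  have hlog : ∀ K, IsCompact K → a ∈ K → K ⊆ U → ∃ l : ℂ → ℂ, ContinuousOn l K ∧
      (∀ x ∈ K, h x = Complex.exp (l x)) ∧ l a = Complex.log (h a) := by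
    intro K hK haK hKU
    obtain ⟨l, lc, le⟩ := logs_compact hU bU cU hK hKU hc h0
    refine ⟨fun z => l z + (Complex.log (h a) - l a), lc.add continuousOn_const, ?_, by ring⟩
    intro x hx
    rw [Complex.exp_add, Complex.exp_sub, Complex.exp_log (h0 a ha), ← le a haK,
      div_self (h0 a ha), mul_one, le x hx]
  have huniq : ∀ K, IsPreconnected K → a ∈ K → ∀ l l' : ℂ → ℂ, ContinuousOn l K → ContinuousOn l' K →
      (∀ x ∈ K, h x = Complex.exp (l x)) → (∀ x ∈ K, h x = Complex.exp (l' x)) →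
      l a = l' a → ∀ x ∈ K, l x = l' x := by
    intro K pK haK l l' lc lc' le le' haa x hx
    obtain ⟨n, hn⟩ := log_diff_const pK lc lc' fun x hx => by rw [← le x hx, ← le' x hx]
    have h1 := hn a haK
    rw [haa] at h1
    have h2 : (n : ℂ) * (2 * Real.pi * Complex.I) = 0 := by linear_combination -h1
    rw [hn x hx, h2, add_zero]
  choose! K cK pK sK aK zK using hKz
  choose! l lc le la using hlog
  have main : ∀ z ∈ U, ∀ K', IsCompact K' → IsPreconnected K' → a ∈ K' → z ∈ K' → K' ⊆ U →
      ∀ x ∈ K', x ∈ U → l (K x) x = l K' x := by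
    intro z hz K' cK' pK' aK' zK' sK' x hx hxU
    have c2 := (cK x hxU).union cK'
    have s2 := union_subset (sK x hxU) sK'
    have a2 : a ∈ K x ∪ K' := Or.inr aK'
    have e1 := huniq (K x) (pK x hxU) (aK x hxU) _ _ (lc _ (cK x hxU) (aK x hxU) (sK x hxU))
      ((lc _ c2 a2 s2).mono subset_union_left) (le _ (cK x hxU) (aK x hxU) (sK x hxU))
      (fun y hy => le _ c2 a2 s2 y (Or.inl hy))
      (by rw [la _ (cK x hxU) (aK x hxU) (sK x hxU), la _ c2 a2 s2]) x (zK x hxU)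
    have e2 := huniq K' pK' aK' _ _ (lc _ cK' aK' sK')
      ((lc _ c2 a2 s2).mono subset_union_right) (le _ cK' aK' sK')
      (fun y hy => le _ c2 a2 s2 y (Or.inr hy))
      (by rw [la _ cK' aK' sK', la _ c2 a2 s2]) x hx
    rw [e1, e2]
  refine ⟨fun z => l (K z) z, ?_, fun x hx => le _ (cK x hx) (aK x hx) (sK x hx) x (zK x hx)⟩
  intro z hz
  obtain ⟨r, hr, hrU⟩ := Metric.nhds_basis_closedBall.mem_iff.1 (hU.mem_nhds hz)
  have c2 := (cK z hz).union (isCompact_closedBall z r)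
  have s2 := union_subset (sK z hz) hrU
  have p2 : IsPreconnected (K z ∪ closedBall z r) :=
    IsPreconnected.union z (zK z hz) (mem_closedBall_self hr.le) (pK z hz)
      (convex_closedBall z r).isPreconnected
  have a2 : a ∈ K z ∪ closedBall z r := Or.inl (aK z hz)
  have h1 : ContinuousAt (l (K z ∪ closedBall z r)) z :=
    (lc _ c2 a2 s2).continuousAt (mem_of_superset (closedBall_mem_nhds z hr) subset_union_right)
  refine (h1.congr ?_).continuousWithinAt
  filter_upwards [closedBall_mem_nhds z hr] with x hx
  exact (main z hz _ c2 p2 a2 (Or.inl (zK z hz)) s2 x (Or.inr hx) (hrU hx)).symm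

lemma ball_exp {s θ : ℝ} : Complex.exp (s + θ * Complex.I) ∈ ball (1 : ℂ) 1 ↔
    Real.exp s < 2 * Real.cos θ := by
  have hs := Real.exp_pos s
  have hsq := Real.sin_sq_add_cos_sq θ
  have e : ‖Complex.exp (s + θ * Complex.I) - 1‖ ^ 2 =
      Real.exp s ^ 2 - 2 * Real.exp s * Real.cos θ + 1 := by
    rw [← Complex.normSq_eq_norm_sq, Complex.normSq_apply]
    have h1 : (Complex.exp (s + θ * Complex.I) - 1).re = Real.exp s * Real.cos θ - 1 := by
      simp [Complex.exp_re]
    have h2 : (Complex.exp (s + θ * Complex.I) - 1).im = Real.exp s * Real.sin θ := by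
      simp [Complex.exp_im]
    rw [h1, h2]
    linear_combination Real.exp s ^ 2 * hsq
  rw [mem_ball, dist_eq_norm]
  rw [← sq_lt_one_iff₀ (norm_nonneg _), e]
  constructor
  · intro h
    nlinarith
  · intro h
    nlinarith

lemma cos_between {a b t : ℝ} {c : ℝ} (ha : -Real.pi < a) (hb : b < Real.pi) (hat : a ≤ t) (htb : t ≤ b)
    (h1 : c < Real.cos a) (h2 : c < Real.cos b) : c < Real.cos t := by
  rcases le_total 0 t with h | h
  · exact h2.trans_le (Real.cos_le_cos_of_nonneg_of_le_pi h hb.le htb)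
  · rw [← Real.cos_neg t]
    rw [← Real.cos_neg a] at h1
    exact h1.trans_le (Real.cos_le_cos_of_nonneg_of_le_pi (by linarith) (by linarith) (by linarith))

/-- the one dimensional estimate -/
lemma line_estimate {Φ : ℂ → ℂ} {Ω : Set ℂ} (hΩ : IsOpen Ω) (hΦ : DifferentiableOn ℂ Φ Ω) {s a b η : ℝ}
    (hη : 0 < η) (hab : a ≤ b) (hl : b - a ≤ 2 * Real.pi)
    (hseg : ∀ t ∈ Icc a b, (s + t * Complex.I : ℂ) ∈ Ω)
    (hd : η ≤ ‖Φ (s + b * Complex.I) - Φ (s + a * Complex.I)‖) :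
    η ^ 2 / (2 * Real.pi) ≤ ∫ t in a..b, ‖deriv Φ (s + t * Complex.I)‖ ^ 2 := by
  have hpi := Real.pi_pos
  have hcont : ContinuousOn (fun t : ℝ => deriv Φ (s + t * Complex.I)) (Icc a b) := by
    refine (hΦ.deriv hΩ).continuousOn.comp (Continuous.continuousOn (by fun_prop)) hseg
  rw [← uIcc_of_le hab] at hcont
  have hder : ∀ t ∈ uIcc a b, HasDerivAt (fun t : ℝ => Φ (s + t * Complex.I))
      (deriv Φ (s + t * Complex.I) * Complex.I) t := by
    intro t ht
    rw [uIcc_of_le hab] at ht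
    have h1 : HasDerivAt Φ (deriv Φ (s + t * Complex.I)) (s + t * Complex.I) :=
      ((hΦ _ (hseg t ht)).differentiableAt (hΩ.mem_nhds (hseg t ht))).hasDerivAt
    have h2 : HasDerivAt (fun t : ℂ => s + t * Complex.I) Complex.I (t : ℂ) := by
      have := ((hasDerivAt_id (t : ℂ)).mul_const Complex.I).const_add (s : ℂ)
      simpa using this
    exact (HasDerivAt.comp (t : ℂ) h1 h2).comp_ofReal
  have hinI : IntervalIntegrable (fun t : ℝ => deriv Φ (s + t * Complex.I) * Complex.I)
      MeasureTheory.volume a b := (hcont.mul continuousOn_const).intervalIntegrable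
  have hft := intervalIntegral.integral_eq_sub_of_hasDerivAt hder hinI
  have hn1 : IntervalIntegrable (fun t : ℝ => ‖deriv Φ (s + t * Complex.I)‖)
      MeasureTheory.volume a b := hcont.norm.intervalIntegrable
  have hn2 : IntervalIntegrable (fun t : ℝ => ‖deriv Φ (s + t * Complex.I)‖ ^ 2)
      MeasureTheory.volume a b := (hcont.norm.pow 2).intervalIntegrable
  have h1 : η ≤ ∫ t in a..b, ‖deriv Φ (s + t * Complex.I)‖ := by
    refine hd.trans ?_
    rw [← hft]
    refine (intervalIntegral.norm_integral_le_integral_norm hab).trans_eq ?_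
    refine intervalIntegral.integral_congr fun t _ => ?_
    simp
  have h2 : ∫ t in a..b, ‖deriv Φ (s + t * Complex.I)‖ ≤
      ∫ t in a..b, ((Real.pi / η) * ‖deriv Φ (s + t * Complex.I)‖ ^ 2 + η / (4 * Real.pi)) := by
    refine intervalIntegral.integral_mono_on hab hn1 ((hn2.const_mul _).add (by simp)) fun t _ => ?_
    set x := ‖deriv Φ (s + t * Complex.I)‖
    have : (Real.pi / η) * x ^ 2 + η / (4 * Real.pi) - x =
      (Real.pi / η) * (x - η / (2 * Real.pi)) ^ 2 := by
      field_simp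
      ring
    have h3 : 0 ≤ (Real.pi / η) * (x - η / (2 * Real.pi)) ^ 2 := by positivity
    linarith
  rw [intervalIntegral.integral_add (hn2.const_mul _) (by simp), intervalIntegral.integral_const_mul,
    intervalIntegral.integral_const, smul_eq_mul] at h2
  set J := ∫ t in a..b, ‖deriv Φ (s + t * Complex.I)‖ ^ 2
  have h4 : (b - a) * (η / (4 * Real.pi)) ≤ η / 2 := by
    calc (b - a) * (η / (4 * Real.pi)) ≤ 2 * Real.pi * (η / (4 * Real.pi)) := by gcongr
      _ = η / 2 := by field_simp; ring
  have h5 : η / 2 ≤ Real.pi / η * J := by linarith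
  rw [div_le_iff₀ (by positivity)]
  have h6 : η / 2 * (2 * η) ≤ Real.pi / η * J * (2 * η) := by gcongr
  have h7 : Real.pi / η * J * (2 * η) = J * (2 * Real.pi) := by field_simp
  nlinarith

open MeasureTheory in
lemma area_formula {Φ : ℂ → ℂ} {Ω : Set ℂ} (hΩ : IsOpen Ω) (hΦ : DifferentiableOn ℂ Φ Ω)
    (hi : InjOn Φ Ω) :
    ∫⁻ s : ℝ, ∫⁻ t : ℝ, Ω.indicator (fun z => ENNReal.ofReal (‖deriv Φ z‖ ^ 2)) (s + t * Complex.I) =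
      volume (Φ '' Ω) := by
  have h1 : ∀ z ∈ Ω, HasFDerivWithinAt Φ (deriv Φ z • (1 : ℂ →L[ℝ] ℂ)) Ω z := by
    intro z hz
    exact (((hΦ z hz).differentiableAt (hΩ.mem_nhds hz)).hasDerivAt.complexToReal_fderiv).hasFDerivWithinAt
  rw [← lintegral_abs_det_fderiv_eq_addHaar_image volume hΩ.measurableSet h1 hi]
  have hdet : ∀ z : ℂ, |(z • (1 : ℂ →L[ℝ] ℂ)).det| = ‖z‖ ^ 2 := by
    intro z
    have : (z • (1 : ℂ →L[ℝ] ℂ)).det = Algebra.norm ℝ z := by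
      rw [Algebra.norm_apply]
      rfl
    rw [this, Algebra.norm_complex_apply, Complex.normSq_eq_norm_sq, abs_of_nonneg (by positivity)]
  simp_rw [hdet]
  rw [← lintegral_indicator hΩ.measurableSet]
  have hm : Measurable (Ω.indicator (fun z => ENNReal.ofReal (‖deriv Φ z‖ ^ 2))) :=
    (((measurable_deriv Φ).norm.pow_const 2).ennreal_ofReal).indicator hΩ.measurableSet
  rw [← (Complex.volume_preserving_equiv_real_prod.symm).lintegral_comp_emb
    Complex.measurableEquivRealProd.symm.measurableEmbedding]
  rw [Measure.volume_eq_prod, lintegral_prod]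
  · refine lintegral_congr fun s => lintegral_congr fun t => ?_
    congr 1
    apply Complex.ext <;> simp [Complex.measurableEquivRealProd]
  · exact (hm.comp Complex.measurableEquivRealProd.symm.measurable).aemeasurable

open MeasureTheory in
lemma length_area {Ψ : ℂ → ℂ} (hΨ : DifferentiableOn ℂ Ψ (ball 1 1)) (hi : InjOn Ψ (ball 1 1))
    (bd : Bornology.IsBounded (Ψ '' ball 1 1)) {ρ η : ℝ} (hρ : 0 < ρ) (hη : 0 < η) :
    ∃ r, 0 < r ∧ r < ρ ∧ ∀ w ∈ ball (1 : ℂ) 1, ∀ w' ∈ ball (1 : ℂ) 1, ‖w‖ = r → ‖w'‖ = r →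
      ‖Ψ w - Ψ w'‖ ≤ η := by
  by_contra hcon
  push Not at hcon
  have hpi := Real.pi_pos
  set Ω : Set ℂ := {u | u.im ∈ Ioo (-Real.pi) Real.pi} ∩ Complex.exp ⁻¹' (ball 1 1) with hΩd
  have hΩ : IsOpen Ω := (isOpen_Ioo.preimage Complex.continuous_im).inter
    (isOpen_ball.preimage Complex.continuous_exp)
  have hΦ : DifferentiableOn ℂ (fun u => Ψ (Complex.exp u)) Ω :=
    hΨ.comp Complex.differentiable_exp.differentiableOn fun u hu => hu.2
  have hinj : InjOn (fun u => Ψ (Complex.exp u)) Ω := by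
    intro u hu v hv huv
    have h1 := hi hu.2 hv.2 huv
    exact Complex.exp_inj_of_neg_pi_lt_of_le_pi hu.1.1 hu.1.2.le hv.1.1 hv.1.2.le h1
  have harea := area_formula hΩ hΦ hinj
  have hfin : volume ((fun u => Ψ (Complex.exp u)) '' Ω) < ⊤ := by
    refine (bd.subset ?_).measure_lt_top
    rintro _ ⟨u, hu, rfl⟩
    exact ⟨_, hu.2, rfl⟩
  have hlow : ∀ s : ℝ, s < Real.log ρ → ENNReal.ofReal (η ^ 2 / (2 * Real.pi)) ≤
      ∫⁻ t : ℝ, Ω.indicator (fun z => ENNReal.ofReal (‖deriv (fun u => Ψ (Complex.exp u)) z‖ ^ 2))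
        (s + t * Complex.I) := by
    intro s hs
    have hes : Real.exp s < ρ := by rwa [← Real.lt_log_iff_exp_lt hρ]
    obtain ⟨w, hw, w', hw', hwr, hwr', hd⟩ := hcon _ (Real.exp_pos s) hes
    have hrep : ∀ w ∈ ball (1 : ℂ) 1, ‖w‖ = Real.exp s →
        ∃ t : ℝ, -Real.pi < t ∧ t < Real.pi ∧ w = Complex.exp (s + t * Complex.I) := by
      intro w hw hwr
      have hre : 0 < w.re := by
        have h1 := Complex.abs_re_le_norm (w - 1)
        rw [mem_ball, dist_eq_norm] at hw
        have := abs_lt.1 (h1.trans_lt hw)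
        simp at this
        linarith [this.1]
      refine ⟨w.arg, Complex.neg_pi_lt_arg w, ?_, ?_⟩
      · refine lt_of_le_of_ne (Complex.arg_le_pi w) fun h => ?_
        rw [Complex.arg_eq_pi_iff] at h
        linarith [h.1]
      · rw [Complex.exp_add, ← Complex.ofReal_exp, ← hwr, Complex.norm_mul_exp_arg_mul_I]
    obtain ⟨a, ha, ha', rfl⟩ := hrep w hw hwr
    obtain ⟨b, hb, hb', rfl⟩ := hrep w' hw' hwr'
    clear hrep hwr hwr'
    rw [ball_exp] at hw hw'
    wlog hab : a ≤ b generalizing a b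
    · exact this b hb hb' hw' a ha ha' hw (by rwa [norm_sub_rev]) (le_of_not_ge hab)
    have hseg : ∀ t ∈ Icc a b, (s + t * Complex.I : ℂ) ∈ Ω := by
      intro t ht
      refine ⟨?_, ?_⟩
      · have : (s + t * Complex.I : ℂ).im = t := by simp
        change (s + t * Complex.I : ℂ).im ∈ Ioo (-Real.pi) Real.pi
        rw [this]
        exact ⟨ha.trans_le ht.1, ht.2.trans_lt hb'⟩
      · change Complex.exp (s + t * Complex.I : ℂ) ∈ ball (1:ℂ) 1
        rw [ball_exp]
        have := cos_between (c := Real.exp s / 2) ha hb' ht.1 ht.2 (by linarith) (by linarith)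
        linarith
    have h1 := line_estimate hΩ hΦ hη hab (by linarith) hseg
      (by rw [norm_sub_rev]; exact hd.le)
    rw [intervalIntegral.integral_of_le hab] at h1
    refine (ENNReal.ofReal_le_ofReal h1).trans ?_
    have hcont : ContinuousOn (fun t : ℝ => deriv (fun u => Ψ (Complex.exp u)) (s + t * Complex.I)) (Icc a b) :=
      (hΦ.deriv hΩ).continuousOn.comp (Continuous.continuousOn (by fun_prop)) hseg
    rw [ofReal_integral_eq_lintegral_ofReal]
    · rw [← lintegral_indicator measurableSet_Ioc]
      refine lintegral_mono fun t => ?_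
      by_cases ht : t ∈ Ioc a b
      · rw [indicator_of_mem ht, indicator_of_mem (hseg t ⟨ht.1.le, ht.2⟩)]
      · rw [indicator_of_notMem ht]
        exact zero_le
    · exact ((hcont.norm.pow 2).integrableOn_Icc).mono_set Ioc_subset_Icc_self
    · exact Eventually.of_forall fun t => by positivity
  have : ∫⁻ s in Iio (Real.log ρ), ENNReal.ofReal (η ^ 2 / (2 * Real.pi)) ≤
      volume ((fun u => Ψ (Complex.exp u)) '' Ω) := by
    rw [← harea]
    rw [← lintegral_indicator measurableSet_Iio]
    refine lintegral_mono fun s => ?_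
    by_cases hs : s ∈ Iio (Real.log ρ)
    · rw [indicator_of_mem hs]
      exact hlow s hs
    · rw [indicator_of_notMem hs]
      exact zero_le
  rw [setLIntegral_const, Real.volume_Iio, ENNReal.mul_top] at this
  · exact absurd hfin (not_lt.2 this)
  · rw [ne_eq, ENNReal.ofReal_eq_zero, not_le]
    positivity

/-- hypotheses for the boundary extension theorem -/
structure CarH (U Y : Set ℂ) : Prop where
  oU : IsOpen U
  pU : IsPreconnected U
  nU : U.Nonempty
  bU : Bornology.IsBounded U
  cY : IsCompact Y
  pY : IsPreconnected Y
  fr : frontier U ⊆ Y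
  sub : Y ⊆ Uᶜ
  lc : ∀ a ∈ Y, ∀ ε > 0, ∃ η > 0, ∃ Λ ⊆ Y, IsCompact Λ ∧ IsPreconnected Λ ∧
    Y ∩ closedBall a η ⊆ Λ ∧ Λ ⊆ closedBall a ε

structure RMap (U : Set ℂ) (ψ f : ℂ → ℂ) : Prop where
  dif : DifferentiableOn ℂ ψ (ball 0 1)
  fc : ContinuousOn f U
  m1 : MapsTo ψ (ball 0 1) U
  m2 : MapsTo f U (ball 0 1)
  left : ∀ z ∈ ball (0 : ℂ) 1, f (ψ z) = z
  right : ∀ w ∈ U, ψ (f w) = w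

lemma CarH.exists_rmap {U Y : Set ℂ} (H : CarH U Y) : ∃ ψ f, RMap U ψ f := by
  obtain ⟨a, ha⟩ := H.nU
  have cU := compl_preconn H.oU H.nU H.pY H.fr H.sub
  obtain ⟨ψ, f, h1, h2, h3, h4, h5, h6⟩ := riemann H.oU H.pU H.bU ha
    fun h hc h0 => logs_open H.oU H.pU H.bU cU hc h0
  exact ⟨ψ, f, h1, h2, h3, h4, h5, h6⟩

lemma isPreconnected_far' (a : ℂ) {R : ℝ} (hR : 0 < R) : IsPreconnected (closedBall a R)ᶜ := by
  have : (closedBall a R)ᶜ = (fun z => z + a) '' {z : ℂ | R < ‖z‖} := by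
    ext z
    simp only [mem_compl_iff, mem_closedBall, not_le, mem_image, mem_setOf_eq, dist_eq_norm]
    constructor
    · intro h
      exact ⟨z - a, h, by ring⟩
    · rintro ⟨w, hw, rfl⟩
      simpa using hw
  rw [this]
  exact (isPreconnected_far hR).image _ (by fun_prop)

/-- sequences tending to the unit circle are mapped to sequences tending to the boundary -/
lemma RMap.not_mem {U : Set ℂ} {ψ f : ℂ → ℂ} (H : RMap U ψ f) (hU : IsOpen U) {ι : Type*} {l : Filter ι}
    [l.NeBot] {w : ι → ℂ} {ζ a : ℂ} (hζ : ‖ζ‖ = 1) (hw : ∀ᶠ i in l, w i ∈ ball (0 : ℂ) 1)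
    (hwl : Tendsto w l (𝓝 ζ)) (ha : Tendsto (fun i => ψ (w i)) l (𝓝 a)) : a ∉ U := by
  intro haU
  have h1 : Tendsto (fun i => f (ψ (w i))) l (𝓝 (f a)) :=
    ((H.fc.continuousAt (hU.mem_nhds haU)).tendsto).comp ha
  have h2 : Tendsto w l (𝓝 (f a)) := by
    refine h1.congr' ?_
    filter_upwards [hw] with i hi
    exact H.left _ hi
  have h3 := tendsto_nhds_unique hwl h2
  have h4 := H.m2 haU
  rw [← h3, mem_ball_zero_iff, hζ] at h4
  exact lt_irrefl _ h4

lemma RMap.circ {U : Set ℂ} {ψ f : ℂ → ℂ} (H : RMap U ψ f) (bU : Bornology.IsBounded U) {ζ : ℂ} (hζ : ‖ζ‖ = 1)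
    {η : ℝ} (hη : 0 < η) : ∃ r, 0 < r ∧ r < η ∧ ∀ w ∈ ball (0 : ℂ) 1, ∀ w' ∈ ball (0 : ℂ) 1,
      ‖w - ζ‖ = r → ‖w' - ζ‖ = r → ‖ψ w - ψ w'‖ ≤ η := by
  have hζ0 : ζ ≠ 0 := by rintro rfl; simp at hζ
  have hmaps : MapsTo (fun u : ℂ => ζ * (1 - u)) (ball 1 1) (ball 0 1) := by
    intro u hu
    rw [mem_ball, dist_eq_norm] at hu
    rw [mem_ball_zero_iff, norm_mul, hζ, one_mul, norm_sub_rev]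
    exact hu
  obtain ⟨r, hr, hrη, hr2⟩ := length_area (Ψ := fun u => ψ (ζ * (1 - u)))
    (H.dif.comp (Differentiable.differentiableOn (by fun_prop)) hmaps) (by
      intro u hu v hv huv
      have h1 := congrArg f huv
      beta_reduce at h1
      rw [H.left _ (hmaps hu), H.left _ (hmaps hv)] at h1
      have h2 := mul_left_cancel₀ hζ0 h1
      linear_combination -h2)
    (bU.subset (by
      rintro _ ⟨u, hu, rfl⟩
      exact H.m1 (hmaps hu))) hη hη
  refine ⟨r, hr, hrη, ?_⟩
  have key : ∀ w ∈ ball (0 : ℂ) 1, ‖w - ζ‖ = r → (1 - w / ζ) ∈ ball (1 : ℂ) 1 ∧ ‖1 - w / ζ‖ = r ∧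
      ζ * (1 - (1 - w / ζ)) = w := by
    intro w hw hwr
    refine ⟨?_, ?_, by field_simp; ring⟩
    · rw [mem_ball, dist_eq_norm]
      rw [mem_ball_zero_iff] at hw
      have : 1 - w / ζ - 1 = -(w / ζ) := by ring
      rw [this, norm_neg, norm_div, hζ, div_one]
      exact hw
    · have : 1 - w / ζ = -((w - ζ) / ζ) := by field_simp; ring
      rw [this, norm_neg, norm_div, hζ, div_one, hwr]
  intro w hw w' hw' hwr hwr'
  obtain ⟨h1, h2, h3⟩ := key w hw hwr
  obtain ⟨h1', h2', h3'⟩ := key w' hw' hwr'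
  have := hr2 _ h1 _ h1' h2 h2'
  rwa [h3, h3'] at this

lemma CarH.limit {U Y : Set ℂ} (H : CarH U Y) {ψ f : ℂ → ℂ} (R : RMap U ψ f) {ζ : ℂ} (hζ : ‖ζ‖ = 1) :
    ∃ a, Tendsto ψ (𝓝[ball 0 1] ζ) (𝓝 a) := by
  have hr : ∀ n : ℕ, ∃ r, 0 < r ∧ r < 1 / ((n : ℝ) + 1) ∧ ∀ w ∈ ball (0 : ℂ) 1, ∀ w' ∈ ball (0 : ℂ) 1,
      ‖w - ζ‖ = r → ‖w' - ζ‖ = r → ‖ψ w - ψ w'‖ ≤ 1 / ((n : ℝ) + 1) := fun n =>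
    R.circ H.bU hζ (by positivity)
  choose r r0 r1 r2 using hr
  have hn1 : ∀ n : ℕ, 1 / ((n : ℝ) + 1) ≤ 1 := fun n => by
    rw [div_le_one (by positivity)]
    have : (0 : ℝ) ≤ n := Nat.cast_nonneg n
    linarith
  have rlt : ∀ n, r n < 1 := fun n => (r1 n).trans_le (hn1 n)
  set w : ℕ → ℂ := fun n => (1 - (r n : ℂ)) * ζ with hw
  have hwb : ∀ n, w n ∈ ball (0 : ℂ) 1 := by
    intro n
    rw [mem_ball_zero_iff, hw]
    beta_reduce
    rw [norm_mul, hζ, mul_one]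
    have : (1 - (r n : ℂ)) = ((1 - r n : ℝ) : ℂ) := by push_cast; ring
    rw [this, Complex.norm_real, Real.norm_eq_abs, abs_of_nonneg (by linarith [rlt n])]
    linarith [r0 n]
  have hwr : ∀ n, ‖w n - ζ‖ = r n := by
    intro n
    have : w n - ζ = ((-r n : ℝ) : ℂ) * ζ := by
      rw [hw]; push_cast; ring
    rw [this, norm_mul, hζ, mul_one, Complex.norm_real, Real.norm_eq_abs, abs_neg, abs_of_pos (r0 n)]
  have hlim0 : Tendsto (fun n : ℕ => 1 / ((n : ℝ) + 1)) atTop (𝓝 0) := tendsto_one_div_add_atTop_nhds_zero_nat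
  have hrl : Tendsto r atTop (𝓝 0) :=
    squeeze_zero (fun n => (r0 n).le) (fun n => (r1 n).le) hlim0
  have hwl : Tendsto w atTop (𝓝 ζ) := by
    rw [tendsto_iff_norm_sub_tendsto_zero]
    exact hrl.congr fun n => (hwr n).symm
  have hcpt : IsCompact (closure U) := H.bU.isCompact_closure
  obtain ⟨a, ha, φ, φm, hφ⟩ := hcpt.tendsto_subseq (x := fun n => ψ (w n))
    fun n => subset_closure (R.m1 (hwb n))
  have haU : a ∉ U := R.not_mem H.oU (l := atTop) (w := w ∘ φ) hζ (Eventually.of_forall fun n => hwb _)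
    (hwl.comp φm.tendsto_atTop) hφ
  have haY : a ∈ Y := H.fr (by rw [H.oU.frontier_eq]; exact ⟨ha, haU⟩)
  have h0b : (0 : ℂ) ∈ ball (0 : ℂ) 1 := by simp
  have hd : 0 < dist (ψ 0) a := dist_pos.2 fun h => haU (h ▸ R.m1 h0b)
  refine ⟨a, ?_⟩
  rw [(Metric.nhds_basis_closedBall).tendsto_right_iff]
  intro ε' hε'
  obtain ⟨ε, hε, hεε', hεd⟩ : ∃ ε, 0 < ε ∧ ε ≤ ε' ∧ ε < dist (ψ 0) a :=
    ⟨min ε' (dist (ψ 0) a / 2), by positivity, min_le_left _ _, (min_le_right _ _).trans_lt (by linarith)⟩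
  obtain ⟨η, hη, Λ, ΛY, cΛ, pΛ, Λ1, Λ2⟩ := H.lc a haY ε hε
  obtain ⟨n, hn1, hn2⟩ : ∃ n, 1 / ((φ n : ℝ) + 1) < min η ε / 2 ∧ dist (ψ (w (φ n))) a < min η ε / 2 := by
    have h1 := (hlim0.comp φm.tendsto_atTop).eventually (gt_mem_nhds (show (0 : ℝ) < min η ε / 2 by positivity))
    have h2 := hφ.eventually (ball_mem_nhds a (show (0 : ℝ) < min η ε / 2 by positivity))
    obtain ⟨n, hn⟩ := (h1.and h2).exists
    exact ⟨n, hn.1, hn.2⟩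
  set N := φ n
  set C : Set ℂ := {u | u ∈ ball (0 : ℂ) 1 ∧ ‖u - ζ‖ = r N} with hC
  have hCcl : closure (ψ '' C) ⊆ closedBall a (min η ε) := by
    refine closure_minimal ?_ isClosed_closedBall
    rintro _ ⟨u, hu, rfl⟩
    have h1 := r2 N u hu.1 (w N) (hwb N) hu.2 (hwr N)
    rw [mem_closedBall]
    have h2 := dist_triangle (ψ u) (ψ (w N)) a
    rw [dist_eq_norm (ψ u) (ψ (w N))] at h2
    linarith
  have hK1 : IsCompact (closure (ψ '' C) ∪ Λ) :=
    ((isCompact_closedBall a _).of_isClosed_subset isClosed_closure hCcl).union cΛ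
  have hK1s : closure (ψ '' C) ∪ Λ ⊆ closedBall a ε :=
    union_subset (hCcl.trans (closedBall_subset_closedBall (min_le_right _ _))) Λ2
  have hinI : (closure (ψ '' C) ∪ Λ) ∩ Y = Λ := by
    ext z
    constructor
    · rintro ⟨h | h, hY⟩
      · exact Λ1 ⟨hY, closedBall_subset_closedBall (min_le_left _ _) (hCcl h)⟩
      · exact h
    · intro h
      exact ⟨Or.inr h, ΛY h⟩
  rw [eventually_iff_exists_mem]
  refine ⟨ball ζ (r N) ∩ ball 0 1, by rw [inter_comm]; exact inter_mem_nhdsWithin _ (ball_mem_nhds ζ (r0 N)), ?_⟩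
  rintro q ⟨hq1, hq2⟩
  refine closedBall_subset_closedBall hεε' ?_
  by_contra hq
  have n1 : NSep (closure (ψ '' C) ∪ Λ) (ψ 0) (ψ q) := by
    refine NSep.of_preconn (isPreconnected_far' a hε) (compl_subset_compl.2 hK1s) ?_ hq
    rw [mem_compl_iff, mem_closedBall, not_le]
    exact hεd
  have n2 : NSep Y (ψ 0) (ψ q) :=
    NSep.of_preconn H.pU (fun u hu hY => H.sub hY hu) (R.m1 h0b) (R.m1 hq2)
  have n3 := janiszewski hK1 H.cY (by rw [hinI]; exact pΛ) n1 n2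
  set V := connectedComponentIn ((closure (ψ '' C) ∪ Λ) ∪ Y)ᶜ (ψ 0) with hV
  have hV0 : ψ 0 ∈ V := mem_connectedComponentIn n3.left
  have hVU : V ⊆ U := by
    refine clopen_in H.oU isPreconnected_connectedComponentIn ⟨ψ 0, R.m1 h0b, hV0⟩ ?_
    rw [eq_empty_iff_forall_notMem]
    rintro z ⟨h1, h2⟩
    exact connectedComponentIn_subset _ _ h2 (Or.inr (H.fr h1))
  have hp : IsPreconnected ((fun v => ‖f v - ζ‖) '' V) :=
    isPreconnected_connectedComponentIn.image _ ((R.fc.mono hVU).sub continuousOn_const).norm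
  have hmem : r N ∈ (fun v => ‖f v - ζ‖) '' V := by
    refine hp.ordConnected.out ⟨ψ q, n3, rfl⟩ ⟨ψ 0, hV0, rfl⟩ ⟨?_, ?_⟩
    · beta_reduce
      rw [R.left q hq2, ← dist_eq_norm]
      exact (mem_ball.1 hq1).le
    · beta_reduce
      rw [R.left 0 h0b, zero_sub, norm_neg, hζ]
      exact (rlt N).le
  obtain ⟨v, hv, hvr⟩ := hmem
  refine connectedComponentIn_subset _ _ hv (Or.inl (Or.inl (subset_closure ⟨f v, ⟨R.m2 (hVU hv), hvr⟩, R.right v (hVU hv)⟩)))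

/-- the continuous extension -/
structure EMap (U : Set ℂ) (ψ : ℂ → ℂ) : Prop where
  dif : DifferentiableOn ℂ ψ (ball 0 1)
  con : ContinuousOn ψ (closedBall 0 1)
  inj : InjOn ψ (ball 0 1)
  im : ψ '' ball 0 1 = U
  fr : ψ '' sphere 0 1 = frontier U

lemma CarH.exists_emap {U Y : Set ℂ} (H : CarH U Y) : ∃ ψ, EMap U ψ := by
  obtain ⟨ψ, f, R⟩ := H.exists_rmap
  have hcl : closure (ball (0 : ℂ) 1) = closedBall 0 1 := closure_ball 0 one_ne_zero
  have hlim : ∀ x ∈ closedBall (0 : ℂ) 1, ∃ y, Tendsto ψ (𝓝[ball 0 1] x) (𝓝 y) := by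
    intro x hx
    rcases (mem_closedBall_zero_iff.1 hx).lt_or_eq with h | h
    · exact ⟨ψ x, R.dif.continuousOn x (mem_ball_zero_iff.2 h)⟩
    · exact H.limit R h
  set F := extendFrom (ball 0 1) ψ with hF
  have hFc : ContinuousOn F (closedBall 0 1) := continuousOn_extendFrom hcl.ge hlim
  have hFe : ∀ x ∈ ball (0 : ℂ) 1, F x = ψ x := extendFrom_extends R.dif.continuousOn
  have him : F '' ball 0 1 = U := by
    ext u
    constructor
    · rintro ⟨x, hx, rfl⟩
      rw [hFe x hx]
      exact R.m1 hx
    · intro hu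
      exact ⟨f u, R.m2 hu, by rw [hFe _ (R.m2 hu), R.right u hu]⟩
  have hnot : ∀ ζ : ℂ, ‖ζ‖ = 1 → F ζ ∉ U := by
    intro ζ hζ
    have hmem : ζ ∈ closure (ball (0 : ℂ) 1) := by rw [hcl]; simp [hζ]
    haveI : (𝓝[ball 0 1] ζ).NeBot := mem_closure_iff_nhdsWithin_neBot.1 hmem
    exact R.not_mem H.oU (l := 𝓝[ball 0 1] ζ) (w := id) hζ self_mem_nhdsWithin
      (tendsto_id.mono_left nhdsWithin_le_nhds) (tendsto_extendFrom (hlim ζ (by rw [← hcl]; exact hmem)))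
  have hclU : F '' closedBall 0 1 = closure U := by
    refine subset_antisymm ?_ (closure_minimal ?_ ((isCompact_closedBall _ _).image_of_continuousOn hFc).isClosed)
    · rw [← him, ← hcl]
      exact ContinuousOn.image_closure (by rwa [hcl])
    · rw [← him]
      exact image_mono ball_subset_closedBall
  refine ⟨F, R.dif.congr hFe, hFc, ?_, him, ?_⟩
  · intro x hx y hy hxy
    rw [hFe x hx, hFe y hy] at hxy
    rw [← R.left x hx, hxy, R.left y hy]
  · rw [H.oU.frontier_eq, ← hclU]
    ext b
    constructor
    · rintro ⟨ζ, hζ, rfl⟩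
      exact ⟨⟨ζ, sphere_subset_closedBall hζ, rfl⟩, hnot ζ (by simpa using hζ)⟩
    · rintro ⟨⟨ζ, hζ, rfl⟩, hb⟩
      refine ⟨ζ, ?_, rfl⟩
      rcases (mem_closedBall_zero_iff.1 hζ).lt_or_eq with h | h
      · exact absurd (him ▸ ⟨ζ, mem_ball_zero_iff.2 h, rfl⟩) hb
      · simpa using h

lemma norm_expI (t : ℝ) : ‖Complex.exp (t * Complex.I)‖ = 1 := Complex.norm_exp_ofReal_mul_I t

lemma EMap.arc_not_const {U : Set ℂ} {ψ : ℂ → ℂ} (H : EMap U ψ) {α β : ℝ} (hαβ : α < β) {a : ℂ}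
    (ha : a ∉ U) : ∃ θ ∈ Ioo α β, ψ (Complex.exp (θ * Complex.I)) ≠ a := by
  by_contra hcon
  push Not at hcon
  have hpi := Real.pi_pos
  obtain ⟨N, hN⟩ := exists_nat_gt (2 * Real.pi / (β - α))
  have hba : 0 < β - α := by linarith
  have hN0 : (0 : ℝ) < N := lt_trans (by positivity) hN
  have hN0' : 0 < N := by exact_mod_cast hN0
  rw [div_lt_iff₀ hba] at hN
  set ω : ℕ → ℂ := fun k => Complex.exp ((2 * Real.pi * k / N : ℝ) * Complex.I) with hω
  have hωn : ∀ k, ‖ω k‖ = 1 := fun k => norm_expI _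
  set g : ℂ → ℂ := fun z => ∏ k ∈ Finset.range N, (ψ (ω k * z) - a) with hg
  have hm1 : ∀ k, MapsTo (fun z => ω k * z) (ball 0 1) (ball 0 1) := by
    intro k z hz
    rw [mem_ball_zero_iff] at hz ⊢
    beta_reduce
    rwa [norm_mul, hωn, one_mul]
  have hm2 : ∀ k, MapsTo (fun z => ω k * z) (closedBall 0 1) (closedBall 0 1) := by
    intro k z hz
    rw [mem_closedBall_zero_iff] at hz ⊢
    beta_reduce
    rwa [norm_mul, hωn, one_mul]
  have hd : DiffContOnCl ℂ g (ball 0 1) := by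
    constructor
    · refine DifferentiableOn.fun_finsetProd fun k _ => ?_
      exact (H.dif.comp (Differentiable.differentiableOn (by fun_prop)) (hm1 k)).sub_const a
    · rw [closure_ball 0 one_ne_zero]
      refine continuousOn_finset_prod _ fun k _ => ?_
      exact (H.con.comp (Continuous.continuousOn (by fun_prop)) (hm2 k)).sub continuousOn_const
  have hz : ∀ z ∈ frontier (ball (0 : ℂ) 1), ‖g z‖ ≤ 0 := by
    rw [frontier_ball 0 one_ne_zero]
    intro z hz
    rw [mem_sphere_zero_iff_norm] at hz
    rw [norm_le_zero_iff, hg]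
    beta_reduce
    set t := z.arg
    have hzt : z = Complex.exp (t * Complex.I) := by
      have := Complex.norm_mul_exp_arg_mul_I z
      rw [hz] at this
      simpa using this.symm
    set j := ⌊(α - t) * N / (2 * Real.pi)⌋ + 1 with hj
    have hj1 : (α - t) * N / (2 * Real.pi) < j := by
      rw [hj]; push_cast; exact Int.lt_floor_add_one _
    have hj2 : (j : ℝ) ≤ (α - t) * N / (2 * Real.pi) + 1 := by
      rw [hj]; push_cast; linarith [Int.floor_le ((α - t) * N / (2 * Real.pi))]
    have hNz : (N : ℤ) ≠ 0 := by exact_mod_cast hN0'.ne'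
    set k := (j % N).toNat with hk
    have hk1 : ((k : ℤ)) = j % N := Int.toNat_of_nonneg (Int.emod_nonneg _ hNz)
    have hkN : k < N := by
      have := Int.emod_lt_of_pos j (show (0 : ℤ) < N by exact_mod_cast hN0')
      omega
    refine Finset.prod_eq_zero (Finset.mem_range.2 hkN) ?_
    have hq : (j : ℝ) = k + N * (j / N : ℤ) := by
      have := Int.emod_add_mul_ediv j N
      rw [← hk1] at this
      exact_mod_cast this.symm
    have he : ω k * z = Complex.exp ((t + 2 * Real.pi * j / N : ℝ) * Complex.I) := by
      rw [hzt, hω]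
      beta_reduce
      rw [← Complex.exp_add, Complex.exp_eq_exp_iff_exists_int]
      refine ⟨-(j / N : ℤ), ?_⟩
      rw [hq]
      have : (N : ℂ) ≠ 0 := by exact_mod_cast hN0'.ne'
      push_cast
      field_simp
      ring
    rw [he, hcon, sub_self]
    constructor
    · rw [div_lt_iff₀ (by positivity)] at hj1
      have : (α - t) < 2 * Real.pi * j / N := by
        rw [lt_div_iff₀ hN0]
        linarith
      linarith
    · have h1 : (j : ℝ) * (2 * Real.pi) ≤ (α - t) * N + 2 * Real.pi := by
        have : (j : ℝ) * (2 * Real.pi) ≤ ((α - t) * N / (2 * Real.pi) + 1) * (2 * Real.pi) := by gcongr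
        refine this.trans_eq ?_
        field_simp
      have : 2 * Real.pi * j / N < β - t := by
        rw [div_lt_iff₀ hN0]
        nlinarith
      linarith
  have h0 := Complex.norm_le_of_forall_mem_frontier_norm_le isBounded_ball hd hz
    (subset_closure (mem_ball_self one_pos))
  rw [norm_le_zero_iff, hg] at h0
  simp only [mul_zero] at h0
  rw [Finset.prod_const] at h0
  have h1 := (pow_eq_zero_iff (n := (Finset.range N).card) (by simpa using hN0'.ne')).1 h0
  refine ha ?_
  rw [← sub_eq_zero.1 h1, ← H.im]
  exact ⟨0, by simp, rfl⟩

/-- polar coordinates -/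
noncomputable def pol (p : ℝ × ℝ) : ℂ := p.1 * Complex.exp (p.2 * Complex.I)

lemma continuous_pol : Continuous pol := by unfold pol; fun_prop

lemma norm_pol {p : ℝ × ℝ} (hp : 0 ≤ p.1) : ‖pol p‖ = p.1 := by
  rw [pol, norm_mul, norm_expI, mul_one, Complex.norm_real, Real.norm_eq_abs, abs_of_nonneg hp]

lemma pol_inj {ρ ρ' θ θ' : ℝ} (h0 : 0 < ρ) (h0' : 0 ≤ ρ') (h : pol (ρ, θ) = pol (ρ', θ')) :
    ρ = ρ' ∧ ∃ n : ℤ, θ = θ' + n * (2 * Real.pi) := by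
  have h1 : ρ = ρ' := by
    have := congrArg norm h
    rwa [norm_pol h0.le, norm_pol h0'] at this
  refine ⟨h1, ?_⟩
  subst h1
  have h2 : Complex.exp (θ * Complex.I) = Complex.exp (θ' * Complex.I) := by
    refine mul_left_cancel₀ ?_ h
    exact_mod_cast h0.ne'
  obtain ⟨n, hn⟩ := Complex.exp_eq_exp_iff_exists_int.1 h2
  refine ⟨n, ?_⟩
  have h3 : ((θ : ℂ)) = ((θ' + n * (2 * Real.pi) : ℝ) : ℂ) := by
    refine mul_right_cancel₀ Complex.I_ne_zero ?_
    rw [hn]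
    push_cast
    ring
  exact_mod_cast h3

lemma EMap.pol_mem {U : Set ℂ} {ψ : ℂ → ℂ} (H : EMap U ψ) {ρ θ : ℝ} (h0 : 0 ≤ ρ) (h1 : ρ < 1) :
    ψ (pol (ρ, θ)) ∈ U := by
  rw [← H.im]
  exact ⟨_, by rw [mem_ball_zero_iff, norm_pol h0]; exact h1, rfl⟩

/-- a sector is connected to a boundary point -/
lemma EMap.sector {U : Set ℂ} {ψ : ℂ → ℂ} (H : EMap U ψ) (hU : IsOpen U) {α β : ℝ} (hαβ : α < β) {a : ℂ} (ha : a ∉ U)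
    {K : Set ℂ} (hK : K ⊆ U ∪ {a}) (hKs : ∀ ρ ∈ Ioo (0 : ℝ) 1, ∀ θ ∈ Ioo α β, ψ (pol (ρ, θ)) ∉ K) :
    ∃ T, IsPreconnected T ∧ T ⊆ Kᶜ ∧ (∀ ρ ∈ Ioo (0 : ℝ) 1, ∀ θ ∈ Ioo α β, ψ (pol (ρ, θ)) ∈ T) ∧
      (T ∩ (frontier U \ {a})).Nonempty := by
  obtain ⟨θ₀, hθ₀, hne⟩ := H.arc_not_const hαβ ha
  have he : Complex.exp (θ₀ * Complex.I) = pol (1, θ₀) := by simp [pol]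
  rw [he] at hne
  have hbd : ψ (pol (1, θ₀)) ∈ frontier U := by
    rw [← H.fr]
    exact ⟨_, by rw [mem_sphere_zero_iff_norm, norm_pol zero_le_one], rfl⟩
  set T₀ : Set (ℝ × ℝ) := Ioo 0 1 ×ˢ Ioo α β ∪ Ioc 0 1 ×ˢ {θ₀} with hT₀
  have hT₀p : IsPreconnected T₀ := by
    refine IsPreconnected.union (1 / 2, θ₀) ⟨⟨by norm_num, by norm_num⟩, hθ₀⟩
      ⟨⟨by norm_num, by norm_num⟩, rfl⟩ ?_ ?_
    · exact isPreconnected_Ioo.prod isPreconnected_Ioo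
    · exact isPreconnected_Ioc.prod isPreconnected_singleton
  have hr : ∀ p ∈ T₀, 0 < p.1 ∧ p.1 ≤ 1 := by
    rintro p (hp | hp)
    · exact ⟨hp.1.1, hp.1.2.le⟩
    · exact hp.1
  refine ⟨(fun p => ψ (pol p)) '' T₀, hT₀p.image _ ?_, ?_, ?_, ?_⟩
  · refine H.con.comp continuous_pol.continuousOn fun p hp => ?_
    rw [mem_closedBall_zero_iff, norm_pol (hr p hp).1.le]
    exact (hr p hp).2
  · rintro _ ⟨⟨ρ, θ⟩, hp, rfl⟩ hK'
    rcases hp with hp | hp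
    · exact hKs ρ hp.1 θ hp.2 hK'
    · obtain ⟨h1, h2⟩ := hp
      have h2' : θ = θ₀ := h2
      subst h2'
      rcases h1.2.lt_or_eq with h | h
      · exact hKs ρ ⟨h1.1, h⟩ θ hθ₀ hK'
      · have h' : ρ = 1 := h
        subst h'
        rcases hK hK' with h3 | h3
        · rw [hU.frontier_eq] at hbd
          exact hbd.2 h3
        · exact hne h3
  · intro ρ hρ θ hθ
    exact ⟨(ρ, θ), Or.inl ⟨hρ, hθ⟩, rfl⟩
  · exact ⟨_, ⟨(1, θ₀), Or.inr ⟨⟨one_pos, le_rfl⟩, rfl⟩, rfl⟩, hbd, hne⟩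

lemma EMap.no_pinch {U : Set ℂ} {ψ : ℂ → ℂ} (H : EMap U ψ) (hU : IsOpen U)
    (hS : ∀ a ∈ frontier U, ∃ S, IsPreconnected S ∧ S ⊆ (U ∪ {a})ᶜ ∧ frontier U \ {a} ⊆ S)
    {α β : ℝ} (hαβ : α < β) (hβ : β < α + 2 * Real.pi) : ψ (pol (1, α)) ≠ ψ (pol (1, β)) := by
  intro heq
  set a := ψ (pol (1, α)) with ha
  have hpi := Real.pi_pos
  have hbd : a ∈ frontier U := by
    rw [← H.fr]
    exact ⟨_, by rw [mem_sphere_zero_iff_norm, norm_pol zero_le_one], rfl⟩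
  have haU : a ∉ U := by
    rw [hU.frontier_eq] at hbd
    exact hbd.2
  have hmod : ∀ θ ∈ Ioo α (α + 2 * Real.pi), ∀ n : ℤ, θ ≠ α + n * (2 * Real.pi) := by
    rintro θ ⟨h1, h2⟩ n rfl
    have h3 : (0 : ℝ) < n := by nlinarith
    have h4 : (n : ℝ) < 1 := by nlinarith
    have h5 : 0 < n := by exact_mod_cast h3
    have h6 : n < 1 := by exact_mod_cast h4
    omega
  have hpc : ∀ γ : ℝ, ContinuousOn (fun ρ => ψ (pol (ρ, γ))) (Icc 0 1) := by
    intro γ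
    refine H.con.comp (continuous_pol.comp (by fun_prop)).continuousOn fun ρ hρ => ?_
    rw [mem_closedBall_zero_iff, norm_pol hρ.1]
    exact hρ.2
  set P : ℝ → Set ℂ := fun γ => (fun ρ => ψ (pol (ρ, γ))) '' Icc 0 1 with hP
  have hPc : ∀ γ, IsCompact (P γ) := fun γ => isCompact_Icc.image_of_continuousOn (hpc γ)
  have hPp : ∀ γ, IsPreconnected (P γ) := fun γ => isPreconnected_Icc.image _ (hpc γ)
  have hp0 : ∀ γ, pol (0, γ) = 0 := fun γ => by simp [pol]
  have hinj : ∀ ρ ρ' θ θ' : ℝ, 0 ≤ ρ → ρ < 1 → 0 ≤ ρ' → ρ' < 1 → ψ (pol (ρ, θ)) = ψ (pol (ρ', θ')) →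
      pol (ρ, θ) = pol (ρ', θ') := by
    intro ρ ρ' θ θ' h0 h1 h0' h1' he
    exact H.inj (by rw [mem_ball_zero_iff, norm_pol h0]; exact h1)
      (by rw [mem_ball_zero_iff, norm_pol h0']; exact h1') he
  have hPi : P α ∩ P β = {ψ 0, a} := by
    ext z
    constructor
    · rintro ⟨⟨ρ, hρ, rfl⟩, ⟨ρ', hρ', he⟩⟩
      beta_reduce at he ⊢
      rcases hρ.2.lt_or_eq with h | h
      · rcases hρ'.2.lt_or_eq with h' | h'
        · left
          have h2 := hinj _ _ _ _ hρ'.1 h' hρ.1 h he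
          rcases hρ'.1.eq_or_lt with h3 | h3
          · rw [← h2, ← h3, hp0]
          · obtain ⟨-, n, hn⟩ := pol_inj h3 hρ.1 h2
            exact absurd hn (hmod β ⟨hαβ, hβ⟩ n)
        · exfalso
          rw [h', ← heq] at he
          exact haU (he ▸ H.pol_mem hρ.1 h)
      · right
        rw [h]
        rfl
    · rintro (rfl | rfl)
      · exact ⟨⟨0, by simp, by beta_reduce; rw [hp0]⟩, ⟨0, by simp, by beta_reduce; rw [hp0]⟩⟩
      · exact ⟨⟨1, by simp, rfl⟩, ⟨1, by simp, heq.symm⟩⟩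
  have h0a : ψ 0 ≠ a := by
    intro h
    refine haU (h ▸ ?_)
    rw [← H.im]
    exact ⟨0, by simp, rfl⟩
  obtain ⟨x, hx, hxb⟩ := exists_bounded_comp (hPc α) (hPc β) (hPp α) (hPp β) h0a hPi
  set K := P α ∪ P β with hK
  have hKc : IsCompact K := (hPc α).union (hPc β)
  have hKU : K ⊆ U ∪ {a} := by
    rintro z (⟨ρ, hρ, rfl⟩ | ⟨ρ, hρ, rfl⟩)
    · rcases hρ.2.lt_or_eq with h | h
      · exact Or.inl (H.pol_mem hρ.1 h)
      · right; rw [h]; rfl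
    · rcases hρ.2.lt_or_eq with h | h
      · exact Or.inl (H.pol_mem hρ.1 h)
      · right; rw [h]; exact heq.symm
  have hsec : ∀ ρ ∈ Ioo (0 : ℝ) 1, ∀ θ : ℝ, (∀ n : ℤ, θ ≠ α + n * (2 * Real.pi)) →
      (∀ n : ℤ, θ ≠ β + n * (2 * Real.pi)) → ψ (pol (ρ, θ)) ∉ K := by
    rintro ρ hρ θ h1 h2 (⟨ρ', hρ', he⟩ | ⟨ρ', hρ', he⟩)
    · rcases hρ'.2.lt_or_eq with h | h
      · obtain ⟨-, n, hn⟩ := pol_inj hρ.1 hρ'.1 (hinj _ _ _ _ hρ'.1 h hρ.1.le hρ.2 he).symm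
        exact h1 n hn
      · beta_reduce at he
        rw [h] at he
        refine haU ?_
        rw [ha, he]
        exact H.pol_mem hρ.1.le hρ.2
    · rcases hρ'.2.lt_or_eq with h | h
      · obtain ⟨-, n, hn⟩ := pol_inj hρ.1 hρ'.1 (hinj _ _ _ _ hρ'.1 h hρ.1.le hρ.2 he).symm
        exact h2 n hn
      · beta_reduce at he
        rw [h, ← heq] at he
        exact haU (he ▸ H.pol_mem hρ.1.le hρ.2)
  have hmodβ : ∀ θ ∈ Ioo α (α + 2 * Real.pi), θ ≠ β → ∀ n : ℤ, θ ≠ β + n * (2 * Real.pi) := by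
    rintro θ ⟨h1, h2⟩ hne n rfl
    have h3 : (-1 : ℝ) < n := by nlinarith
    have h4 : (n : ℝ) < 1 := by nlinarith
    have h5 : -1 < n := by exact_mod_cast h3
    have h6 : n < 1 := by exact_mod_cast h4
    have h7 : n = 0 := by omega
    subst h7
    simp at hne
  obtain ⟨T₁, pT₁, sT₁, mT₁, t₁, ht₁, ht₁'⟩ := H.sector hU hαβ haU hKU fun ρ hρ θ hθ =>
    hsec ρ hρ θ (hmod θ ⟨hθ.1, hθ.2.trans hβ⟩) (hmodβ θ ⟨hθ.1, hθ.2.trans hβ⟩ hθ.2.ne)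
  obtain ⟨T₂, pT₂, sT₂, mT₂, t₂, ht₂, ht₂'⟩ := H.sector hU hβ haU hKU fun ρ hρ θ hθ =>
    hsec ρ hρ θ (hmod θ ⟨hαβ.trans hθ.1, hθ.2⟩) (hmodβ θ ⟨hαβ.trans hθ.1, hθ.2⟩ hθ.1.ne')
  obtain ⟨S, pS, sS, mS⟩ := hS a hbd
  set W := T₁ ∪ S ∪ T₂ with hW
  have pW : IsPreconnected W := by
    refine IsPreconnected.union t₂ (Or.inr (mS ht₂')) ht₂ ?_ pT₂
    exact IsPreconnected.union t₁ ht₁ (mS ht₁') pT₁ pS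
  have sW : W ⊆ Kᶜ := by
    refine union_subset (union_subset sT₁ ?_) sT₂
    exact sS.trans (compl_subset_compl.2 hKU)
  have hUW : U \ K ⊆ W := by
    rintro u ⟨hu, huK⟩
    rw [← H.im] at hu
    obtain ⟨z, hz, rfl⟩ := hu
    set ρ := ‖z‖ with hρ
    have hρ1 : ρ < 1 := mem_ball_zero_iff.1 hz
    obtain ⟨θ, hθ, hzθ⟩ : ∃ θ, θ ∈ Ico α (α + 2 * Real.pi) ∧ z = pol (ρ, θ) := by
      refine ⟨toIcoMod Real.two_pi_pos α z.arg, toIcoMod_mem_Ico _ _ _, ?_⟩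
      have h1 := Complex.norm_mul_exp_arg_mul_I z
      rw [toIcoMod]
      conv_lhs => rw [← h1]
      rw [pol]
      congr 1
      rw [Complex.exp_eq_exp_iff_exists_int]
      refine ⟨toIcoDiv Real.two_pi_pos α z.arg, ?_⟩
      rw [zsmul_eq_mul]
      push_cast
      ring
    rw [hzθ] at huK ⊢
    have hρ0 : ρ ≠ 0 := by
      intro h
      refine huK (Or.inl ⟨0, by simp, ?_⟩)
      beta_reduce
      rw [h, hp0, hp0]
    have hρ' : ρ ∈ Ioo (0 : ℝ) 1 := ⟨lt_of_le_of_ne (norm_nonneg z) (Ne.symm hρ0), hρ1⟩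
    have hθα : θ ≠ α := by
      rintro h
      exact huK (Or.inl ⟨ρ, Ioo_subset_Icc_self hρ', by rw [h]⟩)
    have hθβ : θ ≠ β := by
      rintro h
      exact huK (Or.inr ⟨ρ, Ioo_subset_Icc_self hρ', by rw [h]⟩)
    rcases lt_or_gt_of_ne hθβ with h | h
    · exact Or.inl (Or.inl (mT₁ ρ hρ' θ ⟨lt_of_le_of_ne hθ.1 hθα.symm, h⟩))
    · exact Or.inr (mT₂ ρ hρ' θ ⟨h, hθ.2⟩)
  have hclW : closure U \ K ⊆ W := by
    rintro u ⟨hu, huK⟩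
    by_cases huU : u ∈ U
    · exact hUW ⟨huU, huK⟩
    · refine Or.inl (Or.inr (mS ⟨by rw [hU.frontier_eq]; exact ⟨hu, huU⟩, ?_⟩))
      rintro rfl
      exact huK (Or.inl ⟨1, by simp, rfl⟩)
  -- every point outside K lies in the component of W
  have hall : ∀ y ∉ K, t₁ ∈ connectedComponentIn Kᶜ y := by
    intro y hy
    by_contra hcon
    have hdisj : ∀ z ∈ connectedComponentIn Kᶜ y, z ∉ W := by
      intro z hz hzW
      refine hcon ?_
      have h1 := pW.subset_connectedComponentIn hzW sW (Or.inl (Or.inl ht₁) : t₁ ∈ W)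
      rwa [← connectedComponentIn_eq hz] at h1
    have ho : IsOpen (connectedComponentIn Kᶜ y) := hKc.isClosed.isOpen_compl.connectedComponentIn
    have hdU : Disjoint (connectedComponentIn Kᶜ y) U := by
      rw [Set.disjoint_left]
      intro z hz hzU
      exact hdisj z hz (hUW ⟨hzU, connectedComponentIn_subset _ _ hz⟩)
    have hfr : frontier (connectedComponentIn Kᶜ y) ⊆ {a} := by
      intro z hz
      have h1 := frontier_comp_subset hKc.isClosed.isOpen_compl y hz
      rw [compl_compl] at h1
      rcases hKU h1 with h2 | h2
      · exact absurd h2 (Set.disjoint_left.1 (hdU.closure_left hU) (frontier_subset_closure hz))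
      · exact h2
    have hsub := clopen_in ho (S := {a}ᶜ)
      (isConnected_compl_singleton_of_one_lt_rank (by simp) a).isPreconnected
      ⟨y, mem_connectedComponentIn hy, fun h => hy (Or.inl ⟨1, by simp, (mem_singleton_iff.1 h).symm⟩)⟩ (by
        rw [eq_empty_iff_forall_notMem]
        rintro z ⟨h1, h2⟩
        exact h2 (hfr h1))
    have h0U : ψ 0 ∈ U := by rw [← H.im]; exact ⟨0, by simp, rfl⟩
    exact Set.disjoint_left.1 hdU (hsub (show ψ 0 ∈ ({a}ᶜ : Set ℂ) from h0a)) h0U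
  have hcov : Kᶜ ⊆ connectedComponentIn Kᶜ x := by
    intro y hy
    have h1 := connectedComponentIn_eq (hall x hx)
    have h2 := connectedComponentIn_eq (hall y hy)
    rw [h1, ← h2]
    exact mem_connectedComponentIn hy
  have : Bornology.IsBounded (univ : Set ℂ) := by
    rw [← union_compl_self K]
    exact hKc.isBounded.union (hxb.subset hcov)
  exact NormedSpace.unbounded_univ ℝ ℂ this

lemma EMap.injOn {U : Set ℂ} {ψ : ℂ → ℂ} (H : EMap U ψ) (hU : IsOpen U)
    (hS : ∀ a ∈ frontier U, ∃ S, IsPreconnected S ∧ S ⊆ (U ∪ {a})ᶜ ∧ frontier U \ {a} ⊆ S) :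
    InjOn ψ (closedBall 0 1) := by
  have hfrU : ∀ z ∈ closedBall (0 : ℂ) 1, ψ z ∈ U → z ∈ ball (0 : ℂ) 1 := by
    intro z hz hzU
    by_contra h
    have hz1 : ‖z‖ = 1 := le_antisymm (mem_closedBall_zero_iff.1 hz) (by
      rw [mem_ball_zero_iff, not_lt] at h; exact h)
    have h2 : ψ z ∈ frontier U := by
      rw [← H.fr]
      exact ⟨z, by simpa using hz1, rfl⟩
    rw [hU.frontier_eq] at h2
    exact h2.2 hzU
  have hb : ∀ z ∈ ball (0 : ℂ) 1, ψ z ∈ U := fun z hz => by rw [← H.im]; exact ⟨z, hz, rfl⟩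
  have hpi := Real.pi_pos
  intro z hz w hw hzw
  by_cases hzb : z ∈ ball (0 : ℂ) 1
  · exact H.inj hzb (hfrU w hw (hzw ▸ hb z hzb)) hzw
  by_cases hwb : w ∈ ball (0 : ℂ) 1
  · exact absurd (hfrU z hz (hzw ▸ hb w hwb)) hzb
  have hp : ∀ z ∈ closedBall (0 : ℂ) 1, z ∉ ball (0 : ℂ) 1 → z = pol (1, z.arg) := by
    intro z hz h
    have hz1 : ‖z‖ = 1 := le_antisymm (mem_closedBall_zero_iff.1 hz) (by
      rw [mem_ball_zero_iff, not_lt] at h; exact h)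
    have h1 := Complex.norm_mul_exp_arg_mul_I z
    rw [hz1] at h1
    exact h1.symm
  rw [hp z hz hzb, hp w hw hwb] at hzw ⊢
  have hza := Complex.arg_mem_Ioc z
  have hwa := Complex.arg_mem_Ioc w
  rcases lt_trichotomy z.arg w.arg with h | h | h
  · exact absurd hzw (H.no_pinch hU hS h (by linarith [hza.1, hwa.2]))
  · rw [h]
  · exact absurd hzw.symm (H.no_pinch hU hS h (by linarith [hza.2, hwa.1]))

/-- the extension theorem -/
lemma caratheodory {U Y : Set ℂ} (H : CarH U Y)
    (hS : ∀ a ∈ frontier U, ∃ S, IsPreconnected S ∧ S ⊆ (U ∪ {a})ᶜ ∧ frontier U \ {a} ⊆ S) :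
    ∃ ψ : ℂ → ℂ, ContinuousOn ψ (closedBall 0 1) ∧ InjOn ψ (closedBall 0 1) ∧ ψ '' ball 0 1 = U ∧
      ψ '' sphere 0 1 = frontier U := by
  obtain ⟨ψ, E⟩ := H.exists_emap
  exact ⟨ψ, E.con, E.injOn H.oU hS, E.im, E.fr⟩

/-- local connectedness in the form used by the boundary extension theorem -/
def LC (Y : Set ℂ) : Prop := ∀ a ∈ Y, ∀ ε > 0, ∃ η > 0, ∃ Λ ⊆ Y, IsCompact Λ ∧ IsPreconnected Λ ∧
    Y ∩ closedBall a η ⊆ Λ ∧ Λ ⊆ closedBall a ε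

lemma LC_image {E : Type*} [NormedAddCommGroup E] [NormedSpace ℝ E] {K : Set E} (hK : IsCompact K)
    (cK : Convex ℝ K) {g : E → ℂ} (hg : ContinuousOn g K) : LC (g '' K) := by
  intro a ha ε hε
  have huc := hK.uniformContinuousOn_of_continuous hg
  rw [Metric.uniformContinuousOn_iff] at huc
  obtain ⟨δ', hδ', hu⟩ := huc ε hε
  set δ := δ' / 2 with hδd
  have hδ : 0 < δ := by positivity
  set Z : Set E := K ∩ g ⁻¹' {a} with hZ
  have cZ : IsClosed Z := hg.preimage_isClosed_of_isClosed hK.isClosed isClosed_singleton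
  have kZ : IsCompact Z := hK.of_isClosed_subset cZ inter_subset_left
  obtain ⟨z0, hz0, hz0a⟩ := ha
  have hz0Z : z0 ∈ Z := ⟨hz0, hz0a⟩
  set K' : Set E := K ∩ {w | δ ≤ infDist w Z} with hK'
  have kK' : IsCompact K' := hK.inter_right
    (isClosed_le continuous_const (continuous_infDist_pt Z))
  have haK' : a ∉ g '' K' := by
    rintro ⟨w, ⟨hw, hwd⟩, hwa⟩
    have : infDist w Z = 0 := infDist_zero_of_mem ⟨hw, hwa⟩
    simp only [mem_setOf_eq] at hwd
    linarith
  have kg : IsClosed (g '' K') := (kK'.image_of_continuousOn (hg.mono inter_subset_left)).isClosed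
  obtain ⟨η, hη, hηs⟩ := Metric.isOpen_iff.1 kg.isOpen_compl a haK'
  refine ⟨η / 2, by positivity, ⋃ z ∈ Z, g '' (K ∩ closedBall z δ), ?_, ?_, ?_, ?_, ?_⟩
  · refine iUnion₂_subset fun z hz => image_mono inter_subset_left
  · have : (⋃ z ∈ Z, g '' (K ∩ closedBall z δ)) =
        (fun p : E × E => g p.2) '' ((Z ×ˢ K) ∩ {p | dist p.2 p.1 ≤ δ}) := by
      ext y
      simp only [mem_iUnion, mem_image, mem_inter_iff, mem_prod, mem_setOf_eq, mem_closedBall,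
        Prod.exists, exists_prop]
      constructor
      · rintro ⟨z, hz, w, ⟨h1, h2⟩, h3⟩
        exact ⟨z, w, ⟨⟨hz, h1⟩, h2⟩, h3⟩
      · rintro ⟨z, w, ⟨⟨hz, h1⟩, h2⟩, h3⟩
        exact ⟨z, hz, w, ⟨h1, h2⟩, h3⟩
    rw [this]
    refine IsCompact.image_of_continuousOn ((kZ.prod hK).inter_right
      (isClosed_le (continuous_snd.dist continuous_fst) continuous_const)) ?_
    exact hg.comp continuous_snd.continuousOn fun p hp => hp.1.2
  · refine isPreconnected_of_forall a ?_
    intro y hy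
    simp only [mem_iUnion] at hy
    obtain ⟨z, hz, hy⟩ := hy
    refine ⟨g '' (K ∩ closedBall z δ), ?_, ?_, hy, ?_⟩
    · exact subset_iUnion₂_of_subset z hz subset_rfl
    · exact ⟨z, ⟨hz.1, mem_closedBall_self hδ.le⟩, hz.2⟩
    · exact ((cK.inter (convex_closedBall z δ)).isPreconnected).image _ (hg.mono inter_subset_left)
  · rintro y ⟨⟨w, hw, rfl⟩, hy⟩
    have h1 : infDist w Z < δ := by
      by_contra h
      push Not at h
      have h2 : g w ∈ ball a η := by
        rw [mem_closedBall] at hy; rw [mem_ball]; linarith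
      exact hηs h2 ⟨w, ⟨hw, h⟩, rfl⟩
    obtain ⟨z, hz, hzd⟩ := (infDist_lt_iff ⟨z0, hz0Z⟩).1 h1
    simp only [mem_iUnion]
    exact ⟨z, hz, w, ⟨hw, hzd.le⟩, rfl⟩
  · refine iUnion₂_subset fun z hz => ?_
    rintro y ⟨w, ⟨hw, hwz⟩, rfl⟩
    have := hu w hw z hz.1 (by rw [mem_closedBall] at hwz; linarith)
    rw [show g z = a from hz.2] at this
    exact this.le

lemma LC.union {Y Z : Set ℂ} (cY : IsClosed Y) (cZ : IsClosed Z) (hY : LC Y) (hZ : LC Z) :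
    LC (Y ∪ Z) := by
  have key : ∀ {Y Z : Set ℂ}, IsClosed Z → LC Y → ∀ a ∈ Y, a ∉ Z → ∀ ε > 0, ∃ η > 0, ∃ Λ ⊆ Y ∪ Z,
      IsCompact Λ ∧ IsPreconnected Λ ∧ (Y ∪ Z) ∩ closedBall a η ⊆ Λ ∧ Λ ⊆ closedBall a ε := by
    intro Y Z cZ hY a ha haZ ε hε
    obtain ⟨η, hη, Λ, h1, h2, h3, h4, h5⟩ := hY a ha ε hε
    obtain ⟨ρ, hρ, hρs⟩ := Metric.isOpen_iff.1 cZ.isOpen_compl a haZ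
    refine ⟨min η (ρ / 2), by positivity, Λ, h1.trans subset_union_left, h2, h3, ?_, h5⟩
    rintro z ⟨hz | hz, hzb⟩
    · exact h4 ⟨hz, closedBall_subset_closedBall (min_le_left _ _) hzb⟩
    · refine absurd hz (hρs ?_)
      rw [mem_closedBall] at hzb
      rw [mem_ball]
      linarith [min_le_right η (ρ / 2)]
  intro a ha ε hε
  by_cases h1 : a ∈ Y
  · by_cases h2 : a ∈ Z
    · obtain ⟨η, hη, Λ, a1, a2, a3, a4, a5⟩ := hY a h1 ε hε
      obtain ⟨η', hη', Λ', b1, b2, b3, b4, b5⟩ := hZ a h2 ε hε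
      refine ⟨min η η', by positivity, Λ ∪ Λ', union_subset_union a1 b1, a2.union b2, ?_, ?_,
        union_subset a5 b5⟩
      · exact IsPreconnected.union a (a4 ⟨h1, mem_closedBall_self hη.le⟩)
          (b4 ⟨h2, mem_closedBall_self hη'.le⟩) a3 b3
      · rintro z ⟨hz | hz, hzb⟩
        · exact Or.inl (a4 ⟨hz, closedBall_subset_closedBall (min_le_left _ _) hzb⟩)
        · exact Or.inr (b4 ⟨hz, closedBall_subset_closedBall (min_le_right _ _) hzb⟩)
    · exact key cZ hY a h1 h2 ε hε
  · have h2 : a ∈ Z := ha.resolve_left h1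
    rw [union_comm]
    exact key cY hZ a h2 h1 ε hε

/-- the unit circle parametrization -/
noncomputable def ee (θ : ℝ) : ℂ := Complex.exp (θ * Complex.I)

lemma norm_ee (θ : ℝ) : ‖ee θ‖ = 1 := Complex.norm_exp_ofReal_mul_I θ

lemma continuous_ee : Continuous ee := by unfold ee; fun_prop

lemma ee_ne (θ : ℝ) : ee θ ≠ 0 := Complex.exp_ne_zero _

lemma ee_add (a b : ℝ) : ee (a + b) = ee a * ee b := by
  unfold ee; rw [← Complex.exp_add]; push_cast; ring_nf

lemma ee_per (a : ℝ) : ee (a + 2 * Real.pi) = ee a := by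
  rw [ee_add]
  have : ee (2 * Real.pi) = 1 := by
    unfold ee; push_cast; exact Complex.exp_two_pi_mul_I
  rw [this, mul_one]

lemma ee_eq {a b : ℝ} (h : ee a = ee b) : ∃ n : ℤ, a = b + n * (2 * Real.pi) := by
  have := pol_inj (ρ := 1) (ρ' := 1) (θ := a) (θ' := b) one_pos zero_le_one
    (by simpa [pol, ee] using h)
  exact this.2

lemma ee_per_int (a : ℝ) (n : ℤ) : ee (a + n * (2 * Real.pi)) = ee a := by
  unfold ee
  rw [Complex.exp_eq_exp_iff_exists_int]
  exact ⟨n, by push_cast; ring⟩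

/-- every unit vector has an angle in a given half open interval -/
lemma exists_ee (a : ℝ) {z : ℂ} (hz : ‖z‖ = 1) : ∃ θ ∈ Ico a (a + 2 * Real.pi), ee θ = z := by
  obtain ⟨t, ht⟩ : ∃ t : ℝ, ee t = z := by
    refine ⟨Complex.arg z, ?_⟩
    have := Complex.norm_mul_exp_arg_mul_I z
    rw [hz] at this
    simpa [ee] using this
  refine ⟨toIcoMod Real.two_pi_pos a t, toIcoMod_mem_Ico _ _ _, ?_⟩
  rw [← ht, ← toIcoMod_add_toIcoDiv_zsmul Real.two_pi_pos a t, zsmul_eq_mul, ee_per_int]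
  congr 1
  simp

lemma ee_injOn {a b : ℝ} (hb : b < a + 2 * Real.pi) : InjOn ee (Icc a b) := by
  intro s hs t ht h
  obtain ⟨n, hn⟩ := ee_eq h
  have hp := Real.two_pi_pos
  have h1 : (n : ℝ) < 1 := by
    by_contra hc; push Not at hc; nlinarith [hs.1, hs.2, ht.1, ht.2]
  have h2 : (-1 : ℝ) < n := by
    by_contra hc; push Not at hc; nlinarith [hs.1, hs.2, ht.1, ht.2]
  have : n = 0 := by
    have a1 : n < 1 := by exact_mod_cast h1
    have a2 : -1 < n := by exact_mod_cast h2
    omega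
  rw [hn, this]; simp

lemma collar {E : Set ℂ} (hE : IsClosed E) (hne : E.Nonempty) {α β : ℝ} (hab : α < β)
    (hs : ∀ θ ∈ Ioo α β, ee θ ∉ E) :
    ∃ n ∈ ball (0 : ℂ) 1 \ E, ∀ θ ∈ Ioo α β, ∃ ε > 0,
      ball (ee θ) ε ∩ ball 0 1 ⊆ connectedComponentIn (ball 0 1 \ E) n := by
  set δ : ℝ → ℝ := fun θ => min (infDist (ee θ) E) (1 / 2) with hδ
  have δc : Continuous δ := ((continuous_infDist_pt E).comp continuous_ee).min continuous_const
  have δp : ∀ θ ∈ Ioo α β, 0 < δ θ := fun θ hθ =>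
    lt_min ((hE.notMem_iff_infDist_pos hne).1 (hs θ hθ)) (by norm_num)
  have δh : ∀ θ, δ θ ≤ 1 / 2 := fun θ => min_le_right _ _
  set F : ℝ × ℝ → ℂ := fun p => ((1 - p.1 * δ p.2 : ℝ) : ℂ) * ee p.2 with hF
  have Fc : Continuous F := by
    refine (Complex.continuous_ofReal.comp ?_).mul (continuous_ee.comp continuous_snd)
    exact continuous_const.sub (continuous_fst.mul (δc.comp continuous_snd))
  set N := F '' (Ioo (0 : ℝ) 1 ×ˢ Ioo α β) with hN
  have Np : IsPreconnected N := by
    refine IsPreconnected.image ?_ _ Fc.continuousOn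
    exact isPreconnected_Ioo.prod isPreconnected_Ioo
  have hdist : ∀ s θ, 0 ≤ s → 0 ≤ δ θ → dist (F (s, θ)) (ee θ) = s * δ θ := by
    intro s θ h1 h2
    rw [dist_eq_norm]
    have : F (s, θ) - ee θ = ((-(s * δ θ) : ℝ) : ℂ) * ee θ := by simp only [hF]; push_cast; ring
    rw [this, norm_mul, norm_ee, Complex.norm_real, Real.norm_eq_abs, abs_neg, mul_one,
      abs_of_nonneg (mul_nonneg h1 h2)]
  have hnotE : ∀ θ ∈ Ioo α β, ∀ z, dist z (ee θ) < δ θ → z ∉ E := by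
    intro θ hθ z hz hzE
    have := infDist_le_dist_of_mem (x := ee θ) hzE
    rw [dist_comm] at this
    linarith [min_le_left (infDist (ee θ) E) (1 / 2)]
  have hFb : ∀ s ∈ Ioo (0 : ℝ) 1, ∀ θ ∈ Ioo α β, F (s, θ) ∈ ball (0 : ℂ) 1 ∧ F (s, θ) ∈ ball (ee θ) (δ θ) := by
    intro s hs' θ hθ
    have h1 := δp θ hθ
    have h2 := δh θ
    refine ⟨?_, ?_⟩
    · simp only [hF, mem_ball_zero_iff, norm_mul, norm_ee, mul_one, Complex.norm_real,
        Real.norm_eq_abs]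
      rw [abs_lt]
      constructor <;> nlinarith [hs'.1, hs'.2]
    · rw [mem_ball, hdist s θ hs'.1.le h1.le]
      nlinarith [hs'.2]
  have Nsub : N ⊆ ball (0 : ℂ) 1 \ E := by
    rintro _ ⟨⟨s, θ⟩, ⟨h1, h2⟩, rfl⟩
    exact ⟨(hFb s h1 θ h2).1, hnotE θ h2 _ (hFb s h1 θ h2).2⟩
  obtain ⟨θ0, hθ0⟩ := nonempty_Ioo.2 hab
  have hn0 : F (1 / 2, θ0) ∈ N := ⟨(1 / 2, θ0), ⟨by norm_num, hθ0⟩, rfl⟩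
  refine ⟨F (1 / 2, θ0), Nsub hn0, fun θ hθ => ⟨δ θ, δp θ hθ, ?_⟩⟩
  have hx : F (1 / 2, θ) ∈ N := ⟨(1 / 2, θ), ⟨by norm_num, hθ⟩, rfl⟩
  have hx' := hFb (1 / 2) (by norm_num) θ hθ
  have hC : IsPreconnected (N ∪ (ball (ee θ) (δ θ) ∩ ball 0 1)) :=
    IsPreconnected.union (F (1 / 2, θ)) hx ⟨hx'.2, hx'.1⟩ Np
      ((convex_ball _ _).inter (convex_ball _ _)).isPreconnected
  refine subset_union_right.trans (hC.subset_connectedComponentIn (Or.inl hn0) ?_)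
  refine union_subset Nsub ?_
  rintro z ⟨h1, h2⟩
  exact ⟨h2, hnotE θ hθ z h1⟩

lemma exists_ofConvex {ψ : ℂ → ℂ} (hc : ContinuousOn ψ (closedBall 0 1))
    (hi : InjOn ψ (closedBall 0 1)) :
    ∃ l : ℂ → ℂ, ContinuousOn l (ψ '' closedBall 0 1) ∧ ∀ z ∈ closedBall (0 : ℂ) 1, l (ψ z) = z := by
  have hl : ∀ z ∈ closedBall (0 : ℂ) 1, Function.invFunOn ψ (closedBall 0 1) (ψ z) = z :=
    fun z hz => hi.leftInvOn_invFunOn hz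
  refine ⟨Function.invFunOn ψ (closedBall 0 1), ?_, hl⟩
  refine factor_continuousOn (isCompact_closedBall 0 1) hc ?_
  exact continuousOn_id.congr fun z hz => hl z hz

lemma disc_cone {c : ℂ → ℂ} (hc : ContinuousOn c (sphere 0 1)) (hb : BijOn c (sphere 0 1) (sphere 0 1)) :
    ∃ C : ℂ → ℂ, ContinuousOn C (closedBall 0 1) ∧ BijOn C (closedBall 0 1) (closedBall 0 1) ∧
      ∀ z ∈ sphere (0 : ℂ) 1, C z = c z := by
  have hu : ∀ z : ℂ, z ≠ 0 → z / ‖z‖ ∈ sphere (0 : ℂ) 1 := fun z hz => by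
    have : ‖z‖ ≠ 0 := norm_ne_zero_iff.2 hz
    rw [mem_sphere_zero_iff_norm, norm_div, Complex.norm_real, norm_norm, div_self this]
  have hcn : ∀ z : ℂ, z ≠ 0 → ‖c (z / ‖z‖)‖ = 1 := fun z hz =>
    mem_sphere_zero_iff_norm.1 (hb.mapsTo (hu z hz))
  have hn : ∀ z : ℂ, ‖(‖z‖ : ℂ) * c (z / ‖z‖)‖ = ‖z‖ := fun z => by
    by_cases hz : z = 0
    · simp [hz]
    · rw [norm_mul, hcn z hz, Complex.norm_real, norm_norm, mul_one]
  refine ⟨fun z => (‖z‖ : ℂ) * c (z / ‖z‖), ?_, ⟨?_, ?_, ?_⟩, ?_⟩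
  · intro z hz
    by_cases hz0 : z = 0
    · subst hz0
      refine ContinuousAt.continuousWithinAt ?_
      rw [ContinuousAt, tendsto_iff_norm_sub_tendsto_zero]
      have : (fun e : ℂ => ‖(‖e‖ : ℂ) * c (e / ‖e‖) - (‖(0 : ℂ)‖ : ℂ) * c (0 / ‖(0 : ℂ)‖)‖)
          = fun e => ‖e‖ := by
        funext e; rw [norm_zero, Complex.ofReal_zero, zero_mul, sub_zero, hn]
      rw [this]
      exact tendsto_norm_zero
    · have h1 : ContinuousOn (fun z : ℂ => (‖z‖ : ℂ) * c (z / ‖z‖)) {0}ᶜ := by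
        refine (Complex.continuous_ofReal.comp continuous_norm).continuousOn.mul ?_
        refine hc.comp ?_ fun z hz => hu z hz
        refine continuousOn_id.div (Complex.continuous_ofReal.comp continuous_norm).continuousOn ?_
        intro z hz
        simpa using hz
      exact (h1.continuousAt (isOpen_compl_singleton.mem_nhds hz0)).continuousWithinAt
  · intro z hz
    simp only [mem_closedBall_zero_iff] at hz ⊢
    rw [hn]; exact hz
  · intro z hz w hw h
    have h1 : ‖z‖ = ‖w‖ := by rw [← hn z, ← hn w]; exact congrArg _ h
    by_cases hz0 : z = 0
    · have : ‖w‖ = 0 := by rw [← h1, hz0, norm_zero]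
      rw [hz0, norm_eq_zero.1 this]
    · have hw0 : w ≠ 0 := fun h' => hz0 (by rw [← norm_eq_zero, h1, h', norm_zero])
      have hne : (‖w‖ : ℂ) ≠ 0 := by simpa using hw0
      simp only [h1] at h
      have h2 := mul_left_cancel₀ hne h
      have h3 := hb.injOn (by rw [← h1]; exact hu z hz0) (hu w hw0) h2
      rwa [div_left_inj' hne] at h3
  · intro w hw
    by_cases hw0 : w = 0
    · exact ⟨0, by simp, by simp [hw0]⟩
    · obtain ⟨u, hu1, hu2⟩ := hb.surjOn (hu w hw0)
      have hne : (‖w‖ : ℂ) ≠ 0 := by simpa using hw0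
      have hun : ‖u‖ = 1 := mem_sphere_zero_iff_norm.1 hu1
      have e : ‖(‖w‖ : ℂ) * u‖ = ‖w‖ := by rw [norm_mul, hun, Complex.norm_real, norm_norm, mul_one]
      refine ⟨(‖w‖ : ℂ) * u, ?_, ?_⟩
      · rw [mem_closedBall_zero_iff, e]; simpa using hw
      · beta_reduce
        rw [e, mul_div_cancel_left₀ _ hne, hu2]
        field_simp
  · intro z hz
    rw [mem_sphere_zero_iff_norm] at hz
    beta_reduce
    simp [hz]

/-- extension of a boundary homeomorphism to the closed disc -/
lemma extend_bd {ψ : ℂ → ℂ} (hc : ContinuousOn ψ (closedBall 0 1))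
    (hi : InjOn ψ (closedBall 0 1)) {Δ : Set ℂ} (cΔ : IsClosed Δ) (xΔ : Convex ℝ Δ)
    (nΔ : (interior Δ).Nonempty) (bΔ : Bornology.IsBounded Δ) {k : ℂ → ℂ}
    (kc : ContinuousOn k (ψ '' sphere 0 1)) (kb : BijOn k (ψ '' sphere 0 1) (frontier Δ)) :
    ∃ H : ℂ → ℂ, ContinuousOn H (ψ '' closedBall 0 1) ∧ BijOn H (ψ '' closedBall 0 1) Δ ∧
      ∀ x ∈ ψ '' sphere 0 1, H x = k x := by
  obtain ⟨h, h1, h2, h3⟩ := exists_homeomorph_image_interior_closure_frontier_eq_unitBall xΔ nΔ bΔ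
  rw [cΔ.closure_eq] at h2
  have hss : sphere (0 : ℂ) 1 ⊆ closedBall 0 1 := sphere_subset_closedBall
  have hcb : BijOn (fun z => h (k (ψ z))) (sphere 0 1) (sphere 0 1) := by
    have a1 : BijOn ψ (sphere 0 1) (ψ '' sphere 0 1) := (hi.mono hss).bijOn_image
    have a2 : BijOn h (frontier Δ) (sphere 0 1) := by
      rw [← h3]; exact h.injective.injOn.bijOn_image
    exact a2.comp (kb.comp a1)
  obtain ⟨C, Cc, Cb, Ce⟩ := disc_cone (c := fun z => h (k (ψ z)))
    (h.continuous.comp_continuousOn (kc.comp (hc.mono hss) fun z hz => ⟨z, hz, rfl⟩)) hcb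
  obtain ⟨l, lc, le⟩ := exists_ofConvex hc hi
  have lb : BijOn l (ψ '' closedBall 0 1) (closedBall 0 1) := by
    refine ⟨?_, ?_, ?_⟩
    · rintro _ ⟨z, hz, rfl⟩; rw [le z hz]; exact hz
    · rintro _ ⟨z, hz, rfl⟩ _ ⟨w, hw, rfl⟩ h; rw [le z hz, le w hw] at h; rw [h]
    · intro z hz; exact ⟨ψ z, ⟨z, hz, rfl⟩, le z hz⟩
  have hb : BijOn h.symm (closedBall 0 1) Δ := by
    rw [← h2]
    refine ⟨?_, h.symm.injective.injOn, ?_⟩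
    · rintro _ ⟨z, hz, rfl⟩; simpa using hz
    · intro z hz; exact ⟨h z, ⟨z, hz, rfl⟩, by simp⟩
  refine ⟨fun x => h.symm (C (l x)), ?_, hb.comp (Cb.comp lb), ?_⟩
  · exact h.symm.continuous.comp_continuousOn (Cc.comp lc lb.mapsTo)
  · rintro _ ⟨z, hz, rfl⟩
    beta_reduce
    rw [le z (hss hz), Ce z hz]
    simp

lemma conj_ee (t : ℝ) : (starRingEnd ℂ) (ee t) = ee (-t) := by
  unfold ee
  rw [← Complex.exp_conj]
  simp

lemma arc_split_aux {ψ : ℂ → ℂ} (hc : ContinuousOn ψ (sphere 0 1))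
    (hi : InjOn ψ (sphere 0 1)) {α β : ℝ} (hab : α < β) (hb : β < α + 2 * Real.pi)
    {l : ℝ → ℝ} (lc : ContinuousOn l (Icc α β)) (lm : StrictMonoOn l (Icc α β))
    (hl : ∀ θ ∈ Icc α β, ψ (ee (l θ)) = ee θ) :
    ∃ κ : ℝ → ℂ, ContinuousOn κ (Icc 0 1) ∧ InjOn κ (Icc 0 1) ∧ κ 0 = ee β ∧ κ 1 = ee α ∧
      ψ '' sphere 0 1 = ee '' Icc α β ∪ κ '' Icc 0 1 ∧ ∀ t ∈ Ioo (0 : ℝ) 1, κ t ∉ ee '' Icc α β := by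
  have ha1 : α ∈ Icc α β := left_mem_Icc.2 hab.le
  have hb1 : β ∈ Icc α β := right_mem_Icc.2 hab.le
  have hlt := lm ha1 hb1 hab
  have hes : ∀ t, ee t ∈ sphere (0 : ℂ) 1 := fun t => mem_sphere_zero_iff_norm.2 (norm_ee t)
  have ivt : ∀ y ∈ Icc (l α) (l β), ∃ t ∈ Icc α β, l t = y := fun y hy =>
    intermediate_value_Icc hab.le lc hy
  have hlt2 : l β < l α + 2 * Real.pi := by
    by_contra h
    push Not at h
    obtain ⟨t, ht, hlt'⟩ := ivt (l α + 2 * Real.pi) ⟨by linarith [Real.two_pi_pos], h⟩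
    have h1 := hl t ht
    rw [hlt', ee_per, hl α ha1] at h1
    have := ee_injOn hb ha1 ht h1
    rw [← this] at hlt'
    linarith [Real.two_pi_pos]
  set σ : ℝ → ℝ := fun t => l β + t * (l α + 2 * Real.pi - l β) with hσ
  have σc : Continuous σ := by fun_prop
  have σi : ∀ s t, σ s = σ t → s = t := by
    intro s t h
    simp only [hσ] at h
    have : (l α + 2 * Real.pi - l β) ≠ 0 := by linarith
    exact mul_right_cancel₀ this (by linarith)
  have σm : ∀ t ∈ Icc (0 : ℝ) 1, σ t ∈ Icc (l β) (l α + 2 * Real.pi) := by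
    intro t ht
    simp only [hσ]
    constructor <;> nlinarith [ht.1, ht.2]
  have inj1 : InjOn ee (Icc (l β) (l α + 2 * Real.pi)) := ee_injOn (by linarith)
  refine ⟨fun t => ψ (ee (σ t)), ?_, ?_, ?_, ?_, ?_, ?_⟩
  · exact hc.comp (continuous_ee.comp σc).continuousOn fun t _ => hes _
  · intro s hs t ht h
    exact σi _ _ (inj1 (σm s hs) (σm t ht) (hi (hes _) (hes _) h))
  · simp only [hσ, zero_mul, add_zero]; exact hl β hb1
  · simp only [hσ, one_mul]
    rw [show l β + (l α + 2 * Real.pi - l β) = l α + 2 * Real.pi by ring, ee_per]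
    exact hl α ha1
  · ext x
    constructor
    · rintro ⟨z, hz, rfl⟩
      obtain ⟨t, ht, rfl⟩ := exists_ee (l α) (mem_sphere_zero_iff_norm.1 hz)
      by_cases htb : t ≤ l β
      · obtain ⟨s, hs, hst⟩ := ivt t ⟨ht.1, htb⟩
        exact Or.inl ⟨s, hs, by rw [← hst, hl s hs]⟩
      · push Not at htb
        right
        have hp : 0 < l α + 2 * Real.pi - l β := by linarith
        refine ⟨(t - l β) / (l α + 2 * Real.pi - l β), ⟨div_nonneg (by linarith) hp.le, ?_⟩, ?_⟩
        · rw [div_le_one hp]; linarith [ht.2]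
        · simp only [hσ]
          rw [div_mul_cancel₀ _ hp.ne']
          congr 2; ring
    · rintro (⟨s, hs, rfl⟩ | ⟨t, ht, rfl⟩)
      · exact ⟨ee (l s), hes _, hl s hs⟩
      · exact ⟨_, hes _, rfl⟩
  · rintro t ht ⟨θ, hθ, h⟩
    rw [← hl θ hθ] at h
    have h1 := hi (hes _) (hes _) h
    obtain ⟨n, hn⟩ := ee_eq h1
    have m1 : l α ≤ l θ := lm.monotoneOn ha1 hθ hθ.1
    have m2 : l θ ≤ l β := lm.monotoneOn hθ hb1 hθ.2
    have m3 : l β < σ t := by simp only [hσ]; nlinarith [ht.1]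
    have m4 : σ t < l α + 2 * Real.pi := by simp only [hσ]; nlinarith [ht.2]
    have hp := Real.two_pi_pos
    have q1 : (n : ℝ) < 0 := by by_contra hc; push Not at hc; nlinarith
    have q2 : (-1 : ℝ) < n := by by_contra hc; push Not at hc; nlinarith
    have a1 : n < 0 := by exact_mod_cast q1
    have a2 : -1 < n := by exact_mod_cast q2
    omega

/-- complementary arc of a circular arc in a Jordan curve -/
lemma arc_split {ψ : ℂ → ℂ} (hc : ContinuousOn ψ (closedBall 0 1))
    (hi : InjOn ψ (closedBall 0 1)) {α β : ℝ} (hab : α < β) (hb : β < α + 2 * Real.pi)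
    (hA : ∀ θ ∈ Icc α β, ee θ ∈ ψ '' sphere 0 1) :
    ∃ κ : ℝ → ℂ, ContinuousOn κ (Icc 0 1) ∧ InjOn κ (Icc 0 1) ∧ κ 0 = ee β ∧ κ 1 = ee α ∧
      ψ '' sphere 0 1 = ee '' Icc α β ∪ κ '' Icc 0 1 ∧ ∀ t ∈ Ioo (0 : ℝ) 1, κ t ∉ ee '' Icc α β := by
  have hss : sphere (0 : ℂ) 1 ⊆ closedBall 0 1 := sphere_subset_closedBall
  obtain ⟨l, lc, le⟩ := exists_ofConvex hc hi
  have gn : ∀ θ ∈ Icc α β, ‖l (ee θ)‖ = 1 ∧ ψ (l (ee θ)) = ee θ := by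
    intro θ hθ
    obtain ⟨z, hz, hzθ⟩ := hA θ hθ
    rw [← hzθ, le z (hss hz)]
    exact ⟨mem_sphere_zero_iff_norm.1 hz, rfl⟩
  have gc : ContinuousOn (fun θ => l (ee θ)) (Icc α β) :=
    lc.comp continuous_ee.continuousOn fun θ hθ => image_mono hss (hA θ hθ)
  obtain ⟨L, Lc, hL⟩ := hasLog_of_convex (convex_Icc α β) gc (fun θ hθ h => by
    have := (gn θ hθ).1; beta_reduce at h; rw [h] at this; simp at this)
  beta_reduce at hL
  have hLe : ∀ θ ∈ Icc α β, l (ee θ) = ee ((L θ).im) := by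
    intro θ hθ
    have h1 := (gn θ hθ).1
    rw [hL θ hθ, Complex.norm_exp, Real.exp_eq_one_iff] at h1
    rw [hL θ hθ, ee]
    congr 1
    apply Complex.ext <;> simp [h1]
  have mc : ContinuousOn (fun θ => (L θ).im) (Icc α β) := Complex.continuous_im.comp_continuousOn Lc
  have mi : InjOn (fun θ => (L θ).im) (Icc α β) := by
    intro s hs t ht h
    beta_reduce at h
    have : l (ee s) = l (ee t) := by rw [hLe s hs, hLe t ht, h]
    have h2 : ee s = ee t := by rw [← (gn s hs).2, ← (gn t ht).2, this]
    exact ee_injOn hb hs ht h2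
  rcases mc.strictMonoOn_of_injOn_Icc' hab.le mi with h | h
  · exact arc_split_aux (hc.mono hss) (hi.mono hss) hab hb mc h (fun θ hθ => by
      rw [← hLe θ hθ]; exact (gn θ hθ).2)
  · have hcs : ∀ z ∈ sphere (0 : ℂ) 1, (starRingEnd ℂ) z ∈ sphere (0 : ℂ) 1 := fun z hz => by
      rw [mem_sphere_zero_iff_norm] at hz ⊢; rwa [RCLike.norm_conj]
    have := arc_split_aux (ψ := fun z => ψ ((starRingEnd ℂ) z)) (α := α) (β := β)
      (l := fun θ => -(L θ).im)
      ((hc.mono hss).comp Complex.continuous_conj.continuousOn hcs)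
      (fun z hz w hw h => (starRingEnd ℂ).injective (hi (hss (hcs z hz)) (hss (hcs w hw)) h))
      hab hb mc.neg (fun s hs t ht hst => neg_lt_neg (h hs ht hst)) (fun θ hθ => by
        rw [conj_ee, neg_neg, ← hLe θ hθ]; exact (gn θ hθ).2)
    have e : (fun z => ψ ((starRingEnd ℂ) z)) '' sphere 0 1 = ψ '' sphere 0 1 := by
      ext x
      constructor
      · rintro ⟨z, hz, rfl⟩; exact ⟨_, hcs z hz, rfl⟩
      · rintro ⟨z, hz, rfl⟩; exact ⟨_, hcs z hz, by simp⟩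
    rw [e] at this
    exact this

lemma glue_equiv {f R H : ℂ → ℂ} {n : ℕ} (hn : 0 < n) (fc : Continuous f) (hfn : ∀ z, f^[n] z = z)
    (Rc : Continuous R) (hRn : ∀ z, R^[n] z = z) {P Δ : Set ℂ} (kP : IsCompact P)
    (Hc : ContinuousOn H P) (Hb : BijOn H P Δ)
    (fD : DD = ⋃ i : Fin n, f^[i] '' P) (RD : DD = ⋃ i : Fin n, R^[i] '' Δ)
    (comp : ∀ i < n, ∀ x ∈ P, ∀ y ∈ P, f^[i] x = y ↔ R^[i] (H x) = H y) :
    ∃ h : ℂ → ℂ, ContinuousOn h DD ∧ BijOn h DD DD ∧ ∀ x ∈ DD, h (f x) = R (h x) := by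
  have gen : ∀ (g : ℂ → ℂ), (∀ z, g^[n] z = z) → ∀ i j x y,
      g^[i] x = g^[j] y ↔ g^[(n * j - j + i) % n] x = y := by
    intro g hg i j x y
    have hnj : ∀ j z, g^[n * j] z = z := fun j z => by
      rw [Function.iterate_mul]
      exact Function.iterate_fixed (hg z) j
    have hmod : ∀ k z, g^[k % n] z = g^[k] z := fun k z => by
      conv_rhs => rw [← Nat.mod_add_div k n, Function.iterate_add_apply, hnj]
    have hle : j ≤ n * j := Nat.le_mul_of_pos_left j hn
    rw [hmod]
    constructor
    · intro h
      rw [Function.iterate_add_apply, h, ← Function.iterate_add_apply, Nat.sub_add_cancel hle, hnj]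
    · intro h
      rw [← h, ← Function.iterate_add_apply, ← add_assoc, Nat.add_sub_cancel' hle,
        Function.iterate_add_apply, hnj]
  have key : ∀ i j, ∀ x ∈ P, ∀ y ∈ P, f^[i] x = f^[j] y ↔ R^[i] (H x) = R^[j] (H y) := by
    intro i j x hx y hy
    rw [gen f hfn, gen R hRn]
    exact comp _ (Nat.mod_lt _ hn) x hx y hy
  have ex : ∀ z, ∃ w, ∀ i, ∀ x ∈ P, f^[i] x = z → w = R^[i] (H x) := by
    intro z
    by_cases h : ∃ i, ∃ x ∈ P, f^[i] x = z
    · obtain ⟨i, x, hx, rfl⟩ := h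
      exact ⟨R^[i] (H x), fun j y hy h => ((key _ _ _ hx _ hy).1 h.symm)⟩
    · push Not at h
      exact ⟨0, fun i x hx h' => absurd h' (h i x hx)⟩
  choose h hh using ex
  have hv : ∀ i, ∀ x ∈ P, h (f^[i] x) = R^[i] (H x) := fun i x hx => hh _ i x hx rfl
  have mem : ∀ z ∈ DD, ∃ i, i < n ∧ ∃ x ∈ P, f^[i] x = z := by
    intro z hz
    rw [fD, mem_iUnion] at hz
    obtain ⟨i, x, hx, hxz⟩ := hz
    exact ⟨i, i.2, x, hx, hxz⟩
  refine ⟨h, ?_, ⟨?_, ?_, ?_⟩, ?_⟩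
  · rw [fD]
    refine LocallyFinite.continuousOn_iUnion (locallyFinite_of_finite _) ?_ ?_
    · intro i
      exact (kP.image (fc.iterate i)).isClosed
    · intro i
      refine factor_continuousOn kP (fc.iterate i).continuousOn ?_
      exact ((Rc.iterate i).comp_continuousOn Hc).congr fun x hx => hv i x hx
  · intro z hz
    obtain ⟨i, hi, x, hx, rfl⟩ := mem z hz
    rw [hv i x hx, RD, mem_iUnion]
    exact ⟨⟨i, hi⟩, H x, Hb.mapsTo hx, rfl⟩
  · intro z hz w hw h
    obtain ⟨i, hi, x, hx, rfl⟩ := mem z hz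
    obtain ⟨j, hj, y, hy, rfl⟩ := mem w hw
    rw [hv i x hx, hv j y hy] at h
    exact (key _ _ _ hx _ hy).2 h
  · intro w hw
    rw [RD, mem_iUnion] at hw
    obtain ⟨i, y, hy, rfl⟩ := hw
    obtain ⟨x, hx, rfl⟩ := Hb.surjOn hy
    refine ⟨f^[i] x, ?_, hv i x hx⟩
    rw [fD, mem_iUnion]
    exact ⟨i, x, hx, rfl⟩
  · intro z hz
    obtain ⟨i, hi, x, hx, rfl⟩ := mem z hz
    rw [hv i x hx, ← Function.iterate_succ_apply' f i x, ← Function.iterate_succ_apply' R i (H x),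
      hv _ x hx]

/-- circular sector -/
def Sec (β : ℝ) : Set ℂ := closedBall 0 1 ∩ {z | 0 ≤ z.im} ∩ {z | (ee (-β) * z).im ≤ 0}

lemma im_pol (ρ θ : ℝ) : ((ρ : ℂ) * ee θ).im = ρ * Real.sin θ := by
  unfold ee
  rw [Complex.im_ofReal_mul, Complex.exp_ofReal_mul_I_im]

lemma ee_mul_pol (ρ θ β : ℝ) : ee β * ((ρ : ℂ) * ee θ) = (ρ : ℂ) * ee (β + θ) := by
  rw [ee_add]; ring

lemma mem_Sec {β : ℝ} (h0 : 0 < β) (h1 : β ≤ Real.pi) {z : ℂ} :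
    z ∈ Sec β ↔ ∃ ρ ∈ Icc (0 : ℝ) 1, ∃ θ ∈ Icc 0 β, z = ρ * ee θ := by
  constructor
  · rintro ⟨⟨a1, a2⟩, a3⟩
    simp only [mem_closedBall_zero_iff, mem_setOf_eq] at a1 a2 a3
    by_cases hz : z = 0
    · exact ⟨0, by norm_num, 0, ⟨le_rfl, h0.le⟩, by simp [hz]⟩
    have hp : 0 < ‖z‖ := norm_pos_iff.2 hz
    have e : z = (‖z‖ : ℂ) * ee z.arg := by
      have := Complex.norm_mul_exp_arg_mul_I z
      simpa [ee] using this.symm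
    refine ⟨‖z‖, ⟨norm_nonneg _, a1⟩, z.arg, ⟨Complex.arg_nonneg_iff.2 a2, ?_⟩, e⟩
    by_contra hc
    push Not at hc
    rw [e, ee_mul_pol, im_pol] at a3
    have := Real.sin_pos_of_pos_of_lt_pi (x := -β + z.arg) (by linarith)
      (by linarith [Complex.arg_le_pi z])
    nlinarith
  · rintro ⟨ρ, hρ, θ, hθ, rfl⟩
    refine ⟨⟨?_, ?_⟩, ?_⟩
    · rw [mem_closedBall_zero_iff, norm_mul, norm_ee, mul_one, Complex.norm_real, Real.norm_eq_abs,
        abs_of_nonneg hρ.1]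
      exact hρ.2
    · simp only [mem_setOf_eq]
      rw [im_pol]
      exact mul_nonneg hρ.1 (Real.sin_nonneg_of_nonneg_of_le_pi hθ.1 (hθ.2.trans h1))
    · simp only [mem_setOf_eq]
      rw [ee_mul_pol, im_pol]
      exact mul_nonpos_of_nonneg_of_nonpos hρ.1
        (Real.sin_nonpos_of_nonpos_of_neg_pi_le (by linarith [hθ.2]) (by linarith [hθ.1]))

lemma Sec_closed (β : ℝ) : IsClosed (Sec β) := by
  refine (isClosed_closedBall.inter (isClosed_le continuous_const Complex.continuous_im)).inter ?_
  exact isClosed_le (Complex.continuous_im.comp (continuous_const.mul continuous_id)) continuous_const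

lemma Sec_bounded (β : ℝ) : Bornology.IsBounded (Sec β) :=
  isBounded_closedBall.subset (inter_subset_left.trans inter_subset_left)

lemma Sec_convex (β : ℝ) : Convex ℝ (Sec β) := by
  refine ((convex_closedBall _ _).inter ?_).inter ?_
  · exact convex_halfSpace_ge Complex.imLm.isLinear 0
  · refine convex_halfSpace_le (f := fun z : ℂ => (ee (-β) * z).im) ⟨?_, ?_⟩ 0
    · intro x y; simp [mul_add] <;> ring
    · intro c x; simp; ring

lemma Sec_interior (β : ℝ) : interior (Sec β) =
    ball 0 1 ∩ {z | 0 < z.im} ∩ {z | (ee (-β) * z).im < 0} := by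
  unfold Sec
  rw [interior_inter, interior_inter, interior_closedBall _ one_ne_zero, Complex.interior_setOf_le_im]
  congr 1
  have := (Homeomorph.mulLeft₀ (ee (-β)) (ee_ne _)).preimage_interior {z | z.im ≤ 0}
  rw [Complex.interior_setOf_im_le] at this
  exact this.symm

lemma Sec_interior_ne {β : ℝ} (h0 : 0 < β) (h1 : β ≤ Real.pi) : (interior (Sec β)).Nonempty := by
  rw [Sec_interior]
  refine ⟨((1 / 2 : ℝ) : ℂ) * ee (β / 2), ⟨?_, ?_⟩, ?_⟩
  · rw [mem_ball_zero_iff, norm_mul, norm_ee, Complex.norm_real]; norm_num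
  · simp only [mem_setOf_eq]
    rw [im_pol]
    have := Real.sin_pos_of_pos_of_lt_pi (x := β / 2) (by linarith) (by linarith)
    linarith
  · simp only [mem_setOf_eq]
    rw [ee_mul_pol, im_pol]
    have := Real.sin_neg_of_neg_of_neg_pi_lt (x := -β + β / 2) (by linarith) (by linarith)
    linarith

lemma ee_zero : ee 0 = 1 := by simp [ee]

lemma Sec_frontier {β : ℝ} (h0 : 0 < β) (h1 : β ≤ Real.pi) : frontier (Sec β) =
    ee '' Icc 0 β ∪ (Complex.ofReal '' Icc 0 1 ∪ (fun x : ℝ => (x : ℂ) * ee β) '' Icc 0 1) := by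
  rw [(Sec_closed β).frontier_eq, Sec_interior]
  ext z
  constructor
  · rintro ⟨hz, hn⟩
    obtain ⟨ρ, hρ, θ, hθ, rfl⟩ := (mem_Sec h0 h1).1 hz
    by_cases e1 : θ = 0
    · right; left; exact ⟨ρ, hρ, by rw [e1, ee_zero, mul_one]⟩
    by_cases e2 : θ = β
    · right; right; exact ⟨ρ, hρ, by rw [e2]⟩
    by_cases e3 : ρ = 0
    · right; left; exact ⟨0, by norm_num, by rw [e3]; simp⟩
    by_cases e4 : ρ = 1
    · left; exact ⟨θ, hθ, by rw [e4]; simp⟩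
    exfalso
    apply hn
    have p1 : 0 < θ := lt_of_le_of_ne hθ.1 (Ne.symm e1)
    have p2 : θ < β := lt_of_le_of_ne hθ.2 e2
    have p3 : 0 < ρ := lt_of_le_of_ne hρ.1 (Ne.symm e3)
    have p4 : ρ < 1 := lt_of_le_of_ne hρ.2 e4
    refine ⟨⟨?_, ?_⟩, ?_⟩
    · rw [mem_ball_zero_iff, norm_mul, norm_ee, mul_one, Complex.norm_real, Real.norm_eq_abs,
        abs_of_pos p3]
      exact p4
    · simp only [mem_setOf_eq]
      rw [im_pol]
      exact mul_pos p3 (Real.sin_pos_of_pos_of_lt_pi p1 (by linarith))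
    · simp only [mem_setOf_eq]
      rw [ee_mul_pol, im_pol]
      exact mul_neg_of_pos_of_neg p3
        (Real.sin_neg_of_neg_of_neg_pi_lt (by linarith) (by linarith))
  · rintro (⟨θ, hθ, rfl⟩ | ⟨x, hx, rfl⟩ | ⟨x, hx, rfl⟩)
    · refine ⟨(mem_Sec h0 h1).2 ⟨1, by norm_num, θ, hθ, by simp⟩, fun h => ?_⟩
      have := h.1.1
      rw [mem_ball_zero_iff, norm_ee] at this
      exact lt_irrefl _ this
    · refine ⟨(mem_Sec h0 h1).2 ⟨x, hx, 0, ⟨le_rfl, h0.le⟩, by simp [ee_zero]⟩, fun h => ?_⟩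
      have := h.1.2
      simp at this
    · refine ⟨(mem_Sec h0 h1).2 ⟨x, hx, β, ⟨h0.le, le_rfl⟩, rfl⟩, fun h => ?_⟩
      have := h.2
      simp only [mem_setOf_eq] at this
      rw [ee_mul_pol, im_pol] at this
      simp at this

/-- an involution equal to complex conjugation outside the open unit disc -/
structure RefMap (f : ℂ → ℂ) : Prop where
  cont : Continuous f
  inv : ∀ z, f (f z) = z
  out : ∀ z, 1 ≤ ‖z‖ → f z = (starRingEnd ℂ) z

lemma RefMap.inj {f : ℂ → ℂ} (H : RefMap f) : Function.Injective f := fun a b h => by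
  rw [← H.inv a, ← H.inv b, h]

lemma RefMap.disc {f : ℂ → ℂ} (H : RefMap f) {z : ℂ} (hz : ‖z‖ < 1) : ‖f z‖ < 1 := by
  by_contra h
  push Not at h
  have := H.out _ h
  rw [H.inv] at this
  rw [this, RCLike.norm_conj] at hz
  linarith

lemma RefMap.norm {f : ℂ → ℂ} (H : RefMap f) {z : ℂ} (hz : 1 ≤ ‖z‖) : ‖f z‖ = ‖z‖ := by
  rw [H.out z hz, RCLike.norm_conj]

lemma punct_preconn (p : ℂ) (ρ : ℝ) : IsPreconnected (closedBall p ρ \ {p}) := by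
  have : closedBall p ρ \ {p} = (fun q : ℝ × ℝ => p + pol q) '' (Ioc 0 ρ ×ˢ univ) := by
    ext z
    constructor
    · rintro ⟨h1, h2⟩
      rw [mem_closedBall, dist_eq_norm] at h1
      refine ⟨(‖z - p‖, (z - p).arg), ⟨⟨norm_pos_iff.2 (sub_ne_zero.2 h2), h1⟩, mem_univ _⟩, ?_⟩
      simp only [pol]
      rw [Complex.norm_mul_exp_arg_mul_I]
      ring
    · rintro ⟨⟨r, t⟩, ⟨h1, -⟩, rfl⟩
      have e : ‖pol (r, t)‖ = r := norm_pol h1.1.le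
      refine ⟨?_, ?_⟩
      · rw [mem_closedBall, dist_eq_norm, add_sub_cancel_left, e]; exact h1.2
      · intro h
        have h' : p + pol (r, t) = p := h
        have : pol (r, t) = 0 := by simpa using h'
        rw [this, norm_zero] at e
        exact absurd h1.1 (by rw [← e]; exact lt_irrefl _)
  rw [this]
  exact (isPreconnected_Ioc.prod isPreconnected_univ).image _
    (continuous_const.add continuous_pol).continuousOn

lemma RefMap.log_aux {f : ℂ → ℂ} (H : RefMap f) {p : ℂ} (hp : f p = p) {ρ : ℝ}
    (hρ : 2 * ‖p‖ + 1 < ρ) : HasLog (fun z => (z - p) * (f z - p)) (closedBall p ρ \ {p}) := by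
  have hp0 := norm_nonneg p
  have hρ0 : 0 < ρ := by linarith
  have hfc := H.cont
  have hne : (ρ : ℂ) ≠ 0 := by exact_mod_cast hρ0.ne'
  have A := hasLog_punctured (h := fun w => (ρ * w) * (f (p + ρ * w) - p)) (by fun_prop) (by
      rintro w ⟨-, hw⟩
      have hw' : w ≠ 0 := hw
      refine mul_ne_zero (mul_ne_zero hne hw') fun h => ?_
      have h1 : f (p + ρ * w) = f p := by rw [hp]; linear_combination h
      have h2 := H.inj h1
      have h3 : (ρ : ℂ) * w = 0 := by linear_combination h2
      exact mul_ne_zero hne hw' h3) (by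
      refine hasLog_of_slit (by fun_prop) fun w hw => ?_
      rw [mem_sphere_zero_iff_norm] at hw
      have n1 : ‖(ρ : ℂ) * w‖ = ρ := by
        rw [norm_mul, hw, Complex.norm_real, Real.norm_eq_abs, abs_of_pos hρ0, mul_one]
      have n2 : 1 ≤ ‖p + ρ * w‖ := by
        have := norm_sub_norm_le ((ρ : ℂ) * w) (-p)
        rw [n1, norm_neg, sub_neg_eq_add, add_comm] at this
        linarith
      rw [H.out _ n2]
      left
      have hww : w * (starRingEnd ℂ) w = 1 := by
        rw [Complex.mul_conj, Complex.normSq_eq_norm_sq, hw]; simp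
      have e : (ρ : ℂ) * w * ((starRingEnd ℂ) (p + ρ * w) - p) =
          (ρ ^ 2 : ℝ) + (ρ * w) * ((starRingEnd ℂ) p - p) := by
        simp only [map_add, map_mul, Complex.conj_ofReal]
        push_cast
        linear_combination (ρ : ℂ) ^ 2 * hww
      rw [e, Complex.add_re, Complex.ofReal_re]
      have b1 := Complex.abs_re_le_norm ((ρ * w) * ((starRingEnd ℂ) p - p))
      have b2 : ‖(ρ * w) * ((starRingEnd ℂ) p - p)‖ ≤ ρ * (2 * ‖p‖) := by
        rw [norm_mul, n1]
        have := norm_sub_le ((starRingEnd ℂ) p) p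
        rw [RCLike.norm_conj] at this
        nlinarith
      have b3 := neg_abs_le ((ρ * w) * ((starRingEnd ℂ) p - p)).re
      nlinarith)
  refine (A.comp (g := fun z => (z - p) / ρ) (K' := closedBall p ρ \ {p}) ?_ ?_).congr ?_
  · exact ((continuous_id.sub continuous_const).div_const _).continuousOn
  · rintro z ⟨h1, h2⟩
    rw [mem_closedBall, dist_eq_norm] at h1
    refine ⟨?_, ?_⟩
    · rw [mem_closedBall_zero_iff, norm_div, Complex.norm_real, Real.norm_eq_abs, abs_of_pos hρ0,
        div_le_one hρ0]
      exact h1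
    · intro h
      have h' : (z - p) / ρ = 0 := h
      rw [div_eq_zero_iff] at h'
      rcases h' with h' | h'
      · exact h2 (sub_eq_zero.1 h')
      · exact hne h'
  · intro z _
    beta_reduce
    have : (ρ : ℂ) * ((z - p) / ρ) = z - p := by field_simp
    rw [this, add_sub_cancel]

/-- `h` times its reflection has a symmetric logarithm -/
def SymLog (f h : ℂ → ℂ) (K : Set ℂ) : Prop := ∃ L : ℂ → ℂ, ContinuousOn L K ∧
  (∀ z ∈ K, h z * h (f z) = Complex.exp (L z)) ∧ ∀ z ∈ K, L (f z) = L z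

lemma SymLog.mul {f h h' : ℂ → ℂ} {K : Set ℂ} (H : SymLog f h K) (H' : SymLog f h' K) :
    SymLog f (fun z => h z * h' z) K := by
  obtain ⟨L, a, b, c⟩ := H
  obtain ⟨L', a', b', c'⟩ := H'
  refine ⟨fun z => L z + L' z, a.add a', fun z hz => ?_, fun z hz => ?_⟩
  · beta_reduce
    rw [Complex.exp_add, ← b z hz, ← b' z hz]; ring
  · beta_reduce; rw [c z hz, c' z hz]

lemma SymLog.zpow {f h : ℂ → ℂ} {K : Set ℂ} (H : SymLog f h K) (k : ℤ) :
    SymLog f (fun z => h z ^ k) K := by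
  obtain ⟨L, a, b, c⟩ := H
  refine ⟨fun z => k * L z, continuousOn_const.mul a, fun z hz => ?_, fun z hz => ?_⟩
  · beta_reduce
    rw [Complex.exp_int_mul, ← b z hz, mul_zpow]
  · beta_reduce; rw [c z hz]

lemma SymLog.of_log {f h : ℂ → ℂ} {K : Set ℂ} (hf : Continuous f) (hi : ∀ z, f (f z) = z)
    (hm : MapsTo f K K) (H : HasLog h K) : SymLog f h K := by
  obtain ⟨L, a, b⟩ := H
  refine ⟨fun z => L z + L (f z), a.add (a.comp hf.continuousOn hm), fun z hz => ?_, fun z hz => ?_⟩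
  · beta_reduce
    rw [Complex.exp_add, ← b z hz, ← b _ (hm hz)]
  · beta_reduce; rw [hi, add_comm]

lemma SymLog.congr {f h h' : ℂ → ℂ} {K : Set ℂ} (hm : MapsTo f K K) (H : SymLog f h K)
    (e : ∀ z ∈ K, h' z = h z) : SymLog f h' K := by
  obtain ⟨L, a, b, c⟩ := H
  exact ⟨L, a, fun z hz => by rw [e z hz, e _ (hm hz)]; exact b z hz, c⟩

lemma RefMap.symLog_fix {f : ℂ → ℂ} (H : RefMap f) {K : Set ℂ} (hK : IsCompact K)
    (hm : MapsTo f K K) {p : ℂ} (hp : f p = p) (hpK : p ∉ K) : SymLog f (fun z => z - p) K := by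
  obtain ⟨ρ₁, h1⟩ := (hK.isBounded.union (isBounded_closedBall (x := p) (r := 2 * ‖p‖ + 3))).subset_closedBall p
  obtain ⟨ρ₂', h2'⟩ := (((isCompact_closedBall p ρ₁).image H.cont).isBounded.union
    (isBounded_closedBall (x := p) (r := ρ₁))).subset_closedBall p
  set ρ₂ := max ρ₂' (2 * ‖p‖ + 2) with hρ₂
  have h2 := h2'.trans (closedBall_subset_closedBall (le_max_left ρ₂' (2 * ‖p‖ + 2)))
  have hlog := H.log_aux hp (ρ := ρ₂) (by linarith [le_max_right ρ₂' (2 * ‖p‖ + 2)])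
  obtain ⟨L, Lc, Le⟩ := hlog
  beta_reduce at Le
  have s1 : closedBall p ρ₁ \ {p} ⊆ closedBall p ρ₂ \ {p} :=
    sdiff_subset_sdiff_left (subset_union_right.trans h2)
  have m1 : MapsTo f (closedBall p ρ₁ \ {p}) (closedBall p ρ₂ \ {p}) := by
    rintro z ⟨a, b⟩
    refine ⟨h2 (Or.inl ⟨z, a, rfl⟩), fun h => b ?_⟩
    have : f z = f p := by rw [hp]; exact h
    exact H.inj this
  obtain ⟨n, hn⟩ := log_diff_const (L₁ := fun z => L (f z)) (L₂ := L) (punct_preconn p ρ₁)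
    (Lc.comp H.cont.continuousOn m1) (Lc.mono s1) (fun z hz => by
      rw [← Le z (s1 hz), ← Le _ (m1 hz), H.inv]; ring)
  set x0 : ℂ := ((‖p‖ + 2 : ℝ) : ℂ) with hx0
  have nx : ‖x0‖ = ‖p‖ + 2 := by
    rw [hx0, Complex.norm_real, Real.norm_eq_abs, abs_of_nonneg (by positivity)]
  have fx : f x0 = x0 := by
    rw [H.out _ (by rw [nx]; linarith [norm_nonneg p]), hx0, Complex.conj_ofReal]
  have mx : x0 ∈ closedBall p ρ₁ \ {p} := by
    refine ⟨h1 (Or.inr ?_), fun h => ?_⟩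
    · rw [mem_closedBall, dist_eq_norm]
      have := norm_sub_le x0 p
      linarith
    · have h' : x0 = p := h
      rw [h'] at nx; linarith
  have hn0 := hn x0 mx
  beta_reduce at hn0
  rw [fx] at hn0
  have hz0 : (n : ℂ) * (2 * Real.pi * Complex.I) = 0 := by linear_combination -hn0
  have sK : K ⊆ closedBall p ρ₁ \ {p} := fun z hz => ⟨h1 (Or.inl hz), fun h => by
    have h' : z = p := h
    exact hpK (h' ▸ hz)⟩
  refine ⟨L, Lc.mono (sK.trans s1), fun z hz => Le z (s1 (sK hz)), fun z hz => ?_⟩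
  have := hn z (sK hz)
  beta_reduce at this
  rw [this, hz0, add_zero]

/-- a point and its mirror image are separated by the fixed point set -/
theorem RefMap.sep {f : ℂ → ℂ} (H : RefMap f) {C : Set ℂ} (hC : IsCompact C) (pC : IsPreconnected C)
    {x : ℂ} (hx : x ∈ C) (hfx : f x ∈ C) (hCE : ∀ z ∈ C, f z ≠ z) : False := by
  set s : ℂ → ℂ := fun z => z - f z with hs
  have sc : Continuous s := continuous_id.sub H.cont
  have sf : ∀ z, s (f z) = - s z := fun z => by simp only [hs, H.inv]; ring
  obtain ⟨z0, hz0, hmin⟩ := hC.exists_isMinOn ⟨x, hx⟩ (sc.norm.continuousOn)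
  set ε := ‖s z0‖ with hε
  have hεp : 0 < ε := norm_pos_iff.2 (sub_ne_zero.2 (Ne.symm (hCE z0 hz0)))
  have hCε : ∀ z ∈ C, ε ≤ ‖s z‖ := fun z hz => hmin hz
  obtain ⟨R', hR'⟩ := hC.isBounded.subset_closedBall 0
  set R := max R' 1 with hR
  have hR1 : 1 ≤ R := le_max_right _ _
  have hCR : C ⊆ closedBall 0 R := hR'.trans (closedBall_subset_closedBall (le_max_left _ _))
  set V : Set ℂ := {z | ‖s z‖ < ε} with hV
  have oV : IsOpen V := isOpen_lt sc.norm continuous_const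
  have eV : ∀ e, f e = e → e ∈ V := fun e he => by
    simp only [hV, hs, mem_setOf_eq, he, sub_self, norm_zero]; exact hεp
  set G : Set ℂ := ⋃ e ∈ {e : ℂ | f e = e}, connectedComponentIn V e with hG
  have oG : IsOpen G := isOpen_biUnion fun e _ => oV.connectedComponentIn
  have fG : ∀ z, z ∈ G → f z ∈ G := by
    intro z hz
    simp only [hG, mem_iUnion] at hz ⊢
    obtain ⟨e, he, hze⟩ := hz
    refine ⟨e, he, ?_⟩
    have he' : f e = e := he
    have : IsPreconnected (f '' connectedComponentIn V e) :=
      isPreconnected_connectedComponentIn.image _ H.cont.continuousOn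
    refine this.subset_connectedComponentIn ⟨e, mem_connectedComponentIn (eV e he'), he'⟩ ?_ ⟨z, hze, rfl⟩
    rintro _ ⟨w, hw, rfl⟩
    have := connectedComponentIn_subset _ _ hw
    simp only [hV, mem_setOf_eq] at this ⊢
    rwa [sf, norm_neg]
  have GV : G ⊆ V := iUnion₂_subset fun e _ => connectedComponentIn_subset _ _
  set K : Set ℂ := closedBall 0 R \ G with hK
  have kK : IsCompact K := (isCompact_closedBall 0 R).diff oG
  have mK : MapsTo f K K := by
    rintro z ⟨h1, h2⟩
    refine ⟨?_, fun h => h2 ?_⟩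
    · rw [mem_closedBall_zero_iff] at h1 ⊢
      by_cases hz : 1 ≤ ‖z‖
      · rwa [H.norm hz]
      · push Not at hz
        linarith [H.disc hz]
    · have := fG _ h
      rwa [H.inv] at this
  have CK : C ⊆ K := fun z hz => ⟨hCR hz, fun h => by
    have := GV h
    simp only [hV, mem_setOf_eq] at this
    linarith [hCε z hz]⟩
  have EK : ∀ e, f e = e → e ∉ K := fun e he h => h.2 (by
    simp only [hG, mem_iUnion]
    exact ⟨e, he, mem_connectedComponentIn (eV e he)⟩)
  have s0 : ∀ z ∈ K, s z ≠ 0 := fun z hz h => EK z (sub_eq_zero.1 h).symm hz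
  have hsym : ∀ p ∈ Kᶜ, SymLog f (fun z => z - p) K := by
    intro p hp
    obtain ⟨e, he, hne⟩ : ∃ e, f e = e ∧ NSep K p e := by
      by_cases hpR : R < ‖p‖
      · refine ⟨((R + 1 : ℝ) : ℂ), ?_, ?_⟩
        · rw [H.out, Complex.conj_ofReal]
          rw [Complex.norm_real, Real.norm_eq_abs, abs_of_pos (by linarith)]; linarith
        · refine NSep.of_preconn (isPreconnected_far (R := R) (by linarith)) ?_ hpR ?_
          · intro z hz h
            have := mem_closedBall_zero_iff.1 h.1
            simp only [mem_setOf_eq] at hz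
            linarith
          · simp only [mem_setOf_eq]
            rw [Complex.norm_real, Real.norm_eq_abs, abs_of_pos (by linarith)]; linarith
      · push Not at hpR
        have hpG : p ∈ G := by
          by_contra h
          exact hp ⟨mem_closedBall_zero_iff.2 hpR, h⟩
        have hpG' := hpG
        simp only [hG, mem_iUnion] at hpG
        obtain ⟨e, he, hpe⟩ := hpG
        refine ⟨e, he, NSep.of_preconn (C := connectedComponentIn V e)
          isPreconnected_connectedComponentIn ?_ hpe (mem_connectedComponentIn (eV e he))⟩
        intro z hz h
        refine h.2 ?_
        simp only [hG, mem_iUnion]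
        exact ⟨e, he, hz⟩
    have a1 := SymLog.of_log H.cont H.inv mK (hne.hasLog kK.isClosed)
    have a2 := H.symLog_fix kK mK he (EK e he)
    refine SymLog.congr mK (a1.mul a2) fun z hz => ?_
    have : z - e ≠ 0 := sub_ne_zero.2 fun h => EK e he (h ▸ hz)
    field_simp
  obtain ⟨r, hr, hlog⟩ := factorization kK sc.continuousOn s0
  have hr0 : ∀ z ∈ K, r z ≠ 0 := by
    intro z hz h
    have := hlog.ne_zero hz
    beta_reduce at this
    rw [h, mul_zero] at this
    exact this rfl
  have hrs : SymLog f r K := by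
    clear hlog hr0
    induction hr with
    | one => exact ⟨fun _ => 0, continuousOn_const, fun z _ => by simp, fun z _ => rfl⟩
    | mul r p k _ hp ih => exact ih.mul ((hsym p hp).zpow k)
  have hss : SymLog f s K := by
    have := (SymLog.of_log H.cont H.inv mK hlog).mul (hrs.zpow (-1))
    refine SymLog.congr mK this fun z hz => ?_
    have := hr0 z hz
    rw [zpow_neg_one]
    field_simp
  obtain ⟨L, Lc, Le, Li⟩ := hss
  -- the function `s / exp (L / 2)` has square `-1`
  set σ : ℂ → ℂ := fun z => s z / Complex.exp (L z / 2) with hσ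
  have σc : ContinuousOn σ C := by
    refine (sc.continuousOn).div ?_ fun z _ => Complex.exp_ne_zero _
    exact ((Lc.mono CK).div_const 2).cexp
  have σ2 : ∀ z ∈ C, σ z = Complex.I ∨ σ z = -Complex.I := by
    intro z hz
    have e1 := Le z (CK hz)
    rw [sf] at e1
    have e2 : Complex.exp (L z / 2) ^ 2 = Complex.exp (L z) := by
      rw [← Complex.exp_nat_mul]; congr 1; push_cast; ring
    have e3 : σ z ^ 2 = Complex.I ^ 2 := by
      simp only [hσ]
      rw [div_pow, e2, ← e1, Complex.I_sq]
      have := s0 z (CK hz)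
      field_simp
    exact sq_eq_sq_iff_eq_or_eq_neg.1 e3
  have σf : σ (f x) = - σ x := by
    simp only [hσ]
    rw [sf, Li x (CK hx), neg_div]
  have ic : ContinuousOn (fun z => (σ z).im) C := Complex.continuous_im.comp_continuousOn σc
  have hoc := (pC.image _ ic).ordConnected
  have key : ∀ u ∈ C, ∀ v ∈ C, (σ u).im ≤ 0 → 0 ≤ (σ v).im → False := by
    intro u hu v hv h1 h2
    obtain ⟨w, hw, hw0⟩ := hoc.out ⟨u, hu, rfl⟩ ⟨v, hv, rfl⟩ ⟨h1, h2⟩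
    beta_reduce at hw0
    rcases σ2 w hw with h | h <;> rw [h] at hw0 <;> simp at hw0
  rcases le_total (σ x).im 0 with h | h
  · exact key x hx (f x) hfx h (by rw [σf]; simpa using h)
  · exact key (f x) hfx x hx (by rw [σf]; simpa using h) h

/-- the upper domain of a reflection -/
structure RefDom (f : ℂ → ℂ) (U : Set ℂ) : Prop where
  oU : IsOpen U
  pU : IsPreconnected U
  nU : U.Nonempty
  bU : U ⊆ ball 0 1
  dis : ∀ z ∈ U, f z ∉ U
  col : ∀ θ ∈ Ioo 0 Real.pi, ∃ ε > 0, ball (ee θ) ε ∩ ball 0 1 ⊆ U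
  fr : ∀ z ∈ frontier U, z ∈ ball (0 : ℂ) 1 → f z = z
  all : ∀ z ∈ ball (0 : ℂ) 1, f z ≠ z → z ∈ U ∨ f z ∈ U

lemma ee_conj_ne {θ : ℝ} (h : θ ∈ Ioo 0 Real.pi) : (starRingEnd ℂ) (ee θ) ≠ ee θ := by
  intro h'
  have := congrArg Complex.im h'
  rw [Complex.conj_im] at this
  have e : (ee θ).im = Real.sin θ := by
    have := im_pol 1 θ
    simpa using this
  rw [e] at this
  have := Real.sin_pos_of_pos_of_lt_pi h.1 h.2
  linarith

lemma RefMap.exists_dom {f : ℂ → ℂ} (H : RefMap f) : ∃ U, RefDom f U := by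
  set E : Set ℂ := {z | f z = z} with hE
  have cE : IsClosed E := isClosed_eq H.cont continuous_id
  have h1E : (1 : ℂ) ∈ E := by simp only [hE, mem_setOf_eq]; rw [H.out 1 (by simp)]; simp
  have fee : ∀ θ, f (ee θ) = (starRingEnd ℂ) (ee θ) := fun θ => H.out _ (by rw [norm_ee])
  obtain ⟨n, hn, hcol⟩ := collar cE ⟨1, h1E⟩ Real.pi_pos (fun θ hθ h => ee_conj_ne hθ (by
    rw [← fee]; exact h))
  set B : Set ℂ := ball 0 1 \ E with hB
  have oB : IsOpen B := isOpen_ball.sdiff cE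
  set U := connectedComponentIn B n with hU
  have oU : IsOpen U := oB.connectedComponentIn
  have pU : IsPreconnected U := isPreconnected_connectedComponentIn
  have UB : U ⊆ B := connectedComponentIn_subset _ _
  have dis : ∀ z ∈ U, f z ∉ U := by
    intro z hz hfz
    have : IsPathConnected U := (oU.isConnected_iff_isPathConnected).1 ⟨⟨z, hz⟩, pU⟩
    obtain ⟨γ, hγ⟩ := this.joinedIn z hz (f z) hfz
    refine H.sep (C := range γ) (isCompact_range γ.continuous) (isPreconnected_range γ.continuous)
      ⟨0, γ.source⟩ ⟨1, γ.target⟩ ?_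
    rintro _ ⟨t, rfl⟩
    exact (UB (hγ t)).2
  have fB : ∀ z ∈ B, f z ∈ B := by
    rintro z ⟨h1, h2⟩
    refine ⟨mem_ball_zero_iff.2 (H.disc (mem_ball_zero_iff.1 h1)), fun h => h2 ?_⟩
    exact H.inj h
  have frE : ∀ z ∈ frontier U, z ∈ ball (0 : ℂ) 1 → f z = z := by
    intro z hz hzb
    have := frontier_comp_subset oB n hz
    by_contra h
    exact this ⟨hzb, h⟩
  refine ⟨U, oU, pU, ⟨n, mem_connectedComponentIn hn⟩, UB.trans sdiff_subset, dis, hcol, frE, ?_⟩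
  intro z hzb hzE
  by_contra hcon
  push Not at hcon
  have hzB : z ∈ B := ⟨hzb, hzE⟩
  set V := connectedComponentIn B z with hV
  have oV : IsOpen V := oB.connectedComponentIn
  have pV : IsPreconnected V := isPreconnected_connectedComponentIn
  have VB : V ⊆ B := connectedComponentIn_subset _ _
  have zV : z ∈ V := mem_connectedComponentIn hzB
  have VU : ∀ w ∈ V, w ∉ U := by
    intro w hw hwU
    apply hcon.1
    rw [hU, connectedComponentIn_eq hwU, ← connectedComponentIn_eq hw]
    exact zV
  have VU' : ∀ w ∈ V, f w ∉ U := by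
    intro w hw hwU
    apply hcon.2
    have : IsPreconnected (f '' V) := pV.image _ H.cont.continuousOn
    have h2 := this.subset_connectedComponentIn ⟨w, hw, rfl⟩ (by
      rintro _ ⟨v, hv, rfl⟩; exact fB v (VB hv))
    rw [hU, connectedComponentIn_eq hwU]
    exact h2 ⟨z, zV, rfl⟩
  have clV : ∀ w ∈ closure V, w ∉ V → f w = w := by
    intro w hw hwV
    have hwb : w ∈ closedBall (0 : ℂ) 1 :=
      closure_minimal (VB.trans (sdiff_subset.trans ball_subset_closedBall)) isClosed_closedBall hw
    have hfr : w ∈ frontier V := by rw [oV.frontier_eq]; exact ⟨hw, hwV⟩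
    by_cases hw1 : w ∈ ball (0 : ℂ) 1
    · have := frontier_comp_subset oB z hfr
      by_contra h
      exact this ⟨hw1, h⟩
    have hwn : ‖w‖ = 1 := by
      rw [mem_closedBall_zero_iff] at hwb
      rw [mem_ball_zero_iff] at hw1
      linarith
    obtain ⟨θ, hθ, rfl⟩ := exists_ee (-Real.pi) hwn
    by_cases e1 : θ = -Real.pi
    · rw [fee, conj_ee, e1, ← ee_per (-Real.pi)]; congr 1; ring
    by_cases e2 : θ = 0
    · rw [fee, conj_ee, e2, neg_zero]
    exfalso
    rcases lt_or_gt_of_ne e2 with h0 | h0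
    · obtain ⟨ε, hε, hs⟩ := hcol (-θ) ⟨by linarith, by
        have := lt_of_le_of_ne hθ.1 (Ne.symm e1); linarith⟩
      have hft : f (ee θ) = ee (-θ) := by rw [fee, conj_ee]
      have hnb : f ⁻¹' (ball (ee (-θ)) ε) ∈ 𝓝 (ee θ) := by
        apply H.cont.continuousAt
        rw [hft]; exact ball_mem_nhds _ hε
      obtain ⟨v, hv1, hv2⟩ := mem_closure_iff_nhds.1 hw _ hnb
      exact VU' v hv2 (hs ⟨hv1, (fB v (VB hv2)).1⟩)
    · obtain ⟨ε, hε, hs⟩ := hcol θ ⟨h0, by linarith [hθ.2]⟩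
      obtain ⟨v, hv1, hv2⟩ := mem_closure_iff_nhds.1 hw _ (ball_mem_nhds _ hε)
      exact VU v hv2 (hs ⟨hv1, (VB hv2).1⟩)
  classical
  set W : Set ℂ := V ∪ f ⁻¹' V with hW
  have oW : IsOpen W := oV.union (oV.preimage H.cont)
  have fW : ∀ w ∈ W, f w ∈ W := by
    rintro w (h | h)
    · right; simp only [mem_preimage, H.inv]; exact h
    · left; exact h
  have hgc : Continuous (fun w => if w ∈ W then f w else w) := by
    refine Continuous.if ?_ H.cont continuous_id
    intro w hw
    change w ∈ frontier W at hw
    rw [oW.frontier_eq] at hw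
    obtain ⟨h1, h2⟩ := hw
    rw [hW, closure_union] at h1
    rcases h1 with h1 | h1
    · exact clV w h1 fun h => h2 (Or.inl h)
    · have h3 : f w ∈ closure V := by
        have := closure_minimal (s := f ⁻¹' V) (t := f ⁻¹' closure V)
          (preimage_mono subset_closure) (isClosed_closure.preimage H.cont) h1
        exact this
      have := clV _ h3 fun h => h2 (Or.inr h)
      exact H.inj this
  have := trivial_of_id_outside hgc (n := 2) (by norm_num) (fun w => by
    change (fun w => if w ∈ W then f w else w) ((fun w => if w ∈ W then f w else w) w) = w
    beta_reduce
    by_cases h : w ∈ W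
    · rw [if_pos h, if_pos (fW w h), H.inv]
    · rw [if_neg h, if_neg h]) (fun w hw => by
    refine if_neg ?_
    rintro (h | h)
    · have := mem_ball_zero_iff.1 (VB h).1; linarith
    · have := mem_ball_zero_iff.1 (VB h).1
      rw [H.norm hw] at this; linarith) z
  rw [if_pos (show z ∈ W from Or.inl zV)] at this
  exact hzE this

lemma ee_pi : ee Real.pi = -1 := by unfold ee; exact Complex.exp_pi_mul_I

lemma ee_im (θ : ℝ) : (ee θ).im = Real.sin θ := by
  have := im_pol 1 θ
  simpa using this

lemma sphere_ee : sphere (0 : ℂ) 1 = ee '' Icc 0 (2 * Real.pi) := by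
  ext z
  rw [mem_sphere_zero_iff_norm]
  constructor
  · intro h
    obtain ⟨t, h1, h2⟩ := exists_ee 0 h
    exact ⟨t, ⟨h1.1, by linarith [h1.2]⟩, h2⟩
  · rintro ⟨t, _, rfl⟩; exact norm_ee t

lemma sphere_LC : LC (sphere (0 : ℂ) 1) := by
  rw [sphere_ee]
  exact LC_image isCompact_Icc (convex_Icc _ _) continuous_ee.continuousOn

lemma sphere_preconn : IsPreconnected (sphere (0 : ℂ) 1) := by
  rw [sphere_ee]
  exact isPreconnected_Icc.image _ continuous_ee.continuousOn

lemma ext_preconn {a : ℂ} (ha : ‖a‖ ≤ 1) : IsPreconnected ({z : ℂ | 1 ≤ ‖z‖} \ {a}) := by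
  have h : closure {z : ℂ | 1 < ‖z‖} = {z : ℂ | 1 ≤ ‖z‖} := by
    have e1 : {z : ℂ | 1 < ‖z‖} = (closedBall (0 : ℂ) 1)ᶜ := by ext z; simp
    rw [e1, closure_compl, interior_closedBall _ one_ne_zero]
    ext z; simp
  refine (isPreconnected_far one_pos).subset_closure ?_ (by rw [h]; exact sdiff_subset)
  intro z hz
  refine ⟨(show 1 ≤ ‖z‖ from (show 1 < ‖z‖ from hz).le), fun h' => ?_⟩
  have h'' : z = a := h'
  rw [h''] at hz
  simp only [mem_setOf_eq] at hz
  linarith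

lemma mem_Sec_pi {z : ℂ} : z ∈ Sec Real.pi ↔ ‖z‖ ≤ 1 ∧ 0 ≤ z.im := by
  have e : ee (-Real.pi) = -1 := by rw [← conj_ee, ee_pi]; simp
  unfold Sec
  rw [e]
  simp only [mem_inter_iff, mem_closedBall_zero_iff, mem_setOf_eq, neg_mul, one_mul,
    Complex.neg_im, Left.neg_nonpos_iff, and_assoc, and_self]

lemma MonoArc.of_inj {κ : ℝ → ℂ} {a b : ℝ} (hc : ContinuousOn κ (Icc a b)) (hi : InjOn κ (Icc a b)) :
    MonoArc κ a b := by
  refine ⟨hc, fun s t hs hst ht h w hw => ?_⟩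
  have := hi ⟨hs, hst.trans ht⟩ ⟨hs.trans hst, ht⟩ h
  have : w = s := le_antisymm (by rw [this]; exact hw.2) hw.1
  rw [this]

theorem RefMap.good {f : ℂ → ℂ} (H : RefMap f) : Good f := by
  obtain ⟨U, D⟩ := H.exists_dom
  have hpi := Real.pi_pos
  have oU := D.oU
  have fee : ∀ θ, f (ee θ) = ee (-θ) := fun θ => by rw [H.out _ (by rw [norm_ee]), conj_ee]
  have f1 : f 1 = 1 := by rw [H.out 1 (by simp)]; simp
  have fm1 : f (-1) = -1 := by rw [H.out (-1) (by simp)]; simp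
  have ofU : IsOpen (f ⁻¹' U) := oU.preimage H.cont
  have clb : closure U ⊆ closedBall 0 1 :=
    closure_minimal (D.bU.trans ball_subset_closedBall) isClosed_closedBall
  -- closure of U does not meet the mirror domain
  have dis' : ∀ z ∈ closure U, f z ∉ U := by
    intro z hz hfz
    obtain ⟨v, hv1, hv2⟩ := mem_closure_iff_nhds.1 hz _ (ofU.mem_nhds hfz)
    exact D.dis v hv2 hv1
  have cls : ∀ z ∈ closure U, z ∉ ball (0 : ℂ) 1 → z ∈ ee '' Icc 0 Real.pi := by
    intro z hz hzb
    have hwn : ‖z‖ = 1 := by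
      have h1 := mem_closedBall_zero_iff.1 (clb hz)
      rw [mem_ball_zero_iff] at hzb
      linarith
    obtain ⟨θ, hθ, rfl⟩ := exists_ee (-Real.pi) hwn
    by_cases e1 : θ = -Real.pi
    · refine ⟨Real.pi, ⟨hpi.le, le_rfl⟩, ?_⟩
      rw [e1, ← ee_per (-Real.pi)]; congr 1; ring
    rcases le_or_gt 0 θ with h0 | h0
    · exact ⟨θ, ⟨h0, by linarith [hθ.2]⟩, rfl⟩
    exfalso
    obtain ⟨ε, hε, hs⟩ := D.col (-θ) ⟨by linarith, by
      have := lt_of_le_of_ne hθ.1 (Ne.symm e1); linarith⟩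
    have hnb : f ⁻¹' (ball (ee (-θ)) ε) ∈ 𝓝 (ee θ) := by
      apply H.cont.continuousAt
      rw [fee]; exact ball_mem_nhds _ hε
    obtain ⟨v, hv1, hv2⟩ := mem_closure_iff_nhds.1 hz _ hnb
    exact D.dis v hv2 (hs ⟨hv1, mem_ball_zero_iff.2 (H.disc (mem_ball_zero_iff.1 (D.bU hv2)))⟩)
  have colcl : ∀ a ∈ closedBall (0 : ℂ) 1, ∀ O : Set ℂ, IsOpen O → a ∈ O → O ∩ ball 0 1 ⊆ U →
      a ∈ closure U := by
    intro a ha O oO haO hs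
    rw [mem_closure_iff_nhds]
    intro N hN
    have h2 : a ∈ closure (ball (0 : ℂ) 1) := by rw [closure_ball _ one_ne_zero]; exact ha
    obtain ⟨v, ⟨hv1, hv2⟩, hv3⟩ := mem_closure_iff_nhds.1 h2 _ (inter_mem hN (oO.mem_nhds haO))
    exact ⟨v, hv1, hs ⟨hv2, hv3⟩⟩
  have arcl : ∀ θ ∈ Icc 0 Real.pi, ee θ ∈ closure U := by
    have h1 : MapsTo ee (Ioo 0 Real.pi) (closure U) := by
      intro θ hθ
      obtain ⟨ε, hε, hs⟩ := D.col θ hθ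
      exact colcl _ (by rw [mem_closedBall_zero_iff, norm_ee]) _ isOpen_ball (mem_ball_self hε) hs
    have h2 := h1.closure continuous_ee
    rw [closure_Ioo hpi.ne, closure_closure] at h2
    exact h2
  have neeU : ∀ θ, ee θ ∉ U := fun θ h => by
    have := mem_ball_zero_iff.1 (D.bU h)
    rw [norm_ee] at this; exact lt_irrefl _ this
  have frU : frontier U = closure U \ U := oU.frontier_eq
  have frc : ∀ z ∈ frontier U, z ∈ ee '' Icc 0 Real.pi ∨ (z ∈ ball (0 : ℂ) 1 ∧ f z = z) := by
    intro z hz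
    by_cases h : z ∈ ball (0 : ℂ) 1
    · exact Or.inr ⟨h, D.fr z hz h⟩
    · exact Or.inl (cls z (frontier_subset_closure hz) h)
  -- the folding map
  choose! ε hε hεs using D.col
  set O : Set ℂ := U ∪ ⋃ θ ∈ Ioo 0 Real.pi, ball (ee θ) (ε θ) with hO
  have oO : IsOpen O := oU.union (isOpen_biUnion fun _ _ => isOpen_ball)
  obtain ⟨F, Fc, F1, F2⟩ := glue_continuousOn (f := f) (g := id) (K₁ := closure U)
    (K₂ := closedBall 0 1 \ O) isClosed_closure (isClosed_closedBall.sdiff oO)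
    H.cont.continuousOn continuousOn_id (by
      rintro z ⟨hz1, hz2⟩
      have hfr : z ∈ frontier U := by rw [frU]; exact ⟨hz1, fun h => hz2.2 (Or.inl h)⟩
      rcases frc z hfr with ⟨θ, hθ, rfl⟩ | h
      · have : θ ∉ Ioo 0 Real.pi := fun h => hz2.2 (Or.inr (by
          simp only [mem_iUnion]; exact ⟨θ, h, mem_ball_self (hε θ h)⟩))
        by_cases e0 : θ = 0
        · rw [e0, ee_zero]; exact f1
        by_cases e1 : θ = Real.pi
        · rw [e1, ee_pi]; exact fm1
        exact absurd ⟨lt_of_le_of_ne hθ.1 (Ne.symm e0), lt_of_le_of_ne hθ.2 e1⟩ this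
      · exact h.2)
  have cov : closure U ∪ (closedBall 0 1 \ O) = closedBall 0 1 := by
    apply subset_antisymm (union_subset clb sdiff_subset)
    intro z hz
    by_cases h : z ∈ O
    · left
      rcases h with h | h
      · exact subset_closure h
      · simp only [mem_iUnion] at h
        obtain ⟨θ, hθ, h⟩ := h
        exact colcl z hz _ isOpen_ball h (hεs θ hθ)
    · exact Or.inr ⟨hz, h⟩
  rw [cov] at Fc
  have c1 : (1 : ℂ) ∈ closure U := by
    have := arcl 0 ⟨le_rfl, hpi.le⟩; rwa [ee_zero] at this
  have car : CarH U (F '' closedBall 0 1 ∪ sphere 0 1) := by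
    have kF := (isCompact_closedBall (0 : ℂ) 1).image_of_continuousOn Fc
    refine ⟨oU, D.pU, D.nU, isBounded_ball.subset D.bU, kF.union (isCompact_sphere 0 1), ?_, ?_, ?_, ?_⟩
    · refine IsPreconnected.union 1 ⟨1, clb c1, by rw [F1 1 c1, f1]⟩ (by simp)
        ((convex_closedBall (0 : ℂ) 1).isPreconnected.image _ Fc) sphere_preconn
    · intro z hz
      rcases frc z hz with ⟨θ, hθ, rfl⟩ | ⟨h1, h2⟩
      · right; rw [mem_sphere_zero_iff_norm, norm_ee]
      · left
        exact ⟨z, ball_subset_closedBall h1, by rw [F1 z (frontier_subset_closure hz), h2]⟩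
    · rintro z (⟨w, hw, rfl⟩ | hz) hU
      · rw [← cov] at hw
        rcases hw with hw | hw
        · rw [F1 w hw] at hU; exact dis' w hw hU
        · rw [F2 w hw] at hU; exact hw.2 (Or.inl hU)
      · have := mem_ball_zero_iff.1 (D.bU hU)
        rw [mem_sphere_zero_iff_norm] at hz; linarith
    · exact LC.union kF.isClosed isClosed_sphere
        (LC_image (isCompact_closedBall 0 1) (convex_closedBall 0 1) Fc) sphere_LC
  -- the mirror domain
  have clf : ∀ z ∈ closure U, f z ∈ closure (f '' U) := fun z hz =>
    map_mem_closure H.cont hz fun v hv => ⟨v, hv, rfl⟩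
  have clf' : ∀ z ∈ closure (f '' U), f z ∈ closure U := fun z hz =>
    map_mem_closure H.cont hz (by rintro _ ⟨v, hv, rfl⟩; rw [H.inv]; exact hv)
  have hI : ∀ θ ∈ Icc 0 Real.pi, 0 ≤ (ee θ).im := fun θ hθ => by
    rw [ee_im]; exact Real.sin_nonneg_of_nonneg_of_le_pi hθ.1 hθ.2
  have hmi : ee (-(Real.pi / 2)) ∉ closure U := by
    intro h
    obtain ⟨θ, hθ, h2⟩ := cls _ h (by rw [mem_ball_zero_iff, norm_ee]; exact lt_irrefl _)
    have := hI θ hθ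
    rw [h2, ee_im, Real.sin_neg, Real.sin_pi_div_two] at this
    linarith
  obtain ⟨ψ, ψc, ψi, ψb, ψs⟩ := caratheodory car (by
    intro a ha
    have ha1 := frontier_subset_closure ha
    refine ⟨(closure (f '' U) \ {a}) ∪ ({z : ℂ | 1 ≤ ‖z‖} \ {a}), ?_, ?_, ?_⟩
    · refine IsPreconnected.union (ee (-(Real.pi / 2))) ⟨?_, ?_⟩ ⟨?_, ?_⟩ ?_
        (ext_preconn (mem_closedBall_zero_iff.1 (clb ha1)))
      · rw [← fee]; exact clf _ (arcl _ ⟨by linarith, by linarith⟩)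
      · intro h
        have h' : ee (-(Real.pi / 2)) = a := h
        exact hmi (h' ▸ ha1)
      · simp only [mem_setOf_eq]; rw [norm_ee]
      · intro h
        have h' : ee (-(Real.pi / 2)) = a := h
        exact hmi (h' ▸ ha1)
      · refine (D.pU.image f H.cont.continuousOn).subset_closure ?_ sdiff_subset
        rintro _ ⟨v, hv, rfl⟩
        refine ⟨subset_closure ⟨v, hv, rfl⟩, fun h => ?_⟩
        have h' : f v = a := h
        refine dis' a ha1 ?_
        rw [← h', H.inv]; exact hv
    · rintro z hz (h | h)
      · rcases hz with hz | hz
        · refine dis' _ (clf' z hz.1) ?_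
          rw [H.inv]; exact h
        · have := mem_ball_zero_iff.1 (D.bU h)
          have h3 := hz.1
          simp only [mem_setOf_eq] at h3
          linarith
      · rcases hz with hz | hz <;> exact hz.2 h
    · rintro z ⟨hz, hza⟩
      rcases frc z hz with ⟨θ, hθ, rfl⟩ | ⟨h1, h2⟩
      · right; exact ⟨by simp only [mem_setOf_eq]; rw [norm_ee], hza⟩
      · left
        refine ⟨?_, hza⟩
        rw [← h2]; exact clf z (frontier_subset_closure hz))
  have ψcl : ψ '' closedBall 0 1 = closure U := by
    rw [← ball_union_sphere, image_union, ψb, ψs, closure_eq_self_union_frontier]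
  obtain ⟨κ, κc, κi, κ0, κ1, κs, κa⟩ := arc_split ψc ψi hpi (by linarith) (fun θ hθ => by
    rw [ψs, frU]; exact ⟨arcl θ hθ, neeU θ⟩)
  rw [ψs] at κs
  rw [ee_pi] at κ0
  rw [ee_zero] at κ1
  have κf : ∀ t ∈ Icc (0 : ℝ) 1, f (κ t) = κ t := by
    intro t ht
    by_cases e0 : t = 0
    · rw [e0, κ0, fm1]
    by_cases e1 : t = 1
    · rw [e1, κ1, f1]
    have hm : κ t ∈ frontier U := by rw [κs]; exact Or.inr ⟨t, ht, rfl⟩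
    rcases frc _ hm with h | h
    · exact absurd h (κa t ⟨lt_of_le_of_ne ht.1 (Ne.symm e0), lt_of_le_of_ne ht.2 e1⟩)
    · exact h.2
  have κfr : ∀ t ∈ Icc (0 : ℝ) 1, κ t ∈ frontier U := fun t ht => by
    rw [κs]; exact Or.inr ⟨t, ht, rfl⟩
  have frκ : ∀ z ∈ frontier U, z ∈ ball (0 : ℂ) 1 → z ∈ κ '' Icc 0 1 := by
    intro z hz hzb
    rw [κs] at hz
    rcases hz with ⟨θ, _, rfl⟩ | h
    · rw [mem_ball_zero_iff, norm_ee] at hzb; exact absurd hzb (lt_irrefl _)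
    · exact h
  have m1 : (1 : ℂ) ∈ κ '' Icc 0 1 := ⟨1, by norm_num, κ1⟩
  have mm1 : (-1 : ℂ) ∈ κ '' Icc 0 1 := ⟨0, by norm_num, κ0⟩
  have realpt : ∀ z : ℂ, ‖z‖ = 1 → z.im = 0 → z ∈ κ '' Icc 0 1 := by
    intro z hz hi
    have hz' : z = (z.re : ℂ) := by apply Complex.ext <;> simp [hi]
    rw [hz', Complex.norm_real, Real.norm_eq_abs] at hz
    rcases eq_or_eq_neg_of_abs_eq hz with h | h
    · rw [hz', h]; simpa using m1
    · rw [hz', h]; simpa using mm1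
  have oV : IsOpen (f '' U) := by
    have : f '' U = f ⁻¹' U := by
      ext z; constructor
      · rintro ⟨v, hv, rfl⟩; simp only [mem_preimage, H.inv]; exact hv
      · intro hz; exact ⟨f z, hz, H.inv z⟩
    rw [this]; exact ofU
  -- points of both closures lie on the arc
  have both : ∀ z ∈ closure U, f z ∈ closure U → z ∈ κ '' Icc 0 1 := by
    intro z hz hfz
    have hzU : z ∉ U := fun h => dis' _ hfz (by rw [H.inv]; exact h)
    have hzf : z ∈ frontier U := by rw [frU]; exact ⟨hz, hzU⟩
    by_cases hb : z ∈ ball (0 : ℂ) 1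
    · exact frκ z hzf hb
    have hzn : ‖z‖ = 1 := by
      have h1 := mem_closedBall_zero_iff.1 (clb hz)
      rw [mem_ball_zero_iff] at hb; linarith
    obtain ⟨θ, hθ, e⟩ := cls z hz hb
    have hfb : f z ∉ ball (0 : ℂ) 1 := by
      rw [mem_ball_zero_iff, H.norm hzn.ge, hzn]; exact lt_irrefl _
    obtain ⟨θ', hθ', e'⟩ := cls _ hfz hfb
    have i1 := hI θ hθ
    have i2 := hI θ' hθ'
    rw [e', H.out z hzn.ge, Complex.conj_im] at i2
    rw [e] at i1
    exact realpt z hzn (by linarith)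
  have hcover : ball (0 : ℂ) 1 ⊆ closure U ∪ closure (f '' U) := by
    by_contra hcon
    obtain ⟨q, hq, hqn⟩ := not_subset.1 hcon
    set Q : Set ℂ := ball 0 1 \ (closure U ∪ closure (f '' U)) with hQ
    have oQ : IsOpen Q := isOpen_ball.sdiff (isClosed_closure.union isClosed_closure)
    have AM := MonoArc.of_inj κc κi
    refine clopen_no (B := Q) (K := κ '' Icc 0 1) oQ (isBounded_ball.subset sdiff_subset)
      ⟨q, ⟨hq, hqn⟩, ?_⟩ AM.compact AM.allLog ?_
    · rintro ⟨t, ht, rfl⟩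
      exact hqn (Or.inl (frontier_subset_closure (κfr t ht)))
    · intro z hz
      rw [oQ.frontier_eq] at hz
      obtain ⟨hz1, hz2⟩ := hz
      have hzb : z ∈ closedBall (0 : ℂ) 1 :=
        closure_minimal (sdiff_subset.trans ball_subset_closedBall) isClosed_closedBall hz1
      have nU : z ∉ U := fun h => by
        obtain ⟨v, hv1, hv2⟩ := mem_closure_iff_nhds.1 hz1 _ (oU.mem_nhds h)
        exact hv2.2 (Or.inl (subset_closure hv1))
      have nV : z ∉ f '' U := fun h => by
        obtain ⟨v, hv1, hv2⟩ := mem_closure_iff_nhds.1 hz1 _ (oV.mem_nhds h)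
        exact hv2.2 (Or.inr (subset_closure hv1))
      by_cases hb : z ∈ ball (0 : ℂ) 1
      · have : z ∈ closure U ∪ closure (f '' U) := by
          by_contra h; exact hz2 ⟨hb, h⟩
        rcases this with h | h
        · exact frκ z (by rw [frU]; exact ⟨h, nU⟩) hb
        · have h1 : f z ∈ frontier U := by
            rw [frU]; exact ⟨clf' z h, fun h2 => nV ⟨f z, h2, H.inv z⟩⟩
          have h2 := mem_ball_zero_iff.2 (H.disc (mem_ball_zero_iff.1 hb))
          have h3 := D.fr _ h1 h2
          rw [H.inv] at h3
          rw [h3]; exact frκ _ h1 h2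
      · have hzn : ‖z‖ = 1 := by
          have h1 := mem_closedBall_zero_iff.1 hzb
          rw [mem_ball_zero_iff] at hb; linarith
        obtain ⟨θ, hθ, rfl⟩ := exists_ee (-Real.pi) hzn
        by_cases e1 : θ = -Real.pi
        · refine realpt _ (norm_ee _) ?_
          rw [ee_im, e1, Real.sin_neg, Real.sin_pi, neg_zero]
        by_cases e2 : θ = 0
        · rw [e2, ee_zero]; exact m1
        exfalso
        rcases lt_or_gt_of_ne e2 with h0 | h0
        · have ht : -θ ∈ Ioo 0 Real.pi := ⟨by linarith, by
            have := lt_of_le_of_ne hθ.1 (Ne.symm e1); linarith⟩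
          have hnb : f ⁻¹' (ball (ee (-θ)) (ε (-θ))) ∈ 𝓝 (ee θ) := by
            apply H.cont.continuousAt
            rw [fee]; exact ball_mem_nhds _ (hε _ ht)
          obtain ⟨v, hv1, hv2⟩ := mem_closure_iff_nhds.1 hz1 _ hnb
          refine hv2.2 (Or.inr (subset_closure ⟨f v, hεs _ ht ⟨hv1, ?_⟩, H.inv v⟩))
          exact mem_ball_zero_iff.2 (H.disc (mem_ball_zero_iff.1 hv2.1))
        · have ht : θ ∈ Ioo 0 Real.pi := ⟨h0, by linarith [hθ.2]⟩
          obtain ⟨v, hv1, hv2⟩ := mem_closure_iff_nhds.1 hz1 _ (ball_mem_nhds _ (hε θ ht))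
          exact hv2.2 (Or.inl (subset_closure (hεs θ ht ⟨hv1, hv2.1⟩)))
  have hcover' : closedBall (0 : ℂ) 1 ⊆ closure U ∪ closure (f '' U) := by
    rw [← closure_ball _ one_ne_zero]
    exact closure_minimal hcover (isClosed_closure.union isClosed_closure)
  -- boundary map
  set l : ℂ → ℂ := fun x => ((2 * Function.invFunOn κ (Icc 0 1) x - 1 : ℝ) : ℂ) with hl
  have lκ : ∀ t ∈ Icc (0 : ℝ) 1, l (κ t) = ((2 * t - 1 : ℝ) : ℂ) := fun t ht => by
    simp only [hl]; rw [κi.leftInvOn_invFunOn ht]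
  have lc : ContinuousOn l (κ '' Icc 0 1) := by
    refine factor_continuousOn isCompact_Icc κc ?_
    have : Continuous (fun t : ℝ => ((2 * t - 1 : ℝ) : ℂ)) := by fun_prop
    exact this.continuousOn.congr lκ
  have lend : ∀ t ∈ Icc (0 : ℝ) 1, ‖((2 * t - 1 : ℝ) : ℂ)‖ = 1 → κ t = ((2 * t - 1 : ℝ) : ℂ) := by
    intro t ht hn
    rw [Complex.norm_real, Real.norm_eq_abs] at hn
    rcases eq_or_eq_neg_of_abs_eq hn with h | h
    · have : t = 1 := by linarith
      rw [this, κ1]; norm_num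
    · have : t = 0 := by linarith
      rw [this, κ0]; norm_num
  obtain ⟨k, kc, k1, k2⟩ := glue_continuousOn (f := id) (g := l) (K₁ := ee '' Icc 0 Real.pi)
    (K₂ := κ '' Icc 0 1) (isCompact_Icc.image continuous_ee).isClosed
    (isCompact_Icc.image_of_continuousOn κc).isClosed continuousOn_id lc (by
      rintro x ⟨hx, ⟨t, ht, rfl⟩⟩
      rw [lκ t ht]
      by_cases e0 : t = 0
      · rw [e0, κ0]; norm_num
      by_cases e1 : t = 1
      · rw [e1, κ1]; norm_num
      exact absurd hx (κa t ⟨lt_of_le_of_ne ht.1 (Ne.symm e0), lt_of_le_of_ne ht.2 e1⟩))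
  have kκ : ∀ t ∈ Icc (0 : ℝ) 1, k (κ t) = ((2 * t - 1 : ℝ) : ℂ) := fun t ht => by
    rw [k2 _ ⟨t, ht, rfl⟩, lκ t ht]
  have ke : ∀ θ ∈ Icc 0 Real.pi, k (ee θ) = ee θ := fun θ hθ => k1 _ ⟨θ, hθ, rfl⟩
  have kb : BijOn k (ψ '' sphere 0 1) (frontier (Sec Real.pi)) := by
    rw [ψs, κs, Sec_frontier hpi le_rfl, ee_pi]
    refine ⟨?_, ?_, ?_⟩
    · rintro _ (⟨θ, hθ, rfl⟩ | ⟨t, ht, rfl⟩)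
      · rw [ke θ hθ]; exact Or.inl ⟨θ, hθ, rfl⟩
      · rw [kκ t ht]
        right
        rcases le_total 0 (2 * t - 1) with h | h
        · left; exact ⟨2 * t - 1, ⟨h, by linarith [ht.2]⟩, rfl⟩
        · right; exact ⟨-(2 * t - 1), ⟨by linarith, by linarith [ht.1]⟩, by push_cast; ring⟩
    · have cross : ∀ θ ∈ Icc 0 Real.pi, ∀ t ∈ Icc (0 : ℝ) 1, k (ee θ) = k (κ t) → ee θ = κ t := by
        intro θ hθ t ht h
        rw [ke θ hθ, kκ t ht] at h
        rw [h, lend t ht (by rw [← h, norm_ee])]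
      rintro _ (⟨θ, hθ, rfl⟩ | ⟨t, ht, rfl⟩) _ (⟨θ', hθ', rfl⟩ | ⟨t', ht', rfl⟩) h
      · rwa [ke θ hθ, ke θ' hθ'] at h
      · exact cross θ hθ t' ht' h
      · exact (cross θ' hθ' t ht h.symm).symm
      · rw [kκ t ht, kκ t' ht', Complex.ofReal_inj] at h
        have : t = t' := by linarith
        rw [this]
    · rintro _ (⟨θ, hθ, rfl⟩ | ⟨x, hx, rfl⟩ | ⟨x, hx, rfl⟩)
      · exact ⟨ee θ, Or.inl ⟨θ, hθ, rfl⟩, ke θ hθ⟩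
      · have ht : (x + 1) / 2 ∈ Icc (0 : ℝ) 1 := ⟨by linarith [hx.1], by linarith [hx.2]⟩
        refine ⟨κ ((x + 1) / 2), Or.inr ⟨_, ht, rfl⟩, ?_⟩
        rw [kκ _ ht]; congr 1; ring
      · have ht : (1 - x) / 2 ∈ Icc (0 : ℝ) 1 := ⟨by linarith [hx.2], by linarith [hx.1]⟩
        refine ⟨κ ((1 - x) / 2), Or.inr ⟨_, ht, rfl⟩, ?_⟩
        rw [kκ _ ht]; push_cast; ring
  rw [← κs, ← ψs] at kc
  obtain ⟨Φ, Φc, Φb, Φk⟩ := extend_bd ψc ψi (Sec_closed Real.pi) (Sec_convex _)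
    (Sec_interior_ne hpi le_rfl) (Sec_bounded _) kc kb
  rw [ψcl] at Φc Φb
  rw [ψs] at Φk
  have Φκ : ∀ t ∈ Icc (0 : ℝ) 1, Φ (κ t) = ((2 * t - 1 : ℝ) : ℂ) := fun t ht => by
    rw [Φk _ (κfr t ht), kκ t ht]
  have Φreal : ∀ x ∈ closure U, (Φ x).im = 0 → ∃ t ∈ Icc (0 : ℝ) 1, x = κ t := by
    intro x hx h
    have h1 := (mem_Sec_pi.1 (Φb.mapsTo hx)).1
    have hz' : Φ x = ((Φ x).re : ℂ) := by apply Complex.ext <;> simp [h]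
    have h2 : |(Φ x).re| ≤ 1 := (Complex.abs_re_le_norm _).trans h1
    rw [abs_le] at h2
    have ht : ((Φ x).re + 1) / 2 ∈ Icc (0 : ℝ) 1 := ⟨by linarith, by linarith⟩
    refine ⟨_, ht, Φb.injOn hx (frontier_subset_closure (κfr _ ht)) ?_⟩
    rw [Φκ _ ht]
    rw [hz']; congr 1; simp; ring
  obtain ⟨h, hc, hb, he⟩ := glue_equiv (f := f) (R := starRingEnd ℂ) (H := Φ) (n := 2)
    (by norm_num) H.cont H.inv Complex.continuous_conj (fun z => Complex.conj_conj z)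
    (P := closure U) (Δ := Sec Real.pi)
    ((isCompact_closedBall (0 : ℂ) 1).of_isClosed_subset isClosed_closure clb) Φc Φb (by
      ext z
      rw [mem_iUnion, Fin.exists_fin_two]
      constructor
      · intro hz
        rcases hcover' hz with h | h
        · left; exact ⟨z, h, rfl⟩
        · right; exact ⟨f z, clf' z h, H.inv z⟩
      · rintro (⟨w, hw, rfl⟩ | ⟨w, hw, rfl⟩)
        · exact clb hw
        · have := mem_closedBall_zero_iff.1 (clb hw)
          change f w ∈ closedBall (0 : ℂ) 1
          rw [mem_closedBall_zero_iff]
          by_cases hw1 : 1 ≤ ‖w‖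
          · rwa [H.norm hw1]
          · push Not at hw1; exact (H.disc hw1).le) (by
      ext z
      rw [mem_iUnion, Fin.exists_fin_two]
      constructor
      · intro hz
        rw [mem_closedBall_zero_iff] at hz
        rcases le_total 0 z.im with h | h
        · left; exact ⟨z, mem_Sec_pi.2 ⟨hz, h⟩, rfl⟩
        · right
          refine ⟨(starRingEnd ℂ) z, mem_Sec_pi.2 ⟨by rwa [RCLike.norm_conj], ?_⟩, Complex.conj_conj z⟩
          rw [Complex.conj_im]; linarith
      · rintro (⟨w, hw, rfl⟩ | ⟨w, hw, rfl⟩)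
        · exact mem_closedBall_zero_iff.2 (mem_Sec_pi.1 hw).1
        · change (starRingEnd ℂ) w ∈ closedBall (0 : ℂ) 1
          rw [mem_closedBall_zero_iff, RCLike.norm_conj]
          exact (mem_Sec_pi.1 hw).1) (by
      intro i hi x hx y hy
      obtain rfl | rfl : i = 0 ∨ i = 1 := by omega
      · exact ⟨fun h => congrArg Φ h, fun h => Φb.injOn hx hy h⟩
      · change f x = y ↔ (starRingEnd ℂ) (Φ x) = Φ y
        constructor
        · rintro rfl
          obtain ⟨t, ht, rfl⟩ := both x hx hy
          rw [κf t ht, Φκ t ht, Complex.conj_ofReal]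
        · intro h
          have i1 := (mem_Sec_pi.1 (Φb.mapsTo hx)).2
          have i2 := (mem_Sec_pi.1 (Φb.mapsTo hy)).2
          rw [← h, Complex.conj_im] at i2
          have i3 : (Φ x).im = 0 := by linarith
          rw [Complex.conj_eq_iff_im.2 i3] at h
          obtain ⟨t, ht, rfl⟩ := Φreal x hx i3
          rw [κf t ht]
          exact Φb.injOn hx hy h)
  exact ⟨Complex.conjLIE, h, hc, hb, fun x hx => by rw [he x hx]; rfl⟩

theorem reflection_good {g : ℂ → ℂ} (hg : Continuous g) {n : ℕ} (hn : 0 < n) (hi : ∀ z, g^[n] z = z)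
    (ho : ∀ z, 1 ≤ ‖z‖ → g z = (starRingEnd ℂ) z) : Good g := by
  refine RefMap.good ⟨hg, ?_, ho⟩
  refine trivial_of_id_outside (g := fun z => g (g z)) (hg.comp hg) hn (fun z => ?_) (fun z hz => ?_)
  · have : (fun z => g (g z)) = g^[2] := rfl
    rw [this, ← Function.iterate_mul, mul_comm, Function.iterate_mul]
    exact Function.iterate_fixed (hi z) 2
  · rw [ho z hz, ho _ (by rw [RCLike.norm_conj]; exact hz), Complex.conj_conj]

lemma ee_eq_lt {a b : ℝ} (h : ee a = ee b) (h1 : b < a + 2 * Real.pi) (h2 : a < b + 2 * Real.pi) :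
    a = b := by
  rcases le_total a b with h' | h'
  · exact ee_injOn h1 ⟨le_rfl, h'⟩ ⟨h', le_rfl⟩ h
  · exact ee_injOn h2 ⟨h', le_rfl⟩ ⟨le_rfl, h'⟩ h

/-- a connected subset of the disc off a crosscut lies on one side -/
lemma crosscut {C A B : Set ℂ} {θ p θ' q : ℝ} (pC : IsPreconnected C) (bC : C ⊆ closedBall 0 1)
    (cA : IsClosed A) (cB : IsClosed B) (pA : IsPreconnected A) (pB : IsPreconnected B)
    (zA : (0 : ℂ) ∈ A) (zB : (0 : ℂ) ∈ B) (eA : ee p ∈ A) (eB : ee q ∈ B)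
    (sA : ∀ z ∈ A, ‖z‖ = 1 → z = ee p) (sB : ∀ z ∈ B, ‖z‖ = 1 → z = ee q)
    (dA : ∀ z ∈ C, z ∉ A) (dB : ∀ z ∈ C, z ∉ B) (h1 : θ < p) (h2 : p < θ') (h3 : θ' < q)
    (h4 : q < θ + 2 * Real.pi) (hθ : ee θ ∈ C) (hθ' : ee θ' ∈ C) : False := by
  set r : ℂ → ℂ := fun z => z / ((max 1 ‖z‖ : ℝ) : ℂ) with hr
  have mpos : ∀ z : ℂ, 0 < max 1 ‖z‖ := fun z => lt_max_of_lt_left one_pos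
  have rc : Continuous r := by
    refine continuous_id.div (by fun_prop) fun z => ?_
    rw [Complex.ofReal_ne_zero]; exact (mpos z).ne'
  have rn : ∀ z, ‖r z‖ ≤ 1 := fun z => by
    simp only [hr]
    rw [norm_div, Complex.norm_real, Real.norm_eq_abs, abs_of_pos (mpos z), div_le_one (mpos z)]
    exact le_max_right _ _
  have rid : ∀ z, ‖z‖ ≤ 1 → r z = z := fun z hz => by
    simp only [hr]; rw [max_eq_left hz]; simp
  set O : Set ℂ := r ⁻¹' (A ∪ B)ᶜ with hO
  have oO : IsOpen O := (cA.union cB).isOpen_compl.preimage rc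
  have CO : C ⊆ O := by
    intro z hz
    change r z ∈ (A ∪ B)ᶜ
    rw [rid z (mem_closedBall_zero_iff.1 (bC hz))]
    rintro (h | h)
    exacts [dA z hz h, dB z hz h]
  have hcc : IsConnected (connectedComponentIn O (ee θ)) :=
    ⟨⟨_, mem_connectedComponentIn (CO hθ)⟩, isPreconnected_connectedComponentIn⟩
  obtain ⟨γ, hγ⟩ := ((oO.connectedComponentIn.isConnected_iff_isPathConnected).1 hcc).joinedIn _
    (mem_connectedComponentIn (CO hθ)) _ (pC.subset_connectedComponentIn hθ CO hθ')
  set K : Set ℂ := r '' range γ with hK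
  have kK : IsCompact K := (isCompact_range γ.continuous).image rc
  have pK : IsPreconnected K := (isPreconnected_range γ.continuous).image _ rc.continuousOn
  have K1 : ∀ z ∈ K, ‖z‖ ≤ 1 := by rintro _ ⟨z, _, rfl⟩; exact rn z
  have KAB : ∀ z ∈ K, z ∉ A ∪ B := by
    rintro _ ⟨_, ⟨t, rfl⟩, rfl⟩
    exact connectedComponentIn_subset _ _ (hγ t)
  have Kθ : ee θ ∈ K := ⟨ee θ, ⟨0, γ.source⟩, rid _ (norm_ee θ).le⟩
  have Kθ' : ee θ' ∈ K := ⟨ee θ', ⟨1, γ.target⟩, rid _ (norm_ee θ').le⟩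
  have half : ∀ (D : Set ℂ) (w a b : ℝ), IsPreconnected D → (0 : ℂ) ∈ D → ee w ∈ D →
      (∀ z ∈ D, ‖z‖ = 1 → z = ee w) → (∀ z ∈ K, z ∉ D) → ee w ∉ ee '' Icc a b →
      NSep (K ∪ ee '' Icc a b) 0 2 := by
    intro D w a b pD zD eD sD KD nw
    have hcl : ee w ∈ closure {z : ℂ | 1 < ‖z‖} := by
      have e1 : {z : ℂ | 1 < ‖z‖} = (closedBall (0 : ℂ) 1)ᶜ := by ext z; simp
      rw [e1, closure_compl, interior_closedBall _ one_ne_zero]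
      simp [norm_ee]
    have h5 : IsPreconnected (insert (ee w) {z : ℂ | 1 < ‖z‖}) :=
      (isPreconnected_far one_pos).subset_closure (subset_insert _ _)
        (insert_subset hcl subset_closure)
    refine NSep.of_preconn (IsPreconnected.union (ee w) eD (mem_insert _ _) pD h5) ?_ (Or.inl zD)
      (Or.inr (Or.inr (by simp)))
    have aux : ∀ z ∈ D, z ∉ K ∪ ee '' Icc a b := by
      rintro z hz (h | ⟨s, hs, rfl⟩)
      · exact KD z h hz
      · exact nw ⟨s, hs, sD _ hz (norm_ee s)⟩
    rintro z (hz | rfl | hz)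
    · exact aux z hz
    · exact aux _ eD
    · have hz' : 1 < ‖z‖ := hz
      rintro (h | ⟨s, hs, rfl⟩)
      · linarith [K1 z h]
      · rw [norm_ee] at hz'; exact lt_irrefl _ hz'
  have n1 := half B q θ θ' pB zB eB sB (fun z hz h => KAB z hz (Or.inr h)) (by
    rintro ⟨s, hs, h⟩
    have := ee_eq_lt h (by linarith [hs.1]) (by linarith [hs.2, Real.pi_pos])
    linarith [hs.2])
  have n2 := half A p θ' (θ + 2 * Real.pi) pA zA eA sA (fun z hz h => KAB z hz (Or.inl h)) (by
    rintro ⟨s, hs, h⟩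
    have := ee_eq_lt h (by linarith [hs.1, Real.pi_pos]) (by linarith [hs.2])
    linarith [hs.1])
  have hp : (K ∪ ee '' Icc θ θ') ∩ (K ∪ ee '' Icc θ' (θ + 2 * Real.pi)) = K := by
    rw [← union_inter_distrib_left, union_eq_left]
    rintro _ ⟨⟨s, hs, rfl⟩, ⟨t, ht, h⟩⟩
    by_cases h5 : t < s + 2 * Real.pi
    · have := ee_eq_lt h (by linarith [hs.2, ht.1, Real.pi_pos]) h5
      have : s = θ' := by linarith [hs.2, ht.1]
      rw [this]; exact Kθ'
    · have : s = θ := by linarith [hs.1, ht.2]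
      rw [this]; exact Kθ
  have n3 := janiszewski (kK.union (isCompact_Icc.image continuous_ee))
    (kK.union (isCompact_Icc.image continuous_ee)) (by rw [hp]; exact pK) n1 n2
  have n4 : NSep (sphere (0 : ℂ) 1) 0 2 := by
    refine n3.mono fun z hz => ?_
    obtain ⟨s, hs, rfl⟩ := exists_ee θ (mem_sphere_zero_iff_norm.1 hz)
    rcases le_total s θ' with h | h
    · exact Or.inl (Or.inr ⟨s, ⟨hs.1, h⟩, rfl⟩)
    · exact Or.inr (Or.inr ⟨s, ⟨h, hs.2.le⟩, rfl⟩)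
  obtain ⟨z, hz, hz1⟩ := (isPreconnected_connectedComponentIn (x := (0 : ℂ))
    (F := (sphere (0 : ℂ) 1)ᶜ)).intermediate_value (mem_connectedComponentIn n4.left) n4
    (f := fun z => ‖z‖) continuous_norm.continuousOn (show (1 : ℝ) ∈ Icc ‖(0 : ℂ)‖ ‖(2 : ℂ)‖ by simp)
  exact connectedComponentIn_subset _ _ hz (mem_sphere_zero_iff_norm.2 hz1)

/-- a closed connected subset of a monotone arc containing both ends is everything -/
lemma MonoArc.full {τ : ℝ → ℂ} {a b : ℝ} (M : MonoArc τ a b) (hab : a ≤ b) {C : Set ℂ}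
    (pC : IsPreconnected C) (hC : C ⊆ τ '' Icc a b) (h0 : τ a ∈ C) (h1 : τ b ∈ C) :
    τ '' Icc a b ⊆ C := by
  rintro _ ⟨u, hu, rfl⟩
  obtain ⟨z, hz, ⟨s, hs, e1⟩, ⟨t, ht, e2⟩⟩ := isPreconnected_closed_iff.1 pC (τ '' Icc a u) (τ '' Icc u b)
    (M.sub le_rfl hu.2).compact.isClosed (M.sub hu.1 le_rfl).compact.isClosed (by
      rw [← image_union, Icc_union_Icc_eq_Icc hu.1 hu.2]; exact hC)
    ⟨_, h0, a, ⟨le_rfl, hu.1⟩, rfl⟩ ⟨_, h1, b, ⟨hu.2, le_rfl⟩, rfl⟩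
  rw [M.2 s t hs.1 (hs.2.trans ht.1) ht.2 (e1.trans e2.symm) u ⟨hs.2, ht.1⟩, e1]
  exact hz

/-- attaching a monotone arc with a point removed -/
lemma MonoArc.attach {τ : ℝ → ℂ} (M : MonoArc τ 0 1) {E : Set ℂ} {x : ℂ} (pE : IsPreconnected E)
    (h0 : τ 0 ∈ E ∨ τ 0 = x) (h1 : τ 1 ∈ E ∨ τ 1 = x) :
    IsPreconnected (E ∪ (τ '' Icc 0 1 \ {x})) := by
  by_cases hx : x ∈ τ '' Icc 0 1
  swap
  · rw [sdiff_singleton_eq_self hx]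
    have := h0.resolve_right fun h => hx ⟨0, by norm_num, h⟩
    exact IsPreconnected.union _ this ⟨0, by norm_num, rfl⟩ pE M.preconn
  obtain ⟨u, hu, rfl⟩ := hx
  have key : ∀ {A : Set ℝ} {c : ℝ} (E : Set ℂ), IsPreconnected E → A.OrdConnected → A ⊆ Icc 0 1 →
      (A.Nonempty → c ∈ A) → (c ∈ A → τ c ∈ E) → IsPreconnected (E ∪ τ '' A) := by
    intro A c E pE oA sA hc hcE
    rcases A.eq_empty_or_nonempty with h | h
    · rw [h]; simpa using pE
    · exact IsPreconnected.union _ (hcE (hc h)) ⟨c, hc h, rfl⟩ pE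
        (oA.isPreconnected.image _ (M.1.mono sA))
  have p1 := key (A := {s | s ∈ Icc 0 u ∧ τ s ≠ τ u}) (c := 0) E pE ⟨by
    rintro s ⟨hs, hs'⟩ t ⟨ht, ht'⟩ w hw
    refine ⟨⟨hs.1.trans hw.1, hw.2.trans ht.2⟩, fun h => ht' ?_⟩
    rw [M.2 w u (hs.1.trans hw.1) (hw.2.trans ht.2) hu.2 h t ⟨hw.2, ht.2⟩, h]⟩
    (fun s hs => ⟨hs.1.1, hs.1.2.trans hu.2⟩) (by
    rintro ⟨s, hs, hs'⟩
    refine ⟨⟨le_rfl, hu.1⟩, fun h => hs' ?_⟩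
    rw [M.2 0 u le_rfl hu.1 hu.2 h s hs, h]) (fun h => h0.resolve_right h.2)
  have p2 := key (A := {s | s ∈ Icc u 1 ∧ τ s ≠ τ u}) (c := 1) _ p1 ⟨by
    rintro s ⟨hs, hs'⟩ t ⟨ht, ht'⟩ w hw
    refine ⟨⟨hs.1.trans hw.1, hw.2.trans ht.2⟩, fun h => hs' ?_⟩
    exact M.2 u w hu.1 (hs.1.trans hw.1) (hw.2.trans ht.2) h.symm s ⟨hs.1, hw.1⟩⟩
    (fun s hs => ⟨hu.1.trans hs.1.1, hs.1.2⟩) (by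
    rintro ⟨s, hs, hs'⟩
    refine ⟨⟨hu.2, le_rfl⟩, fun h => hs' ?_⟩
    exact M.2 u 1 hu.1 hu.2 le_rfl h.symm s hs) (fun h => Or.inl (h1.resolve_right h.2))
  rw [union_assoc] at p2
  convert p2 using 2
  ext z
  constructor
  · rintro ⟨⟨s, hs, rfl⟩, hz⟩
    rcases le_total s u with h | h
    · exact Or.inl ⟨s, ⟨⟨hs.1, h⟩, hz⟩, rfl⟩
    · exact Or.inr ⟨s, ⟨⟨h, hs.2⟩, hz⟩, rfl⟩
  · rintro (⟨s, hs, rfl⟩ | ⟨s, hs, rfl⟩)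
    · exact ⟨⟨s, ⟨hs.1.1, hs.1.2.trans hu.2⟩, rfl⟩, hs.2⟩
    · exact ⟨⟨s, ⟨hu.1.trans hs.1.1, hs.1.2⟩, rfl⟩, hs.2⟩

noncomputable def bt (d : ℕ) : ℝ := 2 * Real.pi / d

/-- the images of an arc under the iterates -/
def gm (f : ℂ → ℂ) (τ : ℝ → ℂ) (i : ℕ) : Set ℂ := f^[i] '' (τ '' Icc 0 1)

def gG (f : ℂ → ℂ) (τ : ℝ → ℂ) (k : ℕ) : Set ℂ := {z | ∃ i < k, z ∈ gm f τ i}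

section
variable {f : ℂ → ℂ} {d : ℕ}

lemma RotMap.dpos (H : RotMap f d) : (0 : ℝ) < d := by
  have := H.hd
  exact_mod_cast (by omega : 0 < d)

lemma RotMap.bt_pos (H : RotMap f d) : 0 < bt d :=
  div_pos (by linarith [Real.pi_pos]) H.dpos

lemma RotMap.bt_mul (H : RotMap f d) : d * bt d = 2 * Real.pi := by
  unfold bt; field_simp [H.dpos.ne']

lemma RotMap.bt_le (H : RotMap f d) : bt d ≤ Real.pi := by
  have h2 : (2 : ℝ) ≤ d := by exact_mod_cast H.hd
  nlinarith [H.bt_mul, H.bt_pos]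

lemma RotMap.root (H : RotMap f d) : Complex.exp (2 * Real.pi * Complex.I / d) = ee (bt d) := by
  unfold ee bt; congr 1; push_cast; ring

lemma ee_pow (a : ℝ) (j : ℕ) : ee a ^ j = ee (j * a) := by
  unfold ee
  rw [← Complex.exp_nat_mul]; congr 1; push_cast; ring

lemma RotMap.it_out (H : RotMap f d) (j : ℕ) {z : ℂ} (hz : 1 ≤ ‖z‖) :
    f^[j] z = ee (j * bt d) * z := by
  rw [iter_rot (norm_ee (bt d)) (fun z hz => by rw [H.out z hz, H.root]) j z hz, ee_pow]

lemma RotMap.it_ee (H : RotMap f d) (j : ℕ) (θ : ℝ) : f^[j] (ee θ) = ee (θ + j * bt d) := by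
  rw [H.it_out j (norm_ee θ).ge, ← ee_add, add_comm]

lemma RotMap.inj (H : RotMap f d) : Function.Injective f :=
  iter_inj (by have := H.hd; omega) H.per

lemma RotMap.norm_ge (H : RotMap f d) (j : ℕ) {z : ℂ} (hz : 1 ≤ ‖z‖) : ‖f^[j] z‖ = ‖z‖ := by
  rw [H.it_out j hz, norm_mul, norm_ee, one_mul]

lemma RotMap.norm_lt (H : RotMap f d) (j : ℕ) {z : ℂ} (hz : ‖z‖ < 1) : ‖f^[j] z‖ < 1 := by
  induction j with
  | zero => exact hz
  | succ j ih =>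
    rw [Function.iterate_succ_apply']
    exact disc_inv (by have := H.hd; omega) H.per (fun z hz => H.norm_ge 1 hz) ih

lemma RotMap.norm_le (H : RotMap f d) (j : ℕ) {z : ℂ} (hz : ‖z‖ ≤ 1) : ‖f^[j] z‖ ≤ 1 := by
  rcases hz.lt_or_eq with h | h
  · exact (H.norm_lt j h).le
  · rw [H.norm_ge j h.ge]; exact hz

lemma RotMap.it_zero (H : RotMap f d) (j : ℕ) : f^[j] 0 = 0 := iter_fix H.zero j

lemma RotMap.inv1 (H : RotMap f d) {i : ℕ} (hi : i ≤ d) (z : ℂ) : f^[d - i] (f^[i] z) = z := by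
  rw [← Function.iterate_add_apply, Nat.sub_add_cancel hi, H.per]

lemma RotMap.inv2 (H : RotMap f d) {i : ℕ} (hi : i ≤ d) (z : ℂ) : f^[i] (f^[d - i] z) = z := by
  rw [← Function.iterate_add_apply, Nat.add_sub_cancel' hi, H.per]

lemma RotMap.floor (H : RotMap f d) {θ : ℝ} (h : θ ∈ Ico 0 (0 + 2 * Real.pi)) :
    ∃ i < d, ∃ φ ∈ Ico 0 (bt d), θ = φ + i * bt d := by
  have hb := H.bt_pos
  have h0 : 0 ≤ θ / bt d := div_nonneg h.1 hb.le
  have h1 := Nat.floor_le h0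
  have h2 := Nat.lt_floor_add_one (θ / bt d)
  rw [le_div_iff₀ hb] at h1
  rw [div_lt_iff₀ hb] at h2
  refine ⟨⌊θ / bt d⌋₊, ?_, θ - ⌊θ / bt d⌋₊ * bt d, ⟨by linarith, by linarith⟩, by ring⟩
  have h3 : θ / bt d < d := by
    rw [div_lt_iff₀ hb, H.bt_mul]; linarith [h.2]
  exact (Nat.floor_lt h0).2 h3

/-- an arc from `1` to `0` disjoint from its images -/
structure RotArc (f : ℂ → ℂ) (d : ℕ) (τ : ℝ → ℂ) : Prop where
  R : RotMap f d
  M : MonoArc τ 0 1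
  t0 : τ 0 = 1
  t1 : τ 1 = 0
  disc : ∀ x ∈ τ '' Icc 0 1, ‖x‖ ≤ 1
  sph : ∀ x ∈ τ '' Icc 0 1, ‖x‖ = 1 → x = 1
  eq : ∀ x ∈ τ '' Icc 0 1, ∀ y ∈ τ '' Icc 0 1, ∀ j, x = f^[j] y → x = y

lemma RotMap.exists_arc (H : RotMap f d) : ∃ τ, RotArc f d τ := by
  have hd := H.hd
  have qn : ∀ v ∈ Icc (0 : ℝ) 1, ‖((1 - v : ℝ) : ℂ)‖ = 1 - v := fun v hv => by
    rw [Complex.norm_real, Real.norm_of_nonneg (by linarith [hv.2])]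
  obtain ⟨τ, M, t0, t1, h1, h2⟩ := arc_iter (q := fun t => ((1 - t : ℝ) : ℂ)) H.cont
    (by omega : 0 < d) H.per (by fun_prop) (fun t ht j h0 hj h => by
      have := H.free j h0 hj _ h
      rw [Complex.ofReal_eq_zero] at this
      linarith [ht.2]) (Or.inl fun j h0 hj h => by
      have := H.free j h0 hj _ h
      simp at this) (by simp [H.zero]) (fun t ht j h => by
      have h1 := congrArg (fun z : ℂ => ‖z‖) h
      beta_reduce at h1
      rw [qn t ⟨ht.1.le, ht.2⟩, H.norm_ge j (by simp)] at h1
      simp at h1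
      linarith [ht.1])
  simp only [sub_zero, Complex.ofReal_one, sub_self, Complex.ofReal_zero] at t0 t1
  refine ⟨τ, H, M, t0, t1, ?_, ?_, ?_⟩
  · rintro _ ⟨u, hu, rfl⟩
    obtain ⟨v, hv, j, e⟩ := h1 u hu
    rw [e]; exact H.norm_le j (by rw [qn v hv]; linarith [hv.1])
  · rintro _ ⟨u, hu, rfl⟩ hn
    obtain ⟨v, hv, j, e⟩ := h1 u hu
    have hv0 : v = 0 := by
      by_contra hne
      have hlt : 0 < v := lt_of_le_of_ne hv.1 (Ne.symm hne)
      have := H.norm_lt j (z := ((1 - v : ℝ) : ℂ)) (by rw [qn v hv]; linarith)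
      rw [← e, hn] at this; exact lt_irrefl _ this
    rw [← t0]
    refine h2 u hu 0 (by norm_num) j ?_
    rw [e, t0, hv0]; simp
  · rintro _ ⟨u, hu, rfl⟩ _ ⟨v, hv, rfl⟩ j h
    exact h2 u hu v hv j h

variable {τ : ℝ → ℂ}

lemma RotArc.arc (A : RotArc f d τ) (i : ℕ) : MonoArc (fun t => f^[i] (τ t)) 0 1 :=
  A.M.comp (A.R.cont.iterate i) (A.R.inj.iterate i)

lemma gm_eq (f : ℂ → ℂ) (τ : ℝ → ℂ) (i : ℕ) : gm f τ i = (fun t => f^[i] (τ t)) '' Icc 0 1 :=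
  image_image _ _ _

lemma RotArc.compact (A : RotArc f d τ) (i : ℕ) : IsCompact (gm f τ i) := by
  rw [gm_eq]; exact (A.arc i).compact

lemma RotArc.preconn (A : RotArc f d τ) (i : ℕ) : IsPreconnected (gm f τ i) := by
  rw [gm_eq]; exact (A.arc i).preconn

lemma RotArc.zero_mem (A : RotArc f d τ) (i : ℕ) : (0 : ℂ) ∈ gm f τ i :=
  ⟨0, ⟨1, by norm_num, A.t1⟩, A.R.it_zero i⟩

lemma RotArc.one_eq (A : RotArc f d τ) (i : ℕ) : f^[i] (τ 0) = ee (i * bt d) := by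
  rw [A.t0, ← ee_zero, A.R.it_ee, zero_add]

lemma RotArc.ee_mem (A : RotArc f d τ) (i : ℕ) : ee (i * bt d) ∈ gm f τ i :=
  ⟨τ 0, ⟨0, by norm_num, rfl⟩, A.one_eq i⟩

lemma RotArc.norm_le (A : RotArc f d τ) {i : ℕ} {z : ℂ} (h : z ∈ gm f τ i) : ‖z‖ ≤ 1 := by
  obtain ⟨a, ha, rfl⟩ := h
  exact A.R.norm_le i (A.disc a ha)

lemma RotArc.sphere (A : RotArc f d τ) {i : ℕ} {z : ℂ} (h : z ∈ gm f τ i) (hz : ‖z‖ = 1) :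
    z = ee (i * bt d) := by
  obtain ⟨a, ha, rfl⟩ := h
  rw [← A.one_eq i, A.t0, A.sph a ha]
  by_contra hne
  have := A.R.norm_lt i (lt_of_le_of_ne (A.disc a ha) hne)
  rw [hz] at this; exact lt_irrefl _ this

lemma RotArc.inter (A : RotArc f d τ) {i j : ℕ} (hi : i < d) (hj : j < d) (hij : i ≠ j) {z : ℂ}
    (h : z ∈ gm f τ i) (h' : z ∈ gm f τ j) : z = 0 := by
  have hd := A.R.hd
  have key : ∀ i j : ℕ, j < d → i < j → z ∈ gm f τ i → z ∈ gm f τ j → z = 0 := by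
    rintro i j hj hij ⟨a, ha, e1⟩ ⟨b, hb, e2⟩
    obtain ⟨k, hk⟩ := iter_neg (by omega : 0 < d) A.R.per e1
    have hab : a = b := A.eq a ha b hb (k + j) (by rw [Function.iterate_add_apply, e2, hk])
    rw [← hab] at e2
    have h3 : f^[j - i] a = a := by
      apply A.R.inj.iterate i
      rw [← Function.iterate_add_apply, Nat.add_sub_cancel' hij.le, e1, e2]
    rw [← e1, A.R.free (j - i) (by omega) (by omega) a h3, A.R.it_zero]
  rcases lt_or_gt_of_ne hij with h1 | h1
  · exact key i j hj h1 h h'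
  · exact key j i hi h1 h' h

lemma RotArc.mod (A : RotArc f d τ) (i : ℕ) : gm f τ i = gm f τ (i % d) := by
  unfold gm
  exact image_congr fun a _ => iter_mod A.R.per i a

lemma RotArc.shift (A : RotArc f d τ) {i j : ℕ} {z : ℂ} (h : z ∈ gm f τ i) :
    f^[j] z ∈ gm f τ ((j + i) % d) := by
  rw [← A.mod]
  obtain ⟨a, ha, rfl⟩ := h
  exact ⟨a, ha, by rw [Function.iterate_add_apply]⟩

lemma RotArc.gG_shift (A : RotArc f d τ) (j : ℕ) {z : ℂ} (h : z ∈ gG f τ d) : f^[j] z ∈ gG f τ d := by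
  obtain ⟨i, hi, h⟩ := h
  exact ⟨_, Nat.mod_lt _ (by omega), A.shift h⟩

lemma RotArc.gG_log (A : RotArc f d τ) (k : ℕ) (hk : k ≤ d) :
    IsCompact (gG f τ k) ∧ AllLog (gG f τ k) := by
  induction k with
  | zero =>
    have : gG f τ 0 = ∅ := by ext z; simp [gG]
    rw [this]
    exact ⟨isCompact_empty, fun h _ _ => ⟨0, continuousOn_empty _, by simp⟩⟩
  | succ k ih =>
    obtain ⟨c, l⟩ := ih (by omega)
    have e : gG f τ (k + 1) = gG f τ k ∪ gm f τ k := by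
      ext z; constructor
      · rintro ⟨i, hi, h⟩
        rcases Nat.lt_succ_iff_lt_or_eq.1 hi with h' | rfl
        · exact Or.inl ⟨i, h', h⟩
        · exact Or.inr h
      · rintro (⟨i, hi, h⟩ | h)
        · exact ⟨i, by omega, h⟩
        · exact ⟨k, by omega, h⟩
    have aM := (A.arc k).allLog
    rw [← gm_eq] at aM
    rw [e]
    refine ⟨c.union (A.compact k), fun h hc hn => ?_⟩
    refine HasLog.union (l h (hc.mono subset_union_left) fun z hz => hn z (Or.inl hz))
      (aM h (hc.mono subset_union_right) fun z hz => hn z (Or.inr hz)) c.isClosed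
      (A.compact k).isClosed (Set.Subsingleton.isPreconnected ?_)
    have key : ∀ x ∈ gG f τ k ∩ gm f τ k, x = 0 := by
      rintro x ⟨⟨i, hi, h1⟩, h2⟩
      exact A.inter (by omega) (by omega) hi.ne h1 h2
    intro x hx y hy
    rw [key x hx, key y hy]

/-- the fundamental domain -/
structure RotDom (f : ℂ → ℂ) (d : ℕ) (τ : ℝ → ℂ) (U : Set ℂ) : Prop where
  oU : IsOpen U
  pU : IsPreconnected U
  nU : U.Nonempty
  bU : U ⊆ ball 0 1
  col : ∀ θ ∈ Ioo 0 (bt d), ∃ ε > 0, ball (ee θ) ε ∩ ball 0 1 ⊆ U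
  dG : ∀ z ∈ U, z ∉ gG f τ d
  fr : ∀ z ∈ closure U, z ∈ ball (0 : ℂ) 1 → z ∉ U → z ∈ gm f τ 0 ∪ gm f τ 1
  cls : ∀ z ∈ closure U, ‖z‖ = 1 → z ∈ ee '' Icc 0 (bt d)
  dis : ∀ i, 0 < i → i < d → ∀ z ∈ U, f^[i] z ∉ U
  arcl : ∀ θ ∈ Icc 0 (bt d), ee θ ∈ closure U
  cov : ∀ z ∈ ball (0 : ℂ) 1, z ∈ gG f τ d ∨ ∃ i < d, ∃ w ∈ closure U, f^[i] w = z

lemma RotArc.exists_dom (A : RotArc f d τ) : ∃ U, RotDom f d τ U := by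
  have H := A.R
  have hd := H.hd
  have hb := H.bt_pos
  have hbm := H.bt_mul
  have hbl := H.bt_le
  have hpi := Real.pi_pos
  set G := gG f τ d with hG
  obtain ⟨kG, aG⟩ := A.gG_log d le_rfl
  have idx : ∀ i : ℕ, i < d → (i : ℝ) * bt d ≤ 2 * Real.pi - bt d := by
    intro i hi
    have : (i : ℝ) + 1 ≤ d := by exact_mod_cast hi
    nlinarith
  obtain ⟨n, hn, hcol⟩ := collar (E := G) kG.isClosed ⟨0, 0, by omega, A.zero_mem 0⟩ hb (by
    rintro θ hθ ⟨i, hi, h⟩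
    have h1 := A.sphere h (norm_ee θ)
    have h2 := idx i hi
    have h3 : 0 ≤ (i : ℝ) * bt d := by positivity
    have h4 := ee_eq_lt h1 (by linarith [hθ.1]) (by linarith [hθ.2])
    rcases Nat.eq_zero_or_pos i with rfl | hi0
    · simp at h4; linarith [hθ.1]
    · have : (1 : ℝ) ≤ i := by exact_mod_cast hi0
      nlinarith [hθ.2])
  set B : Set ℂ := ball 0 1 \ G with hB
  have oB : IsOpen B := isOpen_ball.sdiff kG.isClosed
  set U := connectedComponentIn B n with hU
  have oU : IsOpen U := oB.connectedComponentIn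
  have pU : IsPreconnected U := isPreconnected_connectedComponentIn
  have UB : U ⊆ B := connectedComponentIn_subset _ _
  have bU : U ⊆ ball 0 1 := UB.trans sdiff_subset
  have clb : closure U ⊆ closedBall 0 1 :=
    closure_minimal (bU.trans ball_subset_closedBall) isClosed_closedBall
  have arcl : ∀ θ ∈ Icc 0 (bt d), ee θ ∈ closure U := by
    have h1 : MapsTo ee (Ioo 0 (bt d)) (closure U) := by
      intro θ hθ
      obtain ⟨ε, hε, hs⟩ := hcol θ hθ
      rw [mem_closure_iff_nhds]
      intro N hN
      have h2 : ee θ ∈ closure (ball (0 : ℂ) 1) := by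
        rw [closure_ball _ one_ne_zero, mem_closedBall_zero_iff, norm_ee]
      obtain ⟨v, ⟨hv1, hv2⟩, hv3⟩ := mem_closure_iff_nhds.1 h2 _ (inter_mem hN (ball_mem_nhds _ hε))
      exact ⟨v, hv1, hs ⟨hv2, hv3⟩⟩
    have h2 := h1.closure continuous_ee
    rw [closure_Ioo hb.ne, closure_closure] at h2
    exact h2
  have hm : ee (bt d / 2) ∈ closure U := arcl _ ⟨by linarith, by linarith⟩
  -- a connected set attached to `U` stays on one side of the first two arcs
  have cc : ∀ (C : Set ℂ) (z : ℂ) (θ : ℝ), IsPreconnected C → C ⊆ closedBall 0 1 → z ∈ C →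
      z ∈ closure U → (∀ w ∈ C, w ∉ gm f τ 0) → (∀ w ∈ C, w ∉ gm f τ 1) → θ ∈ Ioo (bt d) (2 * Real.pi) →
      ee θ ∈ C → False := by
    intro C z θ pC bC zC zU c0 c1 hθ eC
    have ne : ∀ i < d, ∀ w ∈ U, w ∉ gm f τ i := fun i hi w hw h => (UB hw).2 ⟨i, hi, h⟩
    have p1 : IsPreconnected (U ∪ {z, ee (bt d / 2)}) :=
      pU.subset_closure subset_union_left (union_subset subset_closure (by
        rintro w (rfl | rfl); exacts [zU, hm]))
    have p2 := IsPreconnected.union z (Or.inr (Or.inl rfl)) zC p1 pC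
    have key : ∀ i : ℕ, i < 2 → (∀ w ∈ C, w ∉ gm f τ i) →
        ∀ w ∈ U ∪ {z, ee (bt d / 2)} ∪ C, w ∉ gm f τ i := by
      rintro i hi hC w ((hw | rfl | rfl) | hw)
      · exact ne i (by omega) w hw
      · exact hC _ zC
      · intro h
        have h2 := A.sphere h (norm_ee _)
        have h3 : (i : ℝ) = 0 ∨ (i : ℝ) = 1 := by
          have : i = 0 ∨ i = 1 := by omega
          rcases this with rfl | rfl <;> simp
        rcases h3 with h3 | h3 <;> rw [h3] at h2 <;>
          have := ee_eq_lt h2 (by linarith) (by linarith) <;> linarith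
      · exact hC w hw
    refine crosscut (A := gm f τ 1) (B := gm f τ 0) (θ := bt d / 2) (p := bt d) (θ' := θ)
      (q := 2 * Real.pi) p2 ?_ (A.compact 1).isClosed (A.compact 0).isClosed (A.preconn 1)
      (A.preconn 0) (A.zero_mem 1) (A.zero_mem 0) ?_ ?_ ?_ ?_ (key 1 (by norm_num) c1)
      (key 0 (by norm_num) c0) (by linarith) hθ.1 hθ.2 (by linarith) (Or.inl (Or.inr (Or.inr rfl)))
      (Or.inr eC)
    · rintro w ((hw | rfl | rfl) | hw)
      exacts [clb (subset_closure hw), clb zU, clb hm, bC hw]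
    · simpa using A.ee_mem 1
    · have := A.ee_mem 0
      rw [Nat.cast_zero, zero_mul, ← ee_per, zero_add] at this; exact this
    · intro w hw h; simpa using A.sphere hw h
    · intro w hw h
      have := A.sphere hw h
      rw [Nat.cast_zero, zero_mul, ← ee_per, zero_add] at this; exact this
  have cls : ∀ z ∈ closure U, ‖z‖ = 1 → z ∈ ee '' Icc 0 (bt d) := by
    intro z hz hz1
    obtain ⟨θ, hθ, rfl⟩ := exists_ee 0 hz1
    rw [zero_add] at hθ
    refine ⟨θ, ⟨hθ.1, ?_⟩, rfl⟩
    by_contra hlt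
    push Not at hlt
    refine cc {ee θ} (ee θ) θ isPreconnected_singleton (by
      rintro w rfl; rw [mem_closedBall_zero_iff, norm_ee]) rfl hz ?_ ?_ ⟨hlt, hθ.2⟩ rfl
    · rintro w rfl h
      have h2 := A.sphere h (norm_ee _)
      rw [Nat.cast_zero, zero_mul] at h2
      have := ee_eq_lt h2 (by linarith) (by linarith [hθ.2]); linarith
    · rintro w rfl h
      have h2 := A.sphere h (norm_ee _)
      rw [Nat.cast_one, one_mul] at h2
      have := ee_eq_lt h2 (by linarith) (by linarith [hθ.2]); linarith
  have frB : ∀ z ∈ closure U, z ∈ ball (0 : ℂ) 1 → z ∉ U → z ∈ G := by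
    intro z hz hzb hzU
    have : z ∈ frontier U := by rw [oU.frontier_eq]; exact ⟨hz, hzU⟩
    by_contra h
    exact frontier_comp_subset oB n this ⟨hzb, h⟩
  have fr : ∀ z ∈ closure U, z ∈ ball (0 : ℂ) 1 → z ∉ U → z ∈ gm f τ 0 ∪ gm f τ 1 := by
    intro z hz hzb hzU
    obtain ⟨j, hj, h⟩ := frB z hz hzb hzU
    by_contra hcon
    have hz0 : z ≠ 0 := by rintro rfl; exact hcon (Or.inl (A.zero_mem 0))
    have hj2 : 2 ≤ j := by
      by_contra hlt
      have : j = 0 ∨ j = 1 := by omega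
      rcases this with rfl | rfl
      exacts [hcon (Or.inl h), hcon (Or.inr h)]
    have p := (A.arc j).attach (E := {ee (j * bt d)}) (x := 0) isPreconnected_singleton
      (Or.inl (A.one_eq j)) (Or.inr (by rw [A.t1, H.it_zero]))
    rw [← gm_eq] at p
    have hCg : ∀ w ∈ {ee (j * bt d)} ∪ gm f τ j \ {0}, w ∈ gm f τ j ∧ w ≠ 0 := by
      rintro w (rfl | hw)
      · exact ⟨A.ee_mem j, ee_ne _⟩
      · exact hw
    have hjr : (2 : ℝ) ≤ j := by exact_mod_cast hj2
    refine cc _ z (j * bt d) p (fun w hw => mem_closedBall_zero_iff.2 (A.norm_le (hCg w hw).1))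
      (Or.inr ⟨h, hz0⟩) hz (fun w hw h' => (hCg w hw).2 ?_) (fun w hw h' => (hCg w hw).2 ?_)
      ⟨by nlinarith, by linarith [idx j hj]⟩ (Or.inl rfl)
    · exact A.inter hj (by omega) (by omega) (hCg w hw).1 h'
    · exact A.inter hj (by omega) (by omega) (hCg w hw).1 h'
  have dis : ∀ i, 0 < i → i < d → ∀ z ∈ U, f^[i] z ∉ U := by
    intro i h0 hi z hz hfz
    have h1 : f^[i] '' U ⊆ U := by
      have := (pU.image _ (H.cont.iterate i).continuousOn).subset_connectedComponentIn
        (F := B) ⟨z, hz, rfl⟩ (by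
        rintro _ ⟨w, hw, rfl⟩
        refine ⟨mem_ball_zero_iff.2 (H.norm_lt i (mem_ball_zero_iff.1 (bU hw))), fun h => ?_⟩
        have := A.gG_shift (d - i) h
        rw [H.inv1 hi.le] at this
        exact (UB hw).2 this)
      rwa [← connectedComponentIn_eq hfz] at this
    have h2 := map_mem_closure (H.cont.iterate i) hm fun v hv => h1 ⟨v, hv, rfl⟩
    rw [H.it_ee] at h2
    obtain ⟨θ, hθ, h3⟩ := cls _ h2 (norm_ee _)
    have h4 := idx i hi
    have h5 : (1 : ℝ) ≤ i := by exact_mod_cast h0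
    have h6 : bt d ≤ i * bt d := by nlinarith
    have := ee_eq_lt h3 (by linarith [hθ.1]) (by linarith [hθ.2])
    linarith [hθ.2]
  refine ⟨U, oU, pU, ⟨n, mem_connectedComponentIn hn⟩, bU, hcol, fun z hz => (UB hz).2, fr, cls, dis,
    arcl, ?_⟩
  set W : Set ℂ := ⋃ i ∈ Iio d, f^[i] '' closure U with hW
  have kU : IsCompact (closure U) := (isCompact_closedBall (0 : ℂ) 1).of_isClosed_subset isClosed_closure clb
  have cW : IsClosed W := (finite_Iio d).isClosed_biUnion fun i _ =>
    (kU.image (H.cont.iterate i)).isClosed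
  have mW : ∀ i < d, ∀ w ∈ closure U, f^[i] w ∈ W := fun i hi w hw =>
    mem_biUnion (show i ∈ Iio d from hi) ⟨w, hw, rfl⟩
  set Q : Set ℂ := ball 0 1 \ (G ∪ W) with hQ
  have oQ : IsOpen Q := isOpen_ball.sdiff (kG.isClosed.union cW)
  have Qe : ¬ Q.Nonempty := by
    rintro ⟨q, hq⟩
    refine clopen_no (B := Q) (K := G) oQ (isBounded_ball.subset sdiff_subset)
      ⟨q, hq, fun h => hq.2 (Or.inl h)⟩ kG aG ?_
    intro z hz
    rw [oQ.frontier_eq] at hz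
    obtain ⟨hz1, hz2⟩ := hz
    by_contra hzG
    -- no point of `Q` near images of `U`
    have near : ∀ i < d, ∀ N : Set ℂ, IsOpen N → f^[d - i] z ∈ N → N ∩ ball 0 1 ⊆ U → False := by
      intro i hi N oN hzN hNU
      obtain ⟨v, hv1, hv2⟩ := mem_closure_iff_nhds.1 hz1 _
        ((oN.preimage (H.cont.iterate (d - i))).mem_nhds hzN)
      have h1 := hNU ⟨hv1, mem_ball_zero_iff.2 (H.norm_lt _ (mem_ball_zero_iff.1 hv2.1))⟩
      refine hv2.2 (Or.inr ?_)
      rw [← H.inv2 hi.le v]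
      exact mW i hi _ (subset_closure h1)
    have hzb : ‖z‖ ≤ 1 := mem_closedBall_zero_iff.1
      (closure_minimal (sdiff_subset.trans ball_subset_closedBall) isClosed_closedBall hz1)
    rcases hzb.lt_or_eq with hlt | heq
    · have hzW : z ∈ W := by
        by_contra h
        exact hz2 ⟨mem_ball_zero_iff.2 hlt, by rintro (h' | h'); exacts [hzG h', h h']⟩
      obtain ⟨i, hi, w, hw, e⟩ := mem_iUnion₂.1 hzW
      have hi' : i < d := hi
      have e2 : f^[d - i] z = w := by rw [← e, H.inv1 hi'.le]
      by_cases hwU : w ∈ U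
      · exact near i hi' U oU (by rw [e2]; exact hwU) inter_subset_left
      · have := frB w hw (by rw [← e2]; exact mem_ball_zero_iff.2 (H.norm_lt _ hlt)) hwU
        exact hzG (by rw [← e]; exact A.gG_shift i this)
    · obtain ⟨θ, hθ, rfl⟩ := exists_ee 0 heq
      obtain ⟨i, hi, φ, hφ, rfl⟩ := H.floor hθ
      by_cases h0 : φ = 0
      · rw [h0, zero_add] at hzG
        exact hzG ⟨i, hi, A.ee_mem i⟩
      obtain ⟨ε, hε, hs⟩ := hcol φ ⟨lt_of_le_of_ne hφ.1 (Ne.symm h0), hφ.2⟩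
      refine near i hi _ isOpen_ball ?_ hs
      rw [← H.it_ee, H.inv1 hi.le]
      exact mem_ball_self hε
  intro z hz
  by_contra hcon
  push Not at hcon
  refine Qe ⟨z, hz, ?_⟩
  rintro (h | h)
  · exact hcon.1 h
  · obtain ⟨i, hi, w, hw, e⟩ := mem_iUnion₂.1 h
    exact hcon.2 i hi w hw e

end

section
variable {f : ℂ → ℂ} {d : ℕ} {τ : ℝ → ℂ} {U : Set ℂ}

lemma RotDom.clb (D : RotDom f d τ U) : closure U ⊆ closedBall 0 1 :=
  closure_minimal (D.bU.trans ball_subset_closedBall) isClosed_closedBall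

lemma RotDom.frc (D : RotDom f d τ U) {z : ℂ} (hz : z ∈ closure U) (hU : z ∉ U) :
    z ∈ ee '' Icc 0 (bt d) ∨ z ∈ gm f τ 0 ∪ gm f τ 1 := by
  rcases (mem_closedBall_zero_iff.1 (D.clb hz)).lt_or_eq with h | h
  · exact Or.inr (D.fr z hz (mem_ball_zero_iff.2 h) hU)
  · exact Or.inl (D.cls z hz h)

lemma RotArc.one_gm (A : RotArc f d τ) : (1 : ℂ) ∈ gm f τ 0 := by
  have := A.ee_mem 0
  rwa [Nat.cast_zero, zero_mul, ee_zero] at this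

lemma RotArc.eb_gm (A : RotArc f d τ) : ee (bt d) ∈ gm f τ 1 := by
  simpa using A.ee_mem 1

lemma gm_one {z : ℂ} : z ∈ gm f τ 1 ↔ ∃ x ∈ gm f τ 0, f x = z := by
  constructor
  · rintro ⟨x, hx, rfl⟩; exact ⟨x, ⟨x, hx, rfl⟩, rfl⟩
  · rintro ⟨_, ⟨x, hx, rfl⟩, rfl⟩; exact ⟨x, hx, rfl⟩

/-- the boundary of the fundamental domain is a Jordan curve -/
lemma RotDom.jordan (A : RotArc f d τ) (D : RotDom f d τ U) : ∃ ψ : ℂ → ℂ,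
    ContinuousOn ψ (closedBall 0 1) ∧ InjOn ψ (closedBall 0 1) ∧ ψ '' ball 0 1 = U ∧
    ψ '' sphere 0 1 = frontier U := by
  have hd := A.R.hd
  have frU : frontier U = closure U \ U := D.oU.frontier_eq
  have gU : ∀ z, z ∈ gm f τ 0 ∪ gm f τ 1 → z ∉ U := by
    rintro z (h | h) hU
    · exact D.dG z hU ⟨0, by omega, h⟩
    · exact D.dG z hU ⟨1, by omega, h⟩
  have kg : IsCompact (gm f τ 0 ∪ gm f τ 1) := (A.compact 0).union (A.compact 1)
  have lcg : ∀ i, LC (gm f τ i) := fun i => by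
    rw [gm_eq]; exact LC_image isCompact_Icc (convex_Icc 0 1) (A.arc i).1
  have car : CarH U (gm f τ 0 ∪ gm f τ 1 ∪ sphere 0 1) := by
    refine ⟨D.oU, D.pU, D.nU, isBounded_ball.subset D.bU, kg.union (isCompact_sphere 0 1),
      IsPreconnected.union 1 (Or.inl A.one_gm) (by simp)
        (IsPreconnected.union 0 (A.zero_mem 0) (A.zero_mem 1) (A.preconn 0) (A.preconn 1))
        sphere_preconn, ?_, ?_, LC.union kg.isClosed isClosed_sphere (LC.union
        (A.compact 0).isClosed (A.compact 1).isClosed (lcg 0) (lcg 1)) sphere_LC⟩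
    · intro z hz
      rw [frU] at hz
      rcases D.frc hz.1 hz.2 with ⟨θ, _, rfl⟩ | h
      · right; rw [mem_sphere_zero_iff_norm, norm_ee]
      · exact Or.inl h
    · rintro z (hz | hz) hU
      · exact gU z hz hU
      · have := mem_ball_zero_iff.1 (D.bU hU)
        rw [mem_sphere_zero_iff_norm] at hz; linarith
  refine caratheodory car fun a ha => ?_
  have ha1 := mem_closedBall_zero_iff.1 (D.clb (frontier_subset_closure ha))
  set E : Set ℂ := {z : ℂ | 1 ≤ ‖z‖} \ {a} with hE
  have pE : IsPreconnected E := ext_preconn ha1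
  have e0 : ∀ i, f^[i] (τ 0) ∈ E ∨ f^[i] (τ 0) = a := fun i => by
    by_cases h : f^[i] (τ 0) = a
    · exact Or.inr h
    · refine Or.inl ⟨?_, h⟩
      simp only [mem_setOf_eq]
      rw [A.one_eq, norm_ee]
  have e1 : ∀ i, f^[i] (τ 1) = 0 := fun i => by rw [A.t1, A.R.it_zero]
  have key : ∀ i j, a ≠ 0 → a ∉ gm f τ i → IsPreconnected (E ∪ gm f τ i \ {a} ∪ gm f τ j \ {a}) := by
    intro i j h0 hi
    have p1 : IsPreconnected (E ∪ gm f τ i \ {a}) := by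
      rw [sdiff_singleton_eq_self hi]
      refine IsPreconnected.union (ee (i * bt d)) ?_ (A.ee_mem i) pE (A.preconn i)
      rw [← A.one_eq]
      refine (e0 i).resolve_right fun h => hi ?_
      rw [← h, A.one_eq]; exact A.ee_mem i
    have := (A.arc j).attach p1 (x := a) ((e0 j).imp_left Or.inl)
      (Or.inl (Or.inr (by beta_reduce; rw [e1]; exact ⟨A.zero_mem i, Ne.symm h0⟩)))
    rwa [← gm_eq] at this
  refine ⟨E ∪ gm f τ 0 \ {a} ∪ gm f τ 1 \ {a}, ?_, ?_, ?_⟩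
  · by_cases h0 : a = 0
    · have p1 := (A.arc 0).attach pE (x := a) (e0 0) (Or.inr (by rw [e1, h0]))
      have p2 := (A.arc 1).attach p1 (x := a) ((e0 1).imp_left Or.inl) (Or.inr (by rw [e1, h0]))
      rwa [← gm_eq, ← gm_eq] at p2
    · by_cases h1 : a ∈ gm f τ 0
      · rw [union_right_comm]
        exact key 1 0 h0 fun h => h0 (A.inter (by omega) (by omega) zero_ne_one h1 h)
      · exact key 0 1 h0 h1
  · rintro z hz (h | h)
    · rcases hz with (hz | hz) | hz
      · have := mem_ball_zero_iff.1 (D.bU h)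
        have h3 : 1 ≤ ‖z‖ := hz.1
        linarith
      · exact gU z (Or.inl hz.1) h
      · exact gU z (Or.inr hz.1) h
    · rcases hz with (hz | hz) | hz <;> exact hz.2 h
  · rintro z ⟨hz, hza⟩
    rw [frU] at hz
    rcases D.frc hz.1 hz.2 with ⟨θ, hθ, rfl⟩ | h | h
    · exact Or.inl (Or.inl ⟨(norm_ee θ).ge, hza⟩)
    · exact Or.inl (Or.inr ⟨h, hza⟩)
    · exact Or.inr ⟨h, hza⟩

/-- the map of the fundamental domain onto the standard sector -/
lemma RotDom.sector (A : RotArc f d τ) (D : RotDom f d τ U) : ∃ Φ : ℂ → ℂ,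
    ContinuousOn Φ (closure U) ∧ BijOn Φ (closure U) (Sec (bt d)) ∧ gm f τ 0 ⊆ closure U ∧
    gm f τ 1 ⊆ closure U ∧ (∀ x ∈ gm f τ 0, Φ (f x) = ee (bt d) * Φ x) ∧ Φ 0 = 0 ∧
    ∀ ρ ∈ Icc (0 : ℝ) 1, ∃ x ∈ gm f τ 0, Φ x = ρ := by
  have H := A.R
  have hd := H.hd
  have hb := H.bt_pos
  have hbl := H.bt_le
  have hpi := Real.pi_pos
  have disj : ∀ z, z ∈ gm f τ 0 → z ∈ gm f τ 1 → z = 0 := fun z h h' =>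
    A.inter (by omega) (by omega) zero_ne_one h h'
  have frU : frontier U = closure U \ U := D.oU.frontier_eq
  obtain ⟨ψ, ψc, ψi, ψb, ψs⟩ := D.jordan A
  have ψcl : ψ '' closedBall 0 1 = closure U := by
    rw [← ball_union_sphere, image_union, ψb, ψs, closure_eq_self_union_frontier]
  obtain ⟨κ, κc, κi, κ0, κ1, κs, κa⟩ := arc_split ψc ψi hb (by linarith) (fun θ hθ => by
    rw [ψs, frU]
    refine ⟨D.arcl θ hθ, fun h => ?_⟩
    have := mem_ball_zero_iff.1 (D.bU h)
    rw [norm_ee] at this; exact lt_irrefl _ this)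
  rw [ψs] at κs
  rw [ee_zero] at κ1
  have κfr : ∀ t ∈ Icc (0 : ℝ) 1, κ t ∈ frontier U := fun t ht => by
    rw [κs]; exact Or.inr ⟨t, ht, rfl⟩
  have κg : ∀ t ∈ Icc (0 : ℝ) 1, κ t ∈ gm f τ 0 ∪ gm f τ 1 := by
    intro t ht
    by_cases e0 : t = 0
    · rw [e0, κ0]; exact Or.inr A.eb_gm
    by_cases e1 : t = 1
    · rw [e1, κ1]; exact Or.inl A.one_gm
    have hm := κfr t ht
    rw [frU] at hm
    exact (D.frc hm.1 hm.2).resolve_left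
      (κa t ⟨lt_of_le_of_ne ht.1 (Ne.symm e0), lt_of_le_of_ne ht.2 e1⟩)
  -- connected pieces of the curve which cross from one arc to the other contain the origin
  have cross : ∀ J : Set ℝ, J ⊆ Icc 0 1 → J.OrdConnected → ∀ s ∈ J, ∀ t ∈ J, κ s ∈ gm f τ 0 →
      κ t ∈ gm f τ 1 → ∃ u ∈ J, κ u = 0 := by
    intro J hJ oJ s hs t ht h0 h1
    obtain ⟨_, ⟨u, hu, rfl⟩, h2, h3⟩ := isPreconnected_closed_iff.1
      (oJ.isPreconnected.image κ (κc.mono hJ)) _ _ (A.compact 0).isClosed (A.compact 1).isClosed (by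
        rintro _ ⟨u, hu, rfl⟩; exact κg u (hJ hu)) ⟨_, ⟨s, hs, rfl⟩, h0⟩ ⟨_, ⟨t, ht, rfl⟩, h1⟩
    exact ⟨u, hu, disj _ h2 h3⟩
  have m0 : (0 : ℝ) ∈ Icc (0 : ℝ) 1 := by norm_num
  have m1 : (1 : ℝ) ∈ Icc (0 : ℝ) 1 := by norm_num
  have k1g : κ 1 ∈ gm f τ 0 := by rw [κ1]; exact A.one_gm
  have k0g : κ 0 ∈ gm f τ 1 := by rw [κ0]; exact A.eb_gm
  obtain ⟨t0, ht0, hκ0⟩ := cross (Icc 0 1) subset_rfl ordConnected_Icc 1 m1 0 m0 k1g k0g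
  have ht01 : t0 < 1 := lt_of_le_of_ne ht0.2 fun h => by
    rw [h, κ1] at hκ0; exact one_ne_zero hκ0
  have ht00 : 0 < t0 := lt_of_le_of_ne ht0.1 fun h => by
    rw [← h, κ0] at hκ0; exact ee_ne _ hκ0
  have κz : ∀ u ∈ Icc (0 : ℝ) 1, κ u = 0 → u = t0 := fun u hu h => κi hu ht0 (h.trans hκ0.symm)
  have s1 : ∀ t ∈ Icc t0 1, κ t ∈ gm f τ 0 := by
    intro t ht
    rcases ht.1.eq_or_lt with h | h
    · rw [← h, hκ0]; exact A.zero_mem 0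
    refine (κg t ⟨ht0.1.trans ht.1, ht.2⟩).resolve_right fun h' => ?_
    have hJ : Ioc t0 1 ⊆ Icc 0 1 := fun s hs => ⟨ht0.1.trans hs.1.le, hs.2⟩
    obtain ⟨u, hu, h2⟩ := cross (Ioc t0 1) hJ ordConnected_Ioc 1 ⟨ht01, le_rfl⟩ t ⟨h, ht.2⟩ k1g h'
    exact hu.1.ne' (κz u (hJ hu) h2)
  have s0 : ∀ t ∈ Icc 0 t0, κ t ∈ gm f τ 1 := by
    intro t ht
    rcases ht.2.eq_or_lt with h | h
    · rw [h, hκ0]; exact A.zero_mem 1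
    refine (κg t ⟨ht.1, ht.2.trans ht0.2⟩).resolve_left fun h' => ?_
    have hJ : Ico 0 t0 ⊆ Icc 0 1 := fun s hs => ⟨hs.1, hs.2.le.trans ht0.2⟩
    obtain ⟨u, hu, h2⟩ := cross (Ico 0 t0) hJ ordConnected_Ico t ⟨ht.1, h⟩ 0 ⟨le_rfl, ht00⟩ h' k0g
    exact hu.2.ne (κz u (hJ hu) h2)
  have full : ∀ (i : ℕ) (J : Set ℝ), J ⊆ Icc 0 1 → J.OrdConnected → (∀ t ∈ J, κ t ∈ gm f τ i) →
      t0 ∈ J → ee (i * bt d) ∈ κ '' J → gm f τ i ⊆ κ '' J := by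
    intro i J hJ oJ hs h0 h1
    rw [gm_eq] at *
    refine (A.arc i).full zero_le_one (oJ.isPreconnected.image κ (κc.mono hJ)) ?_ ?_ ?_
    · rintro _ ⟨t, ht, rfl⟩; exact hs t ht
    · beta_reduce; rw [A.one_eq]; exact h1
    · exact ⟨t0, h0, by rw [hκ0, A.t1, H.it_zero]⟩
  have g0 : gm f τ 0 ⊆ κ '' Icc t0 1 := full 0 _ (Icc_subset_Icc ht0.1 le_rfl) ordConnected_Icc s1
    ⟨le_rfl, ht0.2⟩ ⟨1, ⟨ht0.2, le_rfl⟩, by rw [κ1, Nat.cast_zero, zero_mul, ee_zero]⟩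
  have g1 : gm f τ 1 ⊆ κ '' Icc 0 t0 := full 1 _ (Icc_subset_Icc le_rfl ht0.2) ordConnected_Icc s0
    ⟨ht0.1, le_rfl⟩ ⟨0, ⟨le_rfl, ht0.1⟩, by rw [κ0, Nat.cast_one, one_mul]⟩
  have κeq : κ '' Icc 0 1 = gm f τ 0 ∪ gm f τ 1 := by
    apply subset_antisymm
    · rintro _ ⟨t, ht, rfl⟩; exact κg t ht
    · exact union_subset (g0.trans (image_mono (Icc_subset_Icc ht0.1 le_rfl)))
        (g1.trans (image_mono (Icc_subset_Icc le_rfl ht0.2)))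
  rw [κeq] at κs
  have gfr : ∀ z, z ∈ gm f τ 0 ∪ gm f τ 1 → z ∈ frontier U := fun z hz => by
    rw [κs]; exact Or.inr hz
  -- the parameter on the arc
  have ht1 : 0 < 1 - t0 := by linarith
  set l : ℂ → ℂ := fun x => (((Function.invFunOn κ (Icc 0 1) x - t0) / (1 - t0) : ℝ) : ℂ) with hl
  have lκ : ∀ t ∈ Icc (0 : ℝ) 1, l (κ t) = (((t - t0) / (1 - t0) : ℝ) : ℂ) := fun t ht => by
    simp only [hl]; rw [κi.leftInvOn_invFunOn ht]
  have lc : ContinuousOn l (κ '' Icc 0 1) := by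
    refine factor_continuousOn isCompact_Icc κc ?_
    have : Continuous (fun t : ℝ => (((t - t0) / (1 - t0) : ℝ) : ℂ)) := by fun_prop
    exact this.continuousOn.congr lκ
  rw [κeq] at lc
  have l0 : l 0 = 0 := by
    have := lκ t0 ht0
    rw [hκ0] at this; rw [this]; simp
  have l1 : l 1 = 1 := by
    have := lκ 1 m1
    rw [κ1] at this; rw [this, div_self ht1.ne']; simp
  have lre : ∀ x ∈ gm f τ 0, ∃ ρ ∈ Icc (0 : ℝ) 1, l x = ρ := by
    intro x hx
    obtain ⟨t, ht, rfl⟩ := g0 hx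
    refine ⟨_, ⟨div_nonneg (by linarith [ht.1]) ht1.le, ?_⟩, lκ t ⟨ht0.1.trans ht.1, ht.2⟩⟩
    rw [div_le_one ht1]; linarith [ht.2]
  have linj : ∀ x ∈ gm f τ 0, ∀ y ∈ gm f τ 0, l x = l y → x = y := by
    intro x hx y hy h
    obtain ⟨t, ht, rfl⟩ := g0 hx
    obtain ⟨s, hs, rfl⟩ := g0 hy
    rw [lκ t ⟨ht0.1.trans ht.1, ht.2⟩, lκ s ⟨ht0.1.trans hs.1, hs.2⟩, Complex.ofReal_inj,
      div_left_inj' ht1.ne'] at h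
    have : t = s := by linarith
    rw [this]
  have lsurj : ∀ ρ ∈ Icc (0 : ℝ) 1, ∃ x ∈ gm f τ 0, l x = ρ := by
    intro ρ hρ
    have ht : t0 + ρ * (1 - t0) ∈ Icc t0 1 := ⟨by nlinarith [hρ.1], by nlinarith [hρ.2]⟩
    refine ⟨_, s1 _ ht, ?_⟩
    rw [lκ _ ⟨ht0.1.trans ht.1, ht.2⟩]
    congr 1; field_simp; ring
  -- the boundary map
  set ζ := ee (bt d) with hζ
  have ζ0 : ζ ≠ 0 := ee_ne _
  have back : ∀ x, f^[d - 1] (f x) = x := fun x => H.inv1 (i := 1) (by omega) x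
  obtain ⟨m, mc, mg0, mg1⟩ := glue_continuousOn (f := l) (g := fun x => ζ * l (f^[d - 1] x))
    (A.compact 0).isClosed (A.compact 1).isClosed (lc.mono subset_union_left)
    (continuousOn_const.mul (ContinuousOn.comp (t := gm f τ 0) (lc.mono subset_union_left)
      (H.cont.iterate _).continuousOn (by
        intro x hx
        obtain ⟨y, hy, rfl⟩ := gm_one.1 hx
        rw [back]; exact hy))) (by
      rintro x ⟨h, h'⟩
      rw [disj x h h']
      beta_reduce
      rw [H.it_zero, l0, mul_zero])
  have mf : ∀ x ∈ gm f τ 0, m (f x) = ζ * l x := fun x hx => by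
    rw [mg1 _ (gm_one.2 ⟨x, hx, rfl⟩)]
    beta_reduce; rw [back]
  have f1 : f 1 = ζ := by
    have := H.it_ee 1 0
    rwa [ee_zero, Nat.cast_one, one_mul, zero_add] at this
  have munit : ∀ x ∈ gm f τ 0 ∪ gm f τ 1, ‖m x‖ = 1 → m x = x := by
    have l1' : ∀ x ∈ gm f τ 0, ‖l x‖ = 1 → x = 1 := by
      intro x hx hn
      obtain ⟨ρ, hρ, e⟩ := lre x hx
      rw [e, Complex.norm_real, Real.norm_of_nonneg hρ.1] at hn
      exact linj x hx 1 A.one_gm (by rw [e, l1, hn]; simp)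
    rintro x (hx | hx) hn
    · rw [mg0 x hx] at hn ⊢
      rw [l1' x hx hn, l1]
    · obtain ⟨y, hy, rfl⟩ := gm_one.1 hx
      rw [mf y hy] at hn ⊢
      rw [norm_mul, hζ, norm_ee, one_mul] at hn
      rw [l1' y hy hn, l1, f1, mul_one]
  obtain ⟨k, kc, k1, k2⟩ := glue_continuousOn (f := id) (g := m) (K₁ := ee '' Icc 0 (bt d))
    (isCompact_Icc.image continuous_ee).isClosed ((A.compact 0).union (A.compact 1)).isClosed
    continuousOn_id mc (by
      rintro x ⟨⟨θ, hθ, rfl⟩, hx | hx⟩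
      · rw [mg0 _ hx, A.sphere hx (norm_ee θ), Nat.cast_zero, zero_mul, ee_zero, l1]; rfl
      · have e := A.sphere hx (norm_ee θ)
        rw [Nat.cast_one, one_mul] at e
        rw [e, ← hζ, ← f1, mf 1 A.one_gm, l1, f1, mul_one]; rfl)
  have ke : ∀ θ ∈ Icc 0 (bt d), k (ee θ) = ee θ := fun θ hθ => k1 _ ⟨θ, hθ, rfl⟩
  have kl : ∀ x ∈ gm f τ 0, k x = l x := fun x hx => (k2 x (Or.inl hx)).trans (mg0 x hx)
  have kf : ∀ x ∈ gm f τ 0, k (f x) = ζ * l x := fun x hx =>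
    (k2 _ (Or.inr (gm_one.2 ⟨x, hx, rfl⟩))).trans (mf x hx)
  have kb : BijOn k (ψ '' sphere 0 1) (frontier (Sec (bt d))) := by
    rw [ψs, κs, Sec_frontier hb hbl]
    refine ⟨?_, ?_, ?_⟩
    · rintro _ (⟨θ, hθ, rfl⟩ | hx | hx)
      · rw [ke θ hθ]; exact Or.inl ⟨θ, hθ, rfl⟩
      · obtain ⟨ρ, hρ, e⟩ := lre _ hx
        rw [kl _ hx, e]; exact Or.inr (Or.inl ⟨ρ, hρ, rfl⟩)
      · obtain ⟨y, hy, rfl⟩ := gm_one.1 hx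
        obtain ⟨ρ, hρ, e⟩ := lre _ hy
        rw [kf _ hy, e]; exact Or.inr (Or.inr ⟨ρ, hρ, mul_comm _ _⟩)
    · have c1 : ∀ θ ∈ Icc 0 (bt d), ∀ x ∈ gm f τ 0 ∪ gm f τ 1, k (ee θ) = k x → ee θ = x := by
        intro θ hθ x hx h
        rw [ke θ hθ, k2 x hx] at h
        rw [h]; exact munit x hx (by rw [← h, norm_ee])
      have c2 : ∀ x ∈ gm f τ 0, ∀ y ∈ gm f τ 0, k x = k (f y) → x = f y := by
        intro x hx y hy h
        obtain ⟨ρ, hρ, e⟩ := lre _ hx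
        obtain ⟨ρ', hρ', e'⟩ := lre _ hy
        rw [kl x hx, kf y hy, e, e'] at h
        have hn := congrArg (fun z : ℂ => ‖z‖) h
        beta_reduce at hn
        rw [norm_mul, hζ, norm_ee, one_mul, Complex.norm_real, Complex.norm_real,
          Real.norm_of_nonneg hρ.1, Real.norm_of_nonneg hρ'.1] at hn
        rw [← hn] at h e'
        have hρ0 : ρ = 0 := by
          by_contra hne
          have h2 : ζ = 1 := by
            have : (ρ : ℂ) ≠ 0 := Complex.ofReal_ne_zero.2 hne
            exact mul_right_cancel₀ this (by rw [← h, one_mul])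
          rw [hζ, ← ee_zero] at h2
          have := ee_eq_lt h2 (by linarith) (by linarith)
          linarith
        rw [hρ0, Complex.ofReal_zero, ← l0] at e e'
        rw [linj x hx 0 (A.zero_mem 0) e, linj y hy 0 (A.zero_mem 0) e', H.zero]
      rintro _ (⟨θ, hθ, rfl⟩ | hx | hx) _ (⟨θ', hθ', rfl⟩ | hy | hy) h
      · rwa [ke θ hθ, ke θ' hθ'] at h
      · exact c1 θ hθ _ (Or.inl hy) h
      · exact c1 θ hθ _ (Or.inr hy) h
      · exact (c1 θ' hθ' _ (Or.inl hx) h.symm).symm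
      · rw [kl _ hx, kl _ hy] at h; exact linj _ hx _ hy h
      · obtain ⟨y, hy', rfl⟩ := gm_one.1 hy
        exact c2 _ hx y hy' h
      · exact (c1 θ' hθ' _ (Or.inr hx) h.symm).symm
      · obtain ⟨x, hx', rfl⟩ := gm_one.1 hx
        exact (c2 _ hy x hx' h.symm).symm
      · obtain ⟨x, hx', rfl⟩ := gm_one.1 hx
        obtain ⟨y, hy', rfl⟩ := gm_one.1 hy
        rw [kf _ hx', kf _ hy'] at h
        rw [linj _ hx' _ hy' (mul_left_cancel₀ ζ0 h)]
    · rintro _ (⟨θ, hθ, rfl⟩ | ⟨ρ, hρ, rfl⟩ | ⟨ρ, hρ, rfl⟩)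
      · exact ⟨ee θ, Or.inl ⟨θ, hθ, rfl⟩, ke θ hθ⟩
      · obtain ⟨x, hx, e⟩ := lsurj ρ hρ
        exact ⟨x, Or.inr (Or.inl hx), by rw [kl x hx, e]⟩
      · obtain ⟨x, hx, e⟩ := lsurj ρ hρ
        exact ⟨f x, Or.inr (Or.inr (gm_one.2 ⟨x, hx, rfl⟩)), by rw [kf x hx, e]; exact mul_comm _ _⟩
  rw [← κs, ← ψs] at kc
  obtain ⟨Φ, Φc, Φb, Φk⟩ := extend_bd ψc ψi (Sec_closed (bt d)) (Sec_convex _)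
    (Sec_interior_ne hb hbl) (Sec_bounded _) kc kb
  rw [ψcl] at Φc Φb
  rw [ψs] at Φk
  have Φl : ∀ x ∈ gm f τ 0, Φ x = l x := fun x hx => by rw [Φk x (gfr x (Or.inl hx)), kl x hx]
  refine ⟨Φ, Φc, Φb, fun x hx => frontier_subset_closure (gfr x (Or.inl hx)),
    fun x hx => frontier_subset_closure (gfr x (Or.inr hx)), fun x hx => ?_, ?_, fun ρ hρ => ?_⟩
  · rw [Φk _ (gfr _ (Or.inr (gm_one.2 ⟨x, hx, rfl⟩))), kf x hx, Φl x hx]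
  · rw [Φl 0 (A.zero_mem 0), l0]
  · obtain ⟨x, hx, e⟩ := lsurj ρ hρ
    exact ⟨x, hx, by rw [Φl x hx, e]⟩

end

lemma RotMap.num {f : ℂ → ℂ} {d : ℕ} (H : RotMap f d) {i : ℕ} (h0 : 0 < i) (hi : i < d) {θ θ' : ℝ}
    (hθ : θ ∈ Icc 0 (bt d)) (hθ' : θ' ∈ Icc 0 (bt d)) (h : ee (i * bt d + θ) = ee θ') :
    (i = 1 ∧ θ = 0 ∧ θ' = bt d) ∨ (i + 1 = d ∧ θ = bt d ∧ θ' = 0) := by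
  have hb := H.bt_pos
  have hm := H.bt_mul
  have hpi := Real.pi_pos
  obtain ⟨a1, a2⟩ := hθ
  obtain ⟨b1, b2⟩ := hθ'
  have i1 : bt d ≤ i * bt d := le_mul_of_one_le_left hb.le (by exact_mod_cast h0)
  have i2 : ((i : ℝ) + 1) * bt d ≤ d * bt d :=
    mul_le_mul_of_nonneg_right (by exact_mod_cast hi) hb.le
  rcases lt_or_ge (i * bt d + θ) (θ' + 2 * Real.pi) with h3 | h3
  · left
    have h4 := ee_eq_lt h (by nlinarith) h3
    have h5 : (i : ℝ) * bt d = 1 * bt d := by linarith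
    exact ⟨by exact_mod_cast mul_right_cancel₀ hb.ne' h5, by linarith, by linarith⟩
  · right
    have h5 : ((i : ℝ) + 1) * bt d = d * bt d := by linarith
    exact ⟨by exact_mod_cast mul_right_cancel₀ hb.ne' h5, by linarith, by linarith⟩

theorem RotMap.rotGood {f : ℂ → ℂ} {d : ℕ} (H : RotMap f d) :
    RotGood f (Complex.exp (2 * Real.pi * Complex.I / d)) := by
  obtain ⟨τ, A⟩ := H.exists_arc
  obtain ⟨U, D⟩ := A.exists_dom
  obtain ⟨Φ, Φc, Φb, g0, g1, Φf, Φ0, Φs⟩ := RotDom.sector A D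
  have hd := H.hd
  have hb := H.bt_pos
  have hbl := H.bt_le
  have hm := H.bt_mul
  have hpi := Real.pi_pos
  have Ri : ∀ (i : ℕ) z, (fun z => ee (bt d) * z)^[i] z = ee (i * bt d) * z := fun i z => by
    rw [mul_left_iterate, ee_pow]
  have ed : ee (d * bt d) = 1 := by rw [← ee_pow, ← H.root, ← Complex.exp_nat_mul,
    mul_div_cancel₀ _ (by exact_mod_cast H.dpos.ne'), Complex.exp_two_pi_mul_I]
  have z0 : (0 : ℂ) ∈ closure U := g0 (A.zero_mem 0)
  have cb : ∀ z ∈ closure U, ‖z‖ ≤ 1 := fun z hz => by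
    have := closure_mono D.bU hz
    rwa [closure_ball _ one_ne_zero, mem_closedBall_zero_iff] at this
  have cK : IsCompact (closure U) := (isBounded_ball.subset D.bU).isCompact_closure
  have ydj : ∀ y ∈ closure U, y ∉ U → ∀ j, 2 ≤ j → j < d → y ∈ gm f τ j → y = 0 := by
    intro y hy hyU j h2 hj hg
    rcases D.frc hy hyU with ⟨φ, hφ, rfl⟩ | h | h
    · exfalso
      have h1 := A.sphere hg (norm_ee _)
      have h3 : (2 : ℝ) * bt d ≤ j * bt d := mul_le_mul_of_nonneg_right (by exact_mod_cast h2) hb.le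
      have h4 : (j : ℝ) * bt d < d * bt d := mul_lt_mul_of_pos_right (by exact_mod_cast hj) hb
      have := ee_eq_lt h1 (by linarith [hφ.1]) (by linarith [hφ.2])
      linarith [hφ.2]
    · exact A.inter hj (by omega) (by omega) hg h
    · exact A.inter hj (by omega) (by omega) hg h
  have nU : ∀ i, 0 < i → i < d → ∀ x ∈ closure U, f^[i] x ∉ U := by
    intro i h0 hi x hx h
    obtain ⟨v, h1, h2⟩ := mem_closure_iff.1 hx _ (D.oU.preimage (H.cont.iterate i)) h
    exact D.dis i h0 hi v h2 h1
  rw [H.root]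
  refine glue_equiv (n := d) (by omega) H.cont H.per (continuous_const.mul continuous_id)
    (fun z => by rw [Ri, ed, one_mul]) cK Φc Φb ?_ ?_ ?_
  · ext z
    simp only [mem_iUnion]
    constructor
    · intro hz
      rcases (mem_closedBall_zero_iff.1 hz).lt_or_eq with h | h
      · rcases D.cov z (mem_ball_zero_iff.2 h) with ⟨i, hi, a, ha, e⟩ | ⟨i, hi, w, hw, e⟩
        · exact ⟨⟨i, hi⟩, a, g0 ⟨a, ha, rfl⟩, e⟩
        · exact ⟨⟨i, hi⟩, w, hw, e⟩
      · obtain ⟨θ, hθ, rfl⟩ := exists_ee 0 h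
        obtain ⟨i, hi, φ, hφ, rfl⟩ := H.floor hθ
        exact ⟨⟨i, hi⟩, ee φ, D.arcl φ ⟨hφ.1, hφ.2.le⟩, H.it_ee i φ⟩
    · rintro ⟨i, w, hw, rfl⟩
      exact mem_closedBall_zero_iff.2 (H.norm_le _ (cb w hw))
  · ext z
    simp only [mem_iUnion]
    constructor
    · intro hz
      have hz := mem_closedBall_zero_iff.1 hz
      rcases eq_or_ne z 0 with rfl | hne
      · exact ⟨⟨0, by omega⟩, 0, (mem_Sec hb hbl).2 ⟨0, by simp, 0, ⟨le_rfl, hb.le⟩, by simp⟩, rfl⟩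
      · have hn : (‖z‖ : ℂ) ≠ 0 := by exact_mod_cast (norm_ne_zero_iff.2 hne)
        obtain ⟨θ, hθ, e⟩ := exists_ee 0 (z := z / ‖z‖) (by
          rw [norm_div, Complex.norm_real, norm_norm, div_self (norm_ne_zero_iff.2 hne)])
        obtain ⟨i, hi, φ, hφ, rfl⟩ := H.floor hθ
        refine ⟨⟨i, hi⟩, ‖z‖ * ee φ, (mem_Sec hb hbl).2
          ⟨‖z‖, ⟨norm_nonneg _, hz⟩, φ, ⟨hφ.1, hφ.2.le⟩, rfl⟩, ?_⟩
        show (fun z => ee (bt d) * z)^[i] _ = _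
        rw [Ri, ee_mul_pol, add_comm, e, mul_div_cancel₀ _ hn]
    · rintro ⟨i, w, hw, rfl⟩
      obtain ⟨ρ, hρ, θ, hθ, rfl⟩ := (mem_Sec hb hbl).1 hw
      rw [Ri, ee_mul_pol]
      refine mem_closedBall_zero_iff.2 ?_
      rw [norm_mul, norm_ee, mul_one, Complex.norm_real, Real.norm_of_nonneg hρ.1]
      exact hρ.2
  · intro i hi x hx y hy
    rw [Ri]
    rcases Nat.eq_zero_or_pos i with rfl | h0
    · simp only [Function.iterate_zero, id, Nat.cast_zero, zero_mul, ee_zero, one_mul]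
      exact ⟨fun h => by rw [h], fun h => Φb.injOn hx hy h⟩
    constructor
    · intro h
      have yU : y ∉ U := h ▸ nU i h0 hi x hx
      have hxy : f^[d - i] y = x := by rw [← h, H.inv1 hi.le]
      have xU : x ∉ U := hxy ▸ nU (d - i) (by omega) (by omega) y hy
      have hz : y = 0 → ee (i * bt d) * Φ x = Φ y := fun e => by
        rw [e, H.it_zero] at hxy
        rw [e, ← hxy, Φ0, mul_zero]
      have hx' : x ∈ gm f τ 0 ∨ x ∈ gm f τ 1 := by
        rcases D.frc hx xU with ⟨φ, hφ, rfl⟩ | h'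
        · rw [H.it_ee] at h
          obtain ⟨φ', hφ', e⟩ := D.cls y hy (by rw [← h, norm_ee])
          rw [← e, add_comm] at h
          rcases H.num h0 hi hφ hφ' h with ⟨_, r, _⟩ | ⟨_, r, _⟩
          · left; have := A.ee_mem 0; rwa [Nat.cast_zero, zero_mul, ← r] at this
          · right; have := A.ee_mem 1; rwa [Nat.cast_one, one_mul, ← r] at this
        · exact h'
      rcases hx' with hx' | hx'
      · rcases (by omega : i = 1 ∨ 2 ≤ i) with rfl | h2
        · rw [← h, Function.iterate_one, Φf x hx', Nat.cast_one, one_mul]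
        · refine hz (ydj y hy yU i h2 hi ?_)
          have := A.shift (j := i) hx'
          rwa [h, add_zero, Nat.mod_eq_of_lt hi] at this
      · rcases (by omega : i + 1 = d ∨ i + 1 < d) with h2 | h2
        · obtain ⟨x', hx2, rfl⟩ := gm_one.1 hx'
          have : y = x' := by
            rw [← h, ← Function.iterate_succ_apply, Nat.succ_eq_add_one, h2, H.per]
          rw [this, Φf x' hx2, ← mul_assoc, ← ee_add, ← add_one_mul, ← Nat.cast_succ]
          rw [Nat.succ_eq_add_one, h2, ed, one_mul]
        · refine hz (ydj y hy yU (i + 1) (by omega) h2 ?_)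
          have := A.shift (j := i) hx'
          rwa [h, Nat.mod_eq_of_lt h2] at this
    · intro h
      have real : ∀ x ∈ closure U, ∀ ρ ∈ Icc (0 : ℝ) 1, Φ x = ρ → x ∈ gm f τ 0 := by
        intro x hx ρ hρ e
        obtain ⟨x', hx', e'⟩ := Φs ρ hρ
        rwa [Φb.injOn hx (g0 hx') (e.trans e'.symm)]
      obtain ⟨ρ, hρ, θ, hθ, e⟩ := (mem_Sec hb hbl).1 (Φb.mapsTo hx)
      obtain ⟨ρ', hρ', θ', hθ', e'⟩ := (mem_Sec hb hbl).1 (Φb.mapsTo hy)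
      have h' := h
      rw [e, e', ee_mul_pol] at h'
      have hr : ρ = ρ' := by
        have := congrArg norm h'
        rwa [norm_mul, norm_mul, norm_ee, norm_ee, mul_one, mul_one, Complex.norm_real,
          Complex.norm_real, Real.norm_of_nonneg hρ.1, Real.norm_of_nonneg hρ'.1] at this
      subst hr
      rcases eq_or_ne ρ 0 with rfl | hne
      · rw [Complex.ofReal_zero, zero_mul, ← Φ0] at e e'
        rw [Φb.injOn hx z0 e, Φb.injOn hy z0 e', H.it_zero]
      rcases H.num h0 hi hθ hθ' (mul_left_cancel₀ (Complex.ofReal_ne_zero.2 hne) h') with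
        ⟨rfl, rfl, -⟩ | ⟨h2, -, rfl⟩
      · rw [ee_zero, mul_one] at e
        have hx0 := real x hx ρ hρ e
        refine Φb.injOn (g1 (gm_one.2 ⟨x, hx0, rfl⟩)) hy ?_
        show Φ (f x) = Φ y
        rw [Φf x hx0, ← h, Nat.cast_one, one_mul]
      · rw [ee_zero, mul_one] at e'
        have hy0 := real y hy ρ hρ e'
        have : x = f y := by
          refine Φb.injOn hx (g1 (gm_one.2 ⟨y, hy0, rfl⟩)) ?_
          rw [Φf y hy0, ← h, ← mul_assoc, ← ee_add, add_comm, ← add_one_mul, ← Nat.cast_succ]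
          rw [Nat.succ_eq_add_one, h2, ed, one_mul]
        rw [this, ← Function.iterate_succ_apply, Nat.succ_eq_add_one, h2, H.per]

theorem final (f : (Metric.closedBall (0 : ℂ) 1) ≃ₜ (Metric.closedBall (0 : ℂ) 1))
    (m : ℕ) (hm : 1 ≤ m) (hf : (⇑f)^[m] = id) :
    ∃ (r : ℂ ≃ₗᵢ[ℝ] ℂ)
      (h : (Metric.closedBall (0 : ℂ) 1) ≃ₜ (Metric.closedBall (0 : ℂ) 1)),
      ∀ x : (Metric.closedBall (0 : ℂ) 1), ((h (f x)) : ℂ) = r ((h x : ℂ)) := by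
  classical
  let F : ℂ → ℂ := fun z => if h : z ∈ closedBall (0 : ℂ) 1 then f ⟨z, h⟩ else z
  have hF : ∀ x : closedBall (0 : ℂ) 1, F x = f x := fun x => by simp only [F]; rw [dif_pos x.2]
  have hFi : ∀ (k : ℕ) (x : closedBall (0 : ℂ) 1), F^[k] x = (f^[k] x : closedBall (0 : ℂ) 1) := by
    intro k
    induction k with
    | zero => intro x; rfl
    | succ k ih => intro x; rw [Function.iterate_succ_apply, hF, ih, Function.iterate_succ_apply]
  have Fc : ContinuousOn F DD := by
    rw [continuousOn_iff_continuous_restrict]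
    have : DD.domRestrict F = fun x => ((f x : closedBall (0 : ℂ) 1) : ℂ) := funext fun x => hF x
    rw [this]; exact continuous_subtype_val.comp f.continuous
  obtain ⟨r, h, hc, hb, he⟩ : Good F := by
    refine normalize Fc (fun x hx => by rw [hF ⟨x, hx⟩]; exact Subtype.coe_prop _) hm
      (fun x hx => by rw [hFi m ⟨x, hx⟩, hf]; rfl) fun g gc gi hg => ?_
    rcases hg with ⟨ζ, hζ, ho⟩ | ho
    · exact rot_reduce (fun f d H => H.rotGood) gc hm gi hζ ho
    · exact reflection_good gc hm gi ho
  let e : closedBall (0 : ℂ) 1 ≃ closedBall (0 : ℂ) 1 := hb.equiv h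
  have ec : Continuous e := hc.restrict.subtype_mk _
  haveI : CompactSpace (closedBall (0 : ℂ) 1) := isCompact_iff_compactSpace.1 (isCompact_closedBall _ _)
  refine ⟨r, ec.homeoOfEquivCompactToT2, fun x => ?_⟩
  show h (f x) = r (h x)
  rw [← hF, he _ x.2]

end KE

/-- (Kérékjartó–Eilenberg) Every finite-order homeomorphism `f` of the closed unit disc
`D² = {z ∈ ℂ : |z| ≤ 1}` is conjugate, by a homeomorphism `h` of the disc, to the
restriction of a real-linear isometry `r ∈ O(2)` of `ℂ`: `f = h⁻¹ ∘ r ∘ h`, i.e.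
`h ∘ f = r ∘ h` on `D²`. -/
theorem finiteOrder_homeo_disc_conj_rotation
    (f : (Metric.closedBall (0 : ℂ) 1) ≃ₜ (Metric.closedBall (0 : ℂ) 1))
    (m : ℕ) (hm : 1 ≤ m) (hf : (⇑f)^[m] = id) :
    ∃ (r : ℂ ≃ₗᵢ[ℝ] ℂ)
      (h : (Metric.closedBall (0 : ℂ) 1) ≃ₜ (Metric.closedBall (0 : ℂ) 1)),
      ∀ x : (Metric.closedBall (0 : ℂ) 1), ((h (f x)) : ℂ) = r ((h x : ℂ)) := by
  exact KE.final f m hm hf
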